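/- For every ε > 0 there exists x₀ such that for every x ≥ x₀ there exists B₀, either equal to 1 or a prime with B₀ ≤ x, such that, setting P := (∏_{p ≤ x, p prime} p)/B₀, the following holds: for every real Z ≥ P^{160} and every integer a with 1 ≤ a ≤ P and gcd(a, P) = 1, #{z ∈ ℤ : 1 ≤ z ≤ Z and Pz + a is prime} ≥ (1−ε)·(1−e^{−2})·(e^{γ}/(1 + 1/160))·(log x/log Z)·Z. -/

import Mathlib

open Real

/-- `primorial x` is the product of all primes `p ≤ x`. -/
noncomputable def primorialBelow (x : ℝ) : ℕ :=
  ∏ p ∈ Finset.filter Nat.Prime (Finset.range (⌊x⌋₊ + 1)), p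

section
open Finset Filter MeasureTheory DirichletCharacter
open Complex (I norm_real)

section
open scoped ComplexConjugate

/-- Multiplicative derivative `Δ_h f`. -/
def mulDelta {G : Type*} [AddCommGroup G] (h : G) (f : G → ℂ) : G → ℂ :=
  fun n => f (n + h) * conj (f n)

/-- Average over `h₁, …, h_k` of the modulus of the mean of `Δ_{h₁} ⋯ Δ_{h_k} f`. -/
noncomputable def gowersMean {G : Type*} [AddCommGroup G] [Fintype G] : ℕ → (G → ℂ) → ℝ
  | 0, f => ‖univ.expect f‖
  | k + 1, f => univ.expect fun h => gowersMean k (mulDelta h f)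

lemma gowersMean_nonneg {G : Type*} [AddCommGroup G] [Fintype G] (k : ℕ) (f : G → ℂ) :
    0 ≤ gowersMean k f := by
  induction k generalizing f with
  | zero => exact norm_nonneg _
  | succ k ih => exact expect_nonneg fun h _ => ih _

lemma norm_mulDelta_le_one {G : Type*} [AddCommGroup G] (h : G) {f : G → ℂ}
    (hf : ∀ n, ‖f n‖ ≤ 1) (n : G) : ‖mulDelta h f n‖ ≤ 1 := by
  simp only [mulDelta, norm_mul, RCLike.norm_conj]
  exact mul_le_one₀ (hf _) (norm_nonneg _) (hf _)

lemma norm_expect_le_one {G : Type*} [Fintype G] [Nonempty G] {f : G → ℂ}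
    (hf : ∀ n, ‖f n‖ ≤ 1) : ‖univ.expect f‖ ≤ 1 := by
  rw [Fintype.expect_eq_sum_div_card, norm_div, Complex.norm_natCast]
  apply div_le_one_of_le₀ _ (Nat.cast_nonneg _)
  exact (norm_sum_le_of_le _ fun i _ => hf i).trans (by simp)

lemma gowersMean_le_one {G : Type*} [AddCommGroup G] [Fintype G] (k : ℕ) {f : G → ℂ}
    (hf : ∀ n, ‖f n‖ ≤ 1) : gowersMean k f ≤ 1 := by
  induction k generalizing f with
  | zero => exact norm_expect_le_one hf
  | succ k ih => exact expect_le univ_nonempty fun h _ => ih (norm_mulDelta_le_one h hf)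

lemma expect_pi_prod {ι : Type*} [Fintype ι] [DecidableEq ι] {G : ι → Type*}
    [∀ i, Fintype (G i)] {K : Type*} [Semifield K] [CharZero K] (f : ∀ i, G i → K) :
    (univ.expect fun x : ∀ i, G i => ∏ i, f i (x i)) = ∏ i, univ.expect (f i) := by
  simp_rw [Fintype.expect_eq_sum_div_card]
  rw [prod_div_distrib, prod_univ_sum, Fintype.card_pi]
  simp

lemma gowersMean_pi {ι : Type*} [Fintype ι] [DecidableEq ι] {G : ι → Type*}
    [∀ i, Fintype (G i)] [∀ i, AddCommGroup (G i)] (k : ℕ) (f : ∀ i, G i → ℂ) :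
    gowersMean k (fun x : ∀ i, G i => ∏ i, f i (x i)) = ∏ i, gowersMean k (f i) := by
  induction k generalizing f with
  | zero =>
    simp only [gowersMean]
    rw [← norm_prod, ← expect_pi_prod]
  | succ k ih =>
    simp only [gowersMean]
    rw [← expect_pi_prod]
    refine expect_congr rfl fun h _ => ?_
    rw [← ih]
    congr 1
    ext x
    simp [mulDelta, prod_mul_distrib]

lemma gowersMean_comp_equiv {G H : Type*} [AddCommGroup G] [Fintype G] [AddCommGroup H] [Fintype
    H] (e : G ≃+ H) (k : ℕ) (f : H → ℂ) : gowersMean k (fun x => f (e x)) = gowersMean k f := by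
  induction k generalizing f with
  | zero =>
    simp only [gowersMean]
    rw [Fintype.expect_equiv e.toEquiv (fun x => f (e x)) f (fun x => rfl)]
  | succ k ih =>
    simp only [gowersMean]
    refine Fintype.expect_equiv e.toEquiv _ _ fun h => ?_
    rw [← ih]
    congr 1
    ext x
    simp [mulDelta]

/-- `Φ` is `F` (a function mod `Q₀`) times `k` bounded functions with periods coprime to `Q₀` and
at most `N / Q₀`. -/
def FactorsInto (Q₀ : ℕ) (N : ℝ) : ℕ → (ZMod Q₀ → ℂ) → (ℤ → ℂ) → Prop
  | 0, F, Φ => ∀ n : ℤ, Φ n = F n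
  | k + 1, F, Φ => ∃ (Q : ℕ) (φ Ψ : ℤ → ℂ), Q.Coprime Q₀ ∧ (Q₀ * Q : ℝ) ≤ N ∧
      (∀ n, φ (n + Q) = φ n) ∧ (∀ n, ‖φ n‖ ≤ 1) ∧ FactorsInto Q₀ N k F Ψ ∧ ∀ n, Φ n = φ n * Ψ n

lemma FactorsInto.mulDelta {Q₀ : ℕ} {N : ℝ} {k : ℕ} {F : ZMod Q₀ → ℂ} {Φ : ℤ → ℂ} (h : FactorsInto
    Q₀ N k F Φ) (t : ℤ) : FactorsInto Q₀ N k (mulDelta (t : ZMod Q₀) F) (mulDelta t Φ) := by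
  induction k generalizing Φ with
  | zero => intro n; simp [_root_.mulDelta, h n, h (n + t)]
  | succ k ih =>
    obtain ⟨Q, φ, Ψ, h1, h2, h3, h4, h5, h6⟩ := h
    refine ⟨Q, _root_.mulDelta t φ, _root_.mulDelta t Ψ, h1, h2, ?_, norm_mulDelta_le_one t h4,
      ih h5, ?_⟩
    · intro n
      simp only [_root_.mulDelta]
      rw [h3 n, show n + (Q : ℤ) + t = n + t + Q by ring, h3]
    · intro n
      simp only [_root_.mulDelta, h6, map_mul]
      ring

lemma sum_Ico_period {Q₀ : ℕ} [NeZero Q₀] (F : ZMod Q₀ → ℂ) (a : ℤ) :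
    ∑ n ∈ Ico a (a + Q₀), F n = ∑ x, F x := by
  have hinj : Set.InjOn (fun n : ℤ => (n : ZMod Q₀)) (Ico a (a + Q₀) : Finset ℤ) := by
    intro m hm n hn hmn
    simp only [coe_Ico, Set.mem_Ico] at hm hn
    have := (ZMod.intCast_eq_intCast_iff_dvd_sub m n Q₀).1 hmn
    have h2 := Int.eq_zero_of_abs_lt_dvd this (by rw [abs_lt]; constructor <;> linarith)
    linarith
  have himg : (Ico a (a + Q₀)).image (fun n : ℤ => (n : ZMod Q₀)) = univ := by
    apply eq_univ_of_card
    rw [card_image_of_injOn hinj]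
    simp [ZMod.card]
  rw [← himg, sum_image hinj]

lemma norm_sum_Ico_le {Q₀ : ℕ} [NeZero Q₀] {N : ℝ} (hN : 0 < N) (F : ZMod Q₀ → ℂ) (hF : ∀ n, ‖F n‖
    ≤ 1) (a b : ℤ) (hab : (b - a : ℝ) ≤ N) : ‖∑ n ∈ Ico a b, F n‖ ≤ N * ‖univ.expect F‖ + Q₀ := by
  have key : ∀ (t : ℕ) (a b : ℤ), b - a ≤ (t + 1) * Q₀ → t * Q₀ ≤ b - a →
      ‖∑ n ∈ Ico a b, F n‖ ≤ (t * Q₀) * ‖univ.expect F‖ + Q₀ := by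
    intro t
    induction t with
    | zero =>
      intro a b h1 h2
      refine (norm_sum_le_of_le (f := fun n : ℤ => F n) (n := fun _ => 1) _
        fun i _ => hF i).trans ?_
      simp only [sum_const, Int.card_Ico, nsmul_eq_mul, mul_one, Nat.cast_zero, zero_mul, zero_add]
      norm_cast
      simp only [Nat.cast_zero, zero_add, one_mul] at h1
      omega
    | succ t ih =>
      intro a b h1 h2
      have hQ : (0 : ℤ) < Q₀ := mod_cast NeZero.pos Q₀
      rw [← Ico_union_Ico_eq_Ico (b := a + Q₀) (by linarith) (by push_cast at h2; nlinarith),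
        sum_union (Ico_disjoint_Ico_consecutive _ _ _), sum_Ico_period]
      have := ih (a + Q₀) b (by push_cast at h1; linarith) (by push_cast at h2; linarith)
      refine (norm_add_le _ _).trans ?_
      have h3 : ‖∑ x, F x‖ = Q₀ * ‖univ.expect F‖ := by
        rw [Fintype.expect_eq_sum_div_card, norm_div, Complex.norm_natCast, ZMod.card]
        have : Q₀ ≠ 0 := mod_cast NeZero.ne Q₀
        field_simp
      rw [h3]
      push_cast
      linarith
  rcases le_or_gt b a with hba | hba
  · rw [Ico_eq_empty (by linarith)]
    simp only [sum_empty, norm_zero]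
    positivity
  · have hQ : (0 : ℤ) < Q₀ := mod_cast NeZero.pos Q₀
    have h0 : 0 ≤ (b - a) / Q₀ := Int.ediv_nonneg (by linarith) hQ.le
    obtain ⟨t, ht⟩ := Int.eq_ofNat_of_zero_le h0
    have e1 := Int.emod_add_mul_ediv (b - a) Q₀
    have e2 := Int.emod_nonneg (b - a) hQ.ne'
    have e3 := Int.emod_lt_of_pos (b - a) hQ
    rw [ht] at e1
    have e4 : (t : ℤ) * Q₀ ≤ b - a := by linarith
    have := key t a b (by linarith) e4
    refine this.trans ?_
    gcongr
    have : ((t : ℤ) * Q₀ : ℝ) ≤ b - a := mod_cast e4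
    push_cast at this
    linarith
lemma sum_Ico_shift_ite (w : ℤ → ℂ) {a b L s : ℤ} (h0 : 0 ≤ s) (hL : s ≤ L) :
    ∑ n ∈ Ico (a - L) b, (if n + s ∈ Ico a b then w (n + s) else 0) =
      ∑ n ∈ Ico a b, w n := by
  rw [← sum_filter]
  refine sum_nbij' (fun n => n + s) (fun n => n - s) ?_ ?_ ?_ ?_ ?_
  · intro n hn; exact (mem_filter.1 hn).2
  · intro n hn
    simp only [mem_filter, mem_Ico] at hn ⊢
    omega
  · intro n _; simp
  · intro n _; simp
  · intro n _; rfl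

lemma vanDerCorput {ι : Type*} [Fintype ι] (s : ι → ℤ) {L a b : ℤ} (hab : a ≤ b) (hs0 : ∀ i, 0 ≤ s
    i) (hsL : ∀ i, s i ≤ L) (φ Ψ : ℤ → ℂ) (hφ : ∀ n, ‖φ n‖ ≤ 1) (hper : ∀ i n, φ (n + s i) = φ n) :
    (Fintype.card ι * ‖∑ n ∈ Ico a b, φ n * Ψ n‖) ^ 2 ≤ (b - a + L) * ∑ i, ∑ j, ‖∑ m ∈ Ico (max a (a
    - (s i - s j))) (min b (b - (s i - s j))), mulDelta (s i - s j) Ψ m‖ := by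
  rcases isEmpty_or_nonempty ι with he | ⟨⟨i₀⟩⟩
  · simp
  have hL0 := (hs0 i₀).trans (hsL i₀)
  set J := Ico (a - L) b with hJ
  set w : ℤ → ℂ := fun n => if n ∈ Ico a b then Ψ n else 0 with hw
  have h1 : (Fintype.card ι : ℂ) * ∑ n ∈ Ico a b, φ n * Ψ n = ∑ n ∈ J, φ n * ∑ i, w (n + s i) := by
    have : ∀ i, ∑ n ∈ Ico a b, φ n * Ψ n = ∑ n ∈ J, φ n * w (n + s i) := by
      intro i
      rw [← sum_Ico_shift_ite (fun n => φ n * Ψ n) (hs0 i) (hsL i)]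
      refine sum_congr rfl fun n _ => ?_
      simp only [hw]
      split_ifs
      · rw [hper]
      · simp
    calc _ = ∑ i : ι, ∑ n ∈ Ico a b, φ n * Ψ n := by simp
      _ = ∑ i, ∑ n ∈ J, φ n * w (n + s i) := sum_congr rfl fun i _ => this i
      _ = _ := by rw [sum_comm]; simp_rw [mul_sum]
  have h2 : Fintype.card ι * ‖∑ n ∈ Ico a b, φ n * Ψ n‖ ≤ ∑ n ∈ J, ‖∑ i, w (n + s i)‖ := by
    have := congrArg norm h1
    rw [norm_mul, Complex.norm_natCast] at this
    rw [this]
    refine norm_sum_le_of_le _ fun n _ => ?_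
    rw [norm_mul]
    exact mul_le_of_le_one_left (norm_nonneg _) (hφ n)
  have hcard : (J.card : ℝ) = b - a + L := by
    rw [hJ, Int.card_Ico]
    have : ((b - (a - L)).toNat : ℤ) = b - a + L := by rw [Int.toNat_of_nonneg] <;> omega
    exact_mod_cast this
  have h3 : ∑ n ∈ J, ‖∑ i, w (n + s i)‖ ^ 2 ≤
      ∑ i, ∑ j, ‖∑ n ∈ J, w (n + s i) * conj (w (n + s j))‖ := by
    have e : ((∑ n ∈ J, ‖∑ i, w (n + s i)‖ ^ 2 : ℝ) : ℂ) =
        ∑ i, ∑ j, ∑ n ∈ J, w (n + s i) * conj (w (n + s j)) := by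
      have : ∀ n, ((‖∑ i, w (n + s i)‖ ^ 2 : ℝ) : ℂ) =
          ∑ i, ∑ j, w (n + s i) * conj (w (n + s j)) := by
        intro n
        push_cast
        rw [← Complex.mul_conj', map_sum, sum_mul_sum]
      rw [Complex.ofReal_sum, sum_congr rfl fun n _ => this n, sum_comm]
      refine sum_congr rfl fun i _ => ?_
      rw [sum_comm]
    have h4 : 0 ≤ ∑ n ∈ J, ‖∑ i, w (n + s i)‖ ^ 2 := by positivity
    rw [← abs_of_nonneg h4, ← norm_eq_abs, ← norm_real, e]
    exact norm_sum_le_of_le _ fun i _ => norm_sum_le _ _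
  have h5 : ∀ i j, ∑ n ∈ J, w (n + s i) * conj (w (n + s j)) =
      ∑ m ∈ Ico (max a (a - (s i - s j))) (min b (b - (s i - s j))), mulDelta (s i - s j) Ψ m := by
    intro i j
    have : ∀ n, w (n + s i) * conj (w (n + s j)) = if n + s j ∈ Ico a b then
        (fun m => w (m + (s i - s j)) * conj (Ψ m)) (n + s j) else 0 := by
      intro n
      simp only [hw]
      rw [show n + s j + (s i - s j) = n + s i by ring]
      split_ifs <;> simp
    rw [sum_congr rfl fun n _ => this n]
    refine (sum_Ico_shift_ite (fun m => w (m + (s i - s j)) * conj (Ψ m)) (hs0 j) (hsL j)).trans ?_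
    simp only [hw, ite_mul, zero_mul]
    rw [← sum_filter]
    refine sum_congr ?_ fun n _ => rfl
    ext n
    simp only [mem_filter, mem_Ico]
    omega
  simp_rw [h5] at h3
  have hpos : (0 : ℝ) ≤ b - a + L := by rw [← hcard]; positivity
  calc _ ≤ (∑ n ∈ J, ‖∑ i, w (n + s i)‖) ^ 2 := by gcongr
    _ ≤ J.card * ∑ n ∈ J, ‖∑ i, w (n + s i)‖ ^ 2 := sq_sum_le_card_mul_sum_sq
    _ ≤ _ := by rw [hcard]; gcongr

lemma sum_gowersMean_mulDelta {Q₀ Q : ℕ} [NeZero Q₀] (hcop : Q.Coprime Q₀) (k : ℕ) (F : ZMod Q₀ →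
    ℂ) : ∑ p : ZMod Q₀ × ZMod Q₀, gowersMean k (mulDelta ((p.1 - p.2) * Q : ZMod Q₀) F) = Q₀ ^ 2 *
    gowersMean (k + 1) F := by
  obtain ⟨u, hu⟩ := (ZMod.isUnit_iff_coprime Q Q₀).2 hcop
  rw [Fintype.sum_prod_type_right]
  have : ∀ y : ZMod Q₀, ∑ x : ZMod Q₀, gowersMean k (mulDelta ((x - y) * Q : ZMod Q₀) F) =
      ∑ x, gowersMean k (mulDelta x F) := by
    intro y
    refine Fintype.sum_equiv ((Equiv.subRight y).trans u.mulRight) _ _ fun x => ?_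
    simp [← hu]
  rw [sum_congr rfl fun y _ => this y]
  have h2 : gowersMean (k + 1) F = (∑ x, gowersMean k (mulDelta x F)) / Q₀ := by
    rw [gowersMean, Fintype.expect_eq_sum_div_card, ZMod.card]
  rw [h2, sum_const, card_univ, ZMod.card, nsmul_eq_mul]
  field_simp

lemma sum_pow_two_pow_le {ι : Type*} [Fintype ι] (σ : ι → ℝ) (hσ : ∀ i, 0 ≤ σ i) (k : ℕ) :
    (∑ p, σ p) ^ 2 ^ k ≤ (Fintype.card ι : ℝ) ^ (2 ^ k - 1) * ∑ p, σ p ^ 2 ^ k := by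
  rcases isEmpty_or_nonempty ι with he | hne
  · simp
  have := pow_sum_div_card_le_sum_pow (s := univ) (f := σ) (fun i _ => hσ i) (2 ^ k - 1)
  rw [Nat.sub_add_cancel Nat.one_le_two_pow, div_le_iff₀' (by positivity), card_univ] at this
  exact this

lemma norm_sum_pow_le_gowersMean {Q₀ : ℕ} [NeZero Q₀] {N : ℝ} (hN : 0 < N) (k : ℕ)
    {F : ZMod Q₀ → ℂ} {Φ : ℤ → ℂ} (hF : ∀ n, ‖F n‖ ≤ 1) (h : FactorsInto Q₀ N k F Φ)
    {a b : ℤ} (hab : (b - a : ℝ) ≤ N) :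
    ‖∑ n ∈ Ico a b, Φ n‖ ^ 2 ^ k ≤ (2 * N) ^ 2 ^ k * (gowersMean k F + Q₀ / N) := by
  induction k generalizing F Φ a b with
  | zero =>
    have := norm_sum_Ico_le hN F hF a b hab
    simp only [pow_zero, pow_one, gowersMean]
    rw [sum_congr rfl fun n _ => h n]
    have e : 2 * N * (‖univ.expect F‖ + Q₀ / N) =
        2 * (N * ‖univ.expect F‖ + Q₀) := by field_simp
    rw [e]
    have := norm_nonneg (∑ n ∈ Ico a b, F n)
    linarith
  | succ k ih =>
    obtain ⟨Q, φ, Ψ, hcop, hQ, hper, hφ, hΨ, hΦ⟩ := h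
    rcases lt_or_ge b a with hlt | hle
    · rw [Ico_eq_empty (by linarith)]
      simp only [sum_empty, norm_zero]
      rw [zero_pow (by positivity)]
      have := gowersMean_nonneg (k + 1) F
      positivity
    set s : ZMod Q₀ → ℤ := fun i => (i.val : ℤ) * Q with hs
    have hper' : ∀ (m : ℕ) n, φ (n + m * Q) = φ n := by
      intro m
      induction m with
      | zero => simp
      | succ m ihm => intro n; rw [← ihm n, ← hper (n + m * Q)]; congr 1; push_cast; ring
    have hv := vanDerCorput s (L := Q₀ * Q) hle (fun i => by positivity)
      (fun i => by
        simp only [hs]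
        have : (i.val : ℤ) ≤ Q₀ := mod_cast (ZMod.val_lt i).le
        gcongr) φ Ψ hφ (fun i n => hper' _ n)
    rw [← sum_congr rfl fun n _ => hΦ n, ZMod.card] at hv
    push_cast at hv
    set S := ‖∑ n ∈ Ico a b, Φ n‖ with hS
    set σ : ZMod Q₀ × ZMod Q₀ → ℝ := fun p => ‖∑ m ∈ Ico (max a (a - (s p.1 - s p.2)))
        (min b (b - (s p.1 - s p.2))), mulDelta (s p.1 - s p.2) Ψ m‖ with hσ
    have hv1 : (Q₀ * S) ^ 2 ≤ 2 * N * ∑ p, σ p := by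
      have hv' : (Q₀ * S) ^ 2 ≤ (b - a + Q₀ * Q) * ∑ p, σ p := by
        rw [Fintype.sum_prod_type]
        exact hv
      exact hv'.trans (mul_le_mul_of_nonneg_right (by linarith) (sum_nonneg fun p _ => norm_nonneg _))
    have hσb : ∀ p, σ p ^ 2 ^ k ≤ (2 * N) ^ 2 ^ k *
        (gowersMean k (mulDelta ((p.1 - p.2) * Q : ZMod Q₀) F) + Q₀ / N) := by
      intro p
      have hF' := hΨ.mulDelta (s p.1 - s p.2)
      have e : (((s p.1 - s p.2 : ℤ)) : ZMod Q₀) = (p.1 - p.2) * Q := by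
        simp only [hs]; push_cast; rw [ZMod.natCast_rightInverse, ZMod.natCast_rightInverse]; ring
      rw [e] at hF'
      refine ih (norm_mulDelta_le_one _ hF) hF' ?_
      have : (((min b (b - (s p.1 - s p.2)) : ℤ)) : ℝ) ≤ b := mod_cast min_le_left _ _
      have : a ≤ ((max a (a - (s p.1 - s p.2)) : ℤ) : ℝ) := mod_cast le_max_left _ _
      linarith
    have havg := sum_gowersMean_mulDelta hcop k F
    have hmean : (∑ p, σ p) ^ 2 ^ k ≤ (Q₀ ^ 2 : ℝ) ^ (2 ^ k - 1) * ∑ p, σ p ^ 2 ^ k := by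
      have := sum_pow_two_pow_le σ (fun p => norm_nonneg _) k
      rw [Fintype.card_prod, ZMod.card, Nat.cast_mul, ← pow_two] at this
      exact this
    have hfin : (Q₀ * S) ^ 2 ^ (k + 1) ≤ (2 * N) ^ 2 ^ k * ((Q₀ ^ 2 : ℝ) ^ (2 ^ k - 1) *
        ((2 * N) ^ 2 ^ k * (Q₀ ^ 2 * (gowersMean (k + 1) F + Q₀ / N)))) := by
      calc (Q₀ * S) ^ 2 ^ (k + 1) = ((Q₀ * S) ^ 2) ^ 2 ^ k := by rw [← pow_mul]; ring_nf
        _ ≤ (2 * N * ∑ p, σ p) ^ 2 ^ k := by gcongr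
        _ = (2 * N) ^ 2 ^ k * (∑ p, σ p) ^ 2 ^ k := mul_pow _ _ _
        _ ≤ _ := by
          gcongr
          refine hmean.trans ?_
          gcongr
          refine (sum_le_sum fun p _ => hσb p).trans (le_of_eq ?_)
          rw [← mul_sum, sum_add_distrib, havg, sum_const, card_univ,
            Fintype.card_prod, ZMod.card, nsmul_eq_mul]
          push_cast
          ring
    have e : (Q₀ ^ 2 : ℝ) ^ (2 ^ k - 1) * Q₀ ^ 2 = Q₀ ^ 2 ^ (k + 1) := by
      rw [← pow_succ, Nat.sub_add_cancel Nat.one_le_two_pow, ← pow_mul]; ring_nf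
    have e2 : (2 * N) ^ 2 ^ (k + 1) = (2 * N) ^ 2 ^ k * (2 * N) ^ 2 ^ k := by
      rw [← pow_add]; ring_nf
    rw [mul_pow] at hfin
    refine le_of_mul_le_mul_left (hfin.trans (le_of_eq ?_)) (pow_pos (mod_cast NeZero.pos Q₀) (2 ^ (k + 1)))
    rw [← e, e2]
    ring
variable {G : Type*} [AddCommGroup G]

/-- Iterated multiplicative derivative along a list of shifts. -/
def mulDeltaList : List G → (G → ℂ) → (G → ℂ)
  | [], f => f
  | h :: t, f => mulDeltaList t (mulDelta h f)

/-- Iterated average over lists of length `k`. -/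
noncomputable def listAvg {G : Type*} [Fintype G] : ℕ → (List G → ℝ) → ℝ
  | 0, Ψ => Ψ []
  | k + 1, Ψ => univ.expect fun h => listAvg k fun t => Ψ (h :: t)

lemma listAvg_mono {G : Type*} [Fintype G] (k : ℕ) {Ψ Ψ' : List G → ℝ}
    (h : ∀ l, l.length = k → Ψ l ≤ Ψ' l) : listAvg k Ψ ≤ listAvg k Ψ' := by
  induction k generalizing Ψ Ψ' with
  | zero => exact h [] rfl
  | succ k ih => exact expect_le_expect fun a _ => ih fun l hl => h _ (by simp [hl])

lemma listAvg_affine {G : Type*} [Fintype G] [Nonempty G] (k : ℕ) (Ψ : List G → ℝ) (a b : ℝ) :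
    listAvg k (fun l => a * Ψ l + b) = a * listAvg k Ψ + b := by
  induction k generalizing Ψ with
  | zero => rfl
  | succ k ih =>
    simp only [listAvg, ih]
    rw [expect_add_distrib, mul_expect, expect_const univ_nonempty]

lemma gowersMean_eq_listAvg [Fintype G] (k : ℕ) (f : G → ℂ) :
    gowersMean k f = listAvg k fun l => ‖univ.expect (mulDeltaList l f)‖ := by
  induction k generalizing f with
  | zero => rfl
  | succ k ih => simp only [gowersMean, listAvg, ih]; rfl

lemma mulDeltaList_norm {f : G → ℂ} (hf : ∀ n, ‖f n‖ = 1) (l : List G) (n : G) :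
    ‖mulDeltaList l f n‖ = 1 := by
  induction l generalizing f with
  | nil => exact hf n
  | cons h t ih => exact ih fun n => by simp [mulDelta, hf]

lemma mulDeltaList_mul (l : List G) (f g : G → ℂ) :
    mulDeltaList l (fun n => f n * g n) = fun n => mulDeltaList l f n * mulDeltaList l g n := by
  induction l generalizing f g with
  | nil => rfl
  | cons h t ih =>
    simp only [mulDeltaList]
    rw [← ih]
    congr 1
    ext n
    simp only [mulDelta, map_mul]
    ring

lemma mulDeltaList_translate (l : List G) (f : G → ℂ) (s : G) :
    mulDeltaList l (fun n => f (n + s)) = fun n => mulDeltaList l f (n + s) := by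
  induction l generalizing f with
  | nil => rfl
  | cons h t ih =>
    simp only [mulDeltaList]
    rw [← ih]
    congr 1
    ext n
    simp only [mulDelta]
    rw [add_right_comm]

lemma mulDeltaList_comp_hom (l : List G) (f : G → ℂ) (μ : G →+ G) :
    mulDeltaList l (fun n => f (μ n)) = fun n => mulDeltaList (l.map μ) f (μ n) := by
  induction l generalizing f with
  | nil => rfl
  | cons h t ih =>
    simp only [mulDeltaList, List.map_cons]
    rw [← ih]
    congr 1
    ext n
    simp [mulDelta]

lemma mulDeltaList_const_mul {l : List G} (hl : l ≠ []) (f : G → ℂ) {c : ℂ} (hc : ‖c‖ = 1) :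
    mulDeltaList l (fun n => c * f n) = mulDeltaList l f := by
  cases l with
  | nil => exact absurd rfl hl
  | cons h t =>
    simp only [mulDeltaList]
    congr 1
    ext n
    simp only [mulDelta, map_mul]
    have : c * conj c = 1 := by rw [Complex.mul_conj']; simp [hc]
    linear_combination (f (n + h) * conj (f n)) * this

lemma norm_mul_sub_mul_le {a b c d : ℂ} (hb : ‖b‖ ≤ 1) (hc : ‖c‖ ≤ 1) :
    ‖a * b - c * d‖ ≤ ‖a - c‖ + ‖b - d‖ := by
  have : a * b - c * d = (a - c) * b + c * (b - d) := by ring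
  rw [this]
  refine (norm_add_le _ _).trans ?_
  rw [norm_mul, norm_mul]
  exact add_le_add (mul_le_of_le_one_right (norm_nonneg _) hb)
    (mul_le_of_le_one_left (norm_nonneg _) hc)

variable [Fintype G]

lemma expect_translate (F : G → ℝ) (s : G) : (univ.expect fun n => F (n + s)) = univ.expect F :=
  Fintype.expect_equiv (Equiv.addRight s) _ _ fun _ => rfl

lemma expect_mulDeltaList_sub_le (l : List G) {f g : G → ℂ} (hf : ∀ n, ‖f n‖ ≤ 1)
    (hg : ∀ n, ‖g n‖ ≤ 1) : (univ.expect fun n => ‖mulDeltaList l f n - mulDeltaList l g n‖) ≤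
      2 ^ l.length * univ.expect fun n => ‖f n - g n‖ := by
  induction l generalizing f g with
  | nil => simp [mulDeltaList]
  | cons h t ih =>
    simp only [mulDeltaList, List.length_cons]
    refine (ih (norm_mulDelta_le_one h hf) (norm_mulDelta_le_one h hg)).trans ?_
    rw [pow_succ, mul_assoc]
    gcongr
    calc (univ.expect fun n => ‖mulDelta h f n - mulDelta h g n‖) ≤
        univ.expect fun n => (‖f (n + h) - g (n + h)‖ + ‖f n - g n‖) := by
          refine expect_le_expect fun n _ => ?_
          have := norm_mul_sub_mul_le (a := f (n + h)) (b := conj (f n)) (c := g (n + h))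
            (d := conj (g n)) (by simpa using hf n) (hg _)
          rwa [← map_sub, RCLike.norm_conj] at this
      _ = _ := by
          rw [expect_add_distrib, expect_translate (fun n => ‖f n - g n‖)]
          ring

lemma expect_mulDeltaList_nsmul (h : G) (t : List G) {f : G → ℂ} (hf : ∀ n, ‖f n‖ = 1) {c : ℂ}
    (hc : ‖c‖ ≤ 1) (m : ℕ) : (univ.expect fun n => ‖mulDeltaList ((m • h) :: t) f n - c ^ m‖) ≤
      m * univ.expect fun n => ‖mulDeltaList (h :: t) f n - c‖ := by
  induction m with
  | zero =>
    have : mulDelta 0 f = fun _ => 1 := by ext n; simp [mulDelta, Complex.mul_conj', hf]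
    have h1 : ∀ t : List G, mulDeltaList t (fun _ => 1) = fun _ => 1 := by
      intro t
      induction t with
      | nil => rfl
      | cons a t ih =>
        have : mulDelta a (fun _ => 1) = fun _ => 1 := by ext; simp [mulDelta]
        simp only [mulDeltaList]
        rw [this, ih]
    simp [mulDeltaList, this, h1]
  | succ m ih =>
    have e : mulDelta ((m + 1) • h) f = fun n => mulDelta (m • h) f (n + h) * mulDelta h f n := by
      ext n
      simp only [mulDelta]
      have : conj (f (n + h)) * f (n + h) = 1 := by rw [Complex.conj_mul']; simp [hf]
      rw [show n + (m + 1) • h = n + h + m • h by rw [succ_nsmul]; abel]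
      linear_combination -(f (n + h + m • h) * conj (f n)) * this
    have e2 : mulDeltaList (((m + 1) • h) :: t) f = fun n =>
        mulDeltaList ((m • h) :: t) f (n + h) * mulDeltaList (h :: t) f n := by
      simp only [mulDeltaList]
      rw [e, mulDeltaList_mul, mulDeltaList_translate]
    calc _ ≤ univ.expect fun n => (‖mulDeltaList ((m • h) :: t) f (n + h) - c ^ m‖ +
          ‖mulDeltaList (h :: t) f n - c‖) := by
          refine expect_le_expect fun n _ => ?_
          rw [e2, pow_succ]
          exact norm_mul_sub_mul_le (mulDeltaList_norm hf _ _).le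
            (by rw [norm_pow]; exact pow_le_one₀ (norm_nonneg _) hc)
      _ ≤ _ := by
          rw [expect_add_distrib,
            expect_translate (fun n => ‖mulDeltaList ((m • h) :: t) f n - c ^ m‖)]
          push_cast
          linarith

lemma expect_mulDeltaList_double (l : List G) {f : G → ℂ} (hf : ∀ n, ‖f n‖ = 1) {c : ℂ}
    (hc : ‖c‖ ≤ 1) : (univ.expect fun n => ‖mulDeltaList (l.map (2 • ·)) f n - c ^ 2 ^ l.length‖) ≤
      2 ^ l.length * univ.expect fun n => ‖mulDeltaList l f n - c‖ := by
  induction l generalizing f c with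
  | nil => simp [mulDeltaList]
  | cons h t ih =>
    have := ih (f := mulDelta (2 • h) f) (c := c ^ 2) (fun n => by simp [mulDelta, hf])
      (by rw [norm_pow]; exact pow_le_one₀ (norm_nonneg _) hc)
    have h2 := expect_mulDeltaList_nsmul h t hf hc 2
    simp only [mulDeltaList, List.map_cons, List.length_cons] at h2 ⊢
    rw [← pow_mul, ← pow_succ'] at this
    refine this.trans ?_
    rw [pow_succ 2, mul_assoc]
    gcongr
    exact_mod_cast h2

/-- `χ` with its value at `0` replaced by `1`. -/
noncomputable def unimodularExt {p : ℕ} (χ : DirichletCharacter ℂ p) (n : ZMod p) : ℂ :=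
  if n = 0 then 1 else χ n

variable {p : ℕ} [hp : Fact p.Prime]

lemma norm_unimodularExt (χ : DirichletCharacter ℂ p) (n : ZMod p) : ‖unimodularExt χ n‖ = 1 := by
  unfold unimodularExt
  split_ifs with h
  · simp
  · exact unit_norm_eq_one χ (Units.mk0 n h)

lemma expect_norm_sub_le_of_eq_off_zero {f g : ZMod p → ℂ} (h : ∀ n, n ≠ 0 → f n = g n)
    {C : ℝ} (h0 : ‖f 0 - g 0‖ ≤ C) : (univ.expect fun n => ‖f n - g n‖) ≤ C / p := by
  rw [Fintype.expect_eq_sum_div_card, ZMod.card]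
  gcongr
  rw [sum_eq_single_of_mem 0 (mem_univ _) (fun n _ hn => by simp [h n hn])]
  exact h0

lemma norm_expect_pow_sub_self_le (hp2 : p ≠ 2) (χ : DirichletCharacter ℂ p) {l : List (ZMod p)}
    (hl : l ≠ []) {c : ℂ} (hc : ‖c‖ ≤ 1) : ‖c ^ 2 ^ l.length - c‖ ≤ (2 ^ l.length + 1) *
      (univ.expect fun n => ‖mulDeltaList l (unimodularExt χ) n - c‖) + 2 ^ l.length * (2 / p) := by
  set f := unimodularExt χ with hf
  have hfn : ∀ n, ‖f n‖ = 1 := norm_unimodularExt χ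
  have h2 : (2 : ZMod p) ≠ 0 := by
    intro h
    have : ((2 : ℕ) : ZMod p) = 0 := mod_cast h
    rw [ZMod.natCast_eq_zero_iff] at this
    exact hp2 ((Nat.prime_dvd_prime_iff_eq hp.out Nat.prime_two).1 this)
  have hχ2 : ‖χ 2‖ = 1 := unit_norm_eq_one χ (Units.mk0 2 h2)
  have hd := expect_mulDeltaList_double l hfn hc
  have hE : (univ.expect fun n => ‖mulDeltaList l (fun n => f (2 * n)) n -
      mulDeltaList l (fun n => χ 2 * f n) n‖) ≤ 2 ^ l.length * (2 / p) := by
    refine (expect_mulDeltaList_sub_le l (fun n => (hfn _).le) (fun n => ?_)).trans ?_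
    · rw [norm_mul, hχ2, hfn, one_mul]
    · gcongr
      apply expect_norm_sub_le_of_eq_off_zero
      · intro n hn
        simp [hf, unimodularExt, h2, hn]
      · refine (norm_sub_le _ _).trans ?_
        rw [norm_mul, hχ2, hfn, hfn]
        norm_num
  have hcomp := mulDeltaList_comp_hom l f (AddMonoidHom.mulLeft (2 : ZMod p))
  simp only [AddMonoidHom.coe_mulLeft] at hcomp
  rw [mulDeltaList_const_mul hl f hχ2, hcomp] at hE
  have hl2 : l.map (fun x : ZMod p => 2 • x) = l.map (fun x => 2 * x) := by congr 1; ext x; simp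
  rw [hl2] at hd
  have htr : (univ.expect fun n => ‖mulDeltaList (l.map (fun x => 2 * x)) f n -
      c ^ 2 ^ l.length‖) = univ.expect fun n =>
        ‖mulDeltaList (l.map (fun x => 2 * x)) f (2 * n) - c ^ 2 ^ l.length‖ :=
    (Fintype.expect_equiv (Equiv.mulLeft₀ (2 : ZMod p) h2) _ _ fun _ => rfl).symm
  rw [htr] at hd
  set A := fun n => mulDeltaList (l.map (fun x => 2 * x)) f (2 * n) with hA
  set B := mulDeltaList l f with hB
  have : ‖c ^ 2 ^ l.length - c‖ ≤ univ.expect fun n =>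
      (‖A n - c ^ 2 ^ l.length‖ + ‖A n - B n‖ + ‖B n - c‖) := by
    rw [← expect_const (univ_nonempty (α := ZMod p)) ‖c ^ 2 ^ l.length - c‖]
    refine expect_le_expect fun n _ => ?_
    have e : c ^ 2 ^ l.length - c = -(A n - c ^ 2 ^ l.length) + (A n - B n) + (B n - c) := by ring
    rw [e]
    refine (norm_add₃_le).trans ?_
    rw [norm_neg]
  rw [expect_add_distrib, expect_add_distrib] at this
  linarith

/-- `E ‖Δ_l f - mean‖`, averaged over `l`. -/
noncomputable def gowersDev {p : ℕ} [NeZero p] (k : ℕ) (f : ZMod p → ℂ) : ℝ :=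
  listAvg k fun l => univ.expect fun n => ‖mulDeltaList l f n - univ.expect (mulDeltaList l f)‖

lemma gowersDev_le_succ (hp2 : p ≠ 2) {k : ℕ} (hpk : 2 ^ (k + 1) ≤ p)
    (χ : DirichletCharacter ℂ p) : gowersDev k (unimodularExt χ) ≤
      2 ^ (k + 3) * (gowersDev (k + 1) (unimodularExt χ) + 1 / p) := by
  set f := unimodularExt χ with hf
  have hfn := norm_unimodularExt χ
  set N : ℕ := 2 ^ (k + 1) - 1 with hN
  have hN1 : N + 1 = 2 ^ (k + 1) := Nat.sub_add_cancel Nat.one_le_two_pow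
  have hNp : (N : ZMod p) ≠ 0 := by
    rw [Ne, ZMod.natCast_eq_zero_iff]
    intro h
    have h1 : 1 < 2 ^ (k + 1) := Nat.one_lt_two_pow (by omega)
    have := Nat.le_of_dvd (by omega) h
    omega
  -- the innermost variation bounds the lower deviation
  have step1 : gowersDev k f ≤ listAvg (k + 1) fun l =>
      univ.expect fun n => ‖mulDeltaList l f n - 1‖ := by
    have key : ∀ (k : ℕ) (f : ZMod p → ℂ), (∀ n, ‖f n‖ = 1) → gowersDev k f ≤
        listAvg (k + 1) fun l => univ.expect fun n => ‖mulDeltaList l f n - 1‖ := by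
      intro k
      induction k with
      | zero =>
        intro f hfn
        simp only [gowersDev, listAvg, mulDeltaList]
        rw [expect_comm]
        refine expect_le_expect fun n _ => ?_
        have h1 : ∀ h, ‖mulDelta h f n - 1‖ = ‖f n - f (n + h)‖ := by
          intro h
          have : mulDelta h f n - 1 = -((f n - f (n + h)) * conj (f n)) := by
            simp only [mulDelta]
            have : f n * conj (f n) = 1 := by rw [Complex.mul_conj']; simp [hfn]
            linear_combination this
          rw [this, norm_neg, norm_mul, RCLike.norm_conj, hfn, mul_one]
        simp_rw [h1]
        have h2 : f n - univ.expect f = univ.expect fun h => (f n - f (n + h)) := by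
          rw [expect_sub_distrib, expect_const univ_nonempty,
            Fintype.expect_equiv (Equiv.addLeft n) (fun h => f (n + h)) f fun _ => rfl]
        rw [h2, Fintype.expect_eq_sum_div_card, Fintype.expect_eq_sum_div_card, norm_div,
          Complex.norm_natCast]
        gcongr
        exact norm_sum_le _ _
      | succ k ih =>
        intro f hfn
        exact expect_le_expect fun h _ => ih (mulDelta h f) fun n => by simp [mulDelta, hfn]
    exact key k f hfn
  have step2 : (listAvg (k + 1) fun l : List (ZMod p) =>
      univ.expect fun n => ‖mulDeltaList l f n - 1‖) =
      listAvg (k + 1) fun l => univ.expect fun n =>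
        ‖mulDeltaList ((N • l.headD 0) :: l.tail) f n - 1‖ := by
    simp only [listAvg, List.headD_cons, List.tail_cons]
    symm
    refine Fintype.expect_equiv (Equiv.mulLeft₀ (N : ZMod p) hNp) _ _ fun h => ?_
    simp
  have step3 : ∀ l : List (ZMod p), l.length = k + 1 → (univ.expect fun n =>
        ‖mulDeltaList ((N • l.headD 0) :: l.tail) f n - 1‖) ≤
      2 ^ (k + 3) * (univ.expect fun n =>
        ‖mulDeltaList l f n - univ.expect (mulDeltaList l f)‖) +
        2 ^ (k + 3) * (1 / p) := by
    intro l hl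
    set c := univ.expect (mulDeltaList l f) with hc
    have hc1 := norm_expect_le_one fun n => (mulDeltaList_norm hfn l n).le
    obtain ⟨h, t, rfl⟩ : ∃ h t, l = h :: t := by
      cases l with
      | nil => simp at hl
      | cons h t => exact ⟨h, t, rfl⟩
    simp only [List.headD_cons, List.tail_cons]
    have h1 := expect_mulDeltaList_nsmul h t hfn hc1 N
    have h2 := norm_expect_pow_sub_self_le hp2 χ (l := h :: t) (by simp) hc1
    rw [hl, ← hf] at h2
    set η := univ.expect fun n => ‖mulDeltaList (h :: t) f n - c‖ with hη
    have h3 : 1 - ‖c‖ ≤ η := by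
      rw [← expect_const (univ_nonempty (α := ZMod p)) (1 - ‖c‖)]
      refine expect_le_expect fun n _ => ?_
      rw [← mulDeltaList_norm hfn (h :: t) n]
      exact norm_sub_norm_le _ _
    have h4 : ‖c ^ N - 1‖ ≤ ‖c ^ 2 ^ (k + 1) - c‖ + 2 * η := by
      have e : c ^ 2 ^ (k + 1) - c = c * (c ^ N - 1) := by rw [← hN1]; ring
      have h5 : ‖c ^ N - 1‖ ≤ 2 := by
        refine (norm_sub_le _ _).trans ?_
        rw [norm_pow, norm_one]
        linarith [pow_le_one₀ (norm_nonneg c) hc1 (n := N)]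
      rw [e, norm_mul]
      nlinarith [norm_nonneg c]
    have h6 : (univ.expect fun n => ‖mulDeltaList ((N • h) :: t) f n - 1‖) ≤
        (univ.expect fun n => ‖mulDeltaList ((N • h) :: t) f n - c ^ N‖) + ‖c ^ N - 1‖ := by
      rw [← expect_const (univ_nonempty (α := ZMod p)) ‖c ^ N - 1‖, ← expect_add_distrib]
      exact expect_le_expect fun n _ => norm_sub_le_norm_sub_add_norm_sub _ _ _
    have hN2 : (N : ℝ) = 2 ^ (k + 1) - 1 := by rw [eq_sub_iff_add_eq]; exact_mod_cast hN1
    have hpp : (0 : ℝ) ≤ 1 / p := by positivity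
    rw [hN2] at h1
    have e8 : (2 : ℝ) ^ (k + 3) = 4 * 2 ^ (k + 1) := by ring
    rw [e8]
    have : (2 : ℝ) / p = 2 * (1 / p) := by ring
    rw [this] at h2
    nlinarith
  rw [step2] at step1
  refine step1.trans ((listAvg_mono _ step3).trans (le_of_eq ?_))
  rw [listAvg_affine, mul_add]
  rfl

lemma exists_le_gowersDev (k : ℕ) : ∃ c : ℝ, 0 < c ∧ ∃ p₀ : ℕ, ∀ (p : ℕ) [Fact p.Prime],
    p₀ ≤ p → ∀ χ : DirichletCharacter ℂ p, χ ≠ 1 → c ≤ gowersDev k (unimodularExt χ) := by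
  induction k with
  | zero =>
    refine ⟨1 / 2, by norm_num, 2, fun p hp hp2 χ hχ => ?_⟩
    simp only [gowersDev, listAvg, mulDeltaList]
    have h0 : ∑ n, unimodularExt χ n = 1 := by
      have := MulChar.sum_eq_zero_of_ne_one hχ
      have h2 : ∑ n, (unimodularExt χ n - χ n) = 1 := by
        rw [sum_eq_single_of_mem 0 (mem_univ _)]
        · simp [unimodularExt, MulChar.map_zero χ]
        · intro n _ hn; simp [unimodularExt, hn]
      rw [sum_sub_distrib, this] at h2
      simpa using h2
    rw [Fintype.expect_eq_sum_div_card (unimodularExt χ), h0, ZMod.card, ← expect_const (univ_nonempty (α := ZMod p)) (1 / 2 : ℝ)]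
    refine expect_le_expect fun n _ => ?_
    have h1 := norm_sub_norm_le (unimodularExt χ n) (1 / p)
    rw [norm_unimodularExt, norm_div, norm_one, Complex.norm_natCast] at h1
    have : (1 : ℝ) / p ≤ 1 / 2 := by gcongr; exact_mod_cast hp2
    linarith
  | succ k ih =>
    obtain ⟨c, hc, p₀, h⟩ := ih
    refine ⟨c / 2 ^ (k + 4), by positivity, max (max p₀ (2 ^ (k + 1) + 2)) (⌈2 ^ (k + 4) / c⌉₊),
      fun p hp hp2 χ hχ => ?_⟩
    simp only [max_le_iff] at hp2
    obtain ⟨⟨h1, h2⟩, h3⟩ := hp2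
    have h4 := h p h1 χ hχ
    have h2k : 0 < 2 ^ (k + 1) := by positivity
    have h5 := gowersDev_le_succ (p := p) (by omega) (k := k) (by omega) χ
    have h6 := Nat.ceil_le.1 h3
    have h7 : 2 ^ (k + 3) * (1 / p) ≤ c / 2 := by
      rw [div_le_iff₀ hc] at h6
      have : (2 : ℝ) ^ (k + 3) * (1 / p) = 2 ^ (k + 3) / p := by ring
      rw [this, div_le_iff₀ (mod_cast hp.out.pos)]
      have : (2 : ℝ) ^ (k + 4) = 2 * 2 ^ (k + 3) := by ring
      linarith
    rw [div_le_iff₀ (by positivity)]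
    have : (2 : ℝ) ^ (k + 4) = 2 * 2 ^ (k + 3) := by ring
    rw [this]
    linarith

lemma exists_gowersMean_le (k : ℕ) : ∃ c : ℝ, 0 < c ∧ c < 1 ∧ ∃ p₀ : ℕ, ∀ (p : ℕ)
    [Fact p.Prime], p₀ ≤ p → ∀ χ : DirichletCharacter ℂ p, χ ≠ 1 →
      gowersMean k (fun n : ZMod p => χ n) ≤ 1 - c := by
  obtain ⟨c, hc, p₀, h⟩ := exists_le_gowersDev k
  refine ⟨min (c ^ 2 / 4) (1 / 2), by positivity, by
    exact (min_le_right _ _).trans_lt (by norm_num), max p₀ (⌈2 ^ k / (c ^ 2 / 4)⌉₊),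
    fun p hp hp2 χ hχ => ?_⟩
  rw [max_le_iff] at hp2
  have h1 := h p hp2.1 χ hχ
  set f := unimodularExt χ with hf
  have hfn := norm_unimodularExt χ
  have hp0 : (0 : ℝ) < p := mod_cast hp.out.pos
  have h2 : gowersDev k f ≤ -(1 / c) * gowersMean k f + (1 / c + c / 2) := by
    rw [gowersMean_eq_listAvg, ← listAvg_affine]
    refine listAvg_mono _ fun l _ => ?_
    set g := mulDeltaList l f with hg
    have hgn := mulDeltaList_norm hfn l
    set m := univ.expect g with hm
    have hm1 := norm_expect_le_one fun n => (hgn n).le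
    have e1 : (univ.expect fun n => ‖g n - m‖ ^ 2) = 1 - ‖m‖ ^ 2 := by
      have : ∀ n, ‖g n - m‖ ^ 2 = 1 + ‖m‖ ^ 2 + (-2) * (g n * conj m).re := by
        intro n
        have := Complex.sq_norm_sub_sq_re
        rw [← Complex.normSq_eq_norm_sq, Complex.normSq_sub, Complex.normSq_eq_norm_sq,
          Complex.normSq_eq_norm_sq, hgn]
        ring
      simp_rw [this]
      rw [expect_add_distrib, expect_const univ_nonempty, ← mul_expect]
      have e2 : (univ.expect fun n => (g n * conj m).re) = ‖m‖ ^ 2 := by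
        rw [Fintype.expect_eq_sum_div_card, ← Complex.re_sum, ← sum_mul]
        have : ∑ n, g n = Fintype.card (ZMod p) * m := by rw [hm, Fintype.card_mul_expect]
        rw [this, mul_assoc, Complex.mul_conj', ← Complex.ofReal_natCast, ← Complex.ofReal_pow,
          ← Complex.ofReal_mul, Complex.ofReal_re, ZMod.card]
        field_simp
      rw [e2]; ring
    calc (univ.expect fun n => ‖g n - m‖) ≤
          univ.expect fun n => (c / 2 + 1 / (2 * c) * ‖g n - m‖ ^ 2) := by
          refine expect_le_expect fun n _ => ?_
          have : c / 2 + 1 / (2 * c) * ‖g n - m‖ ^ 2 - ‖g n - m‖ =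
              1 / (2 * c) * (‖g n - m‖ - c) ^ 2 := by field_simp; ring
          have h3 : 0 ≤ 1 / (2 * c) * (‖g n - m‖ - c) ^ 2 := by positivity
          linarith
      _ = c / 2 + 1 / (2 * c) * (1 - ‖m‖ ^ 2) := by
          rw [expect_add_distrib, expect_const univ_nonempty, ← mul_expect, e1]
      _ ≤ c / 2 + 1 / (2 * c) * (2 * (1 - ‖m‖)) := by
          gcongr
          nlinarith
      _ = _ := by field_simp; ring
  have h3 : gowersMean k (fun n : ZMod p => χ n) ≤ gowersMean k f + 2 ^ k * (1 / p) := by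
    have haff := listAvg_affine k (fun l => ‖univ.expect (mulDeltaList l f)‖) 1 (2 ^ k * (1 / p))
    rw [gowersMean_eq_listAvg, gowersMean_eq_listAvg, ← one_mul (listAvg k _), one_mul, ← one_mul (listAvg k fun l => ‖univ.expect (mulDeltaList l f)‖), ← haff]
    refine listAvg_mono _ fun l hl => ?_
    have h4 := expect_mulDeltaList_sub_le l (f := fun n : ZMod p => χ n) (g := f)
      (fun n => norm_le_one χ n) (fun n => (hfn n).le)
    have h5 : (univ.expect fun n => ‖χ n - f n‖) ≤ 1 / p := by
      apply expect_norm_sub_le_of_eq_off_zero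
      · intro n hn; simp [hf, unimodularExt, hn]
      · simp [hf, unimodularExt, MulChar.map_zero χ]
    have h6 : ‖univ.expect (mulDeltaList l fun n : ZMod p => χ n)‖ ≤
        ‖univ.expect (mulDeltaList l f)‖ + univ.expect fun n =>
          ‖mulDeltaList l (fun n : ZMod p => χ n) n - mulDeltaList l f n‖ := by
      rw [← sub_le_iff_le_add']
      refine (norm_sub_norm_le _ _).trans ?_
      rw [← expect_sub_distrib, Fintype.expect_eq_sum_div_card,
        Fintype.expect_eq_sum_div_card, norm_div, Complex.norm_natCast]
      gcongr
      exact norm_sum_le _ _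
    rw [hl] at h4
    have : 2 ^ k * (univ.expect fun n => ‖χ n - f n‖) ≤ 2 ^ k * (1 / p) := by gcongr
    rw [one_mul]
    linarith
  have h4 : 2 ^ k * (1 / p) ≤ c ^ 2 / 4 := by
    have := Nat.ceil_le.1 hp2.2
    rw [div_le_iff₀ (by positivity)] at this
    rw [mul_one_div, div_le_iff₀ hp0]
    linarith
  have h5 : gowersMean k f ≤ 1 - c ^ 2 / 2 := by
    have := h1.trans h2
    have e : c * (-(1 / c) * gowersMean k f + (1 / c + c / 2)) = -gowersMean k f + 1 + c ^ 2 / 2 := by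
      field_simp
      ring
    nlinarith
  have := min_le_left (c ^ 2 / 4) (1 / 2)
  linarith
end

section

/-- Chinese remainder isomorphism for a product of distinct primes. -/
noncomputable def primesCRT (S : Finset ℕ) (hS : ∀ p ∈ S, p.Prime) :
    ZMod (∏ p ∈ S, p) ≃+* ((i : S) → ZMod (i : ℕ)) :=
  (ZMod.ringEquivCongr (prod_coe_sort S fun p => p).symm).trans
    (ZMod.prodEquivPi (fun i : S => (i : ℕ)) fun i j hij =>
      (Nat.coprime_primes (hS i i.2) (hS j j.2)).2 fun h => hij (Subtype.ext h))

/-- The component of a character modulo a product of distinct primes at one of these primes. -/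
noncomputable def charComponent {S : Finset ℕ} (hS : ∀ p ∈ S, p.Prime)
    (χ : DirichletCharacter ℂ (∏ p ∈ S, p)) (i : S) : DirichletCharacter ℂ (i : ℕ) :=
  { toFun := fun a => χ ((primesCRT S hS).symm (Pi.mulSingle i a))
    map_one' := by simp
    map_mul' := fun a b => by rw [Pi.mulSingle_mul, map_mul, map_mul]
    map_nonunit' := fun a ha => by
      apply χ.map_nonunit
      intro h
      apply ha
      have h1 := h.map (primesCRT S hS)
      rw [RingEquiv.apply_symm_apply] at h1
      have h2 := h1.map (Pi.evalRingHom (fun i : S => ZMod (i : ℕ)) i)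
      simpa using h2 }

lemma charComponent_apply {S : Finset ℕ} (hS : ∀ p ∈ S, p.Prime)
    (χ : DirichletCharacter ℂ (∏ p ∈ S, p)) (i : S) (a : ZMod (i : ℕ)) :
    charComponent hS χ i a = χ ((primesCRT S hS).symm (Pi.mulSingle i a)) := rfl

lemma char_eq_prod_charComponent {S : Finset ℕ} (hS : ∀ p ∈ S, p.Prime)
    (χ : DirichletCharacter ℂ (∏ p ∈ S, p)) (n : ℤ) :
    χ (n : ZMod (∏ p ∈ S, p)) = ∏ i : S, charComponent hS χ i (n : ZMod (i : ℕ)) := by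
  simp_rw [charComponent_apply]
  rw [← map_prod, ← map_prod]
  congr 1
  rw [RingEquiv.eq_symm_apply, map_intCast]
  exact (univ_prod_mulSingle (fun i : S => (n : ZMod i))).symm

/-- A component as a family indexed by all natural numbers. -/
noncomputable def charFamily {S : Finset ℕ} (hS : ∀ p ∈ S, p.Prime)
    (χ : DirichletCharacter ℂ (∏ p ∈ S, p)) (p : ℕ) : DirichletCharacter ℂ p :=
  if h : p ∈ S then charComponent hS χ ⟨p, h⟩ else 1

lemma char_eq_prod_charFamily {S : Finset ℕ} (hS : ∀ p ∈ S, p.Prime) (χ : DirichletCharacter ℂ (∏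
    p ∈ S, p)) (n : ℤ) : χ (n : ZMod (∏ p ∈ S, p)) = ∏ p ∈ S, charFamily hS χ p (n : ZMod p) := by
  rw [char_eq_prod_charComponent hS, ← prod_coe_sort S]
  refine prod_congr rfl fun i _ => ?_
  simp [charFamily]
end

section

/-- The arithmetic function `n ↦ ∏_{p ∈ S} X_p(n)`. -/
noncomputable def familyProd (X : (p : ℕ) → DirichletCharacter ℂ p) (S : Finset ℕ) (n : ℤ) : ℂ :=
  ∏ p ∈ S, X p (n : ZMod p)

variable (X : (p : ℕ) → DirichletCharacter ℂ p)

lemma norm_familyProd_le_one (S : Finset ℕ) (n : ℤ) : ‖familyProd X S n‖ ≤ 1 := by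
  rw [familyProd, norm_prod]
  exact prod_le_one (fun _ _ => norm_nonneg _) fun p _ => norm_le_one _ _

lemma familyProd_periodic (S : Finset ℕ) (n : ℤ) :
    familyProd X S (n + (∏ p ∈ S, p : ℕ)) = familyProd X S n := by
  refine prod_congr rfl fun p hp => ?_
  have h : (((∏ p ∈ S, p : ℕ) : ℤ) : ZMod p) = 0 := by
    rw [Int.cast_natCast, ZMod.natCast_eq_zero_iff]
    exact dvd_prod_of_mem (fun p => p) hp
  rw [Int.cast_add, h, add_zero]

lemma exists_gowersMean_familyProd_le {S : Finset ℕ} (hS : ∀ p ∈ S, p.Prime)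
    [NeZero (∏ p ∈ S, p)] {k : ℕ} {c : ℝ} {p₀ : ℕ}
    (h : ∀ (p : ℕ) [Fact p.Prime], p₀ ≤ p → ∀ χ : DirichletCharacter ℂ p, χ ≠ 1 →
      gowersMean k (fun n : ZMod p => χ n) ≤ 1 - c) (hX : ∀ p ∈ S, X p ≠ 1) :
    ∃ F : ZMod (∏ p ∈ S, p) → ℂ, (∀ n, ‖F n‖ ≤ 1) ∧ (∀ n : ℤ, familyProd X S n = F n) ∧
      gowersMean k F ≤ (1 - c) ^ (S.filter (p₀ ≤ ·)).card := by
  have hfact : ∀ i : S, Fact (i : ℕ).Prime := fun i => ⟨hS i i.2⟩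
  set e := primesCRT S hS with he
  refine ⟨fun x => ∏ i : S, X i (e x i), fun n => ?_, fun n => ?_, ?_⟩
  · rw [norm_prod]
    exact prod_le_one (fun _ _ => norm_nonneg _) fun p _ => norm_le_one _ _
  · rw [familyProd, ← prod_coe_sort S]
    simp
  · have h1 := gowersMean_comp_equiv e.toAddEquiv k
      (fun x : (i : S) → ZMod i => ∏ i : S, X i (x i))
    have h2 := gowersMean_pi k (fun (i : S) (x : ZMod i) => X i x)
    rw [h2] at h1
    refine (le_of_eq h1).trans ?_
    have h3 : ∀ i : S, gowersMean k (fun x : ZMod i => X i x) ≤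
        if p₀ ≤ i then 1 - c else 1 := by
      intro i
      split_ifs with hi
      · exact h i hi _ (hX i i.2)
      · exact gowersMean_le_one k fun n => norm_le_one _ _
    refine (prod_le_prod (fun i _ => gowersMean_nonneg k _) fun i _ => h3 i).trans ?_
    rw [prod_coe_sort S (fun p => if p₀ ≤ p then 1 - c else 1), prod_ite]
    simp

/-- Greedy choice of a subset with product in `(A, A x]`. -/
lemma exists_subset_prod {x A : ℝ} (hA : 1 ≤ A) (S : Finset ℕ) (h1 : ∀ p ∈ S, 1 ≤ p)
    (hx : ∀ p ∈ S, (p : ℝ) ≤ x) (hS : A < ∏ p ∈ S, (p : ℝ)) :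
    ∃ T ⊆ S, A < ∏ p ∈ T, (p : ℝ) ∧ ∏ p ∈ T, (p : ℝ) ≤ A * x := by
  induction S using Finset.induction_on with
  | empty => simp at hS; linarith
  | insert p S hp ih =>
    by_cases hc : A < ∏ p ∈ S, (p : ℝ)
    · obtain ⟨T, hT, h⟩ := ih (fun q hq => h1 q (mem_insert_of_mem hq))
        (fun q hq => hx q (mem_insert_of_mem hq)) hc
      exact ⟨T, hT.trans (subset_insert _ _), h⟩
    · refine ⟨insert p S, subset_rfl, hS, ?_⟩
      rw [prod_insert hp, mul_comm]
      have := hx p (mem_insert_self _ _)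
      push Not at hc
      gcongr

lemma exists_factorsInto {S₀ : Finset ℕ} {x A N : ℝ} (hA : 1 ≤ A)
    (hx1 : 1 ≤ x) (hS₀ : ∀ p ∈ S₀, p.Prime) (hN : (∏ p ∈ S₀, (p : ℝ)) * (A * x) ≤ N) (k : ℕ)
    {F : ZMod (∏ p ∈ S₀, p) → ℂ} (hF : ∀ n : ℤ, familyProd X S₀ n = F n)
    (S : Finset ℕ) (hS : ∀ p ∈ S, p.Prime) (hd : Disjoint S S₀) (hx : ∀ p ∈ S, (p : ℝ) ≤ x)
    (hprod : ∏ p ∈ S, (p : ℝ) ≤ A ^ k) :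
    FactorsInto (∏ p ∈ S₀, p) N k F (familyProd X (S ∪ S₀)) := by
  induction k generalizing S with
  | zero =>
    have : S = ∅ := by
      by_contra hne
      obtain ⟨p, hp⟩ := nonempty_iff_ne_empty.2 hne
      have h2 : (2 : ℝ) ≤ p := mod_cast (hS p hp).two_le
      have h3 := Nat.le_of_dvd (prod_pos fun q hq => (hS q hq).pos)
        (dvd_prod_of_mem (fun p => p) hp)
      have : p ≤ ((∏ p ∈ S, p : ℕ) : ℝ) := Nat.cast_le.2 h3
      rw [Nat.cast_prod] at this
      simp only [pow_zero] at hprod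
      linarith
    subst this
    simpa [FactorsInto] using hF
  | succ k ih =>
    have key : ∃ T ⊆ S, ∏ p ∈ T, (p : ℝ) ≤ A * x ∧ ∏ p ∈ S \ T, (p : ℝ) ≤ A ^ k := by
      by_cases hc : A < ∏ p ∈ S, (p : ℝ)
      · obtain ⟨T, hT, h1, h2⟩ := exists_subset_prod hA S (fun p hp => (hS p hp).one_le) hx hc
        refine ⟨T, hT, h2, ?_⟩
        have : (∏ p ∈ S \ T, (p : ℝ)) * ∏ p ∈ T, (p : ℝ) = ∏ p ∈ S, (p : ℝ) := prod_sdiff hT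
        have hA0 : 0 < A := by linarith
        rw [pow_succ] at hprod
        refine le_of_mul_le_mul_right ?_ hA0
        calc _ ≤ (∏ p ∈ S \ T, (p : ℝ)) * ∏ p ∈ T, (p : ℝ) := by gcongr
          _ ≤ _ := by rw [this]; exact hprod
      · refine ⟨S, subset_rfl, ?_, ?_⟩
        · push Not at hc
          exact hc.trans (le_mul_of_one_le_right (by linarith) hx1)
        · simpa using one_le_pow₀ hA
    obtain ⟨T, hTS, hT1, hT2⟩ := key
    refine ⟨∏ p ∈ T, p, familyProd X T, familyProd X (S \ T ∪ S₀), ?_, ?_, familyProd_periodic X T,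
      norm_familyProd_le_one X T, ih (S \ T) (fun p hp => hS p (mem_sdiff.1 hp).1)
        (hd.mono_left sdiff_subset) (fun p hp => hx p (mem_sdiff.1 hp).1) hT2, ?_⟩
    · refine Nat.Coprime.prod_left fun p hp => Nat.Coprime.prod_right fun q hq => ?_
      refine (Nat.coprime_primes (hS p (hTS hp)) (hS₀ q hq)).2 fun h => ?_
      exact disjoint_left.1 hd (hTS hp) (h ▸ hq)
    · push_cast
      refine le_trans ?_ hN
      gcongr
    · intro n
      simp only [familyProd]
      rw [← prod_union]
      · congr 1
        rw [← union_assoc, union_sdiff_of_subset hTS]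
      · rw [disjoint_union_right]
        exact ⟨disjoint_sdiff, hd.mono_left hTS⟩
end

section
open Chebyshev

/-- The primes up to `x`. -/
noncomputable def primesUpTo (x : ℝ) : Finset ℕ := filter Nat.Prime (range (⌊x⌋₊ + 1))

lemma mem_primesUpTo {x : ℝ} (hx : 0 ≤ x) {p : ℕ} : p ∈ primesUpTo x ↔ p.Prime ∧ (p : ℝ) ≤ x := by
  rw [primesUpTo, mem_filter, mem_range, Nat.lt_succ_iff, Nat.le_floor_iff hx, and_comm]

lemma prime_of_mem_primesUpTo {x : ℝ} {p : ℕ} (hp : p ∈ primesUpTo x) : p.Prime :=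
  (mem_filter.1 hp).2

lemma le_of_mem_primesUpTo {x : ℝ} {p : ℕ} (hp : p ∈ primesUpTo x) : (p : ℝ) ≤ x := by
  rcases le_or_gt 0 x with hx | hx
  · exact ((mem_primesUpTo hx).1 hp).2
  · have h := (mem_filter.1 hp)
    rw [Nat.floor_of_nonpos hx.le] at h
    have h1 := mem_range.1 h.1
    have := h.2.two_le
    omega

lemma theta_eq_log_prod_primesUpTo (x : ℝ) : theta x = log (∏ p ∈ primesUpTo x, p : ℕ) := by
  rw [theta_eq_log_primorial]
  rfl

lemma one_le_prod_primes {S : Finset ℕ} (hS : ∀ p ∈ S, p.Prime) : 1 ≤ ∏ p ∈ S, p :=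
  Nat.one_le_iff_ne_zero.2 (prod_ne_zero_iff.2 fun p hp => (hS p hp).ne_zero)

lemma eventually_exp_neg_sqrt_le {b : ℝ} (hb : 0 < b) {K : ℝ} (hK : 0 < K) (n : ℕ) :
    ∀ᶠ x : ℝ in atTop, rexp (-(b * √x)) ≤ K / x ^ n := by
  have h1 := tendsto_sqrt_atTop.eventually ((isLittleO_pow_exp_pos_mul_atTop (2 * n) hb).bound hK)
  filter_upwards [h1, eventually_gt_atTop 0] with x h hx
  rw [pow_mul, sq_sqrt hx.le, norm_of_nonneg (by positivity), norm_of_nonneg (by positivity)] at h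
  rw [le_div_iff₀ (by positivity), exp_neg, ← div_eq_inv_mul, div_le_iff₀ (by positivity)]
  exact h

lemma eventually_log_le_mul_rpow {K : ℝ} (hK : 0 < K) {r : ℝ} (hr : 0 < r) :
    ∀ᶠ x : ℝ in atTop, log x ≤ K * x ^ r := by
  filter_upwards [(isLittleO_log_rpow_atTop hr).bound hK, eventually_gt_atTop 0] with x h hx
  rw [norm_of_nonneg (r := x ^ r) (by positivity)] at h
  exact (le_abs_self _).trans h

lemma eventually_log_le_sqrt : ∀ᶠ x : ℝ in atTop, log x ≤ √x := by
  simpa [sqrt_eq_rpow] using eventually_log_le_mul_rpow one_pos (r := 1 / 2) (by norm_num)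

/-- `θ(x) ≥ x / 2` for large `x`. -/
lemma eventually_half_le_theta : ∀ᶠ x : ℝ in atTop, x / 2 ≤ theta x := by
  filter_upwards [eventually_log_le_mul_rpow (K := 1 / 100) (by norm_num) (r := 1 / 2) (by norm_num),
    eventually_ge_atTop 1000000] with x h hx
  rw [← sqrt_eq_rpow] at h
  refine le_trans ?_ (theta_ge' (by linarith))
  have hl := log_two_gt_d9
  have hs : √x * √x = x := mul_self_sqrt (by linarith)
  have h1000 : 1000 ≤ √x := by
    rw [le_sqrt (by norm_num) (by linarith)]
    linarith
  have h2 : log (x + 2) ≤ log x + log 2 := by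
    rw [← log_mul (by linarith) (by norm_num)]
    exact log_le_log (by linarith) (by linarith)
  have hl2 := log_two_lt_d9
  have h3 : 2 * √x * log x ≤ 2 * √x * (1 / 100 * √x) := by gcongr
  nlinarith

lemma norm_sum_Ico_chop {Q₀ : ℕ} [NeZero Q₀] {N : ℝ} (hN : 1 ≤ N) {k : ℕ}
    {F : ZMod Q₀ → ℂ} {Φ : ℤ → ℂ} (hF : ∀ n, ‖F n‖ ≤ 1) (h : FactorsInto Q₀ N k F Φ) {B : ℝ}
    (hB : 0 ≤ B) (hG : gowersMean k F + Q₀ / N ≤ B ^ 2 ^ k) (j : ℕ) {a b : ℤ}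
    (hab : (b - a : ℝ) ≤ j * (N / 2)) :
    ‖∑ n ∈ Ico a b, Φ n‖ ≤ j * (2 * N * B) := by
  have key : ∀ a b : ℤ, (b - a : ℝ) ≤ N → ‖∑ n ∈ Ico a b, Φ n‖ ≤ 2 * N * B := by
    intro a b hab
    refine le_of_pow_le_pow_left₀ (n := 2 ^ k) (by positivity) (by positivity) ?_
    refine (norm_sum_pow_le_gowersMean (by linarith) k hF h hab).trans ?_
    rw [mul_pow _ B]
    gcongr
  induction j generalizing a with
  | zero =>
    have : b ≤ a := by
      have : (b - a : ℝ) ≤ 0 := by simpa using hab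
      have : (b : ℝ) ≤ a := by linarith
      exact_mod_cast this
    simp [Ico_eq_empty_of_le this]
  | succ j ih =>
    by_cases hc : (b - a : ℝ) ≤ N
    · refine (key a b hc).trans ?_
      push_cast
      have : 0 ≤ 2 * N * B := by positivity
      nlinarith
    · push Not at hc
      have h1 := Int.floor_le N
      have h2 := Int.lt_floor_add_one N
      have h3 : (1 : ℝ) ≤ ⌊N⌋ := mod_cast Int.le_floor.2 (by simpa using hN)
      have h5 : a + ⌊N⌋ ≤ b := by
        have : ((a + ⌊N⌋ : ℤ) : ℝ) ≤ b := by push_cast; linarith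
        exact_mod_cast this
      have h6 : a ≤ a + ⌊N⌋ := by
        have : 1 ≤ ⌊N⌋ := mod_cast h3
        omega
      rw [← Ico_union_Ico_eq_Ico h6 h5,
        sum_union (Ico_disjoint_Ico_consecutive _ _ _)]
      refine (norm_add_le _ _).trans ?_
      have h7 := key a (a + ⌊N⌋) (by push_cast; linarith)
      have h8 := ih (a := a + ⌊N⌋) (by push_cast at hab ⊢; linarith)
      push_cast
      linarith

lemma norm_sum_Icc_le_of_factorsInto {Q₀ : ℕ} [NeZero Q₀] {N : ℝ} (hN : 1 ≤ N) {k : ℕ}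
    {F : ZMod Q₀ → ℂ} {Φ : ℤ → ℂ} (hF : ∀ n, ‖F n‖ ≤ 1) (h : FactorsInto Q₀ N k F Φ) {B : ℝ}
    (hB : 0 ≤ B) (hG : gowersMean k F + Q₀ / N ≤ B ^ 2 ^ k) {M : ℝ} (hM : N ≤ M) :
    ‖∑ n ∈ Icc 1 ⌊M⌋₊, Φ (n : ℤ)‖ ≤ 6 * M * B := by
  have hN0 : 0 < N := by linarith
  have h1 : ∑ n ∈ Icc 1 ⌊M⌋₊, Φ (n : ℤ) = ∑ n ∈ Ico (1 : ℤ) (⌊M⌋₊ + 1), Φ n := by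
    refine sum_bij (fun n _ => (n : ℤ)) ?_ ?_ ?_ ?_
    · intro n hn
      rw [mem_Icc] at hn
      rw [mem_Ico]
      omega
    · intro m _ n _ hmn
      exact_mod_cast hmn
    · intro n hn
      rw [mem_Ico] at hn
      exact ⟨n.toNat, mem_Icc.2 (by omega), by simp; omega⟩
    · simp
  rw [h1]
  have h2 := Nat.floor_le (by linarith : 0 ≤ M)
  refine (norm_sum_Ico_chop hN hF h hB hG ⌈2 * M / N⌉₊ ?_).trans ?_
  · push_cast
    have := Nat.le_ceil (2 * M / N)
    rw [div_le_iff₀ hN0] at this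
    linarith
  · have h3 := (Nat.ceil_lt_add_one (div_nonneg (by linarith) hN0.le : 0 ≤ 2 * M / N)).le
    calc _ ≤ (2 * M / N + 1) * (2 * N * B) := (by gcongr)
      _ = (4 * M + 2 * N) * B := by field_simp; ring
      _ ≤ _ := by gcongr; linarith

/-- Short character sums to smooth moduli: for `x` large, any family of characters modulo the primes
up to `x`, not all trivial, has cancellation of size `x ^ A` in sums longer than `P ^ δ`. -/
lemma norm_sum_familyProd_le {δ : ℝ} (hδ : 0 < δ) (A : ℕ) :
    ∀ᶠ x : ℝ in atTop, ∀ X : (p : ℕ) → DirichletCharacter ℂ p,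
      ∀ S ⊆ primesUpTo x, S.Nonempty → (∀ p ∈ S, X p ≠ 1) →
      ∀ M : ℝ, rexp (δ * theta x) ≤ M →
        ‖∑ n ∈ Icc 1 ⌊M⌋₊, familyProd X S (n : ℤ)‖ ≤ M / x ^ A := by
  set k : ℕ := ⌈4 / δ⌉₊ with hk
  obtain ⟨c, hc0, hc1, p₀, hp₀⟩ := exists_gowersMean_le k
  have hasym1 : ∀ᶠ x : ℝ in atTop, rexp (-(c * (δ / 8 * x / log x - p₀))) + rexp (-(δ / 8 * x))
      ≤ (1 / (6 * x ^ A)) ^ 2 ^ k := by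
    have e1 := eventually_exp_neg_sqrt_le (b := c * (δ / 8)) (by positivity)
      (K := rexp (-(c * p₀)) * (1 / 6) ^ 2 ^ k / 2) (by positivity) (A * 2 ^ k)
    have e2 := eventually_exp_neg_sqrt_le (b := δ / 8) (by positivity)
      (K := (1 / 6) ^ 2 ^ k / 2) (by positivity) (A * 2 ^ k)
    filter_upwards [e1, e2, eventually_log_le_sqrt, eventually_gt_atTop 1] with x h1 h2 h3 hx
    have hlx := log_pos hx
    have hsq := one_le_sqrt.2 hx.le
    have hss := mul_self_sqrt (by linarith)
    have h4 : √x ≤ x / log x := by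
      rw [le_div_iff₀ hlx]
      nlinarith
    have h5 : rexp (-(c * (δ / 8 * x / log x - p₀))) ≤ (1 / 6) ^ 2 ^ k / 2 / x ^ (A * 2 ^ k) := by
      calc _ ≤ rexp (c * p₀) * rexp (-(c * (δ / 8) * √x)) := by
            rw [← exp_add, exp_le_exp, mul_div_assoc]
            have : c * (δ / 8) * √x ≤ c * (δ / 8) * (x / log x) := by gcongr
            linarith
        _ ≤ rexp (c * p₀) * (rexp (-(c * p₀)) * (1 / 6) ^ 2 ^ k / 2 / x ^ (A * 2 ^ k)) := by gcongr
        _ = (rexp (c * p₀) * rexp (-(c * p₀))) * ((1 / 6) ^ 2 ^ k / 2 / x ^ (A * 2 ^ k)) := by ring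
        _ = _ := by rw [← exp_add, add_neg_cancel, exp_zero, one_mul]
    have h6 : rexp (-(δ / 8 * x)) ≤ rexp (-(δ / 8 * √x)) := by
      have : √x ≤ x := by nlinarith
      gcongr
    have h7 : (1 / (6 * x ^ A)) ^ 2 ^ k = (1 / 6) ^ 2 ^ k / 2 / x ^ (A * 2 ^ k) +
        (1 / 6) ^ 2 ^ k / 2 / x ^ (A * 2 ^ k) := by
      rw [pow_mul, one_div, mul_inv, mul_pow, one_div, inv_pow (x ^ A)]
      ring
    rw [h7]
    exact add_le_add h5 (h6.trans h2)
  have hasym0 : ∀ᶠ x : ℝ in atTop, rexp (-(δ / 4 * x)) ≤ 1 / (6 * x ^ A) := by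
    filter_upwards [eventually_exp_neg_sqrt_le (b := δ / 4) (by positivity)
      (K := 1 / 6) (by positivity) A, eventually_ge_atTop 1] with x h1 hx
    have hsq := one_le_sqrt.2 hx
    have hss : √x * √x = x := mul_self_sqrt (by linarith)
    refine le_trans ?_ (h1.trans_eq (by rw [div_div]))
    have : √x ≤ x := by nlinarith
    gcongr
  have hasym2 : ∀ᶠ x : ℝ in atTop, x ^ 2 ≤ rexp (δ / 4 * x) := by
    filter_upwards [(isLittleO_pow_exp_pos_mul_atTop 2 (b := δ / 4) (by positivity)).bound one_pos]
      with x h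
    simpa [abs_of_nonneg, sq_nonneg] using h
  filter_upwards [hasym1, hasym0, hasym2, eventually_half_le_theta, eventually_gt_atTop 1] with
    x h1 h0 h2 hth hx1 X S hSx hSne hX M hM
  have hSp : ∀ p ∈ S, p.Prime := fun p hp => prime_of_mem_primesUpTo (hSx hp)
  set N := rexp (δ * theta x) with hN
  have hθ := theta_nonneg x
  have hN1 : 1 ≤ N := one_le_exp (by positivity)
  have hx0 : 0 < x := by linarith
  have hB : 0 ≤ 1 / (6 * x ^ A) := by positivity
  have hfin : 6 * M * (1 / (6 * x ^ A)) = M / x ^ A := by field_simp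
  rw [← hfin]
  have hthx : δ / 4 * x ≤ δ / 2 * theta x := by nlinarith
  by_cases hc : (∏ p ∈ S, (p : ℝ)) ≤ rexp (δ / 2 * theta x)
  · have : NeZero (∏ p ∈ S, p) := ⟨prod_ne_zero_iff.2 fun p hp => (hSp p hp).ne_zero⟩
    obtain ⟨F, hF1, hF2, hF3⟩ := exists_gowersMean_familyProd_le X hSp (k := 0) (c := 1) (p₀ := 0)
      (fun p _ _ χ hχ => by
        simp only [gowersMean, expect, MulChar.sum_eq_zero_of_ne_one hχ]
        simp) hX
    refine norm_sum_Icc_le_of_factorsInto (k := 0) hN1 hF1 hF2 hB ?_ hM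
    have : (S.filter (0 ≤ ·)).card ≠ 0 := by simpa using hSne.ne_empty
    rw [sub_self, zero_pow this] at hF3
    push_cast
    rw [pow_one]
    refine le_trans ?_ h0
    have : (∏ p ∈ S, (p : ℝ)) / N ≤ rexp (-(δ / 4 * x)) := by
      rw [div_le_iff₀ (by positivity), hN, ← exp_add]
      refine hc.trans (exp_le_exp.2 ?_)
      linarith
    linarith
  · push Not at hc
    have hP : (∏ p ∈ S, (p : ℝ)) ≤ rexp (theta x) := by
      rw [theta_eq_log_prod_primesUpTo, exp_log (by
        exact_mod_cast one_le_prod_primes fun p hp => prime_of_mem_primesUpTo hp)]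
      rw [← Nat.cast_prod]
      exact Nat.cast_le.2 <| Nat.le_of_dvd (one_le_prod_primes fun p hp => prime_of_mem_primesUpTo hp)
        (prod_dvd_prod_of_subset S (primesUpTo x) (fun p => p) hSx)
    have hA : 1 ≤ rexp (δ / 4 * theta x) := one_le_exp (by positivity)
    obtain ⟨S₀, hS₀, hS₁, hS₂⟩ := exists_subset_prod hA S (fun p hp => (hSp p hp).one_le)
      (fun p hp => le_of_mem_primesUpTo (hSx hp)) (lt_of_le_of_lt (exp_le_exp.2 (by nlinarith)) hc)
    have hS₀p : ∀ p ∈ S₀, p.Prime := fun p hp => hSp p (hS₀ hp)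
    have : NeZero (∏ p ∈ S₀, p) := ⟨prod_ne_zero_iff.2 fun p hp => (hS₀p p hp).ne_zero⟩
    obtain ⟨F, hF1, hF2, hF3⟩ := exists_gowersMean_familyProd_le X hS₀p hp₀ fun p hp => hX p (hS₀ hp)
    have hx2 := h2.trans (exp_le_exp.2 hthx)
    have hNN : (∏ p ∈ S₀, (p : ℝ)) * (rexp (δ / 4 * theta x) * x) ≤ N := by
      calc _ ≤ rexp (δ / 4 * theta x) * x * (rexp (δ / 4 * theta x) * x) := by
            gcongr
        _ = rexp (δ / 2 * theta x) * x ^ 2 := by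
            rw [show δ / 2 * theta x = δ / 4 * theta x + δ / 4 * theta x by
              ring, exp_add]
            ring
        _ ≤ rexp (δ / 2 * theta x) * rexp (δ / 2 * theta x) := by gcongr
        _ = N := by rw [hN, ← exp_add]; ring_nf
    have hfac := exists_factorsInto X hA hx1.le hS₀p hNN k hF2 (S \ S₀)
      (fun p hp => hSp p (mem_sdiff.1 hp).1) sdiff_disjoint
      (fun p hp => le_of_mem_primesUpTo (hSx (mem_sdiff.1 hp).1)) (by
        calc (∏ p ∈ S \ S₀, (p : ℝ)) ≤ ∏ p ∈ S, (p : ℝ) := by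
              rw [← Nat.cast_prod, ← Nat.cast_prod]
              exact Nat.cast_le.2 <| Nat.le_of_dvd (one_le_prod_primes hSp)
                (prod_dvd_prod_of_subset (S \ S₀) S (fun p => p) sdiff_subset)
          _ ≤ _ := hP
          _ ≤ _ := by
            rw [← exp_nat_mul]
            refine exp_le_exp.2 ?_
            have : 4 / δ ≤ k := Nat.le_ceil _
            rw [div_le_iff₀ hδ] at this
            nlinarith)
    rw [sdiff_union_of_subset hS₀] at hfac
    refine norm_sum_Icc_le_of_factorsInto hN1 hF1 hfac hB (le_trans ?_ h1) hM
    refine add_le_add (hF3.trans ?_) ?_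
    · have hcard : δ / 8 * x / log x - p₀ ≤ (S₀.filter (p₀ ≤ ·)).card := by
        have h5 : rexp (δ / 4 * theta x) ≤ x ^ S₀.card := by
          refine hS₁.le.trans ?_
          rw [← prod_const]
          exact prod_le_prod (fun p _ => Nat.cast_nonneg p) fun p hp =>
            le_of_mem_primesUpTo (hSx (hS₀ hp))
        rw [← exp_log hx0, ← exp_nat_mul, exp_le_exp, exp_log hx0] at h5
        have h6 : S₀.card ≤ (S₀.filter (p₀ ≤ ·)).card + p₀ := by
          rw [← card_filter_add_card_filter_not (s := S₀) (p₀ ≤ ·)]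
          gcongr
          refine (card_le_card (t := range p₀) fun p hp => ?_).trans_eq (card_range _)
          simpa using (mem_filter.1 hp).2
        have h7 : (S₀.card : ℝ) ≤ (S₀.filter (p₀ ≤ ·)).card + p₀ := mod_cast h6
        have : δ / 8 * x / log x ≤ S₀.card := by
          rw [div_le_iff₀ (log_pos hx1)]
          linarith
        linarith
      calc (1 - c) ^ (S₀.filter (p₀ ≤ ·)).card ≤ rexp (-c) ^ (S₀.filter (p₀ ≤ ·)).card := by
            refine pow_le_pow_left₀ (by linarith) ?_ _
            linarith [add_one_le_exp (-c)]
        _ = rexp (-(c * (S₀.filter (p₀ ≤ ·)).card)) := by rw [← exp_nat_mul]; ring_nf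
        _ ≤ _ := by gcongr
    · push_cast
      rw [div_le_iff₀ (by positivity), hN, ← exp_add]
      calc (∏ p ∈ S₀, (p : ℝ)) ≤ rexp (δ / 4 * theta x) * x := hS₂
        _ ≤ rexp (δ / 4 * theta x) * x ^ 2 := by gcongr; nlinarith
        _ ≤ rexp (δ / 4 * theta x) * rexp (δ / 2 * theta x) := by gcongr
        _ ≤ _ := by
          rw [← exp_add, exp_le_exp]
          linarith
end

section
open scoped Classical

/-- A set of primes is admissible for the thresholds `Z` if its `i`-th largest element (counting from
zero) is at most `Z i`. -/
def SieveAdmissible (Z : ℕ → ℝ) (t : Finset ℕ) : Prop :=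
  ∀ p ∈ t, (p : ℝ) ≤ Z (t.filter (p < ·)).card

lemma sieveAdmissible_insert {Z : ℕ → ℝ} {t : Finset ℕ} {P : ℕ} (hP : ∀ p ∈ t, p < P) :
    SieveAdmissible Z (insert P t) ↔ (P : ℝ) ≤ Z 0 ∧ SieveAdmissible (fun i => Z (i + 1)) t := by
  have h0 : (insert P t).filter (P < ·) = ∅ := by
    refine filter_eq_empty_iff.2 fun q hq => ?_
    rcases mem_insert.1 hq with rfl | hq
    · exact lt_irrefl _
    · exact (hP q hq).le.not_gt
  have h1 : ∀ p ∈ t, ((insert P t).filter (p < ·)).card = (t.filter (p < ·)).card + 1 := by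
    intro p hp
    rw [filter_insert, if_pos (hP p hp), card_insert_of_notMem]
    intro h
    exact lt_irrefl _ (hP P (mem_filter.1 h).1)
  unfold SieveAdmissible
  rw [forall_mem_insert, h0, card_empty]
  refine and_congr_right fun _ => forall₂_congr fun p hp => ?_
  rw [h1 p hp]

/-- The truncation of `∏ (1 - f p)` to admissible sets. -/
noncomputable def sieveSum (S : Finset ℕ) (Z : ℕ → ℝ) (f : ℕ → ℝ) : ℝ :=
  ∑ t ∈ S.powerset, if SieveAdmissible Z t then ∏ p ∈ t, -f p else 0

lemma sieveSum_insert {S : Finset ℕ} {P : ℕ} (hP : ∀ p ∈ S, p < P) (Z : ℕ → ℝ) (f : ℕ → ℝ) :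
    sieveSum (insert P S) Z f = sieveSum S Z f +
      if (P : ℝ) ≤ Z 0 then -f P * sieveSum S (fun i => Z (i + 1)) f else 0 := by
  have hPS : P ∉ S := fun h => lt_irrefl _ (hP P h)
  unfold sieveSum
  rw [sum_powerset_insert hPS]
  congr 1
  have key : ∀ t ∈ S.powerset, (if SieveAdmissible Z (insert P t) then ∏ p ∈ insert P t, -f p else 0) =
      if P ≤ Z 0 then
        -f P * (if SieveAdmissible (fun i => Z (i + 1)) t then ∏ p ∈ t, -f p else 0) else 0 := by
    intro t ht
    have htS := mem_powerset.1 ht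
    rw [sieveAdmissible_insert fun p hp => hP p (htS hp), prod_insert fun h => hPS (htS h)]
    split_ifs <;> simp_all
  rw [sum_congr rfl key]
  split_ifs with h
  · rw [mul_sum]
  · exact sum_const_zero

/-- The error made in the truncation. -/
noncomputable def sieveError (S : Finset ℕ) (Z : ℕ → ℝ) (f : ℕ → ℝ) : ℝ :=
  ∏ p ∈ S, (1 - f p) - sieveSum S Z f

lemma sieveError_insert {S : Finset ℕ} {P : ℕ} (hP : ∀ p ∈ S, p < P) (Z : ℕ → ℝ) (f : ℕ → ℝ) :
    sieveError (insert P S) Z f = sieveError S Z f -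
      f P * if (P : ℝ) ≤ Z 0 then sieveError S (fun i => Z (i + 1)) f else ∏ p ∈ S, (1 - f p) := by
  unfold sieveError
  rw [sieveSum_insert hP, prod_insert (fun h => lt_irrefl _ (hP P h))]
  split_ifs <;> ring

lemma sieveError_empty (Z : ℕ → ℝ) (f : ℕ → ℝ) : sieveError ∅ Z f = 0 := by
  simp [sieveError, sieveSum, SieveAdmissible]

lemma sieveError_sign {f : ℕ → ℝ} (h0 : ∀ p, 0 ≤ f p) (h1 : ∀ p, f p ≤ 1) (S : Finset ℕ) : (∀ Z :
    ℕ → ℝ, (∀ j, Z (2 * j) ≤ Z (2 * j + 1)) → sieveError S Z f ≤ 0) ∧ (∀ Z : ℕ → ℝ, (∀ j, Z (2 * j +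
    1) ≤ Z (2 * j + 2)) → (∀ p ∈ S, (p : ℝ) ≤ Z 0) → 0 ≤ sieveError S Z f) := by
  induction S using Finset.induction_on_max with
  | empty => exact ⟨fun Z _ => (sieveError_empty Z f).le, fun Z _ _ => (sieveError_empty Z f).ge⟩
  | insert P S hP ih =>
    refine ⟨fun Z hZ => ?_, fun Z hZ hZ0 => ?_⟩
    · rw [sieveError_insert hP]
      have hS := ih.1 Z hZ
      split_ifs with h
      · have := ih.2 (fun i => Z (i + 1)) (fun j => hZ (j + 1)) fun p hp =>
          (Nat.cast_le.2 (hP p hp).le).trans (h.trans (hZ 0))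
        linarith [mul_nonneg (h0 P) this]
      · have : 0 ≤ ∏ p ∈ S, (1 - f p) := prod_nonneg fun p _ => sub_nonneg.2 (h1 p)
        linarith [mul_nonneg (h0 P) this]
    · rw [sieveError_insert hP, if_pos (hZ0 P (mem_insert_self _ _))]
      have hS := ih.2 Z hZ fun p hp => hZ0 p (mem_insert_of_mem hp)
      have := ih.1 (fun i => Z (i + 1)) fun j => hZ j
      linarith [mul_nonneg (h0 P) (neg_nonneg.2 this)]

/-- The contribution of the `i`-th stage to the bound for the sieve error. -/
noncomputable def sieveErrorTerm (S : Finset ℕ) (w : ℝ) (f : ℕ → ℝ) (i : ℕ) : ℝ :=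
  (∑ p ∈ S.filter (fun p : ℕ => w < p), f p) ^ (i + 1) / (i + 1).factorial *
    ∏ p ∈ S.filter (fun p : ℕ => (p : ℝ) ≤ w), (1 - f p)

lemma pow_succ_div_factorial_add_le {s a : ℝ} (hs : 0 ≤ s) (ha : 0 ≤ a) (i : ℕ) :
    s ^ (i + 1) / (i + 1).factorial + a * (s ^ i / i.factorial) ≤ (s + a) ^ (i + 1) / (i + 1).factorial := by
  have h : s ^ (i + 1) + (i + 1) * s ^ i * a ≤ (s + a) ^ (i + 1) := by
    induction i with
    | zero => simp
    | succ i ih =>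
      have h1 : (s + a) * (s ^ (i + 1) + (i + 1) * s ^ i * a) ≤ (s + a) * (s + a) ^ (i + 1) := by gcongr
      have h2 : 0 ≤ (i + 1) * s ^ i * a ^ 2 := by positivity
      push_cast
      rw [pow_succ (s + a), mul_comm _ (s + a)]
      refine le_trans ?_ h1
      ring_nf at h2 ⊢
      linarith
  rw [Nat.factorial_succ]
  push_cast
  rw [show s ^ (i + 1) / ((i + 1) * i.factorial : ℝ) + a * (s ^ i / i.factorial) =
    (s ^ (i + 1) + (i + 1) * s ^ i * a) / ((i + 1) * i.factorial) by field_simp]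
  gcongr

lemma abs_sieveError_le {f : ℕ → ℝ} (h0 : ∀ p, 0 ≤ f p) (h1 : ∀ p, f p ≤ 1) (S : Finset ℕ) :
    ∀ (n : ℕ) (Z : ℕ → ℝ), S.card ≤ n →
      |sieveError S Z f| ≤ ∑ i ∈ range n, sieveErrorTerm S (Z i) f i := by
  have hnn : ∀ (S : Finset ℕ) w i, 0 ≤ sieveErrorTerm S w f i := fun S w i =>
    mul_nonneg (div_nonneg (pow_nonneg (sum_nonneg fun p _ => h0 p) _) (by positivity))
      (prod_nonneg fun p _ => sub_nonneg.2 (h1 p))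
  induction S using Finset.induction_on_max with
  | empty =>
    intro n Z _
    rw [sieveError_empty, abs_zero]
    exact sum_nonneg fun i _ => hnn _ _ _
  | insert P S hP ih =>
    intro n Z hn
    have hPS : P ∉ S := fun h => lt_irrefl _ (hP P h)
    rw [card_insert_of_notMem hPS] at hn
    obtain ⟨n, rfl⟩ : ∃ m, n = m + 1 := ⟨n - 1, by omega⟩
    have hbig : ∀ w : ℝ, w < P → ∀ i, sieveErrorTerm (insert P S) w f i =
        (∑ p ∈ S.filter (fun p : ℕ => w < p), f p + f P) ^ (i + 1) / (i + 1).factorial *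
        ∏ p ∈ S.filter (fun p : ℕ => p ≤ w), (1 - f p) := by
      intro w hw i
      rw [sieveErrorTerm, filter_insert, if_pos hw, filter_insert, if_neg (not_le.2 hw),
        sum_insert (fun h => hPS (mem_filter.1 h).1), add_comm (f P)]
    have hsmall : ∀ w : ℝ, P ≤ w → S.filter (fun p : ℕ => w < p) = ∅ := fun w hw =>
      filter_eq_empty_iff.2 fun q hq => not_lt.2 ((Nat.cast_le.2 (hP q hq).le).trans hw)
    have hS := ih (n + 1) Z (by omega)
    have hsum0 : ∀ w : ℝ, 0 ≤ ∑ p ∈ S.filter (fun p : ℕ => w < p), f p := fun w =>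
      sum_nonneg fun p _ => h0 p
    have hW0 : ∀ w : ℝ, 0 ≤ ∏ p ∈ S.filter (fun p : ℕ => p ≤ w), (1 - f p) := fun w =>
      prod_nonneg fun p _ => sub_nonneg.2 (h1 p)
    have hmono : ∀ i, sieveErrorTerm S (Z i) f i ≤ sieveErrorTerm (insert P S) (Z i) f i := by
      intro i
      by_cases h : P ≤ Z i
      · rw [sieveErrorTerm, hsmall _ h]
        simpa using hnn _ _ _
      · push Not at h
        rw [hbig _ h, sieveErrorTerm]
        have := h0 P
        have := hsum0 (Z i)
        gcongr
        · exact hW0 _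
        · linarith
    rw [sieveError_insert hP]
    refine (abs_sub _ _).trans ?_
    rw [abs_mul, abs_of_nonneg (h0 P)]
    split_ifs with h
    · have hS' := ih n (fun i => Z (i + 1)) (by omega)
      refine (add_le_add hS (mul_le_mul_of_nonneg_left hS' (h0 P))).trans ?_
      rw [sum_range_succ', sum_range_succ' _ n, mul_sum, add_right_comm, ← sum_add_distrib]
      refine add_le_add (sum_le_sum fun i _ => ?_) (hmono 0)
      by_cases h : P ≤ Z (i + 1)
      · rw [sieveErrorTerm, sieveErrorTerm, hsmall _ h]
        simpa using hnn _ _ _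
      · push Not at h
        rw [hbig _ h, sieveErrorTerm, sieveErrorTerm, ← mul_assoc, ← add_mul]
        exact mul_le_mul_of_nonneg_right (pow_succ_div_factorial_add_le (hsum0 _) (h0 P) (i + 1)) (hW0 _)
    · push Not at h
      have hW : |∏ p ∈ S, (1 - f p)| ≤ ∏ p ∈ S.filter (fun p : ℕ => p ≤ Z 0), (1 - f p) := by
        rw [abs_of_nonneg (prod_nonneg fun p _ => sub_nonneg.2 (h1 p))]
        exact prod_le_prod_of_subset_of_le_one (filter_subset _ _)
          (fun p _ => sub_nonneg.2 (h1 p)) fun p _ _ => by linarith [h0 p]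
      refine (add_le_add hS (mul_le_mul_of_nonneg_left hW (h0 P))).trans ?_
      rw [sum_range_succ', sum_range_succ' _ n, add_assoc]
      refine add_le_add (sum_le_sum fun i _ => hmono _) ?_
      rw [hbig _ h, sieveErrorTerm]
      simp only [zero_add, pow_one, Nat.factorial_one, Nat.cast_one, div_one]
      linarith
end

lemma sum_log_le_of_sieveAdmissible {w : ℝ} {ζ : ℕ → ℝ} (hζ : ∀ i, 1 ≤ ζ i) (t : Finset ℕ)
    (ht : ∀ p ∈ t, 1 ≤ p) (Z : ℕ → ℝ) (hZ : ∀ i, Z i ≤ max w (ζ i)) (h : SieveAdmissible Z t) :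
    ∑ p ∈ t.filter (fun p : ℕ => w < p), log p ≤ ∑ i ∈ range t.card, log (ζ i) := by
  induction t using Finset.induction_on_max generalizing Z ζ with
  | empty => simp
  | insert P t hP ih =>
    have hPt : P ∉ t := fun h => lt_irrefl _ (hP P h)
    rw [sieveAdmissible_insert hP] at h
    have := ih (fun i => hζ (i + 1)) (fun p hp => ht p (mem_insert_of_mem hp))
      (fun i => Z (i + 1)) (fun i => hZ (i + 1)) h.2
    rw [card_insert_of_notMem hPt, sum_range_succ', filter_insert]
    have hl0 := log_nonneg (hζ 0)
    split_ifs with hw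
    · rw [sum_insert fun h => hPt (mem_filter.1 h).1, add_comm]
      refine add_le_add this (log_le_log ?_ ?_)
      · exact_mod_cast ht P (mem_insert_self _ _)
      · rcases le_max_iff.1 (h.1.trans (hZ 0)) with h' | h'
        · exact absurd hw (not_lt.2 h')
        · exact h'
    · linarith

lemma sum_pow_tsub_le (M n : ℕ) : ∑ i ∈ range n, (9 / 10 : ℝ) ^ (i - 1 - M) ≤ M + 11 := by
  have h1 : ∑ i ∈ range n, (9 / 10 : ℝ) ^ (i - 1 - M) ≤
      ∑ i ∈ range (M + 1 + n), (9 / 10 : ℝ) ^ (i - 1 - M) :=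
    sum_le_sum_of_subset_of_nonneg (Finset.range_mono (by omega)) fun _ _ _ => by positivity
  refine h1.trans ?_
  rw [sum_range_add]
  have h2 : ∑ i ∈ range (M + 1), (9 / 10 : ℝ) ^ (i - 1 - M) ≤ M + 1 := by
    refine (sum_le_card_nsmul _ _ 1 fun i _ => ?_).trans_eq (by simp)
    exact pow_le_one₀ (by norm_num) (by norm_num)
  have h3 : ∑ i ∈ range n, (9 / 10 : ℝ) ^ (M + 1 + i - 1 - M) ≤ 10 := by
    rw [sum_congr rfl fun i _ => by rw [show M + 1 + i - 1 - M = i by omega], geom_sum_eq (by norm_num)]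
    have : (0 : ℝ) < (9 / 10) ^ n := by positivity
    rw [div_le_iff_of_neg (by norm_num)]
    linarith
  linarith

lemma exp_neg_two_mul_le {t : ℝ} (h0 : 0 ≤ t) (h1 : t ≤ 1 / 2) : rexp (-(2 * t)) ≤ 1 - t := by
  rw [exp_neg, inv_le_comm₀ (by positivity) (by linarith)]
  refine le_trans ?_ (quadratic_le_exp_of_nonneg (by positivity : 0 ≤ 2 * t))
  rw [inv_le_iff_one_le_mul₀ (by linarith)]
  nlinarith [mul_nonneg h0 h0]

lemma prod_filter_le_le (S : Finset ℕ) (hS : ∀ p ∈ S, p.Prime) (w : ℝ) :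
    ∏ p ∈ S.filter (fun p : ℕ => (p : ℝ) ≤ w), (1 - 1 / (p : ℝ)) ≤
      (∏ p ∈ S, (1 - 1 / (p : ℝ))) * rexp (2 * ∑ p ∈ S.filter (fun p : ℕ => w < p), 1 / (p : ℝ)) := by
  have hhalf : ∀ p ∈ S, (1 : ℝ) / p ≤ 1 / 2 := fun p hp =>
    one_div_le_one_div_of_le (by norm_num) (by exact_mod_cast (hS p hp).two_le)
  have h1 : rexp (-(2 * ∑ p ∈ S.filter (fun p : ℕ => w < p), 1 / (p : ℝ))) ≤
      ∏ p ∈ S.filter (fun p : ℕ => w < p), (1 - 1 / (p : ℝ)) := by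
    rw [mul_sum, ← sum_neg_distrib, exp_sum]
    exact prod_le_prod (fun _ _ => (exp_pos _).le) fun p hp =>
      exp_neg_two_mul_le (by positivity) (hhalf p (mem_filter.1 hp).1)
  have h2 := prod_filter_mul_prod_filter_not S (fun p : ℕ => p ≤ w) fun p => (1 - 1 / (p : ℝ))
  simp_rw [not_le] at h2
  rw [← h2, mul_assoc]
  refine le_mul_of_one_le_right (prod_nonneg fun p hp => ?_) ?_
  · linarith [hhalf p (mem_filter.1 hp).1]
  · refine le_trans (le_of_eq ?_) (mul_le_mul_of_nonneg_right h1 (exp_pos _).le)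
    rw [← exp_add, neg_add_cancel, exp_zero]

lemma sieveErrorTerm_le {y : ℝ} {w₀ : ℝ} (hw : 2 ≤ w₀) (hwy : w₀ ≤ y) {S : Finset ℕ}
    (hS : ∀ p ∈ S, p.Prime) (hy : ∀ p ∈ S, (p : ℝ) ≤ y)
    (hsum : ∀ w, w₀ ≤ w → w ≤ y →
      ∑ p ∈ S.filter (fun p : ℕ => w < p), 1 / (p : ℝ) ≤ log (log y / log w) + 1 / 100)
    (M i : ℕ) {b : ℝ} (hb : (9 / 10 : ℝ) ^ (i - M) ≤ b) (hb1 : b ≤ 1) :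
    sieveErrorTerm S (max w₀ (y ^ b)) (fun p => 1 / (p : ℝ)) i ≤
      (∏ p ∈ S, (1 - 1 / (p : ℝ))) * if i ≤ M then 0 else (9 / 20 : ℝ) ^ (i + 1) := by
  have hy1 : 1 < y := by linarith
  have hV : 0 ≤ ∏ p ∈ S, (1 - 1 / (p : ℝ)) := prod_nonneg fun p hp => by
    have : (1 : ℝ) / p ≤ 1 := by
      rw [div_le_one (by exact_mod_cast (hS p hp).pos)]
      exact_mod_cast (hS p hp).one_le
    linarith
  have hb0 := lt_of_lt_of_le (by positivity) hb
  set w := max w₀ (y ^ b) with hwdef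
  set s := ∑ p ∈ S.filter (fun p : ℕ => w < p), 1 / (p : ℝ) with hs
  rw [sieveErrorTerm, ← hs]
  split_ifs with hi
  · have := le_antisymm hb1 (by simpa [Nat.sub_eq_zero_of_le hi] using hb)
    have hs' : s = 0 := by
      rw [hs, filter_eq_empty_iff.2, sum_empty]
      intro p hp h
      have h1 : y ≤ w := by rw [hwdef, this, rpow_one]; exact le_max_right _ _
      linarith [hy p hp]
    rw [hs']
    simp
  · push Not at hi
    have hly := log_pos hy1
    have hlw : b * log y ≤ log w := by
      rw [← log_rpow (by linarith)]
      exact log_le_log (by positivity) (le_max_right _ _)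
    have h1 : s ≤ (1 / 9 + 1 / 100) * (i + 1 : ℕ) := by
      refine (hsum w (le_max_left _ _) (max_le hwy ((rpow_le_rpow_of_exponent_le hy1.le hb1).trans_eq (rpow_one y)))).trans ?_
      have h2 : log y / log w ≤ (10 / 9 : ℝ) ^ (i - M) := by
        rw [div_le_iff₀ (lt_of_lt_of_le (by positivity) hlw)]
        calc log y = (10 / 9 : ℝ) ^ (i - M) * ((9 / 10 : ℝ) ^ (i - M) * log y) := by
              rw [← mul_assoc, ← mul_pow]; norm_num
          _ ≤ (10 / 9 : ℝ) ^ (i - M) * (b * log y) := by gcongr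
          _ ≤ _ := by gcongr
      have h3 : log (log y / log w) ≤ (i - M : ℕ) * (1 / 9) := by
        refine (log_le_log (div_pos hly (lt_of_lt_of_le (by positivity) hlw)) h2).trans ?_
        rw [log_pow]
        gcongr
        linarith [log_le_sub_one_of_pos (by norm_num : (0 : ℝ) < 10 / 9)]
      have h4 : ((i - M : ℕ) : ℝ) ≤ (i + 1 : ℕ) := Nat.cast_le.2 (by omega)
      have h5 : (1 : ℝ) ≤ (i + 1 : ℕ) := Nat.one_le_cast.2 (by omega)
      linarith
    have h2 := prod_filter_le_le S hS w
    rw [← hs] at h2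
    have h3 : s ^ (i + 1) / (i + 1).factorial * rexp (2 * s) ≤ (9 / 20 : ℝ) ^ (i + 1) := by
      have h4 : s ^ (i + 1) / (i + 1).factorial ≤
          (1 / 9 + 1 / 100 : ℝ) ^ (i + 1) * rexp 1 ^ (i + 1) := by
        have h5 := pow_div_factorial_le_exp ((i + 1 : ℕ) : ℝ) (by positivity) (i + 1)
        calc _ ≤ ((1 / 9 + 1 / 100) * ((i + 1 : ℕ) : ℝ)) ^ (i + 1) / (i + 1).factorial := by gcongr
          _ = (1 / 9 + 1 / 100 : ℝ) ^ (i + 1) * (((i + 1 : ℕ) : ℝ) ^ (i + 1) / (i + 1).factorial) := by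
            rw [mul_pow]; ring
          _ ≤ (1 / 9 + 1 / 100 : ℝ) ^ (i + 1) * rexp ((i + 1 : ℕ) : ℝ) := by gcongr
          _ = _ := by rw [← exp_nat_mul, mul_one]
      have h6 : rexp (2 * s) ≤ (4 / 3 : ℝ) ^ (i + 1) := by
        calc rexp (2 * s) ≤ rexp ((i + 1 : ℕ) * (1 / 4)) := by
              rw [exp_le_exp]
              have : 0 ≤ (i + 1 : ℕ) := by positivity
              linarith
          _ = rexp (1 / 4) ^ (i + 1) := by rw [exp_nat_mul]
          _ ≤ _ := by
            gcongr
            have := add_one_le_exp (-(1 / 4))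
            have h7 : rexp (1 / 4) * rexp (-(1 / 4)) = 1 := by rw [← exp_add]; norm_num
            nlinarith
      calc _ ≤ (1 / 9 + 1 / 100 : ℝ) ^ (i + 1) * rexp 1 ^ (i + 1) * (4 / 3 : ℝ) ^ (i + 1) := by gcongr
        _ = ((1 / 9 + 1 / 100) * rexp 1 * (4 / 3)) ^ (i + 1) := by rw [← mul_pow, ← mul_pow]
        _ ≤ _ := by
          gcongr
          linarith [exp_one_lt_d9]
    calc _ ≤ s ^ (i + 1) / (i + 1).factorial * ((∏ p ∈ S, (1 - 1 / (p : ℝ))) * rexp (2 * s)) := by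
          gcongr
      _ = (∏ p ∈ S, (1 - 1 / (p : ℝ))) * (s ^ (i + 1) / (i + 1).factorial * rexp (2 * s)) := by ring
      _ ≤ _ := by gcongr

lemma sum_ite_pow_le (M n : ℕ) :
    ∑ i ∈ range n, (if i ≤ M then 0 else (9 / 20 : ℝ) ^ (i + 1)) ≤ (9 / 20 : ℝ) ^ M := by
  have h1 : ∑ i ∈ range n, (if i ≤ M then 0 else (9 / 20 : ℝ) ^ (i + 1)) ≤
      ∑ i ∈ range (M + 1 + n), (if i ≤ M then 0 else (9 / 20 : ℝ) ^ (i + 1)) :=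
    sum_le_sum_of_subset_of_nonneg (Finset.range_mono (by omega)) fun _ _ _ => by
      split_ifs <;> positivity
  refine h1.trans ?_
  rw [sum_range_add, sum_eq_zero fun i hi => if_pos (by have := mem_range.1 hi; omega), zero_add]
  have h2 : ∀ i ∈ range n, (if M + 1 + i ≤ M then 0 else (9 / 20 : ℝ) ^ (M + 1 + i + 1)) =
      (9 / 20 : ℝ) ^ (M + 2) * (9 / 20 : ℝ) ^ i := fun i _ => by
    rw [if_neg (by omega), ← pow_add]
    congr 1
    ring
  rw [sum_congr rfl h2, ← mul_sum, geom_sum_eq (by norm_num), pow_add]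
  have h3 : ((9 / 20 : ℝ) ^ n - 1) / (9 / 20 - 1) ≤ 2 := by
    have : (0 : ℝ) < (9 / 20) ^ n := by positivity
    rw [div_le_iff_of_neg (by norm_num)]
    linarith
  have h4 : (0 : ℝ) < (9 / 20) ^ M := by positivity
  nlinarith

/-- The sign `(-1) ^ ω(d)`. -/
noncomputable def omegaSign (d : ℕ) : ℝ := (-1) ^ d.primeFactors.card

lemma abs_omegaSign (d : ℕ) : |omegaSign d| = 1 := by
  rw [omegaSign, abs_pow, abs_neg, abs_one, one_pow]

lemma injOn_prod_primes {S : Finset ℕ} (hS : ∀ p ∈ S, p.Prime) :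
    Set.InjOn (fun t : Finset ℕ => ∏ p ∈ t, p) (S.powerset : Set (Finset ℕ)) := by
  intro s hs t ht h
  have hs' : s ⊆ S := by simpa using hs
  have ht' : t ⊆ S := by simpa using ht
  have h1 := Nat.primeFactors_prod fun p hp => hS p (hs' hp)
  have h2 := Nat.primeFactors_prod fun p hp => hS p (ht' hp)
  rw [← h1, ← h2]
  exact congrArg Nat.primeFactors h

lemma prod_dvd_iff_of_prime {t : Finset ℕ} (ht : ∀ p ∈ t, p.Prime) (n : ℕ) :
    ∏ p ∈ t, p ∣ n ↔ ∀ p ∈ t, p ∣ n :=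
  ⟨fun h _ hp => (dvd_prod_of_mem (fun p => p) hp).trans h,
    fun h => prod_primes_dvd n (fun p hp => (ht p hp).prime) h⟩

lemma exists_sieve_of_thresholds {y : ℝ} {w₀ : ℕ} (hw : 2 ≤ w₀) (hwy : w₀ ≤ y) {S : Finset ℕ}
    (hS : ∀ p ∈ S, p.Prime) (M : ℕ) (e : ℕ → ℕ) (he : ∀ i, i - 1 ≤ e i) :
    ∃ I : Finset ℕ, (∀ d ∈ I, 1 ≤ d ∧ (d : ℝ) ≤ 4 ^ w₀ * y ^ (M + 11) ∧
        ∀ p : ℕ, p.Prime → p ∣ d → p ∈ S) ∧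
      (∀ n : ℕ, ∑ d ∈ I.filter (· ∣ n), omegaSign d = (if ∀ p ∈ S, ¬ p ∣ n then 1 else 0) -
        sieveError S (fun i => max (w₀ : ℝ) (y ^ (9 / 10 : ℝ) ^ (e i - M))) fun p => if p ∣ n then 1 else 0) ∧
      ∑ d ∈ I, omegaSign d / d = (∏ p ∈ S, (1 - 1 / (p : ℝ))) -
        sieveError S (fun i => max (w₀ : ℝ) (y ^ (9 / 10 : ℝ) ^ (e i - M))) fun p => 1 / (p : ℝ) := by
  classical
  have hy1 : 1 < y := by
    have : (2 : ℝ) ≤ w₀ := mod_cast hw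
    linarith
  set ζ : ℕ → ℝ := fun i => y ^ (9 / 10 : ℝ) ^ (e i - M) with hζdef
  set Z : ℕ → ℝ := fun i => max w₀ (ζ i) with hZdef
  have hsub : ∀ t ∈ S.powerset.filter (SieveAdmissible Z), t ⊆ S := fun t ht =>
    mem_powerset.1 (mem_filter.1 ht).1
  have hsum_eq : ∀ g : ℕ → ℝ, ∑ d ∈ (S.powerset.filter (SieveAdmissible Z)).image
      (fun t : Finset ℕ => ∏ p ∈ t, p), omegaSign d * g d =
      ∑ t ∈ S.powerset, if SieveAdmissible Z t then (-1 : ℝ) ^ t.card * g (∏ p ∈ t, p) else 0 := by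
    intro g
    rw [sum_image fun s hs t ht h => injOn_prod_primes hS (mem_filter.1 hs).1
      (mem_filter.1 ht).1 h, sum_filter]
    refine sum_congr rfl fun t ht => ?_
    rw [omegaSign, Nat.primeFactors_prod fun p hp => hS p (mem_powerset.1 ht hp)]
  refine ⟨(S.powerset.filter (SieveAdmissible Z)).image (fun t => ∏ p ∈ t, p), ?_, ?_, ?_⟩
  · intro d hd
    obtain ⟨t, ht, rfl⟩ := mem_image.1 hd
    have htp : ∀ p ∈ t, p.Prime := fun p hp => hS p (hsub t ht hp)
    have hadm := (mem_filter.1 ht).2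
    refine ⟨Nat.one_le_iff_ne_zero.2 (prod_ne_zero_iff.2 fun p hp => (htp p hp).ne_zero), ?_, ?_⟩
    · have h1 := sum_log_le_of_sieveAdmissible (w := w₀) (ζ := ζ)
        (fun i => one_le_rpow hy1.le (by positivity)) t (fun p hp => (htp p hp).one_le) Z
        (fun i => le_rfl) hadm
      have h2 : ∑ i ∈ range t.card, log (ζ i) ≤ (M + 11) * log y := by
        have h3 := sum_pow_tsub_le M t.card
        refine le_trans ?_ (mul_le_mul_of_nonneg_right h3 (log_pos hy1).le)
        rw [sum_mul]
        refine sum_le_sum fun i _ => ?_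
        rw [hζdef]
        simp only
        rw [log_rpow (by linarith)]
        refine mul_le_mul_of_nonneg_right ?_ (log_pos hy1).le
        exact pow_le_pow_of_le_one (by norm_num) (by norm_num) (Nat.sub_le_sub_right (he i) M)
      have h4 : ∏ p ∈ t.filter (fun p : ℕ => (w₀ : ℝ) < p), (p : ℝ) ≤ y ^ (M + 11) := by
        have hpos : ∀ p ∈ t.filter (fun p : ℕ => (w₀ : ℝ) < p), (0 : ℝ) < p := fun p hp => by
          exact_mod_cast (htp p (mem_filter.1 hp).1).pos
        rw [← exp_log (prod_pos hpos), log_prod fun p hp => (hpos p hp).ne',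
          ← exp_log (by positivity : 0 < y ^ (M + 11)), log_pow, exp_le_exp]
        push_cast
        linarith
      have h5 : ∏ p ∈ t.filter (fun p : ℕ => ¬ (w₀ : ℝ) < p), (p : ℝ) ≤ 4 ^ w₀ := by
        have h6 := Nat.le_of_dvd (primorial_pos w₀) (prod_dvd_prod_of_subset
          (t.filter (fun p : ℕ => ¬ (w₀ : ℝ) < p)) ((range (w₀ + 1)).filter Nat.Prime)
          (fun p => p) fun p hp => by
            rw [mem_filter, not_lt, Nat.cast_le] at hp
            exact mem_filter.2 ⟨mem_range.2 (by omega), htp p hp.1⟩)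
        have h7 := h6.trans (primorial_le_four_pow w₀)
        have h8 : ((∏ p ∈ t.filter (fun p : ℕ => ¬ (w₀ : ℝ) < p), p : ℕ) : ℝ) ≤ ((4 ^ w₀ : ℕ) : ℝ) :=
          Nat.cast_le.2 h7
        rw [Nat.cast_prod] at h8
        push_cast at h8
        simpa using h8
      rw [Nat.cast_prod, ← prod_filter_mul_prod_filter_not t (fun p : ℕ => (w₀ : ℝ) < p), mul_comm]
      gcongr
    · intro p hp hpd
      obtain ⟨r, hr, hpr⟩ := (hp.prime.dvd_finsetProd_iff _).1 hpd
      rw [(Nat.prime_dvd_prime_iff_eq hp (htp r hr)).1 hpr]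
      exact hsub t ht hr
  · intro n
    rw [sum_filter]
    have h1 := hsum_eq fun d => if d ∣ n then 1 else 0
    simp only [mul_ite, mul_one, mul_zero] at h1
    rw [h1, sieveError, prod_congr rfl fun p _ => by
      rw [show (1 : ℝ) - (if p ∣ n then 1 else 0) = if ¬ p ∣ n then 1 else 0 by split_ifs <;> simp_all],
      prod_ite_zero, prod_const_one, sub_sub_cancel, sieveSum]
    refine sum_congr rfl fun t ht => ?_
    congr 1
    rw [prod_neg, prod_ite_zero, prod_const_one]
    simp only [prod_dvd_iff_of_prime (fun p hp => hS p (mem_powerset.1 ht hp)), mul_ite, mul_one, mul_zero]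
  · have h1 := hsum_eq fun d => 1 / (d : ℝ)
    simp only [mul_one_div] at h1
    rw [h1, sieveError, sub_sub_cancel, sieveSum]
    refine sum_congr rfl fun t ht => ?_
    congr 1
    rw [prod_neg, prod_div_distrib, prod_const_one, Nat.cast_prod, mul_one_div]

lemma abs_sieveError_thresholds_le {y : ℝ} {w₀ : ℝ} (hw : 2 ≤ w₀) (hwy : w₀ ≤ y) {S : Finset ℕ}
    (hS : ∀ p ∈ S, p.Prime) (hy : ∀ p ∈ S, (p : ℝ) ≤ y)
    (hsum : ∀ w, w₀ ≤ w → w ≤ y →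
      ∑ p ∈ S.filter (fun p : ℕ => w < p), 1 / (p : ℝ) ≤ log (log y / log w) + 1 / 100)
    (M : ℕ) (e : ℕ → ℕ) (he' : ∀ i, e i ≤ i) :
    |sieveError S (fun i => max w₀ (y ^ (9 / 10 : ℝ) ^ (e i - M))) fun p => 1 / (p : ℝ)| ≤
      (9 / 20) ^ M * ∏ p ∈ S, (1 - 1 / (p : ℝ)) := by
  have hf1 : ∀ p : ℕ, (1 : ℝ) / p ≤ 1 := fun p => by
    rcases Nat.eq_zero_or_pos p with rfl | h
    · simp
    · rw [div_le_one (by exact_mod_cast h)]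
      exact_mod_cast h
  refine (abs_sieveError_le (fun p => by positivity) hf1 S S.card _ le_rfl).trans ?_
  refine (sum_le_sum fun i _ => sieveErrorTerm_le hw hwy hS hy hsum M i
    (pow_le_pow_of_le_one (by norm_num) (by norm_num) (Nat.sub_le_sub_right (he' i) M))
    (pow_le_one₀ (by norm_num) (by norm_num))).trans ?_
  rw [← mul_sum, mul_comm]
  exact mul_le_mul_of_nonneg_right (sum_ite_pow_le M _) (prod_nonneg fun p _ => by
    linarith [hf1 p])

/-- Upper and lower bound sieve weights of level `4 ^ w₀ * y ^ (M + 11)`. -/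
lemma exists_sieve {y : ℝ} {w₀ : ℕ} (hw : 2 ≤ w₀) (hwy : w₀ ≤ y) {S : Finset ℕ}
    (hS : ∀ p ∈ S, p.Prime) (hy : ∀ p ∈ S, (p : ℝ) ≤ y)
    (hsum : ∀ w : ℝ, w₀ ≤ w → w ≤ y →
      ∑ p ∈ S.filter (fun p : ℕ => w < p), 1 / (p : ℝ) ≤ log (log y / log w) + 1 / 100) (M : ℕ) :
    (∃ I : Finset ℕ, (∀ d ∈ I, 1 ≤ d ∧ (d : ℝ) ≤ 4 ^ w₀ * y ^ (M + 11) ∧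
        ∀ p : ℕ, p.Prime → p ∣ d → p ∈ S) ∧
      (∀ n : ℕ, (if ∀ p ∈ S, ¬ p ∣ n then 1 else 0) ≤ ∑ d ∈ I.filter (· ∣ n), omegaSign d) ∧
      ∑ d ∈ I, omegaSign d / d ≤ (1 + (9 / 20) ^ M) * ∏ p ∈ S, (1 - 1 / (p : ℝ))) ∧
    ∃ I : Finset ℕ, (∀ d ∈ I, 1 ≤ d ∧ (d : ℝ) ≤ 4 ^ w₀ * y ^ (M + 11) ∧
        ∀ p : ℕ, p.Prime → p ∣ d → p ∈ S) ∧
      (∀ n : ℕ, ∑ d ∈ I.filter (· ∣ n), omegaSign d ≤ if ∀ p ∈ S, ¬ p ∣ n then 1 else 0) ∧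
      (1 - (9 / 20) ^ M) * ∏ p ∈ S, (1 - 1 / (p : ℝ)) ≤ ∑ d ∈ I, omegaSign d / d := by
  have hw' : (2 : ℝ) ≤ w₀ := mod_cast hw
  have hf0 : ∀ n p : ℕ, (0 : ℝ) ≤ if p ∣ n then 1 else 0 := fun n p => by split_ifs <;> norm_num
  have hf1 : ∀ n p : ℕ, (if p ∣ n then 1 else 0) ≤ (1 : ℝ) := fun n p => by split_ifs <;> norm_num
  constructor
  · obtain ⟨I, h1, h2, h3⟩ := exists_sieve_of_thresholds hw hwy hS M (fun i => i - i % 2)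
      (fun i => by omega)
    refine ⟨I, h1, fun n => ?_, ?_⟩
    · rw [h2]
      have := (sieveError_sign (hf0 n) (hf1 n) S).1
        (fun i => max w₀ (y ^ (9 / 10 : ℝ) ^ (i - i % 2 - M))) fun j => by
          rw [show 2 * j + 1 - (2 * j + 1) % 2 = 2 * j - 2 * j % 2 by omega]
      linarith
    · rw [h3]
      have := abs_le.1 (abs_sieveError_thresholds_le hw' hwy hS hy hsum M (fun i => i - i % 2)
        fun i => by omega)
      linarith
  · have he : ∀ i, (if i = 0 then 0 else 2 * ((i - 1) / 2) + 1) ≤ i := fun i => by split_ifs <;> omega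
    obtain ⟨I, h1, h2, h3⟩ := exists_sieve_of_thresholds hw hwy hS M
      (fun i => if i = 0 then 0 else 2 * ((i - 1) / 2) + 1) (fun i => by split_ifs <;> omega)
    refine ⟨I, h1, fun n => ?_, ?_⟩
    · rw [h2]
      have := (sieveError_sign (hf0 n) (hf1 n) S).2 (fun i => max w₀
        (y ^ (9 / 10 : ℝ) ^ ((if i = 0 then 0 else 2 * ((i - 1) / 2) + 1) - M))) (fun j => by
          rw [if_neg (by omega), if_neg (by omega),
            show (2 * j + 2 - 1) / 2 = (2 * j + 1 - 1) / 2 by omega]) fun p hp => by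
          simpa using Or.inr (hy p hp)
      linarith
    · rw [h3]
      have := abs_le.1 (abs_sieveError_thresholds_le hw' hwy hS hy hsum M _ he)
      linarith

section
open Chebyshev

open ArithmeticFunction hiding log in
lemma log_factorial_eq_sum_vonMangoldt (N : ℕ) :
    log (N.factorial) = ∑ n ∈ Ioc 0 N, vonMangoldt n * (N / n : ℕ) := by
  rw [← sum_Ioc_mul_zeta_eq_sum, vonMangoldt_mul_zeta]
  induction N with
  | zero => simp
  | succ n ih =>
    rw [sum_Ioc_succ_top (Nat.zero_le _), ← ih, Nat.factorial_succ, Nat.cast_mul,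
      log_mul (by positivity) (by positivity), add_comm, log_apply]

lemma mul_log_sub_le_log_factorial (n : ℕ) : n * log n - n ≤ log (n.factorial) := by
  rcases Nat.eq_zero_or_pos n with rfl | h
  · simp
  · have h1 := Stirling.le_log_factorial_stirling h.ne'
    have h2 := log_natCast_nonneg n
    have h3 : 0 ≤ log (2 * π) := log_nonneg (by linarith [pi_gt_three])
    linarith

lemma log_factorial_le (n : ℕ) : log (n.factorial) ≤ n * log n - n + 1 + log n := by
  induction n with
  | zero => simp
  | succ n ih =>
    rw [Nat.factorial_succ, Nat.cast_mul, log_mul (by positivity) (by positivity)]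
    push_cast
    rcases Nat.eq_zero_or_pos n with rfl | h
    · simp
    have hn : (0 : ℝ) < n := mod_cast h
    have h1 : 1 - ((n + 1 : ℝ) / n)⁻¹ ≤ log ((n + 1) / n) := one_sub_inv_le_log_of_pos (by positivity)
    rw [log_div (by positivity) hn.ne', inv_div] at h1
    have h2 := mul_le_mul_of_nonneg_left h1 (by positivity : (0 : ℝ) ≤ n + 1)
    have h3 : ((n : ℝ) + 1) * (1 - n / (n + 1)) = 1 := by field_simp; ring
    linarith

lemma sum_vonMangoldt_div_sub_log_le (N : ℕ) (hN : 1 ≤ N) :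
    |∑ n ∈ Icc 0 N, ArithmeticFunction.vonMangoldt n / n - log N| ≤ log 4 + 4 := by
  have hN' : (0 : ℝ) < N := mod_cast hN
  have h0 : ∑ n ∈ Icc 0 N, ArithmeticFunction.vonMangoldt n / n =
      ∑ n ∈ Ioc 0 N, ArithmeticFunction.vonMangoldt n / n := by
    rw [← add_sum_Ioc_eq_sum_Icc (Nat.zero_le _)]; simp
  have h1 := log_factorial_eq_sum_vonMangoldt N
  have h2 := mul_log_sub_le_log_factorial N
  have h3 := log_factorial_le N
  have h4 := log_le_sub_one_of_pos hN'
  have h5 := psi_le_const_mul_self hN'.le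
  rw [psi, Nat.floor_natCast] at h5
  have h6 : 0 ≤ log 4 := log_nonneg (by norm_num)
  have h7 : log (N.factorial) ≤ N * ∑ n ∈ Ioc 0 N, ArithmeticFunction.vonMangoldt n / n := by
    rw [h1, mul_sum]
    refine sum_le_sum fun n hn => ?_
    rw [mul_div_left_comm]
    exact mul_le_mul_of_nonneg_left Nat.cast_div_le ArithmeticFunction.vonMangoldt_nonneg
  have h8 : N * ∑ n ∈ Ioc 0 N, ArithmeticFunction.vonMangoldt n / n ≤
      log (N.factorial) + ∑ n ∈ Ioc 0 N, ArithmeticFunction.vonMangoldt n := by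
    rw [h1, mul_sum, ← sum_add_distrib]
    refine sum_le_sum fun n hn => ?_
    rw [mul_div_left_comm, ← mul_add_one]
    refine mul_le_mul_of_nonneg_left ?_ ArithmeticFunction.vonMangoldt_nonneg
    have := Nat.lt_floor_add_one ((N : ℝ) / n)
    rw [Nat.floor_div_eq_div] at this
    exact this.le
  rw [h0, abs_le]
  constructor
  · refine le_of_mul_le_mul_left ?_ hN'
    nlinarith
  · refine le_of_mul_le_mul_left ?_ hN'
    nlinarith

lemma sum_div_log_sub_log_div_le {c : ℕ → ℝ} {K : ℝ}
    (hc : ∀ t : ℝ, 2 ≤ t → |∑ n ∈ Icc 0 ⌊t⌋₊, c n - log t| ≤ K) {a b : ℝ} (ha : 2 ≤ a)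
    (hab : a ≤ b) : |∑ n ∈ Ioc ⌊a⌋₊ ⌊b⌋₊, c n / log n - log (log b / log a)| ≤ 2 * K / log a := by
  have hla : 0 < log a := log_pos (by linarith)
  have hlb : 0 < log b := log_pos (by linarith)
  have hpos : ∀ t ∈ Set.Icc a b, 0 < t ∧ 0 < log t := fun t ht =>
    ⟨by linarith [ht.1], log_pos (by linarith [ht.1])⟩
  have hder : ∀ t ∈ Set.Icc a b, HasDerivAt (fun t => (log t)⁻¹) (-(t⁻¹) / (log t) ^ 2) t :=
    fun t ht => (hasDerivAt_log (hpos t ht).1.ne').inv (hpos t ht).2.ne'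
  have hcont :=
    (continuousOn_inv₀.mono fun t ht => (hpos t ht).1.ne').div
      ((continuousOn_log.mono fun t ht => (hpos t ht).1.ne').pow 2)
      fun t ht => pow_ne_zero 2 (hpos t ht).2.ne'
  have hcont' :=
    (continuousOn_inv₀.mono fun t ht => (hpos t ht).1.ne').div
      (continuousOn_log.mono fun t ht => (hpos t ht).1.ne') fun t ht => (hpos t ht).2.ne'
  have hderiv : Set.EqOn (deriv fun t : ℝ => (log t)⁻¹) (fun t => -(t⁻¹ / (log t) ^ 2)) (Set.Icc a b) :=
    fun t ht => by rw [(hder t ht).deriv, neg_div]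
  have hin : IntegrableOn (deriv fun t : ℝ => (log t)⁻¹) (Set.Icc a b) :=
    (hcont.neg.congr fun t ht => hderiv ht).integrableOn_Icc
  have hkey := sum_mul_eq_sub_sub_integral_mul (f := fun t : ℝ => (log t)⁻¹) c (by linarith) hab
    (fun t ht => (hder t ht).differentiableAt) hin
  have hi := integrableOn_mul_sum_Icc (c := c) (m := 0) (by linarith : 0 ≤ a) hin
  rw [← intervalIntegral.integral_of_le hab] at hkey
  have hii : IntervalIntegrable (fun t : ℝ => deriv (fun t : ℝ => (log t)⁻¹) t *
      ∑ n ∈ Icc 0 ⌊t⌋₊, c n) volume a b := by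
    rw [intervalIntegrable_iff_integrableOn_Icc_of_le hab]; exact hi
  have hE : ∀ e : ℝ, ∫ t in a..b, (t⁻¹ / log t + e * (t⁻¹ / (log t) ^ 2)) =
      (log (log b) - e * (log b)⁻¹) - (log (log a) - e * (log a)⁻¹) := by
    intro e
    refine intervalIntegral.integral_eq_sub_of_hasDerivAt (f := fun t => log (log t) - e * (log t)⁻¹)
      (fun t ht => ?_) ?_
    · rw [Set.uIcc_of_le hab] at ht
      refine (((hasDerivAt_log (hpos t ht).1.ne').log (hpos t ht).2.ne').sub
        ((hder t ht).const_mul e)).congr_deriv ?_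
      ring
    · exact ContinuousOn.intervalIntegrable_of_Icc hab (hcont'.add (hcont.const_mul e))
  have hEi : ∀ e : ℝ, IntervalIntegrable (fun t => t⁻¹ / log t + e * (t⁻¹ / (log t) ^ 2))
      volume a b := fun e =>
    ContinuousOn.intervalIntegrable_of_Icc hab (hcont'.add (hcont.const_mul e))
  have hpt : ∀ t ∈ Set.Icc a b, -(deriv (fun t : ℝ => (log t)⁻¹) t * ∑ n ∈ Icc 0 ⌊t⌋₊, c n) =
      t⁻¹ / log t + (∑ n ∈ Icc 0 ⌊t⌋₊, c n - log t) * (t⁻¹ / (log t) ^ 2) := by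
    intro t ht
    rw [hderiv ht]
    have := (hpos t ht).2.ne'
    field_simp
    ring
  have hup := intervalIntegral.integral_mono_on hab hii.neg (hEi K) fun t ht => by
    rw [Pi.neg_apply, hpt t ht]
    have h1 := (abs_le.1 (hc t (ha.trans ht.1))).2
    have := (hpos t ht).1
    gcongr
  have hlo := intervalIntegral.integral_mono_on hab (hEi (-K)) hii.neg fun t ht => by
    rw [Pi.neg_apply, hpt t ht]
    have h1 := (abs_le.1 (hc t (ha.trans ht.1))).1
    have := (hpos t ht).1
    gcongr
  rw [hE, show (∫ u in a..b, (-fun t : ℝ => deriv (fun t : ℝ => (log t)⁻¹) t *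
      ∑ n ∈ Icc 0 ⌊t⌋₊, c n) u) = -∫ t in a..b, deriv (fun t : ℝ => (log t)⁻¹) t *
      ∑ n ∈ Icc 0 ⌊t⌋₊, c n from intervalIntegral.integral_neg] at hup hlo
  rw [(sum_congr rfl fun n _ => by rw [div_eq_inv_mul]), hkey, log_div hlb.ne' hla.ne']
  have h1 := abs_le.1 (hc a ha)
  have h2 := abs_le.1 (hc b (ha.trans hab))
  have h3 := inv_mul_cancel₀ hlb.ne'
  have h4 := inv_mul_cancel₀ hla.ne'
  have ib := inv_pos.2 hlb
  have ia := inv_pos.2 hla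
  have h5 := mul_le_mul_of_nonneg_left h1.1 ia.le
  have h6 := mul_le_mul_of_nonneg_left h1.2 ia.le
  have h7 := mul_le_mul_of_nonneg_left h2.1 ib.le
  have h8 := mul_le_mul_of_nonneg_left h2.2 ib.le
  rw [abs_le, div_eq_mul_inv]
  constructor <;> nlinarith

lemma sum_vonMangoldt_div_log_sub_le {a b : ℝ} (ha : 2 ≤ a) (hab : a ≤ b) :
    |∑ n ∈ Ioc ⌊a⌋₊ ⌊b⌋₊, ArithmeticFunction.vonMangoldt n / n / log n -
      log (log b / log a)| ≤ 2 * (log 4 + 5) / log a := by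
  refine sum_div_log_sub_log_div_le (c := fun n => ArithmeticFunction.vonMangoldt n / n)
    (fun t ht => ?_) ha hab
  have h1 : 1 ≤ ⌊t⌋₊ := Nat.le_floor (by push_cast; linarith)
  have h2 := abs_le.1 (sum_vonMangoldt_div_sub_log_le _ h1)
  have h5 := Nat.floor_le (by linarith : 0 ≤ t)
  have h6 := Nat.lt_floor_add_one t
  have h7 := log_le_log (by linarith) h5
  have h8 : log t ≤ log ⌊t⌋₊ + 1 := by
    have : log (t / ⌊t⌋₊) ≤ t / ⌊t⌋₊ - 1 := log_le_sub_one_of_pos (by positivity)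
    rw [log_div (by positivity) (by positivity)] at this
    have : t / ⌊t⌋₊ ≤ 2 := by rw [div_le_iff₀ (by positivity)]; linarith
    linarith
  rw [abs_le]
  constructor <;> linarith

lemma sum_one_div_prime_le {S : Finset ℕ} (hS : ∀ p ∈ S, p.Prime) {w y : ℝ} (hw : 2 ≤ w) (hwy : w ≤ y)
    (hy : ∀ p ∈ S, (p : ℝ) ≤ y) : ∑ p ∈ S.filter (fun p : ℕ => w < p), 1 / (p : ℝ) ≤
      log (log y / log w) + 2 * (log 4 + 5) / log w := by
  have h1 := (abs_le.1 (sum_vonMangoldt_div_log_sub_le hw hwy)).2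
  refine le_trans ?_ (sub_le_iff_le_add'.1 h1)
  rw [sum_congr rfl (g := fun n : ℕ => ArithmeticFunction.vonMangoldt n / n / log n) fun p hp => by
    have hp' := hS p (mem_filter.1 hp).1
    have : 0 < log p := log_pos (mod_cast hp'.one_lt)
    rw [ArithmeticFunction.vonMangoldt_apply_prime hp']
    field_simp]
  refine sum_le_sum_of_subset_of_nonneg (fun p hp => ?_) fun n _ _ => ?_
  · rw [mem_filter] at hp
    exact mem_Ioc.2 ⟨(Nat.floor_lt (by linarith)).2 hp.2, Nat.le_floor (hy p hp.1)⟩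
  · exact div_nonneg (div_nonneg ArithmeticFunction.vonMangoldt_nonneg (Nat.cast_nonneg _))
      (log_natCast_nonneg n)

lemma exists_sum_one_div_prime_le (c : ℝ) (hc : 0 < c) : ∃ w₀ : ℕ, 2 ≤ w₀ ∧
    ∀ S : Finset ℕ, (∀ p ∈ S, p.Prime) → ∀ y : ℝ, (∀ p ∈ S, (p : ℝ) ≤ y) → ∀ w : ℝ, w₀ ≤ w → w ≤ y →
      ∑ p ∈ S.filter (fun p : ℕ => w < p), 1 / (p : ℝ) ≤ log (log y / log w) + c := by
  have h1 : Filter.Tendsto (fun n : ℕ => 2 * (log 4 + 5) / log n) atTop (nhds 0) :=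
    tendsto_const_nhds.div_atTop (tendsto_log_atTop.comp tendsto_natCast_atTop_atTop)
  obtain ⟨w₀, h2, h3⟩ := ((h1.eventually (gt_mem_nhds hc)).and (eventually_ge_atTop 2)).exists
  refine ⟨w₀, h3, fun S hS y hy w hw hwy => ?_⟩
  have h4 : (2 : ℝ) ≤ w₀ := mod_cast h3
  refine (sum_one_div_prime_le hS (h4.trans hw) hwy hy).trans ?_
  have h5 := log_le_log (by linarith) hw
  have h6 : 0 < log w₀ := log_pos (by linarith)
  have h7 : 2 * (log 4 + 5) / log w ≤ 2 * (log 4 + 5) / log w₀ := by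
    have : 0 ≤ log 4 := log_nonneg (by norm_num)
    gcongr
  linarith
end

section
open Chebyshev
open ArithmeticFunction hiding log

lemma log_factorial_combination_le_psi (N : ℕ) :
    log ((30 * N).factorial) - log ((15 * N).factorial) - log ((10 * N).factorial) -
      log ((6 * N).factorial) + log (N.factorial) ≤ psi ((30 * N : ℕ) : ℝ) := by
  have hext : ∀ M ≤ 30 * N, log (M.factorial) =
      ∑ n ∈ Ioc 0 (30 * N), vonMangoldt n * (M / n : ℕ) := by
    intro M hM
    rw [log_factorial_eq_sum_vonMangoldt]
    refine sum_subset (Ioc_subset_Ioc_right hM) fun n hn hn' => ?_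
    rw [mem_Ioc] at hn hn'
    rw [Nat.div_eq_of_lt (by omega)]
    simp
  rw [hext (30 * N) le_rfl, hext (15 * N) (by omega), hext (10 * N) (by omega), hext (6 * N) (by omega),
    hext N (by omega), ← sum_sub_distrib, ← sum_sub_distrib, ← sum_sub_distrib,
    ← sum_add_distrib, psi, Nat.floor_natCast]
  refine sum_le_sum fun n _ => ?_
  rw [← mul_sub, ← mul_sub, ← mul_sub, ← mul_add]
  refine mul_le_of_le_one_right vonMangoldt_nonneg ?_
  have e2 : 15 * N / n = 30 * N / n / 2 := by
    rw [Nat.div_div_eq_div_mul, mul_comm n, ← Nat.div_div_eq_div_mul]; congr 1; omega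
  have e3 : 10 * N / n = 30 * N / n / 3 := by
    rw [Nat.div_div_eq_div_mul, mul_comm n, ← Nat.div_div_eq_div_mul]; congr 1; omega
  have e5 : 6 * N / n = 30 * N / n / 5 := by
    rw [Nat.div_div_eq_div_mul, mul_comm n, ← Nat.div_div_eq_div_mul]; congr 1; omega
  have e30 : N / n = 30 * N / n / 30 := by
    rw [Nat.div_div_eq_div_mul, mul_comm n, ← Nat.div_div_eq_div_mul]; congr 1; omega
  rw [e2, e3, e5, e30]
  generalize 30 * N / n = m
  have : m + m / 30 ≤ 1 + m / 2 + m / 3 + m / 5 := by omega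
  have : (m : ℝ) + (m / 30 : ℕ) ≤ 1 + (m / 2 : ℕ) + (m / 3 : ℕ) + (m / 5 : ℕ) := mod_cast this
  linarith

lemma eventually_mul_le_psi : ∀ᶠ x : ℝ in atTop, (92 / 100 : ℝ) * x ≤ psi x := by
  have h1 := (isLittleO_log_id_atTop.def (by norm_num : (0 : ℝ) < 1 / 10000))
  filter_upwards [h1, eventually_ge_atTop 1000000] with x hx hx1
  set N := ⌊x / 30⌋₊ with hN
  have hN1 : N ≤ x / 30 := Nat.floor_le (by positivity)
  have hN2 : x / 30 < N + 1 := Nat.lt_floor_add_one _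
  have hNpos : (0 : ℝ) < N := by linarith
  have h2 := log_factorial_combination_le_psi N
  have h3 := mul_log_sub_le_log_factorial (30 * N)
  have h4 := log_factorial_le (15 * N)
  have h5 := log_factorial_le (10 * N)
  have h6 := log_factorial_le (6 * N)
  have h7 := mul_log_sub_le_log_factorial N
  have h8 : psi ((30 * N : ℕ) : ℝ) ≤ psi x := psi_mono (by push_cast; linarith)
  push_cast at h3 h4 h5 h6
  have hl : ∀ k : ℝ, 0 < k → log (k * N) = log k + log N := fun k hk => log_mul hk.ne' hNpos.ne'
  have hl2 : log 30 = log 2 + log 3 + log 5 := by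
    rw [← log_mul (by norm_num) (by norm_num), ← log_mul (by norm_num) (by norm_num)]; norm_num
  have hl3 : log 15 = log 3 + log 5 := by rw [← log_mul (by norm_num) (by norm_num)]; norm_num
  have hl4 : log 10 = log 2 + log 5 := by rw [← log_mul (by norm_num) (by norm_num)]; norm_num
  have hl5 : log 6 = log 2 + log 3 := by rw [← log_mul (by norm_num) (by norm_num)]; norm_num
  have hc : (27.63 : ℝ) ≤ 14 * log 2 + 9 * log 3 + 5 * log 5 := by
    have e1 : 14 * log 2 + 9 * log 3 + 5 * log 5 = 40 * log 2 + log (2 ^ 14 * 3 ^ 9 * 5 ^ 5 / 2 ^ 40) := by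
      rw [log_div (by norm_num) (by norm_num), log_mul (by norm_num) (by norm_num),
        log_mul (by norm_num) (by norm_num), log_pow, log_pow, log_pow, log_pow]
      push_cast; ring
    have e2 := one_sub_inv_le_log_of_pos (x := 2 ^ 14 * 3 ^ 9 * 5 ^ 5 / 2 ^ 40) (by norm_num)
    rw [e1]
    linarith [log_two_gt_d9]
  rw [hl _ (by norm_num)] at h3 h4 h5 h6
  have hb : ∀ k : ℝ, 0 < k → k ≤ 15 → log k + log N ≤ 1 / 10000 * x := by
    intro k hk hk'
    rw [← hl k hk]
    refine (log_le_log (by positivity) (by nlinarith : k * N ≤ x)).trans ?_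
    have := hx
    rw [norm_eq_abs, norm_eq_abs, id, abs_of_pos (by linarith : 0 < x)] at this
    exact (le_abs_self _).trans this
  have b1 := hb 15 (by norm_num) (by norm_num)
  have b2 := hb 10 (by norm_num) (by norm_num)
  have b3 := hb 6 (by norm_num) (by norm_num)
  have hmul := mul_le_mul_of_nonneg_left hc hNpos.le
  rw [hl2] at h3
  rw [hl3] at h4 b1
  rw [hl4] at h5 b2
  rw [hl5] at h6 b3
  linarith
end

section
open ArithmeticFunction hiding log

lemma integral_exp_neg_mul_log : IntegrableOn (fun r : ℝ => exp (-r) * log r) (Set.Ioi 0) ∧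
      ∫ r in Set.Ioi (0 : ℝ), exp (-r) * log r = -eulerMascheroniConstant := by
  have h1 := Complex.hasDerivAt_GammaIntegral (s := 1) (by simp)
  have h2 : HasDerivAt Complex.GammaIntegral (-eulerMascheroniConstant : ℂ) 1 := by
    refine Complex.hasDerivAt_Gamma_one.congr_of_eventuallyEq ?_
    have : ∀ᶠ s : ℂ in nhds 1, 0 < s.re :=
      Complex.continuous_re.continuousAt.eventually (lt_mem_nhds (by simp))
    filter_upwards [this] with s hs
    exact (Complex.Gamma_eq_integral hs).symm
  have h3 := h1.unique h2
  have h4 : ∫ r in Set.Ioi 0, exp (-r) * log r = -eulerMascheroniConstant := by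
    rw [← Complex.ofReal_inj, ← integral_complex_ofReal]
    push_cast
    rw [← h3]
    refine integral_congr_ae (Filter.Eventually.of_forall fun r => ?_)
    simp only [sub_self, Complex.cpow_zero, one_mul]
    push_cast
    ring
  refine ⟨?_, h4⟩
  by_contra h
  rw [integral_undef h] at h4
  linarith [one_half_lt_eulerMascheroniConstant]

/-- The terms `-log (1 - 1 / p)` of the logarithm of Mertens' product. -/
noncomputable def mertensTerm (n : ℕ) : ℝ := -log (1 - 1 / n)

lemma one_div_le_mertensTerm {n : ℕ} (hn : 2 ≤ n) :
    1 / (n : ℝ) ≤ mertensTerm n ∧ mertensTerm n ≤ 1 / (n - 1) := by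
  have h : (2 : ℝ) ≤ n := mod_cast hn
  have h0 : 0 < 1 - 1 / (n : ℝ) := by rw [sub_pos, div_lt_one (by linarith)]; linarith
  have h1 := log_le_sub_one_of_pos h0
  have h2 := one_sub_inv_le_log_of_pos h0
  rw [mertensTerm]
  refine ⟨by linarith, ?_⟩
  have h3 : (1 - 1 / (n : ℝ))⁻¹ = 1 + 1 / (n - 1) := by
    have : (n : ℝ) - 1 ≠ 0 := by linarith
    field_simp
    ring
  linarith

lemma mul_log_le_sum_log_div_sub_one (N : ℕ) :
    log (N.factorial) ≤ N * ∑ p ∈ (Icc 0 N).filter Nat.Prime, log p / (p - 1) := by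
  have h1 : N.factorial = ∏ p ∈ (Icc 0 N).filter Nat.Prime, p ^ (N.factorial).factorization p := by
    conv_lhs => rw [← Nat.prod_factorization_pow_eq_self (Nat.factorial_ne_zero N)]
    refine prod_subset (fun p hp => ?_) fun p _ hp => ?_
    · have hp' := Nat.prime_of_mem_primeFactors hp
      exact mem_filter.2 ⟨mem_Icc.2 ⟨Nat.zero_le _,
        (hp'.dvd_factorial).1 (Nat.dvd_of_mem_primeFactors hp)⟩, hp'⟩
    · simp [Finsupp.notMem_support_iff.1 hp]
  have h2 : log (N.factorial) = ∑ p ∈ (Icc 0 N).filter Nat.Prime,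
      ((N.factorial).factorization p : ℝ) * log p := by
    conv_lhs => rw [h1]
    push_cast
    rw [log_prod fun p hp => by
      have := (mem_filter.1 hp).2.pos
      positivity]
    exact sum_congr rfl fun p _ => log_pow _ _
  rw [h2, mul_sum]
  refine sum_le_sum fun p hp => ?_
  have hp' := (mem_filter.1 hp).2
  have hp2 : (2 : ℝ) ≤ p := mod_cast hp'.two_le
  rw [mul_div_left_comm, mul_comm]
  refine mul_le_mul_of_nonneg_left ?_ (log_nonneg (by linarith))
  rw [le_div_iff₀ (by linarith)]
  have : Fact p.Prime := ⟨hp'⟩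
  have h3 := sub_one_mul_padicValNat_factorial (p := p) N
  rw [← Nat.factorization_def _ hp'] at h3
  have h5 : (((p - 1) * (N.factorial).factorization p : ℕ) : ℝ) ≤ N := mod_cast (by omega)
  rw [Nat.cast_mul, Nat.cast_sub hp'.one_le] at h5
  push_cast at h5
  linarith

lemma exists_abs_sum_mertensTerm_mul_log_sub_le : ∃ K : ℝ, 0 ≤ K ∧ ∀ t : ℝ, 2 ≤ t →
    |∑ n ∈ Icc 0 ⌊t⌋₊, (if n.Prime then mertensTerm n * log n else 0) - log t| ≤ K := by
  set C := ∑' n : ℕ, 4 * (1 / (n : ℝ) ^ (3 / 2 : ℝ)) with hC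
  have hl4 : 0 ≤ log 4 := log_nonneg (by norm_num)
  refine ⟨log 4 + 6 + C, by positivity, fun t ht => ?_⟩
  set N := ⌊t⌋₊ with hN
  have h1 : 1 ≤ N := Nat.le_floor (by push_cast; linarith)
  have h5 := Nat.floor_le (by linarith : 0 ≤ t)
  have h6 := Nat.lt_floor_add_one t
  rw [← hN] at h5 h6
  have h7 := log_le_log (by linarith) h5
  have h8 : log t ≤ log N + 1 := by
    have : log (t / N) ≤ t / N - 1 := log_le_sub_one_of_pos (by positivity)
    rw [log_div (by positivity) (by positivity)] at this
    have : t / N ≤ 2 := by rw [div_le_iff₀ (by positivity)]; linarith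
    linarith
  have hgap : ∑ p ∈ (Icc 0 N).filter Nat.Prime, log p * (1 / (p - 1 : ℝ) - 1 / p) ≤ C := by
    refine le_trans (sum_le_sum fun p hp => ?_) (((summable_one_div_nat_rpow.2 (by norm_num)).mul_left 4).sum_le_tsum
      ((Icc 0 N).filter Nat.Prime) fun n _ => by positivity)
    have hp2 : (2 : ℝ) ≤ p := mod_cast (mem_filter.1 hp).2.two_le
    have e1 : log p ≤ p ^ (1 / 2 : ℝ) / (1 / 2) := log_le_rpow_div (by linarith) (by norm_num)
    have e2 : 1 / (p - 1 : ℝ) - 1 / p ≤ 2 / p ^ 2 := by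
      rw [div_sub_div _ _ (by linarith) (by linarith), div_le_div_iff₀ (by nlinarith) (by positivity)]
      nlinarith
    have e3 : (p : ℝ) ^ 2 = p ^ (1 / 2 : ℝ) * p ^ (3 / 2 : ℝ) := by
      rw [← rpow_add (by linarith), ← rpow_natCast]; norm_num
    have e4 : 0 ≤ 1 / (p - 1 : ℝ) - 1 / p := by
      rw [sub_nonneg]; exact one_div_le_one_div_of_le (by linarith) (by linarith)
    have e5 : 0 < (p : ℝ) ^ (1 / 2 : ℝ) := by positivity
    calc log p * (1 / (p - 1 : ℝ) - 1 / p) ≤ p ^ (1 / 2 : ℝ) / (1 / 2) * (2 / p ^ 2) := by gcongr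
      _ = 4 * (1 / p ^ (3 / 2 : ℝ)) := by rw [e3]; field_simp; norm_num
  have hA := (abs_le.1 (sum_vonMangoldt_div_sub_log_le N h1)).2
  have hB := mul_log_le_sum_log_div_sub_one N
  have hB' := mul_log_sub_le_log_factorial N
  have hB2 : log N - 1 ≤ ∑ p ∈ (Icc 0 N).filter Nat.Prime, log p / (p - 1) := by
    refine le_of_mul_le_mul_left ?_ (by linarith : (0 : ℝ) < N)
    linarith
  have hA2 : ∑ p ∈ (Icc 0 N).filter Nat.Prime, log p / p ≤
      ∑ n ∈ Icc 0 N, vonMangoldt n / n := by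
    rw [sum_congr rfl (g := fun n : ℕ => vonMangoldt n / n) fun p hp => by
      rw [vonMangoldt_apply_prime (mem_filter.1 hp).2]]
    exact sum_le_sum_of_subset_of_nonneg (filter_subset _ _) fun n _ _ =>
      div_nonneg vonMangoldt_nonneg (Nat.cast_nonneg _)
  rw [← sum_filter]
  have hU : ∑ p ∈ (Icc 0 N).filter Nat.Prime, mertensTerm p * log p ≤
      ∑ p ∈ (Icc 0 N).filter Nat.Prime, log p / p +
      ∑ p ∈ (Icc 0 N).filter Nat.Prime, log p * (1 / (p - 1 : ℝ) - 1 / p) := by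
    rw [← sum_add_distrib]
    refine sum_le_sum fun p hp => ?_
    have := mul_le_mul_of_nonneg_right (one_div_le_mertensTerm (mem_filter.1 hp).2.two_le).2
      (log_natCast_nonneg p)
    calc _ ≤ _ := this
      _ = _ := by ring
  have hL : ∑ p ∈ (Icc 0 N).filter Nat.Prime, log p / (p - 1 : ℝ) ≤
      ∑ p ∈ (Icc 0 N).filter Nat.Prime, mertensTerm p * log p +
      ∑ p ∈ (Icc 0 N).filter Nat.Prime, log p * (1 / (p - 1 : ℝ) - 1 / p) := by
    rw [← sum_add_distrib]
    refine sum_le_sum fun p hp => ?_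
    have := mul_le_mul_of_nonneg_right (one_div_le_mertensTerm (mem_filter.1 hp).2.two_le).1
      (log_natCast_nonneg p)
    calc log p / (p - 1 : ℝ) = 1 / p * log p + log p * (1 / (p - 1 : ℝ) - 1 / p) := by ring
      _ ≤ _ := by gcongr
  rw [abs_le]
  constructor <;> linarith

lemma exists_abs_sum_mertensTerm_sub_le : ∃ K : ℝ, 0 ≤ K ∧ ∀ a b : ℝ, 2 ≤ a → a ≤ b →
    |∑ n ∈ (Ioc ⌊a⌋₊ ⌊b⌋₊).filter Nat.Prime, mertensTerm n - log (log b / log a)| ≤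
      K / log a := by
  obtain ⟨K, hK, h⟩ := exists_abs_sum_mertensTerm_mul_log_sub_le
  refine ⟨2 * K, by positivity, fun a b ha hab => ?_⟩
  have h1 := sum_div_log_sub_log_div_le h ha hab
  rw [sum_filter]
  convert h1 using 4 with n hn
  split_ifs with hp
  · have : log n ≠ 0 := (log_pos (mod_cast hp.one_lt)).ne'
    field_simp
  · simp

lemma neg_log_one_sub_mul_le {u v : ℝ} (hu : u < 1) (hv : 0 ≤ v) (hv' : v ≤ 1) :
    -log (1 - u * v) ≤ v * -log (1 - u) := by
  have h2 := rpow_one_add_le_one_add_mul_self (s := -u) (by linarith) hv hv'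
  have h4 := log_le_log (rpow_pos_of_pos (by linarith) v) h2
  rw [log_rpow (by linarith)] at h4
  rw [show 1 - u * v = 1 + v * -u by ring, show 1 - u = 1 + -u by ring]
  linarith

lemma tendsto_prod_primesBelow_rpow {s : ℝ} (hs : 1 < s) :
    Filter.Tendsto (fun N : ℕ => ∏ p ∈ N.primesBelow, (1 - (p : ℝ) ^ (-s))⁻¹) atTop
      (nhds (∑' n : ℕ, 1 / (n : ℝ) ^ s)) := by
  let f : ℕ →*₀ ℝ :=
    { toFun := fun n => n ^ (-s)
      map_zero' := by simp only [Nat.cast_zero]; exact zero_rpow (by linarith)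
      map_one' := by simp
      map_mul' := fun m n => by
        push_cast
        exact mul_rpow (Nat.cast_nonneg m) (Nat.cast_nonneg n) }
  have h0 : ∀ n : ℕ, f n = 1 / n ^ s := fun n => by
    change (n : ℝ) ^ (-s) = _
    rw [rpow_neg (Nat.cast_nonneg n), one_div]
  have h1 : Summable fun n => ‖f n‖ := by
    refine (summable_one_div_nat_rpow.2 hs).congr fun n => ?_
    rw [h0, norm_of_nonneg (by positivity)]
  have h2 := EulerProduct.eulerProduct_completely_multiplicative h1
  rw [tsum_congr h0] at h2
  exact h2

lemma log_tsum_le_of_forall {α c : ℝ} (hα : 0 < α) (h : ∀ N : ℕ, ∑ p ∈ N.primesBelow, mertensTerm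
    p * (p : ℝ) ^ (-α) ≤ c) : log (∑' n : ℕ, 1 / (n : ℝ) ^ (1 + α)) ≤ c := by
  have h1 := tendsto_prod_primesBelow_rpow (s := 1 + α) (by linarith)
  rw [log_le_iff_le_exp ((summable_one_div_nat_rpow.2 (by linarith)).tsum_pos (fun n => by positivity) 1 (by simp))]
  refine le_of_tendsto h1 (Filter.Eventually.of_forall fun N => ?_)
  have hu : ∀ p ∈ N.primesBelow, (0 : ℝ) < 1 - p ^ (-(1 + α)) := fun p hp => by
    have : (1 : ℝ) < p := mod_cast (Nat.prime_of_mem_primesBelow hp).one_lt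
    rw [sub_pos]
    exact rpow_lt_one_of_one_lt_of_neg this (by linarith)
  rw [← exp_log (prod_pos fun p hp => inv_pos.2 (hu p hp)), exp_le_exp,
    log_prod fun p hp => (inv_pos.2 (hu p hp)).ne']
  refine le_trans (sum_le_sum fun p hp => ?_) (h N)
  have hp1 : (1 : ℝ) < p := mod_cast (Nat.prime_of_mem_primesBelow hp).one_lt
  rw [log_inv, mertensTerm, mul_comm, show p ^ (-(1 + α)) = 1 / p * (p : ℝ) ^ (-α) by
    rw [neg_add, rpow_add (by linarith), rpow_neg_one, one_div]]
  exact neg_log_one_sub_mul_le (by rw [div_lt_one (by linarith)]; exact hp1) (by positivity)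
    (rpow_le_one_of_one_le_of_nonpos hp1.le (by linarith))

lemma sum_mertensTerm_mul_rpow_le {α : ℝ} (hα : 0 < α) (N : ℕ) {g : ℝ → ℝ}
    (hg : IntegrableOn (fun r => exp (-r) * g r) (Set.Ioi 0))
    (h : ∀ r : ℝ, 0 < r → ∑ n ∈ (Icc 0 ⌊exp (r / α)⌋₊).filter Nat.Prime, mertensTerm n ≤ g r) :
    ∑ p ∈ N.primesBelow, mertensTerm p * (p : ℝ) ^ (-α) ≤ ∫ r in Set.Ioi (0 : ℝ), exp (-r) * g r := by
  have hterm : ∀ p ∈ N.primesBelow, mertensTerm p * p ^ (-α) =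
      ∫ r in Set.Ioi 0, (Set.Ioi (α * log p)).indicator (fun r => exp (-r) * mertensTerm p) r := by
    intro p hp
    have hp1 : (1 : ℝ) < p := mod_cast (Nat.prime_of_mem_primesBelow hp).one_lt
    have hl := mul_pos hα (log_pos hp1)
    rw [setIntegral_indicator measurableSet_Ioi,
      Set.inter_eq_right.2 (Set.Ioi_subset_Ioi hl.le), integral_mul_const,
      integral_exp_neg_Ioi, rpow_def_of_pos (by linarith)]
    ring_nf
  have hin : ∀ p ∈ N.primesBelow, IntegrableOn
      ((Set.Ioi (α * log p)).indicator (fun r => exp (-r) * mertensTerm p)) (Set.Ioi 0) := fun p _ =>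
    ((integrableOn_exp_neg_Ioi 0).mul_const _).indicator measurableSet_Ioi
  rw [sum_congr rfl hterm, ← integral_finsetSum _ hin]
  refine setIntegral_mono_on (integrable_finsetSum _ hin) hg
    measurableSet_Ioi fun r hr => ?_
  refine le_trans ?_ (mul_le_mul_of_nonneg_left (h r hr) (exp_pos _).le)
  rw [mul_sum]
  have : ∀ p ∈ N.primesBelow, (Set.Ioi (α * log p)).indicator (fun r => exp (-r) * mertensTerm p) r =
      if α * log p < r then exp (-r) * mertensTerm p else 0 := fun p _ => by
    simp [Set.indicator_apply]
  rw [sum_congr rfl this, ← sum_filter]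
  refine sum_le_sum_of_subset_of_nonneg (fun p hp => ?_) fun p hp _ => ?_
  · rw [mem_filter] at hp
    have hp' := Nat.prime_of_mem_primesBelow hp.1
    refine mem_filter.2 ⟨mem_Icc.2 ⟨Nat.zero_le _, Nat.le_floor ?_⟩, hp'⟩
    rw [← log_le_iff_le_exp (mod_cast hp'.pos), le_div_iff₀ hα]
    linarith
  · have hp' := (mem_filter.1 hp).2
    exact mul_nonneg (exp_pos _).le (le_trans (by positivity) (one_div_le_mertensTerm hp'.two_le).1)

lemma neg_log_le_two_mul_rpow {v : ℝ} (hv : 0 < v) : -log v ≤ 2 * v ^ (-(1 / 2) : ℝ) := by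
  have := log_le_rpow_div (inv_pos.2 hv).le (by norm_num : (0 : ℝ) < 1 / 2)
  rw [log_inv, inv_rpow hv.le, ← rpow_neg hv.le] at this
  linarith

lemma exists_loglog_add_le_sum_mertensTerm : ∃ K : ℝ, 0 ≤ K ∧ ∀ x : ℝ, 2 ≤ x →
    log (log x) + eulerMascheroniConstant - K / log x ≤
      ∑ n ∈ (Icc 0 ⌊x⌋₊).filter Nat.Prime, mertensTerm n := by
  obtain ⟨K, hK, h⟩ := exists_abs_sum_mertensTerm_sub_le
  refine ⟨K, hK, fun x hx => ?_⟩
  set H : ℝ → ℝ := fun t => ∑ n ∈ (Icc 0 ⌊t⌋₊).filter Nat.Prime, mertensTerm n with hH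
  have hmono : ∀ s t : ℝ, s ≤ t → H s ≤ H t := fun s t hst =>
    sum_le_sum_of_subset_of_nonneg (filter_subset_filter _
      (Icc_subset_Icc_right (Nat.floor_mono hst))) fun p hp _ =>
      le_trans (by positivity) (one_div_le_mertensTerm (mem_filter.1 hp).2.two_le).1
  have hlx := log_pos (by linarith)
  set c := H x - log (log x) + K / log x with hc
  set K' := 2 + |log (log x)| * (log x) ^ (1 / 2 : ℝ) with hK'
  have hK'0 : 0 ≤ K' := by positivity
  have hbound : ∀ v : ℝ, 0 < v → H (exp v) ≤ log v + c + K' * v ^ (-(1 / 2) : ℝ) := by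
    intro v hv
    have hvp : 0 < v ^ (-(1 / 2) : ℝ) := by positivity
    rcases le_total (log x) v with hxv | hxv
    · have hxe := (log_le_iff_le_exp (by linarith)).1 hxv
      have h1 := (abs_le.1 (h x (exp v) hx hxe)).2
      rw [log_exp, log_div hv.ne' hlx.ne'] at h1
      have h2 : H (exp v) = H x +
          ∑ n ∈ (Ioc ⌊x⌋₊ ⌊exp v⌋₊).filter Nat.Prime, mertensTerm n := by
        simp only [hH, sum_filter]
        have hfl := Nat.floor_mono hxe
        rw [show Icc 0 ⌊exp v⌋₊ = Icc 0 ⌊x⌋₊ ∪ Ioc ⌊x⌋₊ ⌊exp v⌋₊ by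
          ext n; simp only [mem_Icc, mem_union, mem_Ioc]; omega,
          sum_union]
        rw [disjoint_left]
        intro n hn hn'
        rw [mem_Icc] at hn
        rw [mem_Ioc] at hn'
        omega
      have := mul_nonneg hK'0 hvp.le
      rw [h2]
      linarith
    · have h1 := hmono _ _ ((le_log_iff_exp_le (by linarith)).1 hxv)
      have h2 := neg_log_le_two_mul_rpow hv
      have h3 : |log (log x)| ≤ |log (log x)| * (log x) ^ (1 / 2 : ℝ) * v ^ (-(1 / 2) : ℝ) := by
        rw [mul_assoc]
        refine le_mul_of_one_le_right (abs_nonneg _) ?_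
        rw [rpow_neg hv.le, ← div_eq_mul_inv, one_le_div (by positivity)]
        gcongr
      have h4 := le_abs_self (log (log x))
      have h5 : 0 ≤ K / log x := by positivity
      rw [hK', add_mul]
      linarith
  have hI1 := integral_exp_neg_mul_log
  have hI2 : IntegrableOn (fun r : ℝ => exp (-r) * r ^ (-(1 / 2) : ℝ)) (Set.Ioi 0) := by
    have := Real.GammaIntegral_convergent (s := 1 / 2) (by norm_num)
    norm_num at this ⊢
    exact this
  set J := ∫ r in Set.Ioi 0, exp (-r) * r ^ (-(1 / 2) : ℝ) with hJ
  have hkey : ∀ α : ℝ, 0 < α → log (α * ∑' n : ℕ, 1 / (n : ℝ) ^ (1 + α)) ≤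
      -eulerMascheroniConstant + c + K' * α ^ (1 / 2 : ℝ) * J := by
    intro α hα
    have hi0 : IntegrableOn (fun r : ℝ => exp (-r) * (c - log α)) (Set.Ioi 0) :=
      (integrableOn_exp_neg_Ioi 0).mul_const _
    have hi3 : IntegrableOn (fun r : ℝ => exp (-r) * r ^ (-(1 / 2) : ℝ) *
        (K' * α ^ (1 / 2 : ℝ))) (Set.Ioi 0) := hI2.mul_const _
    have hi1 : IntegrableOn (fun r : ℝ => exp (-r) * log r + exp (-r) * (c - log α))
        (Set.Ioi 0) := hI1.1.add hi0
    have e1 : (fun r : ℝ => exp (-r) * (log r + (c - log α) + r ^ (-(1 / 2) : ℝ) *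
        (K' * α ^ (1 / 2 : ℝ)))) = fun r => exp (-r) * log r + exp (-r) * (c - log α) +
        exp (-r) * r ^ (-(1 / 2) : ℝ) * (K' * α ^ (1 / 2 : ℝ)) := by
      funext r; ring
    have h1 := log_tsum_le_of_forall hα fun N => sum_mertensTerm_mul_rpow_le hα N
      (g := fun r => log r + (c - log α) + r ^ (-(1 / 2) : ℝ) * (K' * α ^ (1 / 2 : ℝ)))
      (by rw [e1]; exact hi1.add hi3) fun r hr => by
        refine (hbound (r / α) (by positivity)).trans_eq ?_
        rw [log_div hr.ne' hα.ne', div_rpow hr.le hα.le, rpow_neg hα.le (1 / 2),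
          div_inv_eq_mul]
        ring
    rw [e1, integral_add hi1 hi3, integral_add hI1.1 hi0,
      integral_mul_const, integral_mul_const, integral_exp_neg_Ioi, hI1.2,
      ← hJ, neg_zero, exp_zero] at h1
    rw [log_mul hα.ne' ((summable_one_div_nat_rpow.2 (by linarith)).tsum_pos (fun n => by positivity) 1 (by simp)).ne']
    linarith
  have ht1 : Filter.Tendsto (fun α : ℝ => log (α * ∑' n : ℕ, 1 / (n : ℝ) ^ (1 + α)))
      (nhdsWithin 0 (Set.Ioi 0)) (nhds 0) := by
    have h1 := tendsto_sub_mul_tsum_nat_rpow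
    have h2 : Filter.Tendsto (fun α : ℝ => 1 + α) (nhdsWithin 0 (Set.Ioi 0))
        (nhdsWithin 1 (Set.Ioi 1)) := by
      refine tendsto_nhdsWithin_iff.2 ⟨?_, ?_⟩
      · refine tendsto_nhdsWithin_of_tendsto_nhds ?_
        have : Continuous fun α : ℝ => 1 + α := by fun_prop
        simpa using this.tendsto 0
      · filter_upwards [self_mem_nhdsWithin] with α hα
        simpa using hα
    have h3 := (h1.comp h2).log one_ne_zero
    rw [log_one] at h3
    refine h3.congr fun α => ?_
    simp
  have ht2 : Filter.Tendsto (fun α : ℝ => -eulerMascheroniConstant + c + K' * α ^ (1 / 2 : ℝ) * J)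
      (nhdsWithin 0 (Set.Ioi 0)) (nhds (-eulerMascheroniConstant + c)) := by
    refine tendsto_nhdsWithin_of_tendsto_nhds ?_
    have : Continuous fun α : ℝ => -eulerMascheroniConstant + c + K' * α ^ (1 / 2 : ℝ) * J := by
      have := continuous_rpow_const (q := 1 / 2) (by norm_num)
      fun_prop
    have h2 := this.tendsto 0
    rw [zero_rpow (by norm_num)] at h2
    simpa using h2
  have h0 := le_of_tendsto_of_tendsto ht1 ht2 (by
    filter_upwards [self_mem_nhdsWithin] with α hα using hkey α hα)
  change _ ≤ H x
  linarith

lemma prod_one_sub_one_div_eq {S : Finset ℕ} (hS : ∀ p ∈ S, p.Prime) :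
    ∏ p ∈ S, (1 - 1 / (p : ℝ)) = exp (-∑ p ∈ S, mertensTerm p) := by
  rw [← sum_neg_distrib, exp_sum]
  refine prod_congr rfl fun p hp => ?_
  have : (1 : ℝ) < p := mod_cast (hS p hp).one_lt
  rw [mertensTerm, neg_neg, exp_log]
  rw [sub_pos, div_lt_one (by linarith)]
  exact this

lemma primesUpTo_eq_filter_Icc (x : ℝ) : primesUpTo x = (Icc 0 ⌊x⌋₊).filter Nat.Prime := by
  ext p
  simp [primesUpTo]

/-- Mertens' product theorem, upper bound for `∏ (1 - 1 / p)`. -/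
lemma eventually_prod_one_sub_one_div_le {ε : ℝ} (hε : 0 < ε) : ∀ᶠ x : ℝ in atTop,
    ∏ p ∈ primesUpTo x, (1 - 1 / (p : ℝ)) ≤ (1 + ε) * exp (-eulerMascheroniConstant) / log x := by
  obtain ⟨K, hK, h⟩ := exists_loglog_add_le_sum_mertensTerm
  have h1 : Filter.Tendsto (fun x => exp (K / log x)) atTop (nhds 1) := by
    have := (tendsto_const_nhds (x := K)).div_atTop tendsto_log_atTop
    simpa [Function.comp_def] using (continuous_exp.tendsto 0).comp this
  filter_upwards [h1.eventually (gt_mem_nhds (by linarith : 1 < 1 + ε)),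
    eventually_ge_atTop 2] with x hx hx2
  have hlx := log_pos (by linarith)
  rw [prod_one_sub_one_div_eq fun p hp => prime_of_mem_primesUpTo hp, primesUpTo_eq_filter_Icc]
  calc exp (-∑ p ∈ (Icc 0 ⌊x⌋₊).filter Nat.Prime, mertensTerm p)
      ≤ exp (K / log x + -eulerMascheroniConstant - log (log x)) :=
        exp_le_exp.2 (by linarith [h x hx2])
    _ = exp (K / log x) * exp (-eulerMascheroniConstant) / log x := by
        rw [exp_sub, exp_add, exp_log hlx]
    _ ≤ _ := by gcongr
end

/-- `w₀` is large enough for the sieve weights to be usable with every set of primes. -/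
def IsSieveBase (w₀ : ℕ) : Prop := 2 ≤ w₀ ∧
  ∀ S : Finset ℕ, (∀ p ∈ S, p.Prime) → ∀ y : ℝ, (∀ p ∈ S, (p : ℝ) ≤ y) → ∀ w : ℝ, w₀ ≤ w → w ≤ y →
      ∑ p ∈ S.filter (fun p : ℕ => w < p), 1 / (p : ℝ) ≤ log (log y / log w) + 1 / 100

lemma exists_isSieveBase : ∃ w₀ : ℕ, IsSieveBase w₀ :=
  exists_sum_one_div_prime_le (1 / 100) (by norm_num)

lemma abs_card_filter_zmod_dvd_sub_le {q d : ℕ} [NeZero q] (hd : 1 ≤ d) (hqd : q.Coprime d)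
    (b : ZMod q) {v : ℝ} (hv : 0 ≤ v) :
    |(((Icc 1 ⌊v⌋₊).filter fun n : ℕ => (n : ZMod q) = b ∧ d ∣ n).card : ℝ) - v / q / d| ≤ 2 := by
  have hq : 1 ≤ q := NeZero.one_le
  obtain ⟨r, hr1, hr2⟩ := Nat.chineseRemainder hqd b.val 0
  have h1 : ∀ n : ℕ, ((n : ZMod q) = b ∧ d ∣ n) ↔ n ≡ r [MOD q * d] := by
    intro n
    rw [← Nat.modEq_and_modEq_iff_modEq_mul hqd]
    refine and_congr ?_ ?_
    · rw [← ZMod.natCast_eq_natCast_iff, (ZMod.natCast_eq_natCast_iff _ _ _).2 hr1,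
        ZMod.natCast_zmod_val]
    · rw [← Nat.modEq_zero_iff_dvd]
      exact ⟨fun h => h.trans hr2.symm, fun h => h.trans hr2⟩
  have hqd0 : 0 < q * d := by positivity
  have hqdR : 1 ≤ (q : ℝ) * d := mod_cast hqd0
  rw [filter_congr fun n _ => h1 n]
  change |((((Ioc 0 ⌊v⌋₊).filter fun n : ℕ => n ≡ r [MOD q * d]).card : ℕ) : ℝ) - _| ≤ 2
  have h2 := Nat.Ioc_filter_modEq_card 0 ⌊v⌋₊ hqd0 r
  set c := ((Ioc 0 ⌊v⌋₊).filter fun n : ℕ => n ≡ r [MOD q * d]).card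
  have h3 : (c : ℤ) = ⌊((⌊v⌋₊ : ℚ) - r) / ((q * d : ℕ) : ℚ)⌋ - ⌊((0 : ℚ) - r) / ((q * d : ℕ) : ℚ)⌋ := by
    rw [h2]
    refine max_eq_left (sub_nonneg.2 (Int.floor_mono ?_))
    gcongr
    positivity
  have hA := Int.floor_le (((⌊v⌋₊ : ℚ) - r) / ((q * d : ℕ) : ℚ))
  have hA' := Int.lt_floor_add_one (((⌊v⌋₊ : ℚ) - r) / ((q * d : ℕ) : ℚ))
  have hB := Int.floor_le (((0 : ℚ) - r) / ((q * d : ℕ) : ℚ))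
  have hB' := Int.lt_floor_add_one (((0 : ℚ) - r) / ((q * d : ℕ) : ℚ))
  have h3' : (c : ℚ) = ⌊((⌊v⌋₊ : ℚ) - r) / ((q * d : ℕ) : ℚ)⌋ -
      ⌊((0 : ℚ) - r) / ((q * d : ℕ) : ℚ)⌋ := mod_cast h3
  have e1 : ((⌊v⌋₊ : ℚ) - r) / ((q * d : ℕ) : ℚ) - ((0 : ℚ) - r) / ((q * d : ℕ) : ℚ) =
      (⌊v⌋₊ : ℚ) / (q * d : ℕ) := by
    push_cast
    ring
  have hu : (c : ℚ) ≤ (⌊v⌋₊ : ℚ) / (q * d : ℕ) + 1 := by linarith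
  have hl : (⌊v⌋₊ : ℚ) / (q * d : ℕ) - 1 ≤ c := by linarith
  have hu' := (Rat.cast_le (K := ℝ)).2 hu
  have hl' := (Rat.cast_le (K := ℝ)).2 hl
  have hf1 := Nat.floor_le hv
  have hf2 := Nat.lt_floor_add_one v
  push_cast at hu' hl'
  have e2 : (⌊v⌋₊ : ℝ) / (q * d) ≤ v / (q * d) := by gcongr
  have e3 : v / (q * d) ≤ (⌊v⌋₊ : ℝ) / (q * d) + 1 := by
    rw [div_add_one (by positivity), div_le_div_iff_of_pos_right (by positivity)]
    linarith
  rw [div_div, abs_le]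
  constructor <;> linarith

lemma coprime_of_forall_prime_dvd {q d : ℕ} {S : Finset ℕ} (hqS : ∀ p ∈ S, ¬ p ∣ q)
    (hd : ∀ p : ℕ, p.Prime → p ∣ d → p ∈ S) : q.Coprime d :=
  Nat.Coprime.symm (Nat.coprime_of_dvd fun p hp h1 h2 => hqS p (hd p hp h1) h2)

lemma card_le_of_forall_le {I : Finset ℕ} {D : ℝ} (hD : 0 ≤ D) (h : ∀ d ∈ I, 1 ≤ d ∧ (d : ℝ) ≤ D) :
    (I.card : ℝ) ≤ D := by
  have : I ⊆ Icc 1 ⌊D⌋₊ := fun d hd => mem_Icc.2 ⟨(h d hd).1, Nat.le_floor (h d hd).2⟩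
  calc (I.card : ℝ) ≤ (Icc 1 ⌊D⌋₊).card := mod_cast card_le_card this
    _ = ⌊D⌋₊ := by simp
    _ ≤ D := Nat.floor_le hD

lemma abs_sum_omegaSign_mul_card_sub_le {q : ℕ} [NeZero q] {S I : Finset ℕ} {D : ℝ} (hD : 0 ≤ D)
    (hqS : ∀ p ∈ S, ¬ p ∣ q) (hI : ∀ d ∈ I, 1 ≤ d ∧ (d : ℝ) ≤ D ∧ ∀ p : ℕ, p.Prime → p ∣ d → p ∈ S)
    (b : ZMod q) {v : ℝ} (hv : 0 ≤ v) : |∑ n ∈ (Icc 1 ⌊v⌋₊).filter (fun n : ℕ => (n : ZMod q) = b),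
      ∑ d ∈ I.filter (· ∣ n), omegaSign d - v / q * ∑ d ∈ I, omegaSign d / d| ≤ 2 * D := by
  have h1 : ∑ n ∈ (Icc 1 ⌊v⌋₊).filter (fun n : ℕ => (n : ZMod q) = b),
      ∑ d ∈ I.filter (· ∣ n), omegaSign d = ∑ d ∈ I, omegaSign d *
        (((Icc 1 ⌊v⌋₊).filter fun n : ℕ => (n : ZMod q) = b ∧ d ∣ n).card : ℝ) := by
    simp only [sum_filter (s := I)]
    rw [sum_comm]
    refine sum_congr rfl fun d _ => ?_
    rw [← sum_filter, filter_filter, sum_const, nsmul_eq_mul, mul_comm]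
  rw [h1, mul_sum, ← sum_sub_distrib]
  refine (abs_sum_le_sum_abs _ _).trans ?_
  calc _ ≤ ∑ d ∈ I, (2 : ℝ) := by
        refine sum_le_sum fun d hd => ?_
        rw [show v / q * (omegaSign d / d) = omegaSign d * (v / q / d) by ring, ← mul_sub, abs_mul,
          abs_omegaSign, one_mul]
        exact abs_card_filter_zmod_dvd_sub_le (hI d hd).1
          (coprime_of_forall_prime_dvd hqS (hI d hd).2.2) b hv
    _ = 2 * I.card := by rw [sum_const, nsmul_eq_mul, mul_comm]
    _ ≤ _ := by
      have := card_le_of_forall_le hD fun d hd => ⟨(hI d hd).1, (hI d hd).2.1⟩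
      linarith

/-- The fundamental lemma of the sieve in a residue class. -/
lemma abs_card_filter_sieve_sub_le {w₀ : ℕ} (hw : IsSieveBase w₀) {y : ℝ} (hwy : w₀ ≤ y) {S :
    Finset ℕ} (hS : ∀ p ∈ S, p.Prime) (hSy : ∀ p ∈ S, (p : ℝ) ≤ y) {q : ℕ} [NeZero q] (hqS : ∀ p ∈
    S, ¬ p ∣ q) (b : ZMod q) (M : ℕ) {v : ℝ} (hv : 0 ≤ v) : |(((Icc 1 ⌊v⌋₊).filter fun n : ℕ => (n :
    ZMod q) = b ∧ ∀ p ∈ S, ¬ p ∣ n).card : ℝ) - v / q * ∏ p ∈ S, (1 - 1 / (p : ℝ))| ≤ (9 / 20) ^ M *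
    (v / q * ∏ p ∈ S, (1 - 1 / (p : ℝ))) + 2 * (4 ^ w₀ * y ^ (M + 11)) := by
  obtain ⟨⟨I, hI1, hI2, hI3⟩, J, hJ1, hJ2, hJ3⟩ := exists_sieve hw.1 hwy hS hSy (hw.2 S hS y hSy) M
  have hy0 := le_trans (Nat.cast_nonneg _) hwy
  have hD : 0 ≤ 4 ^ w₀ * y ^ (M + 11) := by positivity
  have h1 : (((Icc 1 ⌊v⌋₊).filter fun n : ℕ => (n : ZMod q) = b ∧ ∀ p ∈ S, ¬ p ∣ n).card : ℝ) =
      ∑ n ∈ (Icc 1 ⌊v⌋₊).filter (fun n : ℕ => (n : ZMod q) = b),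
        if ∀ p ∈ S, ¬ p ∣ n then 1 else 0 := by
    rw [← filter_filter, card_filter]
    push_cast
    rfl
  have hu := (abs_le.1 (abs_sum_omegaSign_mul_card_sub_le hD hqS hI1 b hv)).2
  have hl := (abs_le.1 (abs_sum_omegaSign_mul_card_sub_le hD hqS hJ1 b hv)).1
  have hu' := sum_le_sum (s := (Icc 1 ⌊v⌋₊).filter (fun n : ℕ => (n : ZMod q) = b)) fun n _ => hI2 n
  have hl' := sum_le_sum (s := (Icc 1 ⌊v⌋₊).filter (fun n : ℕ => (n : ZMod q) = b)) fun n _ => hJ2 n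
  have hvq : 0 ≤ v / q := by positivity
  have e1 := mul_le_mul_of_nonneg_left hI3 hvq
  have e2 := mul_le_mul_of_nonneg_left hJ3 hvq
  rw [h1, abs_le]
  constructor <;> linarith

lemma norm_sum_filter_sieve_le {w₀ : ℕ} (hw : IsSieveBase w₀) {y : ℝ} (hwy : w₀ ≤ y)
    {S : Finset ℕ} (hS : ∀ p ∈ S, p.Prime) (hSy : ∀ p ∈ S, (p : ℝ) ≤ y) {ψ : ℕ → ℂ}
    (hψ : ∀ n, ‖ψ n‖ ≤ 1) (hmul : ∀ m n, ψ (m * n) = ψ m * ψ n) (M : ℕ) {v β : ℝ} (hv : 1 ≤ v)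
    (hD : 4 ^ w₀ * y ^ (M + 11) ≤ v) (hβ : 0 ≤ β)
    (h : ∀ t : ℝ, v / (4 ^ w₀ * y ^ (M + 11)) ≤ t → ‖∑ m ∈ Icc 1 ⌊t⌋₊, ψ m‖ ≤ β * t) :
    ‖∑ n ∈ (Icc 1 ⌊v⌋₊).filter (fun n : ℕ => ∀ p ∈ S, ¬ p ∣ n), ψ n‖ ≤
      β * v * (1 + log v) + 2 * (9 / 20) ^ M * (v * ∏ p ∈ S, (1 - 1 / (p : ℝ))) +
        4 * (4 ^ w₀ * y ^ (M + 11)) := by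
  obtain ⟨⟨I, hI1, hI2, hI3⟩, J, hJ1, hJ2, hJ3⟩ := exists_sieve hw.1 hwy hS hSy (hw.2 S hS y hSy) M
  have hw2 : (2 : ℝ) ≤ w₀ := mod_cast hw.1
  have hy0 : (0 : ℝ) < y := by linarith
  set D := 4 ^ w₀ * y ^ (M + 11) with hDdef
  have hD0 : 0 < D := by positivity
  have hq1 : ∀ p ∈ S, ¬ p ∣ 1 := fun p hp h => (hS p hp).one_lt.ne' (Nat.dvd_one.1 h)
  have hone : ∀ n : ℕ, ((n : ZMod 1) = 0) := fun n => Subsingleton.elim _ _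
  have hu := (abs_le.1 (abs_sum_omegaSign_mul_card_sub_le hD0.le hq1 hI1 (0 : ZMod 1)
    (by linarith : 0 ≤ v))).2
  have hl := (abs_le.1 (abs_sum_omegaSign_mul_card_sub_le hD0.le hq1 hJ1 (0 : ZMod 1)
    (by linarith : 0 ≤ v))).1
  simp only [hone, filter_true, Nat.cast_one, div_one] at hu hl
  have e1 := mul_le_mul_of_nonneg_left hI3 (by linarith : 0 ≤ v)
  have e2 := mul_le_mul_of_nonneg_left hJ3 (by linarith : 0 ≤ v)
  have hmain : ‖∑ n ∈ Icc 1 ⌊v⌋₊, ψ n * ((∑ d ∈ I.filter (· ∣ n), omegaSign d : ℝ) : ℂ)‖ ≤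
      β * v * (1 + log v) := by
    have h1 : ∑ n ∈ Icc 1 ⌊v⌋₊, ψ n * ((∑ d ∈ I.filter (· ∣ n), omegaSign d : ℝ) : ℂ) =
        ∑ d ∈ I, (omegaSign d : ℂ) * (ψ d * ∑ m ∈ Icc 1 ⌊v / d⌋₊, ψ m) := by
      push_cast
      simp only [sum_filter, mul_sum]
      rw [sum_comm]
      refine sum_congr rfl fun d hd => ?_
      have hd1 := (hI1 d hd).1
      simp only [mul_ite, mul_zero]
      rw [← sum_filter]
      symm
      refine sum_bij (fun m _ => d * m) (fun m hm => ?_) (fun m _ m' _ hmm => ?_) (fun n hn => ?_)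
        fun m _ => by rw [hmul]; ring
      · rw [mem_Icc] at hm
        refine mem_filter.2 ⟨mem_Icc.2 ⟨Nat.mul_pos hd1 hm.1, ?_⟩, dvd_mul_right _ _⟩
        have := (Nat.le_floor_iff (by positivity)).1 hm.2
        rw [le_div_iff₀ (mod_cast hd1)] at this
        exact Nat.le_floor (by push_cast; linarith)
      · exact Nat.eq_of_mul_eq_mul_left hd1 hmm
      · rw [mem_filter, mem_Icc] at hn
        obtain ⟨⟨hn1, hn2⟩, m, rfl⟩ := hn
        refine ⟨m, mem_Icc.2 ⟨Nat.pos_of_mul_pos_left hn1, Nat.le_floor ?_⟩, rfl⟩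
        have := (Nat.le_floor_iff (by positivity)).1 hn2
        rw [le_div_iff₀ (mod_cast hd1)]
        push_cast at this
        linarith
    rw [h1]
    refine (norm_sum_le _ _).trans ?_
    have hharm : ∑ d ∈ I, 1 / (d : ℝ) ≤ 1 + log v := by
      refine (sum_le_sum_of_subset_of_nonneg (fun d hd => mem_Icc.2 ⟨(hI1 d hd).1, Nat.le_floor ((hI1 d hd).2.1.trans hD)⟩) fun _ _ _ => by positivity).trans ?_
      have := harmonic_floor_le_one_add_log v hv
      rw [harmonic_eq_sum_Icc] at this
      push_cast at this
      simpa using this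
    calc _ ≤ ∑ d ∈ I, β * v * (1 / d) := by
          refine sum_le_sum fun d hd => ?_
          rw [norm_mul, norm_mul, norm_real, norm_eq_abs, abs_omegaSign, one_mul]
          calc _ ≤ 1 * (β * (v / d)) := by
                refine mul_le_mul (hψ d) (h _ ?_) (norm_nonneg _) zero_le_one
                exact div_le_div_of_nonneg_left (by linarith) (by exact_mod_cast (hI1 d hd).1) (hI1 d hd).2.1
            _ = _ := by ring
      _ = β * v * ∑ d ∈ I, 1 / (d : ℝ) := by rw [mul_sum]
      _ ≤ _ := by gcongr
  have hdiff : ‖∑ n ∈ (Icc 1 ⌊v⌋₊).filter (fun n : ℕ => ∀ p ∈ S, ¬ p ∣ n), ψ n -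
      ∑ n ∈ Icc 1 ⌊v⌋₊, ψ n * ((∑ d ∈ I.filter (· ∣ n), omegaSign d : ℝ) : ℂ)‖ ≤
      ∑ n ∈ Icc 1 ⌊v⌋₊, (∑ d ∈ I.filter (· ∣ n), omegaSign d -
        ∑ d ∈ J.filter (· ∣ n), omegaSign d) := by
    rw [sum_filter, ← sum_sub_distrib]
    refine (norm_sum_le _ _).trans (sum_le_sum fun n _ => ?_)
    have a1 := hI2 n
    have a2 := hJ2 n
    have e3 : (if ∀ p ∈ S, ¬ p ∣ n then ψ n else 0) - ψ n * ((∑ d ∈ I.filter (· ∣ n), omegaSign d : ℝ) : ℂ)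
        = ψ n * (((if ∀ p ∈ S, ¬ p ∣ n then 1 else 0) - ∑ d ∈ I.filter (· ∣ n), omegaSign d : ℝ) : ℂ) := by
      split_ifs <;> push_cast <;> ring
    rw [e3, norm_mul, norm_real, norm_eq_abs, abs_of_nonpos (by linarith)]
    calc _ ≤ 1 * -((if ∀ p ∈ S, ¬ p ∣ n then 1 else 0) - ∑ d ∈ I.filter (· ∣ n), omegaSign d) := by
          gcongr
          · linarith
          · exact hψ n
      _ ≤ _ := by linarith
  rw [sum_sub_distrib] at hdiff
  have := norm_sub_norm_le (∑ n ∈ (Icc 1 ⌊v⌋₊).filter (fun n : ℕ => ∀ p ∈ S, ¬ p ∣ n), ψ n)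
    (∑ n ∈ Icc 1 ⌊v⌋₊, ψ n * ((∑ d ∈ I.filter (· ∣ n), omegaSign d : ℝ) : ℂ))
  linarith

/-- The integers in `[2, v]` without prime factors `≤ w`. -/
noncomputable def roughIn (w v : ℝ) : Finset ℕ :=
  (Icc 2 ⌊v⌋₊).filter fun n => ∀ p ∈ primesUpTo w, ¬ p ∣ n

/-- The number of integers in `[2, v]` without prime factors `≤ w` in a residue class. -/
noncomputable def roughCount (w : ℝ) {q : ℕ} (b : ZMod q) (v : ℝ) : ℝ :=
  ((roughIn w v).filter fun n : ℕ => (n : ZMod q) = b).card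

lemma mem_roughIn {w v : ℝ} {n : ℕ} :
    n ∈ roughIn w v ↔ 2 ≤ n ∧ n ≤ ⌊v⌋₊ ∧ ∀ p ∈ primesUpTo w, ¬ p ∣ n := by
  simp [roughIn, and_assoc]

lemma lt_of_mem_roughIn {w v : ℝ} {n : ℕ} (hn : n ∈ roughIn w v) : w < n := by
  obtain ⟨h2, -, h⟩ := mem_roughIn.1 hn
  by_contra! hc
  have hp := Nat.minFac_prime (n := n) (by omega)
  refine h _ ((mem_primesUpTo (le_trans (Nat.cast_nonneg _) hc)).2 ⟨hp, le_trans ?_ hc⟩) n.minFac_dvd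
  exact_mod_cast n.minFac_le (by omega)

lemma roughIn_eq_empty {w v : ℝ} (h : v ≤ w) : roughIn w v = ∅ := by
  by_contra hne
  obtain ⟨n, hn⟩ := nonempty_iff_ne_empty.2 hne
  have h1 := lt_of_mem_roughIn hn
  obtain ⟨h2, h3, -⟩ := mem_roughIn.1 hn
  have := (Nat.le_floor_iff' (by omega)).1 h3
  linarith

lemma roughCount_nonneg (w : ℝ) {q : ℕ} (b : ZMod q) (v : ℝ) : 0 ≤ roughCount w b v :=
  Nat.cast_nonneg _

lemma roughCount_eq_zero {w v : ℝ} {q : ℕ} (b : ZMod q) (h : v ≤ w) : roughCount w b v = 0 := by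
  simp [roughCount, roughIn_eq_empty h]

lemma totient_prod_primes {S : Finset ℕ} (hS : ∀ p ∈ S, p.Prime) :
    (Nat.totient (∏ p ∈ S, p) : ℝ) = (∏ p ∈ S, p : ℕ) * ∏ p ∈ S, (1 - 1 / (p : ℝ)) := by
  have h := Nat.totient_eq_mul_prod_factors (∏ p ∈ S, p)
  rw [Nat.primeFactors_prod hS] at h
  have h2 := congrArg (fun t : ℚ => (t : ℝ)) h
  push_cast at h2
  push_cast
  simpa [one_div] using h2

lemma eventually_prod_primesUpTo_le : ∀ᶠ w : ℝ in atTop,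
    ∏ p ∈ primesUpTo w, (1 - 1 / (p : ℝ)) ≤ 1 / log w := by
  filter_upwards [eventually_prod_one_sub_one_div_le (ε := 1 / 10) (by norm_num),
    eventually_gt_atTop 1] with w h hw
  have hl := log_pos hw
  refine h.trans (div_le_div_of_nonneg_right ?_ hl.le)
  have h1 := one_half_lt_eulerMascheroniConstant
  have h2 : exp (-eulerMascheroniConstant) ≤ 1 / (1 + 1 / 2) := by
    rw [exp_neg, ← one_div]
    exact one_div_le_one_div_of_le (by norm_num)
      (by linarith [add_one_le_exp eulerMascheroniConstant])
  linarith

lemma one_sub_one_div_mem {p : ℕ} (hp : p.Prime) : 0 ≤ 1 - 1 / (p : ℝ) ∧ 1 - 1 / (p : ℝ) ≤ 1 := by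
  have : (1 : ℝ) ≤ p := mod_cast hp.one_le
  have h2 : 1 / (p : ℝ) ≤ 1 := by rw [div_le_one (by linarith)]; exact this
  have h3 : 0 ≤ 1 / (p : ℝ) := by positivity
  constructor <;> linarith

lemma card_filter_le_roughCount_add_one {w v : ℝ} {S : Finset ℕ} (hSw : S ⊆ primesUpTo w)
    {q : ℕ} (hq : q = ∏ p ∈ S, p) {b : ZMod q} (hb : IsUnit b) :
    roughCount w b v ≤ (((Icc 1 ⌊v⌋₊).filter fun n : ℕ => (n : ZMod q) = b ∧
      ∀ p ∈ primesUpTo w \ S, ¬ p ∣ n).card : ℝ) ∧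
    (((Icc 1 ⌊v⌋₊).filter fun n : ℕ => (n : ZMod q) = b ∧
      ∀ p ∈ primesUpTo w \ S, ¬ p ∣ n).card : ℝ) ≤ roughCount w b v + 1 := by
  constructor
  · refine Nat.cast_le.2 (card_le_card fun n hn => ?_)
    obtain ⟨h1, h2⟩ := mem_filter.1 hn
    obtain ⟨h3, h4, h5⟩ := mem_roughIn.1 h1
    exact mem_filter.2 ⟨mem_Icc.2 ⟨by omega, h4⟩, h2,
      fun p hp => h5 p (mem_sdiff.1 hp).1⟩
  · rw [roughCount]
    norm_cast
    refine le_trans (card_le_card fun n hn => ?_) (card_insert_le 1 _)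
    obtain ⟨h1, h2, h3⟩ := mem_filter.1 hn
    obtain ⟨h4, h5⟩ := mem_Icc.1 h1
    rw [mem_insert, mem_filter, mem_roughIn]
    rcases eq_or_ne n 1 with h | h
    · exact Or.inl h
    refine Or.inr ⟨⟨by omega, h5, fun p hp hpn => ?_⟩, h2⟩
    by_cases hpS : p ∈ S
    · rw [← h2, ZMod.isUnit_iff_coprime] at hb
      exact ((fun p hp => prime_of_mem_primesUpTo (hSw hp)) p hpS).one_lt.ne' (Nat.dvd_one.1 (hb ▸ Nat.dvd_gcd hpn (hq ▸ dvd_prod_of_mem _ hpS)))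
    · exact h3 p (mem_sdiff.2 ⟨hp, hpS⟩) hpn

lemma not_dvd_prod_of_mem_sdiff {w : ℝ} {S : Finset ℕ} (hS : ∀ p ∈ S, p.Prime) :
    ∀ p ∈ primesUpTo w \ S, ¬ p ∣ ∏ p ∈ S, p := by
  intro p hp hd
  obtain ⟨h1, h2⟩ := mem_sdiff.1 hp
  obtain ⟨r, hr, hpr⟩ := (prime_of_mem_primesUpTo h1).prime.exists_mem_finset_dvd hd
  exact h2 (((Nat.prime_dvd_prime_iff_eq (prime_of_mem_primesUpTo h1) (hS r hr)).1 hpr) ▸ hr)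

lemma nine_div_twenty_le : (9 / 20 : ℝ) ≤ exp (-(79 / 100)) := by
  rw [exp_neg, ← inv_inv (9 / 20 : ℝ)]
  refine inv_anti₀ (exp_pos _) ?_
  refine le_of_pow_le_pow_left₀ (n := 100) (by norm_num) (by norm_num) ?_
  rw [← exp_nat_mul]
  have : ((100 : ℕ) : ℝ) * (79 / 100) = ((79 : ℕ) : ℝ) * 1 := by norm_num
  rw [this, exp_nat_mul]
  refine (pow_le_pow_left₀ (exp_pos _).le exp_one_lt_d9.le 79).trans ?_
  norm_num

set_option maxHeartbeats 800000 in
/-- Rough numbers in residue classes: the fundamental lemma. -/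
lemma exists_abs_totient_mul_roughCount_sub_le : ∃ w₁ : ℝ, 2 ≤ w₁ ∧ ∀ w : ℝ, w₁ ≤ w →
    ∀ S ⊆ primesUpTo w, ∀ q : ℕ, q = ∏ p ∈ S, p → ∀ b : ZMod q, IsUnit b → ∀ v : ℝ, q * w ^ 14 ≤ v →
      |Nat.totient q * roughCount w b v - v * ∏ p ∈ primesUpTo w, (1 - 1 / (p : ℝ))| ≤
        exp 12 * (v / log w) * exp (-(3 / 4 * (log (v / q) / log w))) := by
  obtain ⟨w₀, hw₀⟩ := exists_isSieveBase
  obtain ⟨w₂, hw₂⟩ := eventually_atTop.1 (eventually_prod_primesUpTo_le.and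
    ((eventually_log_le_mul_rpow (K := 1 / (3 * 4 ^ w₀)) (by positivity) (r := 1) one_pos).and
      ((eventually_ge_atTop (w₀ : ℝ)).and (eventually_ge_atTop (exp 15)))))
  refine ⟨max 2 w₂, le_max_left _ _, fun w hw S hSw q hq b hb v hv => ?_⟩
  obtain ⟨hV, hlw, hww, h15⟩ := hw₂ w (le_trans (le_max_right _ _) hw)
  have hw2 := le_trans (le_max_left _ _) hw
  have hw0 : 0 < w := by linarith
  have hL15 := (le_log_iff_exp_le hw0).2 h15
  have hL0 : 0 < log w := by linarith
  have hS : ∀ p ∈ S, p.Prime := fun p hp => prime_of_mem_primesUpTo (hSw hp)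
  have hq1 := hq ▸ one_le_prod_primes hS
  have : NeZero q := ⟨by omega⟩
  have hqR : (1 : ℝ) ≤ q := mod_cast hq1
  have hv0 := lt_of_lt_of_le (by positivity) hv
  set V := ∏ p ∈ primesUpTo w, (1 - 1 / (p : ℝ)) with hVdef
  set u := log (v / q) / log w with hu
  have hlu : log (v / q) = u * log w := by rw [hu]; field_simp
  have hu14 : 14 ≤ u := by
    rw [hu, le_div_iff₀ hL0, ← Nat.cast_ofNat (n := 14), ← log_pow]
    refine log_le_log (by positivity) ?_
    rw [le_div_iff₀ (by linarith)]; linarith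
  set M := ⌊95 / 100 * u⌋₊ - 12 with hM
  have hfl := Nat.lt_floor_add_one (95 / 100 * u)
  have hfl2 := Nat.floor_le (a := 95 / 100 * u) (by positivity)
  have hMr : (M : ℝ) = ⌊95 / 100 * u⌋₊ - 12 := by rw [hM, Nat.cast_sub (Nat.le_floor (by push_cast; linarith))]; norm_num
  have hmain := abs_card_filter_sieve_sub_le hw₀ hww (S := primesUpTo w \ S) (fun p hp =>
    prime_of_mem_primesUpTo (mem_sdiff.1 hp).1) (fun p hp => le_of_mem_primesUpTo (mem_sdiff.1
    hp).1) (hq ▸ not_dvd_prod_of_mem_sdiff hS) b M hv0.le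
  obtain ⟨hc1, hc2⟩ := card_filter_le_roughCount_add_one (v := v) hSw hq hb
  set R := roughCount w b v
  set N := (((Icc 1 ⌊v⌋₊).filter fun n : ℕ => (n : ZMod q) = b ∧
      ∀ p ∈ primesUpTo w \ S, ¬ p ∣ n).card : ℝ)
  have htot := totient_prod_primes hS
  rw [← hq] at htot
  set φ := (Nat.totient q : ℝ)
  have hφ0 : 0 ≤ φ := Nat.cast_nonneg _
  have hφq : φ ≤ q := Nat.cast_le.2 (Nat.totient_le q)
  have hVV : φ * (v / q * ∏ p ∈ primesUpTo w \ S, (1 - 1 / (p : ℝ))) = v * V := by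
    rw [htot, hVdef, ← prod_sdiff hSw]
    field_simp
  have hV0 : 0 ≤ V := prod_nonneg fun p hp => (one_sub_one_div_mem (prime_of_mem_primesUpTo hp)).1
  set E := exp (-(3 / 4 * u)) with hE
  have e1 : (9 / 20 : ℝ) ^ M ≤ exp 11 * E := by
    calc (9 / 20 : ℝ) ^ M ≤ (exp (-(79 / 100))) ^ M :=
          pow_le_pow_left₀ (by norm_num) nine_div_twenty_le M
      _ = exp (M * (-(79 / 100))) := by rw [exp_nat_mul]
      _ ≤ exp (11 + -(3 / 4 * u)) := exp_le_exp.2 (by rw [hMr]; linarith)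
      _ = _ := exp_add _ _
  have e2 : w ^ (M + 11) ≤ v / q * E / w := by
    have hvq : v / q = exp (u * log w) := by rw [← hlu, exp_log (by positivity)]
    calc w ^ (M + 11) = exp (((M + 11 : ℕ) : ℝ) * log w) := by rw [exp_nat_mul, exp_log hw0]
      _ ≤ exp (u * log w + -(3 / 4 * u) - log w) := by
          refine exp_le_exp.2 ?_
          push_cast
          rw [hMr]
          nlinarith
      _ = v / q * E / w := by rw [exp_sub, exp_add, ← hvq, ← ((exp_log hw0).symm)]
  have e3 : 3 * 4 ^ w₀ / w ≤ 1 / log w := by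
    rw [rpow_one] at hlw
    have h4 : 0 < 3 * 4 ^ w₀ := by positivity
    rw [div_le_div_iff₀ hw0 hL0, one_mul]
    calc 3 * 4 ^ w₀ * log w ≤ 3 * 4 ^ w₀ * (1 / (3 * 4 ^ w₀) * w) := by gcongr
      _ = w := by field_simp
  have e4 : φ * (2 * (4 ^ w₀ * w ^ (M + 11)) + 1) ≤ v / log w * E := by
    have h1 : 1 ≤ 4 ^ w₀ * w ^ (M + 11) :=
      one_le_mul_of_one_le_of_one_le (one_le_pow₀ (by norm_num)) (one_le_pow₀ (by linarith))
    calc φ * (2 * (4 ^ w₀ * w ^ (M + 11)) + 1) ≤ q * (3 * (4 ^ w₀ * (v / q * E / w))) := by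
          gcongr
          linarith [mul_le_mul_of_nonneg_left e2 (by positivity : (0 : ℝ) ≤ 4 ^ w₀)]
      _ = v * E * (3 * 4 ^ w₀ / w) := by field_simp
      _ ≤ v * E * (1 / log w) := by gcongr
      _ = _ := by ring
  have e5 : φ * ((9 / 20) ^ M * (v / q * ∏ p ∈ primesUpTo w \ S, (1 - 1 / (p : ℝ)))) ≤
      exp 11 * (v / log w * E) := by
    calc _ = (9 / 20) ^ M * (v * V) := by rw [← hVV]; ring
      _ ≤ exp 11 * E * (v * (1 / log w)) := by gcongr
      _ = _ := by ring
  have e6 : exp 11 + 1 ≤ exp 12 := by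
    have h1 : exp 12 = exp 11 * exp 1 := by rw [← exp_add]; norm_num
    have h2 := add_one_le_exp 1
    have h3 := add_one_le_exp 11
    nlinarith
  have e7 : 0 ≤ v / log w * E := by positivity
  have e8 := abs_le.1 hmain
  have e9 : φ * N - v * V ≤ φ * ((9 / 20) ^ M * (v / q * ∏ p ∈ primesUpTo w \ S, (1 - 1 / (p : ℝ))) +
      2 * (4 ^ w₀ * w ^ (M + 11))) := by
    rw [← hVV, ← mul_sub]; exact mul_le_mul_of_nonneg_left e8.2 hφ0
  have e10 : -(φ * ((9 / 20) ^ M * (v / q * ∏ p ∈ primesUpTo w \ S, (1 - 1 / (p : ℝ))) +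
      2 * (4 ^ w₀ * w ^ (M + 11)))) ≤ φ * N - v * V := by
    rw [← hVV, ← mul_sub, ← mul_neg]; exact mul_le_mul_of_nonneg_left e8.1 hφ0
  have f1 := mul_le_mul_of_nonneg_left hc1 hφ0
  have f2 := mul_le_mul_of_nonneg_left hc2 hφ0
  have f3 := mul_le_mul_of_nonneg_right e6 e7
  have f4 : exp 12 * (v / log w) * E = exp 12 * (v / log w * E) := by ring
  rw [f4, abs_le]
  constructor <;> linarith

/-- Rough numbers in residue classes: the upper bound sieve. -/
lemma exists_totient_mul_roughCount_le : ∃ w₁ : ℝ, 2 ≤ w₁ ∧ ∀ w : ℝ, w₁ ≤ w →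
    ∀ S ⊆ primesUpTo w, ∀ q : ℕ, q = ∏ p ∈ S, p → ∀ b : ZMod q, IsUnit b → ∀ v : ℝ,
      q * w ^ (1 / 5 : ℝ) ≤ v → Nat.totient q * roughCount w b v ≤ 201 * (v / log w) := by
  obtain ⟨w₀, hw₀⟩ := exists_isSieveBase
  have htr := tendsto_rpow_atTop (y := 1 / 100) (by norm_num)
  obtain ⟨w₂, hw₂⟩ := eventually_atTop.1 ((htr.eventually eventually_prod_primesUpTo_le).and
    ((eventually_log_le_mul_rpow (K := 1 / (2 * 4 ^ w₀)) (by positivity)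
      (r := 9 / 100) (by norm_num)).and (htr.eventually_ge_atTop w₀)))
  refine ⟨max 2 w₂, le_max_left _ _, fun w hw S hSw q hq b hb v hv => ?_⟩
  obtain ⟨hV, hlw, hww⟩ := hw₂ w (le_trans (le_max_right _ _) hw)
  have hw2 := le_trans (le_max_left _ _) hw
  have hw0 : 0 < w := by linarith
  have hS : ∀ p ∈ S, p.Prime := fun p hp => prime_of_mem_primesUpTo (hSw hp)
  have hq1 := hq ▸ one_le_prod_primes hS
  have : NeZero q := ⟨by omega⟩
  have hv0 := lt_of_lt_of_le (by positivity) hv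
  set y := w ^ (1 / 100 : ℝ) with hy
  have hyw : y ≤ w := by
    calc y ≤ w ^ 1 := rpow_le_rpow_of_exponent_le (by linarith) (by norm_num)
      _ = w := rpow_one w
  have hlogy : log y = log w / 100 := by rw [hy, log_rpow hw0]; ring
  have hmain := abs_card_filter_sieve_sub_le hw₀ hww (S := primesUpTo y \ S) (fun p hp =>
    prime_of_mem_primesUpTo (mem_sdiff.1 hp).1) (fun p hp => le_of_mem_primesUpTo (mem_sdiff.1
    hp).1) (hq ▸ not_dvd_prod_of_mem_sdiff hS) b 0 hv0.le
  have hc : roughCount w b v ≤ (((Icc 1 ⌊v⌋₊).filter fun n : ℕ => (n : ZMod q) = b ∧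
      ∀ p ∈ primesUpTo y \ S, ¬ p ∣ n).card : ℝ) := by
    refine Nat.cast_le.2 (card_le_card fun n hn => ?_)
    obtain ⟨h1, h2⟩ := mem_filter.1 hn
    obtain ⟨h3, h4, h5⟩ := mem_roughIn.1 h1
    refine mem_filter.2 ⟨mem_Icc.2 ⟨by omega, h4⟩, h2, fun p hp => h5 p ?_⟩
    have hp1 := (mem_sdiff.1 hp).1
    exact (mem_primesUpTo hw0.le).2 ⟨prime_of_mem_primesUpTo hp1, (le_of_mem_primesUpTo hp1).trans hyw⟩
  have htot := totient_prod_primes hS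
  rw [← hq] at htot
  set φ := (Nat.totient q : ℝ)
  have hφ0 : 0 ≤ φ := Nat.cast_nonneg _
  have hφq : φ ≤ q := Nat.cast_le.2 (Nat.totient_le q)
  have hVV : φ * (v / q * ∏ p ∈ primesUpTo y \ S, (1 - 1 / (p : ℝ))) ≤ v * (100 / log w) := by
    calc _ = v * ((∏ p ∈ S, (1 - 1 / (p : ℝ))) * ∏ p ∈ primesUpTo y \ S, (1 - 1 / (p : ℝ))) := by
          rw [htot]; field_simp
      _ = v * ∏ p ∈ S ∪ (primesUpTo y \ S), (1 - 1 / (p : ℝ)) := by rw [prod_union disjoint_sdiff]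
      _ ≤ v * ∏ p ∈ primesUpTo y, (1 - 1 / (p : ℝ)) := by
          refine mul_le_mul_of_nonneg_left ?_ hv0.le
          rw [union_sdiff_self_eq_union, union_comm, ← union_sdiff_self_eq_union,
            prod_union disjoint_sdiff]
          refine mul_le_of_le_one_right (prod_nonneg fun p hp =>
            (one_sub_one_div_mem (prime_of_mem_primesUpTo hp)).1) (prod_le_one
            (fun p hp => (one_sub_one_div_mem (hS p (mem_sdiff.1 hp).1)).1)
            fun p hp => (one_sub_one_div_mem (hS p (mem_sdiff.1 hp).1)).2)
      _ ≤ v * (1 / log y) := by gcongr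
      _ = _ := by rw [hlogy]; field_simp
  have e4 : φ * (2 * (4 ^ w₀ * y ^ (0 + 11))) ≤ v / log w := by
    have hy11 : y ^ (0 + 11) = w ^ (1 / 5 : ℝ) * w ^ (-(9 / 100) : ℝ) := by
      rw [hy, ← rpow_natCast, ← rpow_mul hw0.le, ← rpow_add hw0]
      norm_num
    have h9 : w ^ (-(9 / 100) : ℝ) * (2 * 4 ^ w₀) ≤ 1 / log w := by
      rw [le_div_iff₀ (log_pos (by linarith)), rpow_neg hw0.le]
      have h4 : 0 < 2 * 4 ^ w₀ := by positivity
      have hw9 : 0 < w ^ (9 / 100 : ℝ) := by positivity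
      calc _ ≤ (w ^ (9 / 100 : ℝ))⁻¹ * (2 * 4 ^ w₀) * (1 / (2 * 4 ^ w₀) * w ^ (9 / 100 : ℝ)) := by
            gcongr
        _ = 1 := by field_simp
    calc φ * (2 * (4 ^ w₀ * y ^ (0 + 11))) ≤ q * (2 * (4 ^ w₀ * y ^ (0 + 11))) := by gcongr
      _ = q * w ^ (1 / 5 : ℝ) * (w ^ (-(9 / 100) : ℝ) * (2 * 4 ^ w₀)) := by rw [hy11]; ring
      _ ≤ v * (1 / log w) := by gcongr
      _ = _ := by ring
  have e8 := (abs_le.1 hmain).2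
  rw [pow_zero, one_mul] at e8
  have f1 := mul_le_mul_of_nonneg_left hc hφ0
  have f2 := mul_le_mul_of_nonneg_left e8 hφ0
  have f3 : v * (100 / log w) = 100 * (v / log w) := by ring
  linarith

lemma roughCount_one_eq (w v : ℝ) : roughCount w (0 : ZMod 1) v = (roughIn w v).card := by
  rw [roughCount, filter_true_of_mem fun n _ => Subsingleton.elim _ _]

lemma exists_card_roughIn_le : ∃ w₁ : ℝ, 2 ≤ w₁ ∧ ∀ w : ℝ, w₁ ≤ w → ∀ v : ℝ, 0 ≤ v →
    ((roughIn w v).card : ℝ) ≤ 201 * (v / log w) := by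
  obtain ⟨w₁, hw₁, h⟩ := exists_totient_mul_roughCount_le
  refine ⟨w₁, hw₁, fun w hw v hv => ?_⟩
  have hL0 : 0 < log w := log_pos (by linarith)
  rcases le_or_gt v w with hvw | hvw
  · rw [roughIn_eq_empty hvw]; simp; positivity
  have := h w hw ∅ (empty_subset _) 1 (by simp) 0 (isUnit_of_subsingleton _) v (by
    rw [Nat.cast_one, one_mul]
    calc w ^ (1 / 5 : ℝ) ≤ w ^ 1 := rpow_le_rpow_of_exponent_le (by linarith) (by norm_num)
      _ = w := rpow_one w
      _ ≤ v := hvw.le)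
  rwa [Nat.totient_one, Nat.cast_one, one_mul, roughCount_one_eq] at this

lemma two_hundred_two_le_exp_six : 202 ≤ exp 6 := by
  have h := exp_one_gt_d9
  calc 202 ≤ 2.7 ^ 6 := by norm_num
    _ ≤ (exp 1) ^ 6 := pow_le_pow_left₀ (by norm_num) (by linarith) 6
    _ = exp 6 := by rw [← exp_nat_mul]; norm_num

lemma trivial_rough_bound {w v : ℝ} (hw : 1 < w) (hv1 : 1 ≤ v) (hv : v ≤ w ^ 14) :
    202 * (v / log w) ≤ exp 13 * (v / log w) * exp (-(1 / 2 * (log v / log w))) := by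
  have hL0 := log_pos hw
  have h1 : log v / log w ≤ 14 := by
    rw [div_le_iff₀ hL0]
    have := log_le_log (by linarith) hv
    rwa [log_pow] at this
  have h2 : exp (-7) ≤ exp (-(1 / 2 * (log v / log w))) := exp_le_exp.2 (by linarith)
  have h3 : exp 13 = exp 6 * exp 7 := by rw [← exp_add]; norm_num
  have h4 : exp 7 * exp (-7) = 1 := by rw [← exp_add]; norm_num
  calc 202 * (v / log w) ≤ exp 6 * (v / log w) := by gcongr; exact two_hundred_two_le_exp_six
    _ = exp 6 * (v / log w) * (exp 7 * exp (-7)) := by rw [h4, mul_one]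
    _ ≤ exp 6 * (v / log w) * (exp 7 * exp (-(1 / 2 * (log v / log w)))) := by gcongr
    _ = _ := by rw [h3]; ring

lemma exists_abs_card_roughIn_sub_le : ∃ w₁ : ℝ, 2 ≤ w₁ ∧ ∀ w : ℝ, w₁ ≤ w → ∀ v : ℝ, 1 ≤ v →
    |((roughIn w v).card : ℝ) - v * ∏ p ∈ primesUpTo w, (1 - 1 / (p : ℝ))| ≤
      exp 13 * (v / log w) * exp (-(1 / 2 * (log v / log w))) := by
  obtain ⟨w₁, hw₁, h⟩ := exists_card_roughIn_le
  obtain ⟨w₂, hw₂, h'⟩ := exists_abs_totient_mul_roughCount_sub_le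
  obtain ⟨w₃, hw₃⟩ := eventually_atTop.1 eventually_prod_primesUpTo_le
  refine ⟨max w₁ (max w₂ w₃), le_max_of_le_left hw₁, fun w hw v hv => ?_⟩
  obtain ⟨g1, g2⟩ := max_le_iff.1 hw
  obtain ⟨g3, g4⟩ := max_le_iff.1 g2
  have hL0 : 0 < log w := log_pos (by linarith)
  rcases le_or_gt v (w ^ 14) with hvw | hvw
  · refine le_trans ?_ (trivial_rough_bound (by linarith) hv hvw)
    have e1 := h w g1 v (by linarith)
    have e2 := mul_le_mul_of_nonneg_left (hw₃ w g4) (by linarith : 0 ≤ v)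
    have e3 : 0 ≤ v * ∏ p ∈ primesUpTo w, (1 - 1 / (p : ℝ)) := mul_nonneg (by linarith)
      (prod_nonneg fun p hp => (one_sub_one_div_mem (prime_of_mem_primesUpTo hp)).1)
    have e5 : v * (1 / log w) = v / log w := by ring
    rw [abs_le]
    constructor <;> linarith
  · have := h' w g3 ∅ (empty_subset _) 1 (by simp) 0 (isUnit_of_subsingleton _) v (by
      rw [Nat.cast_one, one_mul]; exact hvw.le)
    rw [Nat.totient_one, Nat.cast_one, one_mul, roughCount_one_eq, div_one] at this
    refine this.trans ?_
    have e0 := div_nonneg (log_nonneg hv) hL0.le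
    have : 0 ≤ v / log w := by positivity
    refine mul_le_mul (mul_le_mul_of_nonneg_right (exp_le_exp.2 (by norm_num)) this)
      (exp_le_exp.2 (by linarith)) (exp_pos _).le (by positivity)

lemma coprime_of_mem_roughIn {w v : ℝ} {S : Finset ℕ} (hSw : S ⊆ primesUpTo w) {n : ℕ}
    (hn : n ∈ roughIn w v) : Nat.Coprime n (∏ p ∈ S, p) :=
  Nat.Coprime.prod_right fun p hp => ((Nat.Prime.coprime_iff_not_dvd
    (prime_of_mem_primesUpTo (hSw hp))).2 ((mem_roughIn.1 hn).2.2 p (hSw hp))).symm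

lemma primesUpTo_subset {x w : ℝ} (hxw : x ≤ w) : primesUpTo x ⊆ primesUpTo w := by
  refine filter_subset_filter _ (Finset.range_subset_range.2 ?_)
  have := Nat.floor_mono hxw
  omega

/-- Character sums over rough numbers by equidistribution in residue classes. -/
lemma norm_sum_roughIn_le_of_forall {w v B : ℝ} {S : Finset ℕ} (hSw : S ⊆ primesUpTo w) {q : ℕ}
    (hq : q = ∏ p ∈ S, p) (V : ℝ) {χ : DirichletCharacter ℂ q} (hχ : χ ≠ 1) (h : ∀ b : ZMod q,
    IsUnit b → |Nat.totient q * roughCount w b v - V| ≤ B) : ‖∑ n ∈ roughIn w v, χ n‖ ≤ B := by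
  have hq0 : 0 < q := hq ▸ one_le_prod_primes fun p hp => prime_of_mem_primesUpTo (hSw hp)
  have : NeZero q := ⟨hq0.ne'⟩
  have h1 : ∑ n ∈ roughIn w v, χ n = ∑ b : (ZMod q)ˣ, χ (b : ZMod q) * (roughCount w (b : ZMod q) v : ℂ) := by
    have h2 : ∑ n ∈ roughIn w v, χ n = ∑ b : ZMod q, χ b * (roughCount w b v : ℂ) := by
      rw [← sum_fiberwise (roughIn w v) (fun n : ℕ => (n : ZMod q))]
      refine sum_congr rfl fun b _ => ?_
      rw [sum_congr rfl fun n hn => by rw [(mem_filter.1 hn).2], sum_const,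
        nsmul_eq_mul, mul_comm, roughCount]
      push_cast
      rfl
    rw [h2]
    symm
    refine sum_of_injOn (fun b : (ZMod q)ˣ => (b : ZMod q)) (fun a _ b _ h => Units.ext h)
      (fun _ _ => mem_coe.2 (mem_univ _)) (fun b _ hb => ?_) (fun _ _ => rfl)
    rw [χ.map_nonunit, zero_mul]
    rintro ⟨u, hu⟩
    exact hb ⟨u, by simp, hu⟩
  have h0 : ∑ b : (ZMod q)ˣ, χ (b : ZMod q) = 0 := by
    have h3 := MulChar.sum_eq_zero_of_ne_one hχ
    rw [← h3]
    refine sum_of_injOn (fun b : (ZMod q)ˣ => (b : ZMod q)) (fun a _ b _ h => Units.ext h)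
      (fun _ _ => mem_coe.2 (mem_univ _)) (fun b _ hb => ?_) (fun _ _ => rfl)
    refine χ.map_nonunit ?_
    rintro ⟨u, hu⟩
    exact hb ⟨u, by simp, hu⟩
  have h4 : (Nat.totient q : ℂ) * ∑ n ∈ roughIn w v, χ n =
      ∑ b : (ZMod q)ˣ, χ (b : ZMod q) * ((Nat.totient q * roughCount w (b : ZMod q) v - V : ℝ) : ℂ) := by
    have : ∑ b : (ZMod q)ˣ, χ (b : ZMod q) * V = 0 := by rw [← sum_mul, h0, zero_mul]
    rw [h1, mul_sum, ← sub_zero (∑ b : (ZMod q)ˣ, _), ← this, ← sum_sub_distrib]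
    refine sum_congr rfl fun b _ => ?_
    push_cast; ring
  have h5 : Nat.totient q * ‖∑ n ∈ roughIn w v, χ n‖ ≤ Nat.totient q * B := by
    calc Nat.totient q * ‖∑ n ∈ roughIn w v, χ n‖ = ‖(Nat.totient q : ℂ) * ∑ n ∈ roughIn w v, χ n‖ := by
          rw [norm_mul, Complex.norm_natCast]
      _ ≤ ∑ b : (ZMod q)ˣ, B := by
          rw [h4]
          refine (norm_sum_le _ _).trans (sum_le_sum fun b _ => ?_)
          rw [norm_mul, norm_real, norm_eq_abs]
          exact (mul_le_of_le_one_left (abs_nonneg _) (norm_le_one _ _)).trans (h b b.isUnit)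
      _ = _ := by rw [sum_const, card_univ, ZMod.card_units_eq_totient, nsmul_eq_mul]
  exact le_of_mul_le_mul_left h5 (mod_cast Nat.totient_pos.2 hq0)

lemma sum_roughIn_eq_sum_familyProd {x w v : ℝ} (hxw : x ≤ w) (hv : 1 ≤ v) {N : ℕ}
    (hN : N = ∏ p ∈ primesUpTo x, p) {χ : DirichletCharacter ℂ N} (hχ : χ ≠ 1) :
    ∃ X : (p : ℕ) → DirichletCharacter ℂ p, ∃ S ⊆ primesUpTo x, S.Nonempty ∧ (∀ p ∈ S, X p ≠ 1) ∧
      ∑ n ∈ (Icc 1 ⌊v⌋₊).filter (fun n : ℕ => ∀ p ∈ primesUpTo w, ¬ p ∣ n),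
        familyProd X S (n : ℤ) = 1 + ∑ n ∈ roughIn w v, χ n := by
  classical
  subst hN
  have hS : ∀ p ∈ primesUpTo x, p.Prime := fun p hp => prime_of_mem_primesUpTo hp
  set X := charFamily hS χ with hX
  set S := (primesUpTo x).filter fun p => X p ≠ 1 with hSdef
  have hval : ∀ n : ℕ, (∀ p ∈ primesUpTo x, ¬ p ∣ n) → χ (n : ZMod (∏ p ∈ primesUpTo x, p)) =
      familyProd X S (n : ℤ) := by
    intro n hn
    have h1 := char_eq_prod_charFamily hS χ (n : ℤ)
    rw [Int.cast_natCast] at h1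
    rw [h1, familyProd, hSdef, prod_filter]
    refine prod_congr rfl fun p hp => ?_
    split_ifs with h
    · rfl
    · push Not at h
      rw [← hX, h]
      refine MulChar.one_apply ?_
      rw [Int.cast_natCast, ZMod.isUnit_iff_coprime]
      exact ((hS p hp).coprime_iff_not_dvd.2 (hn p hp)).symm
  refine ⟨X, S, filter_subset _ _, ?_, fun p hp => (mem_filter.1 hp).2, ?_⟩
  · by_contra hne
    rw [not_nonempty_iff_eq_empty] at hne
    refine hχ (MulChar.ext fun u => ?_)
    rw [MulChar.one_apply u.isUnit]
    have : NeZero (∏ p ∈ primesUpTo x, p) := ⟨Nat.one_le_iff_ne_zero.1 (one_le_prod_primes hS)⟩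
    obtain ⟨n, hn⟩ := ZMod.natCast_zmod_surjective (u : ZMod (∏ p ∈ primesUpTo x, p))
    have hu := hn ▸ u.isUnit
    rw [← hn, hval n, hne, familyProd, prod_empty]
    intro p hp hpn
    rw [ZMod.isUnit_iff_coprime] at hu
    exact (hS p hp).one_lt.ne' (Nat.dvd_one.1 (hu ▸ Nat.dvd_gcd hpn (dvd_prod_of_mem _ hp)))
  · have h1 : 1 ≤ ⌊v⌋₊ := Nat.le_floor (by simpa using hv)
    have h2 : (Icc 1 ⌊v⌋₊).filter (fun n : ℕ => ∀ p ∈ primesUpTo w, ¬ p ∣ n) =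
        insert 1 (roughIn w v) := by
      ext n
      rw [mem_insert, mem_roughIn, mem_filter, mem_Icc]
      constructor
      · rintro ⟨⟨a, b⟩, c⟩
        rcases eq_or_ne n 1 with h | h
        · exact Or.inl h
        · exact Or.inr ⟨by omega, b, c⟩
      · rintro (h | ⟨a, b, c⟩)
        · subst h
          exact ⟨⟨le_rfl, h1⟩, fun p hp hd => (prime_of_mem_primesUpTo hp).one_lt.ne' (Nat.dvd_one.1 hd)⟩
        · exact ⟨⟨by omega, b⟩, c⟩
    rw [h2, sum_insert (by simp [mem_roughIn])]
    congr 1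
    · simp [familyProd]
    · exact sum_congr rfl fun n hn =>
        (hval n fun p hp => (mem_roughIn.1 hn).2.2 p (primesUpTo_subset hxw hp)).symm

lemma eventually_two_mul_log_le {c : ℝ} (hc : 0 < c) : ∀ᶠ z : ℝ in atTop, c * log z ≤ z := by
  filter_upwards [eventually_log_le_mul_rpow (K := 1 / c) (by positivity) (r := 1) one_pos] with z hz
  rw [rpow_one] at hz
  calc c * log z ≤ c * (1 / c * z) := by gcongr
    _ = z := by field_simp

set_option maxHeartbeats 800000 in
/-- Character sums over rough numbers. -/
lemma eventually_norm_sum_roughIn_le {δ : ℝ} (hδ : 0 < δ) (hδ' : δ ≤ 1 / 14) :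
    ∀ᶠ x : ℝ in atTop, ∀ N : ℕ, N = ∏ p ∈ primesUpTo x, p → ∀ χ : DirichletCharacter ℂ N,
      χ ≠ 1 → ∀ z : ℝ, z = exp (δ * Chebyshev.theta x) → ∀ v : ℝ, 1 ≤ v →
        ‖∑ n ∈ roughIn z v, χ n‖ ≤ exp 13 * (v / log z) * exp (-(1 / 2 * (log v / log z))) := by
  obtain ⟨w₁, hw₁, hA⟩ := exists_card_roughIn_le
  obtain ⟨w₂, hw₂, hB⟩ := exists_abs_totient_mul_roughCount_sub_le
  obtain ⟨w₃, hw₃⟩ := eventually_atTop.1 eventually_prod_primesUpTo_le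
  obtain ⟨w₀, hw₀⟩ := exists_isSieveBase
  obtain ⟨w₄, hw₄⟩ := eventually_atTop.1 (eventually_two_mul_log_le
    (c := 4 * 4 ^ w₀ * exp (1 / 2 * (3 / δ))) (by positivity))
  have hθ : Filter.Tendsto (fun x : ℝ => exp (δ * Chebyshev.theta x)) atTop atTop := by
    refine tendsto_exp_atTop.comp (Filter.Tendsto.const_mul_atTop hδ ?_)
    refine tendsto_atTop_mono' _ eventually_half_le_theta ?_
    exact tendsto_id.atTop_div_const (by norm_num)
  have hzx : ∀ᶠ x : ℝ in atTop, x ≤ exp (δ * Chebyshev.theta x) := by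
    filter_upwards [eventually_two_mul_log_le (c := 2 / δ) (by positivity), eventually_half_le_theta,
      eventually_gt_atTop 0] with x h1 h2 h0
    rw [← log_le_iff_le_exp h0]
    calc log x = δ / 2 * (2 / δ * log x) := by field_simp
      _ ≤ δ / 2 * x := by gcongr
      _ = δ * (x / 2) := by ring
      _ ≤ _ := by gcongr
  filter_upwards [norm_sum_familyProd_le hδ 4, hzx, eventually_ge_atTop 1,
    hθ.eventually_ge_atTop w₁, hθ.eventually_ge_atTop w₂, hθ.eventually_ge_atTop w₃,
    hθ.eventually_ge_atTop w₄, hθ.eventually_ge_atTop (4 ^ w₀), hθ.eventually_ge_atTop w₀,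
    eventually_ge_atTop (exp (1 / 2 * (3 / δ)) * 14)]
    with x hS5 hzx hx1 h1 h2 h3 h4 h5 h6 h7 N hN χ hχ z hz v hv
  rw [← hz] at hzx h1 h2 h3 h4 h5 h6
  have hz0 : 0 < z := by linarith
  have hL : log z = δ * Chebyshev.theta x := by rw [hz, log_exp]
  have hL0 : 0 < log z := log_pos (by linarith)
  have hsub := primesUpTo_subset hzx
  have hN0 : (0 : ℝ) < N := mod_cast (hN ▸ one_le_prod_primes fun p hp => prime_of_mem_primesUpTo hp)
  have hlogN : log N = Chebyshev.theta x := by rw [hN, theta_eq_log_prod_primesUpTo]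
  have htriv : ‖∑ n ∈ roughIn z v, χ n‖ ≤ (roughIn z v).card := by
    refine (norm_sum_le _ _).trans ?_
    rw [card_eq_sum_ones]
    push_cast
    exact sum_le_sum fun n _ => norm_le_one _ _
  have hv0 : 0 < v := by linarith
  have hvL : 0 < v / log z := by positivity
  rcases le_or_gt v (z ^ 14) with hvz | hvz
  · have e1 := hA z h1 v (by linarith)
    refine htriv.trans (le_trans ?_ (trivial_rough_bound (by linarith) hv hvz))
    linarith
  have hu14 : 14 ≤ log v / log z := by
    rw [le_div_iff₀ hL0, ← Nat.cast_ofNat (n := 14), ← log_pow]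
    gcongr
  rcases le_or_gt ((N : ℝ) ^ 3) v with hvN | hvN
  · refine le_trans (norm_sum_roughIn_le_of_forall hsub hN _ hχ fun b hb =>
      hB z h2 _ hsub N hN b hb v ?_) ?_
    · have h8 : z ^ 14 ≤ N ^ 2 := by
        rw [← exp_log (pow_pos hz0 14), ← exp_log (pow_pos hN0 2)]
        refine exp_le_exp.2 ?_
        rw [log_pow, log_pow, hlogN, hL]
        push_cast
        nlinarith
      calc (N : ℝ) * z ^ 14 ≤ N * N ^ 2 := by gcongr
        _ = (N : ℝ) ^ 3 := by ring
        _ ≤ v := hvN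
    · have h9 : 3 * log N ≤ log v := by
        have := log_le_log (by positivity) hvN
        rwa [log_pow, Nat.cast_ofNat] at this
      have h10 := log_div hv0.ne' hN0.ne'
      refine mul_le_mul (mul_le_mul_of_nonneg_right (exp_le_exp.2 (by norm_num)) hvL.le)
        (exp_le_exp.2 ?_) (exp_pos _).le (by positivity)
      rw [h10, neg_le_neg_iff, ← mul_div_assoc, ← mul_div_assoc]
      exact div_le_div_of_nonneg_right (by linarith) hL0.le
  · obtain ⟨X, S, hSx, hSne, hX, hsum⟩ := sum_roughIn_eq_sum_familyProd hzx hv hN hχ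
    set u := log v / log z with hu
    have hlv : log v = u * log z := by rw [hu]; field_simp
    have hu3 : u ≤ 3 / δ := by
      rw [hu, div_le_div_iff₀ hL0 hδ, hL]
      have := (log_lt_log hv0 hvN).le
      rw [log_pow, hlogN] at this
      push_cast at this
      nlinarith
    have hE : exp (-(1 / 2 * (3 / δ))) ≤ exp (-(1 / 2 * u)) := (by gcongr)
    set M := ⌊u⌋₊ - 13 with hM
    have hfl := Nat.lt_floor_add_one u
    have hfl2 := Nat.floor_le (a := u) (by linarith)
    have hMr : (M : ℝ) = ⌊u⌋₊ - 13 := by rw [hM, Nat.cast_sub (Nat.le_floor (by push_cast; linarith))]; norm_num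
    set D := 4 ^ w₀ * z ^ (M + 11) with hD
    have hD0 : 0 < D := by positivity
    have hDz : D * z ≤ v := by
      calc D * z = 4 ^ w₀ * z ^ (M + 12) := by rw [hD]; ring
        _ ≤ z * z ^ (M + 12) := by gcongr
        _ = z ^ (M + 13) := by ring
        _ = exp (((M + 13 : ℕ) : ℝ) * log z) := by rw [exp_nat_mul, exp_log hz0]
        _ ≤ exp (u * log z) := by
            refine exp_le_exp.2 ?_
            push_cast
            rw [hMr]
            gcongr
            linarith
        _ = v := by rw [← hlv, exp_log hv0]
    have hmain := norm_sum_filter_sieve_le hw₀ h6 (S := primesUpTo z)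
      (fun p hp => prime_of_mem_primesUpTo hp) (fun p hp => le_of_mem_primesUpTo hp)
      (ψ := fun n => familyProd X S (n : ℤ)) (fun n => norm_familyProd_le_one X S _)
      (fun m n => by
        simp only [familyProd]
        rw [← prod_mul_distrib]
        refine prod_congr rfl fun p _ => ?_
        rw [← map_mul]; push_cast; rfl) M hv (le_trans (le_mul_of_one_le_right hD0.le (by linarith)) hDz) (β := 1 / x ^ 4) (by positivity)
      (fun t ht => by
        have : rexp (δ * Chebyshev.theta x) ≤ t := by
          rw [← hz]
          refine le_trans ?_ ht
          rw [le_div_iff₀ hD0]; linarith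
        refine (hS5 X S hSx hSne hX t this).trans (le_of_eq (by ring)))
    rw [hsum] at hmain
    have hle : ‖∑ n ∈ roughIn z v, χ n‖ ≤ ‖1 + ∑ n ∈ roughIn z v, χ n‖ + 1 := by
      have := norm_sub_le (1 + ∑ n ∈ roughIn z v, χ n) 1
      rwa [add_sub_cancel_left, norm_one] at this
    set E := exp (-(1 / 2 * u)) with hEdef
    have hee : exp (1 / 2 * (3 / δ)) * exp (-(1 / 2 * (3 / δ))) = 1 := by rw [← exp_add]; simp
    have hEe :=
      hee.symm.le.trans (mul_le_mul_of_nonneg_left hE (exp_pos _).le)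
    have t1 : 1 / x ^ 4 * v * (1 + log v) ≤ v / log z * E := by
      have hth : Chebyshev.theta x ≤ 2 * x := by
        refine (Chebyshev.theta_le_log4_mul_x (by linarith)).trans ?_
        have h4 : log 4 ≤ 2 := by
          have : log 4 = 2 * log 2 := by
            rw [show (4 : ℝ) = 2 ^ 2 by norm_num, log_pow]; norm_num
          linarith [log_two_lt_d9]
        gcongr
      have hlv6 : 1 + log v ≤ 7 * x := by
        have := (log_lt_log hv0 hvN).le
        rw [log_pow, hlogN] at this
        push_cast at this
        linarith
      have hLx : log z ≤ 2 * x := by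
        rw [hL]; nlinarith
      have hlv0 := log_nonneg hv
      have hkey : (1 + log v) * log z ≤ x ^ 4 * E := by
        calc (1 + log v) * log z ≤ 7 * x * (2 * x) := by gcongr
          _ = x ^ 2 * 14 * 1 := by ring
          _ ≤ x ^ 2 * 14 * (exp (1 / 2 * (3 / δ)) * E) := by gcongr
          _ = x ^ 2 * (exp (1 / 2 * (3 / δ)) * 14) * E := by ring
          _ ≤ x ^ 2 * x * E := by gcongr
          _ ≤ x ^ 2 * x * E * x := le_mul_of_one_le_right (by positivity) hx1
          _ = x ^ 4 * E := by ring
      rw [div_mul_eq_mul_div, one_mul, div_mul_eq_mul_div, div_mul_eq_mul_div,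
        div_le_div_iff₀ (by positivity) hL0]
      calc v * (1 + log v) * log z = v * ((1 + log v) * log z) := by ring
        _ ≤ v * (x ^ 4 * E) := by gcongr
        _ = _ := by ring
    have t2 : 2 * (9 / 20) ^ M * (v * ∏ p ∈ primesUpTo z, (1 - 1 / (p : ℝ))) ≤
        2 * exp 12 * (v / log z * E) := by
      have e1 : (9 / 20 : ℝ) ^ M ≤ exp 12 * E := by
        calc (9 / 20 : ℝ) ^ M ≤ (exp (-(79 / 100))) ^ M :=
              pow_le_pow_left₀ (by norm_num) nine_div_twenty_le M
          _ = exp (M * (-(79 / 100))) := by rw [exp_nat_mul]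
          _ ≤ exp (12 + -(1 / 2 * u)) := exp_le_exp.2 (by rw [hMr]; linarith)
          _ = _ := exp_add _ _
      have hV0 : 0 ≤ ∏ p ∈ primesUpTo z, (1 - 1 / (p : ℝ)) := prod_nonneg fun p hp =>
        (one_sub_one_div_mem (prime_of_mem_primesUpTo hp)).1
      calc _ ≤ 2 * (exp 12 * E) * (v * (1 / log z)) := by gcongr; exact hw₃ z h3
        _ = _ := by ring
    have t3 : 4 * D ≤ v / log z * E := by
      have h8 := hw₄ z h4
      have h9 : (1 : ℝ) ≤ 4 ^ w₀ := one_le_pow₀ (by norm_num)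
      have h10 : 4 * log z ≤ z * E := by
        calc 4 * log z = 4 * 1 * log z * 1 := by ring
          _ ≤ 4 * 4 ^ w₀ * log z * (exp (1 / 2 * (3 / δ)) * E) := by gcongr
          _ = 4 * 4 ^ w₀ * exp (1 / 2 * (3 / δ)) * log z * E := by ring
          _ ≤ z * E := by gcongr
      rw [div_mul_eq_mul_div, le_div_iff₀ hL0]
      calc 4 * D * log z = D * (4 * log z) := by ring
        _ ≤ D * (z * E) := by gcongr
        _ = D * z * E := by ring
        _ ≤ v * E := by gcongr
    have t4 : 1 ≤ D := by
      refine one_le_mul_of_one_le_of_one_le (one_le_pow₀ (by norm_num)) (one_le_pow₀ (by linarith))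
    have e6 : 2 * exp 12 + 3 ≤ exp 13 := by
      have h1 : exp 13 = exp 12 * exp 1 := by rw [← exp_add]; norm_num
      have h2 := exp_one_gt_d9
      have h3 := add_one_le_exp 12
      nlinarith
    have e7 : 0 ≤ v / log z * E := by positivity
    have e8 := mul_le_mul_of_nonneg_right e6 e7
    have e9 : exp 13 * (v / log z) * E = exp 13 * (v / log z * E) := by ring
    rw [e9]
    linarith

open MeasureTheory Set in
/-- The error in the approximation of the summatory function of `f` by `1 + V * t`. -/
noncomputable def summatoryError (f : ℕ → ℂ) (V : ℝ) (t : ℝ) : ℂ :=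
  ∑ k ∈ Icc 1 ⌊t⌋₊, f k - 1 - V * t

lemma measurable_summatoryError (f : ℕ → ℂ) (V : ℝ) : Measurable (summatoryError f V) := by
  have h : Measurable fun n : ℕ => ∑ k ∈ Icc 1 n, f k := measurable_from_top
  exact ((h.comp Nat.measurable_floor).sub measurable_const).sub
    (measurable_const.mul Complex.measurable_ofReal)

lemma norm_cpow_neg_add_one_le {t : ℝ} (ht : 1 ≤ t) {s : ℂ} (hs : 1 ≤ s.re) :
    ‖(t : ℂ) ^ (-(s + 1))‖ ≤ t ^ (-2 : ℝ) := by
  rw [Complex.norm_cpow_eq_rpow_re_of_pos (by linarith)]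
  refine rpow_le_rpow_of_exponent_le ht ?_
  simp; linarith

lemma norm_summatoryError_mul_le {f : ℕ → ℂ} {V B l : ℝ}
    (H : ∀ t : ℝ, 1 ≤ t → ‖summatoryError f V t‖ ≤ B * t ^ (1 - l)) {s : ℂ} (hs : 1 ≤ s.re)
    {t : ℝ} (ht : 1 ≤ t) : ‖summatoryError f V t * (t : ℂ) ^ (-(s + 1))‖ ≤ B * t ^ (-1 - l) := by
  have h1 := H t ht
  rw [norm_mul]
  calc _ ≤ B * t ^ (1 - l) * t ^ (-2 : ℝ) :=
        mul_le_mul h1 (norm_cpow_neg_add_one_le ht hs) (norm_nonneg _) ((norm_nonneg _).trans h1)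
    _ = B * t ^ (-1 - l) := by rw [mul_assoc, ← rpow_add (by linarith)]; ring_nf

lemma measurable_cpow_const' (c : ℂ) : Measurable fun t : ℝ => (t : ℂ) ^ c := by
  fun_prop

lemma integrableOn_summatoryError_mul {f : ℕ → ℂ} {V B l : ℝ} (hl : 0 < l) (H : ∀ t : ℝ, 1 ≤ t →
    ‖summatoryError f V t‖ ≤ B * t ^ (1 - l)) {s : ℂ} (hs : 1 ≤ s.re) : IntegrableOn
    (fun t : ℝ => summatoryError f V t * (t : ℂ) ^ (-(s + 1))) (Set.Ioi 1) := by
  have hi : IntegrableOn (fun t : ℝ => B * t ^ (-1 - l)) (Set.Ioi 1) :=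
    (integrableOn_Ioi_rpow_of_lt (by linarith) one_pos).const_mul B
  refine hi.mono' ((measurable_summatoryError f V).mul
    (measurable_cpow_const' _)).aestronglyMeasurable ?_
  refine (ae_restrict_iff' measurableSet_Ioi).2 (Filter.Eventually.of_forall fun t ht => ?_)
  exact norm_summatoryError_mul_le H hs (Set.mem_Ioi.1 ht).le

lemma lSeries_eq_add_mul_integral {f : ℕ → ℂ} (hf : ∀ n, ‖f n‖ ≤ 1) {V B l : ℝ} (hl : 0 < l)
    (H : ∀ t : ℝ, 1 ≤ t → ‖summatoryError f V t‖ ≤ B * t ^ (1 - l)) {s : ℂ} (hs : 1 < s.re) :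
    LSeries f s = 1 + V * (s / (s - 1)) +
      s * ∫ t in Set.Ioi (1 : ℝ), summatoryError f V t * (t : ℂ) ^ (-(s + 1)) := by
  have hO : (fun n : ℕ => ∑ k ∈ Icc 1 n, ‖f k‖) =O[atTop] fun n => (n : ℝ) ^ (1 : ℝ) := by
    refine Asymptotics.isBigO_of_le _ fun n => ?_
    rw [rpow_one, norm_of_nonneg (sum_nonneg fun _ _ => norm_nonneg _),
      norm_of_nonneg (Nat.cast_nonneg _)]
    refine (sum_le_sum fun k _ => hf k).trans ?_
    simp
  rw [LSeries_eq_mul_integral' f zero_le_one hs hO]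
  have hs0 : s ≠ 0 := by rintro rfl; simp at hs; linarith
  have i0 := integrableOn_summatoryError_mul hl H hs.le
  have r1 : (-(s + 1)).re < -1 := by simp; linarith
  have r2 : (-s).re < -1 := by simp; linarith
  have i1 :=
    integrableOn_Ioi_cpow_of_lt r1 one_pos
  have i2 : IntegrableOn (fun t : ℝ => V * (t : ℂ) ^ (-s)) (Set.Ioi 1) :=
    (integrableOn_Ioi_cpow_of_lt r2 one_pos).const_mul _
  have i01 : IntegrableOn (fun t : ℝ =>
      summatoryError f V t * t ^ (-(s + 1)) + t ^ (-(s + 1))) (Set.Ioi 1) := i0.add i1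
  have e : ∫ t in Set.Ioi (1 : ℝ), (∑ k ∈ Icc 1 ⌊t⌋₊, f k) * t ^ (-(s + 1)) =
      ∫ t in Set.Ioi 1, ((summatoryError f V t * t ^ (-(s + 1)) + t ^ (-(s + 1))) +
        (V : ℂ) * t ^ (-s)) := by
    refine setIntegral_congr_fun measurableSet_Ioi fun t ht => ?_
    have : t ^ (-s) = (t : ℂ) ^ (-(s + 1)) * t := by
      rw [show -s = -(s + 1) + 1 by ring, Complex.cpow_add _ _ (Complex.ofReal_ne_zero.2 (by linarith [Set.mem_Ioi.1 ht])), Complex.cpow_one]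
    simp only [this, summatoryError]
    ring
  rw [e, integral_add i01 i2, integral_add i0 i1,
    integral_const_mul, integral_Ioi_cpow_of_lt r1 one_pos,
    integral_Ioi_cpow_of_lt r2 one_pos]
  have h1 : -(s + 1) + 1 = -s := by ring
  have h2 : -s + 1 = -(s - 1) := by ring
  rw [h1, h2, Complex.ofReal_one, Complex.one_cpow, Complex.one_cpow]
  field_simp
  ring

lemma integral_rpow_neg_one_sub {l : ℝ} (hl : 0 < l) :
    ∫ t in Set.Ioi (1 : ℝ), t ^ (-1 - l) = 1 / l := by
  rw [integral_Ioi_rpow_of_lt (by linarith) one_pos, one_rpow]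
  have : -1 - l + 1 = -l := by ring
  rw [this, neg_div_neg_eq]

lemma norm_integral_summatoryError_le {f : ℕ → ℂ} {V B l : ℝ} (hl : 0 < l)
    (H : ∀ t : ℝ, 1 ≤ t → ‖summatoryError f V t‖ ≤ B * t ^ (1 - l)) {s : ℂ} (hs : 1 ≤ s.re) :
    ‖∫ t in Set.Ioi (1 : ℝ), summatoryError f V t * (t : ℂ) ^ (-(s + 1))‖ ≤ B / l := by
  have hi : IntegrableOn (fun t : ℝ => B * t ^ (-1 - l)) (Set.Ioi 1) :=
    (integrableOn_Ioi_rpow_of_lt (by linarith) one_pos).const_mul B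
  refine (norm_integral_le_of_norm_le hi ?_).trans (le_of_eq ?_)
  · refine (ae_restrict_iff' measurableSet_Ioi).2 (Filter.Eventually.of_forall fun t ht => ?_)
    exact norm_summatoryError_mul_le H hs (Set.mem_Ioi.1 ht).le
  · rw [integral_const_mul, integral_rpow_neg_one_sub hl]; ring

lemma norm_lSeries_sub_le {f : ℕ → ℂ} (hf : ∀ n, ‖f n‖ ≤ 1) {V B l : ℝ} (hl : 0 < l)
    (H : ∀ t : ℝ, 1 ≤ t → ‖summatoryError f V t‖ ≤ B * t ^ (1 - l)) {s : ℂ} (hs : 1 < s.re) :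
    ‖LSeries f s - (1 + V * (s / (s - 1)))‖ ≤ ‖s‖ * (B / l) := by
  rw [lSeries_eq_add_mul_integral hf hl H hs, add_sub_cancel_left, norm_mul]
  exact mul_le_mul_of_nonneg_left (norm_integral_summatoryError_le hl H hs.le) (norm_nonneg _)

lemma norm_cpow_sub_cpow_le {t : ℝ} (ht : 1 ≤ t) {s s' : ℂ} (hs : 1 ≤ s.re) (hs' : 1 ≤ s'.re) :
    ‖(t : ℂ) ^ (-(s + 1)) - (t : ℂ) ^ (-(s' + 1))‖ ≤ ‖s - s'‖ * (log t * t ^ (-2 : ℝ)) := by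
  have ht0 : 0 < t := by linarith
  have key := Convex.norm_image_sub_le_of_norm_hasDerivWithin_le (f := fun z : ℂ => (t : ℂ) ^ (-(z + 1)))
    (f' := fun z => t ^ (-(z + 1)) * Complex.log t * (-1)) (C := log t * t ^ (-2 : ℝ))
    (s := {z : ℂ | 1 ≤ z.re}) (x := s') (y := s) (fun z _ => ?_) (fun z hz => ?_)
    (convex_halfSpace_re_ge 1) hs' hs
  · rw [mul_comm]; exact key
  · refine HasDerivAt.hasDerivWithinAt ?_
    exact HasDerivAt.const_cpow (((hasDerivAt_id z).add_const 1).neg) (Or.inl (Complex.ofReal_ne_zero.2 ht0.ne'))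
  · rw [norm_mul, norm_mul, ← Complex.ofReal_log ht0.le, norm_real, norm_neg, norm_one, mul_one,
      norm_of_nonneg (log_nonneg ht), mul_comm]
    exact mul_le_mul_of_nonneg_left (norm_cpow_neg_add_one_le ht hz) (log_nonneg ht)

lemma norm_lSeries_sub_lSeries_le {f : ℕ → ℂ} (hf : ∀ n, ‖f n‖ ≤ 1) {B l : ℝ} (hl : 0 < l)
    (hB : 0 ≤ B) (H : ∀ t : ℝ, 1 ≤ t → ‖summatoryError f 0 t‖ ≤ B * t ^ (1 - l)) {s s' : ℂ}
    (hs : 1 < s.re) (hs' : 1 < s'.re) :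
    ‖LSeries f s - LSeries f s'‖ ≤ ‖s - s'‖ * (B / l + ‖s'‖ * (4 * B / l ^ 2)) := by
  have e : LSeries f s - LSeries f s' =
      (s - s') * (∫ t in Set.Ioi 1, summatoryError f 0 t * t ^ (-(s + 1))) +
      s' * (∫ t in Set.Ioi 1, summatoryError f 0 t *
        (t ^ (-(s + 1)) - t ^ (-(s' + 1)))) := by
    simp_rw [mul_sub]
    rw [integral_sub (integrableOn_summatoryError_mul hl H hs.le)
      (integrableOn_summatoryError_mul hl H hs'.le), lSeries_eq_add_mul_integral hf hl H hs,
      lSeries_eq_add_mul_integral hf hl H hs']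
    push_cast
    ring
  have hi : IntegrableOn (fun t : ℝ => ‖s - s'‖ * (B * (2 / l)) * t ^ (-1 - l / 2))
      (Set.Ioi 1) :=
    (integrableOn_Ioi_rpow_of_lt (by linarith) one_pos).const_mul _
  have h2 : ‖∫ t in Set.Ioi 1, summatoryError f 0 t *
      (t ^ (-(s + 1)) - t ^ (-(s' + 1)))‖ ≤ ‖s - s'‖ * (4 * B / l ^ 2) := by
    refine (norm_integral_le_of_norm_le hi ?_).trans (le_of_eq ?_)
    · refine (ae_restrict_iff' measurableSet_Ioi).2
        (Filter.Eventually.of_forall fun t ht => ?_)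
      have ht1 := (Set.mem_Ioi.1 ht).le
      have ht0 : 0 < t := by linarith
      have hlog : log t ≤ 2 / l * t ^ (l / 2) := by
        have := log_le_rpow_div ht0.le (half_pos hl)
        calc log t ≤ t ^ (l / 2) / (l / 2) := this
          _ = _ := by field_simp
      rw [norm_mul]
      calc _ ≤ B * t ^ (1 - l) * (‖s - s'‖ * (log t * t ^ (-2 : ℝ))) :=
            mul_le_mul (H t ht1) (norm_cpow_sub_cpow_le ht1 hs.le hs'.le) (norm_nonneg _) (by positivity)
        _ ≤ B * t ^ (1 - l) * (‖s - s'‖ * (2 / l * t ^ (l / 2) * t ^ (-2 : ℝ))) := by gcongr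
        _ = ‖s - s'‖ * (B * (2 / l)) * (t ^ (1 - l) * t ^ (l / 2) * t ^ (-2 : ℝ)) := by ring
        _ = _ := by
            rw [← rpow_add ht0, ← rpow_add ht0]; ring_nf
    · rw [integral_const_mul, integral_rpow_neg_one_sub (half_pos hl)]
      field_simp
      ring
  rw [e]
  calc _ ≤ ‖s - s'‖ * (B / l) + ‖s'‖ * (‖s - s'‖ * (4 * B / l ^ 2)) := by
        refine (norm_add_le _ _).trans (add_le_add ?_ ?_)
        · rw [norm_mul]
          exact mul_le_mul_of_nonneg_left (norm_integral_summatoryError_le hl H hs.le) (norm_nonneg _)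
        · rw [norm_mul]
          gcongr
    _ = _ := by ring

section

/-- A group of Dirichlet characters whose summatory functions are as small as those of characters
restricted to integers free of primes below `exp (1 / (2 * l))`. -/
structure IsRoughFamily {M : ℕ} (G : Subgroup (DirichletCharacter ℂ M)) (C l : ℝ) : Prop where
  one_le : 1 ≤ C
  pos : 0 < l
  le_one : l ≤ 1
  principal : ∃ V : ℝ, 0 ≤ V ∧ V ≤ 2 * l ∧ ∀ t : ℝ, 1 ≤ t →
    ‖summatoryError (fun n : ℕ => (1 : DirichletCharacter ℂ M) n) V t‖ ≤ C * l * t ^ (1 - l)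
  nonprincipal : ∀ χ ∈ G, χ ≠ 1 → ∀ t : ℝ, 1 ≤ t →
    ‖summatoryError (fun n : ℕ => χ n) 0 t‖ ≤ C * l * t ^ (1 - l)

/-- The Dirichlet series of a Dirichlet character. -/
noncomputable def charSeries {M : ℕ} (χ : DirichletCharacter ℂ M) (s : ℂ) : ℂ :=
  LSeries (fun n : ℕ => χ n) s

lemma one_lt_re_one_add_add {a : ℝ} (ha : 0 < a) (t : ℝ) : 1 < (1 + a + I * t : ℂ).re := by
  simp [ha]

lemma norm_one_add_add_le {a : ℝ} (ha : 0 < a) (t : ℝ) : ‖(1 + a + I * t : ℂ)‖ ≤ 1 + a + |t| := by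
  refine (norm_add_le _ _).trans (add_le_add ?_ ?_)
  · rw [← Complex.ofReal_one, ← Complex.ofReal_add, norm_real, norm_of_nonneg (by linarith)]
  · simp

namespace IsRoughFamily

variable {M : ℕ} {G : Subgroup (DirichletCharacter ℂ M)} {C l : ℝ}

lemma norm_charSeries_one_le (h : IsRoughFamily G C l) {a : ℝ} (ha : 0 < a) (t : ℝ) {r : ℝ} (hr :
    0 < r) (hrt : r * l ≤ ‖(a + I * t : ℂ)‖) : ‖charSeries (1 : DirichletCharacter ℂ M) (1 +
    a + I * t)‖ ≤ 1 + (1 + a + |t|) * (2 / r + C) := by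
  obtain ⟨V, hV0, hV, hH⟩ := h.principal
  have h1 := norm_lSeries_sub_le (fun n => norm_le_one _ _) h.pos hH (one_lt_re_one_add_add ha t)
  have hl := h.pos
  set s : ℂ := 1 + a + I * t with hs
  have hs1 : s - 1 = a + I * t := by rw [hs]; ring
  have hs2 := norm_one_add_add_le ha t
  have h2 : ‖1 + V * (s / (s - 1))‖ ≤ 1 + (1 + a + |t|) * (2 / r) := by
    refine (norm_add_le _ _).trans (add_le_add (by simp) ?_)
    rw [norm_mul, norm_div, norm_real, norm_of_nonneg hV0, hs1]
    calc _ ≤ 2 * l * ((1 + a + |t|) / (r * l)) := by gcongr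
      _ = _ := by field_simp
  have h3 : C * l / l = C := by field_simp
  rw [h3] at h1
  have h4 : ‖charSeries (1 : DirichletCharacter ℂ M) s‖ ≤ ‖1 + V * (s / (s - 1))‖ + ‖s‖ * C := by
    have := norm_le_norm_add_norm_sub' (charSeries (1 : DirichletCharacter ℂ M) s) (1 + V * (s / (s - 1)))
    exact this.trans (add_le_add le_rfl h1)
  calc _ ≤ _ := h4
    _ ≤ _ := add_le_add h2 (mul_le_mul_of_nonneg_right hs2 (by linarith [h.one_le]))
    _ = _ := by ring

lemma norm_charSeries_le (h : IsRoughFamily G C l) {χ : DirichletCharacter ℂ M} (hχ : χ ∈ G) (hχ1 : χ ≠ 1)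
    {a : ℝ} (ha : 0 < a) (t : ℝ) :
    ‖charSeries χ (1 + a + I * t)‖ ≤ 1 + (1 + a + |t|) * C := by
  have h1 := norm_lSeries_sub_le (fun n => norm_le_one _ _) h.pos
    (h.nonprincipal χ hχ hχ1) (one_lt_re_one_add_add ha t)
  have hl := h.pos
  have h3 : C * l / l = C := by field_simp
  rw [h3, Complex.ofReal_zero, zero_mul, add_zero] at h1
  have h5 := mul_le_mul_of_nonneg_right (norm_one_add_add_le ha t) (by linarith [h.one_le] : 0 ≤ C)
  have := norm_le_norm_add_norm_sub' (charSeries χ (1 + a + I * t)) 1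
  rw [norm_one] at this
  exact this.trans (add_le_add le_rfl (h1.trans h5))

lemma norm_charSeries_sub_le (h : IsRoughFamily G C l) {χ : DirichletCharacter ℂ M} (hχ : χ ∈ G)
    (hχ1 : χ ≠ 1) {a : ℝ} (ha : 0 < a) (ha3 : a ≤ 3) (t : ℝ) {a' : ℝ} (ha' : 0 < a') (t' : ℝ) :
    ‖charSeries χ (1 + a' + I * t') - charSeries χ (1 + a + I * t)‖ ≤
      ‖((1 + a' + I * t') - (1 + a + I * t) : ℂ)‖ * ((17 + 4 * |t|) * C / l) := by
  have hl := h.pos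
  have hC := h.one_le
  refine (norm_lSeries_sub_lSeries_le (fun n => norm_le_one _ _) h.pos
    (by positivity) (h.nonprincipal χ hχ hχ1) (one_lt_re_one_add_add ha' t')
    (one_lt_re_one_add_add ha t)).trans (mul_le_mul_of_nonneg_left ?_ (norm_nonneg _))
  have h5 := norm_one_add_add_le ha t
  calc C * l / l + ‖(1 + a + I * t : ℂ)‖ * (4 * (C * l) / l ^ 2)
      ≤ C * l / l + (1 + a + |t|) * (4 * (C * l) / l ^ 2) := by gcongr
    _ ≤ C / l + (4 + |t|) * (4 * C / l) := by
        have h6 : C * l / l ≤ C / l := by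
          have : C * l ≤ C := by nlinarith [h.le_one]
          gcongr
        have h7 : 4 * (C * l) / l ^ 2 = 4 * C / l := by field_simp
        rw [h7]
        have : 1 + a + |t| ≤ 4 + |t| := by linarith
        gcongr
    _ = _ := by ring

lemma charSeries_real_lower (h : IsRoughFamily G C l) {χ : DirichletCharacter ℂ M} (hχ2 : χ ^ 2 = 1) {a : ℝ} (ha3 : a ≤ 3) {r : ℝ} (hr : 0 < r) (hr1 : r ≤ 1) (hra : r * l ≤ a) :
    r / (9 + 4 * C) ≤ ‖charSeries χ (1 + a)‖ := by
  have hl := h.pos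
  have hC := h.one_le
  have ha : 0 < a := by nlinarith
  have h1 := norm_LSeries_product_ge_one χ ha 0
  have h2 := h.norm_charSeries_one_le ha 0 hr (by simp [abs_of_pos ha, hra])
  simp only [Complex.ofReal_zero, mul_zero, add_zero, hχ2, abs_zero] at h1 h2
  change ‖charSeries (1 : DirichletCharacter ℂ M) (1 + a) ^ 3 * charSeries χ (1 + a) ^ 4 *
    charSeries (1 : DirichletCharacter ℂ M) (1 + a)‖ ≥ 1 at h1
  rw [norm_mul, norm_mul, norm_pow, norm_pow] at h1
  have h3 : 1 ≤ (‖charSeries (1 : DirichletCharacter ℂ M) (1 + a)‖ * ‖charSeries χ (1 + a)‖) ^ 4 := by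
    nlinarith
  have h4 : 1 ≤ ‖charSeries (1 : DirichletCharacter ℂ M) (1 + a)‖ * ‖charSeries χ (1 + a)‖ := by
    by_contra! hcon
    exact absurd h3 (not_le.2 (pow_lt_one₀ (by positivity) hcon (by norm_num)))
  have h5 : ‖charSeries (1 : DirichletCharacter ℂ M) (1 + a)‖ ≤ (9 + 4 * C) / r := by
    refine h2.trans ?_
    have : (1 + a) * (2 / r + C) ≤ 4 * (2 / r + C) := by gcongr; linarith
    refine (add_le_add le_rfl this).trans ?_
    rw [le_div_iff₀ hr]
    have : (1 + 4 * (2 / r + C)) * r = r + 8 + 4 * C * r := by field_simp; ring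
    rw [this]
    nlinarith
  rw [div_le_iff₀ (by linarith)]
  have h6 := mul_le_mul_of_nonneg_right h5 (norm_nonneg (charSeries χ (1 + a)))
  have h7 := h4.trans h6
  rw [div_mul_eq_mul_div, le_div_iff₀ hr] at h7
  linarith

end IsRoughFamily

lemma one_le_norm_charSeries_prod_four {M : ℕ} {χ ψ : DirichletCharacter ℂ M} (hχ : χ ^ 2 = 1)
    (hψ : ψ ^ 2 = 1) {a : ℝ} (ha : 0 < a) :
    1 ≤ ‖charSeries (1 : DirichletCharacter ℂ M) (1 + a) * charSeries χ (1 + a) * charSeries ψ (1 + a) *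
      charSeries (χ * ψ) (1 + a)‖ := by
  have hs : 1 < (1 + a : ℂ).re := by simp [ha]
  have e := fun ξ : DirichletCharacter ℂ M => DirichletCharacter.LSeries_eulerProduct ξ hs
  have := ((((e 1).mul (e χ)).mul (e ψ)).mul (e (χ * ψ))).norm
  refine ge_of_tendsto this (Filter.Eventually.of_forall fun n => ?_)
  rw [← prod_mul_distrib, ← prod_mul_distrib, ← prod_mul_distrib, norm_prod]
  refine prod_induction _ (fun r : ℝ => 1 ≤ r) (fun _ _ h1 h2 => one_le_mul_of_one_le_of_one_le h1 h2)
    le_rfl fun p hp => ?_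
  rw [← mul_inv, ← mul_inv, ← mul_inv, norm_inv]
  have hp' := Nat.prime_of_mem_primesBelow hp
  have hp1 : (1 : ℝ) < p := mod_cast hp'.one_lt
  set t : ℝ := p ^ (-(1 + a)) with ht
  have ht0 : 0 < t := rpow_pos_of_pos (by linarith) _
  have ht1 : t < 1 := rpow_lt_one_of_one_lt_of_neg hp1 (by linarith)
  have hpt : p ^ (-(1 + a : ℂ)) = (t : ℂ) := by
    rw [ht, Complex.ofReal_cpow (by linarith)]; push_cast; rfl
  rw [hpt]
  have hval : ∀ ξ : DirichletCharacter ℂ M, ξ ^ 2 = 1 → IsUnit (p : ZMod M) → ξ p = 1 ∨ ξ p = -1 := by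
    intro ξ hξ hu
    have : ξ p ^ 2 = 1 := by
      rw [← MulChar.pow_apply' ξ two_ne_zero, hξ, MulChar.one_apply hu]
    exact mul_self_eq_one_iff.1 (by rw [← sq]; exact this)
  refine (one_le_inv₀ ?_).2 ?_
  all_goals by_cases hu : IsUnit (p : ZMod M)
  · rw [MulChar.mul_apply, MulChar.one_apply hu]
    have n1 : (1 - (t : ℂ)) ≠ 0 := by
      rw [← Complex.ofReal_one, ← Complex.ofReal_sub]; exact Complex.ofReal_ne_zero.2 (by linarith)
    have n2 : (1 + (t : ℂ)) ≠ 0 := by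
      rw [← Complex.ofReal_one, ← Complex.ofReal_add]; exact Complex.ofReal_ne_zero.2 (by linarith)
    rw [norm_pos_iff]
    rcases hval χ hχ hu with h1 | h1 <;> rcases hval ψ hψ hu with h2 | h2 <;> rw [h1, h2] <;>
      simp [n1, n2]
  · rw [MulChar.map_nonunit _ hu, MulChar.map_nonunit _ hu, MulChar.map_nonunit _ hu, MulChar.map_nonunit _ hu]
    simp
  · rw [MulChar.mul_apply, MulChar.one_apply hu]
    have key : ∀ u : ℝ, |u| ≤ 1 → ‖(u : ℂ)‖ ≤ 1 := fun u hu => by rwa [norm_real]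
    rcases hval χ hχ hu with h1 | h1 <;> rcases hval ψ hψ hu with h2 | h2 <;> rw [h1, h2]
    · have := key ((1 - t) ^ 4) (by rw [abs_of_nonneg (by positivity)]; exact pow_le_one₀ (by linarith) (by linarith))
      push_cast at this
      refine le_of_eq_of_le (congrArg norm ?_) this
      ring
    all_goals
      have := key ((1 - t ^ 2) ^ 2) (by
        rw [abs_of_nonneg (by positivity)]
        exact pow_le_one₀ (by nlinarith) (by nlinarith))
      push_cast at this
      refine le_of_eq_of_le (congrArg norm ?_) this
      ring
  · rw [MulChar.map_nonunit _ hu, MulChar.map_nonunit _ hu, MulChar.map_nonunit _ hu, MulChar.map_nonunit _ hu]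
    simp

/-- Page's theorem for rough families: at most one real character has a small value near `1`. -/
lemma exists_real_unique {C : ℝ} (hC : 1 ≤ C) : ∃ c : ℝ, 0 < c ∧
    ∀ {M : ℕ} {G : Subgroup (DirichletCharacter ℂ M)} {l : ℝ}, IsRoughFamily G C l →
    ∀ χ ∈ G, ∀ ψ ∈ G, χ ≠ 1 → ψ ≠ 1 → χ ^ 2 = 1 → ψ ^ 2 = 1 →
    (∃ a : ℝ, 0 < a ∧ a ≤ 3 ∧ ‖charSeries χ (1 + a)‖ < c) →
    (∃ a : ℝ, 0 < a ∧ a ≤ 3 ∧ ‖charSeries ψ (1 + a)‖ < c) → χ = ψ := by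
  set k : ℝ := 1 / (20000 * C ^ 4) with hk
  have hk0 : 0 < k := by positivity
  have hk1 : k ≤ 1 := by
    rw [hk, div_le_one (by positivity)]
    have : 1 ≤ C ^ 4 := one_le_pow₀ hC
    linarith
  refine ⟨k / (9 + 4 * C), by positivity, ?_⟩
  intro M G l h χ hχ ψ hψ hχ1 hψ1 hχ2 hψ2 hχe hψe
  by_contra hne
  have hl := h.pos
  have hkl : 0 < k * l := by positivity
  have hkl1 := mul_le_one₀ hk1 hl.le h.le_one
  have small : ∀ ξ ∈ G, ξ ≠ 1 → ξ ^ 2 = 1 →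
      (∃ a : ℝ, 0 < a ∧ a ≤ 3 ∧ ‖charSeries ξ (1 + a)‖ < k / (9 + 4 * C)) →
      ‖charSeries ξ (1 + (k * l : ℝ))‖ ≤ 18 * C * k := by
    rintro ξ hξ hξ1 hξ2 ⟨a, ha0, ha3, ha⟩
    have hal : a < k * l := by
      by_contra! hcon
      exact absurd ha (not_lt.2 (h.charSeries_real_lower hξ2 ha3 hk0 hk1 hcon))
    have h1 := h.norm_charSeries_sub_le hξ hξ1 ha0 ha3 0 hkl 0
    simp only [Complex.ofReal_zero, mul_zero, add_zero, abs_zero] at h1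
    have h2 : ‖((1 + (k * l : ℝ)) - (1 + a) : ℂ)‖ ≤ k * l := by
      rw [show ((1 + (k * l : ℝ)) - (1 + a) : ℂ) = ((k * l - a : ℝ) : ℂ) by push_cast; ring,
        norm_real, norm_of_nonneg (by linarith)]
      linarith
    have h3 : ‖((1 + (k * l : ℝ)) - (1 + a) : ℂ)‖ * (17 * C / l) ≤ 17 * C * k := by
      calc _ ≤ k * l * (17 * C / l) := by gcongr
        _ = _ := by field_simp
    have h4 := norm_le_norm_add_norm_sub' (charSeries ξ (1 + (k * l : ℝ))) (charSeries ξ (1 + a))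
    have h5 : k / (9 + 4 * C) ≤ C * k := by
      rw [div_le_iff₀ (by positivity)]
      nlinarith [mul_pos hk0 (by linarith : 0 < C)]
    linarith
  have s1 := small χ hχ hχ1 hχ2 hχe
  have s2 := small ψ hψ hψ1 hψ2 hψe
  have hprod : χ * ψ ≠ 1 := by
    intro hcon
    apply hne
    have : χ * ψ = ψ * ψ := by rw [hcon, ← hψ2, sq]
    exact mul_right_cancel this
  have s3 := h.norm_charSeries_le (G.mul_mem hχ hψ) hprod hkl 0
  have s4 := h.norm_charSeries_one_le hkl 0 hk0 (by
    simp only [Complex.ofReal_zero, mul_zero, add_zero, norm_real]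
    rw [norm_of_nonneg hkl.le])
  simp only [Complex.ofReal_zero, mul_zero, add_zero, abs_zero] at s3 s4
  have s5 := one_le_norm_charSeries_prod_four hχ2 hψ2 hkl
  rw [norm_mul, norm_mul, norm_mul] at s5
  have t3 : ‖charSeries (χ * ψ) (1 + (k * l : ℝ))‖ ≤ 3 * C := by nlinarith
  have t4 : ‖charSeries (1 : DirichletCharacter ℂ M) (1 + (k * l : ℝ))‖ ≤ 7 * C / k := by
    refine s4.trans ?_
    have : (1 + k * l) * (2 / k + C) ≤ 2 * (2 / k + C) := by gcongr; linarith
    refine (add_le_add le_rfl this).trans ?_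
    rw [le_div_iff₀ hk0]
    have : (1 + 2 * (2 / k + C)) * k = k + 4 + 2 * C * k := by field_simp; ring
    rw [this]
    nlinarith
  have : 1 ≤ 7 * C / k * (18 * C * k) * (18 * C * k) * (3 * C) := by
    refine s5.trans ?_
    gcongr
  have e : 7 * C / k * (18 * C * k) * (18 * C * k) * (3 * C) = 6804 * C ^ 4 * k := by
    field_simp; ring
  rw [e, hk] at this
  have e2 : 6804 * C ^ 4 * (1 / (20000 * C ^ 4)) = 6804 / 20000 := by field_simp
  rw [e2] at this
  norm_num at this

/-- Dirichlet series of non-exceptional characters in a rough family are bounded below. -/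
lemma exists_charSeries_lower {C : ℝ} (hC : 1 ≤ C) {c : ℝ} (hc : 0 < c) {T : ℝ} (hT : 0 ≤ T) :
    ∃ c₀ : ℝ, 0 < c₀ ∧ ∀ {M : ℕ} {G : Subgroup (DirichletCharacter ℂ M)} {l : ℝ}, IsRoughFamily G C l →
    ∀ χ ∈ G, χ ≠ 1 → (χ ^ 2 = 1 → ∀ a : ℝ, 0 < a → a ≤ 3 → c ≤ ‖charSeries χ (1 + a)‖) →
    ∀ t : ℝ, |t| ≤ T → ∀ a : ℝ, 0 < a → a ≤ 3 → c₀ ≤ ‖charSeries χ (1 + a + I * t)‖ := by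
  set b : ℝ := c / (34 * C) with hb
  set D : ℝ := 1 + (4 + 2 * T) * (1 / b + C) with hD
  set E : ℝ := 9 + 4 * C with hE
  set F : ℝ := (17 + 4 * T) * C with hF
  have hD1 : 1 ≤ D := by
    have : 0 ≤ (4 + 2 * T) * (1 / b + C) := by positivity
    linarith
  have hF1 : 1 ≤ F := by nlinarith
  set g : ℝ := 1 / (E * D) with hg
  have hg1 : g ≤ 1 := by
    rw [hg, div_le_one (by positivity)]; nlinarith
  set r : ℝ := g / (2 * F) with hr
  have hr0 : 0 < r := by positivity
  have hr1 : r ≤ 1 := by rw [hr, div_le_one (by positivity)]; linarith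
  refine ⟨min (c / 2) (r ^ 3 * g / 2), by positivity, ?_⟩
  intro M G l h χ hχ hχ1 hreal t ht a ha ha3
  have hl := h.pos
  by_cases hcase : χ ^ 2 = 1 ∧ |t| ≤ b * l
  · obtain ⟨h2, htl⟩ := hcase
    refine (min_le_left _ _).trans ?_
    have h1 := h.norm_charSeries_sub_le hχ hχ1 ha ha3 0 ha t
    simp only [Complex.ofReal_zero, mul_zero, add_zero, abs_zero, add_sub_cancel_left, norm_mul,
      Complex.norm_I, one_mul, norm_real, norm_eq_abs] at h1
    have h3 : |t| * (17 * C / l) ≤ c / 2 := by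
      calc _ ≤ b * l * (17 * C / l) := by gcongr
        _ = _ := by rw [hb]; field_simp; norm_num
    have h4 := norm_le_norm_add_norm_sub (charSeries χ (1 + a + I * t)) (charSeries χ (1 + a))
    have h5 := hreal h2 a ha ha3
    linarith
  · refine (min_le_right _ _).trans ?_
    have main : ∀ a : ℝ, 0 < a → a ≤ 3 → r ^ 4 * l ≤ a →
        r ^ 3 * g ≤ ‖charSeries χ (1 + a + I * t)‖ := by
      intro a ha ha3 hal
      have h341 := norm_LSeries_product_ge_one χ ha t
      change ‖charSeries (1 : DirichletCharacter ℂ M) (1 + a) ^ 3 * charSeries χ (1 + a + I * t) ^ 4 *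
        charSeries (χ ^ 2) (1 + a + 2 * I * t)‖ ≥ 1 at h341
      have hre : (1 + a + 2 * I * t : ℂ) = 1 + a + I * ((2 * t : ℝ) : ℂ) := by
        push_cast; ring
      have hat : 1 + a + |2 * t| ≤ 4 + 2 * T := by rw [abs_mul, abs_two]; linarith
      have d2 : ‖charSeries (χ ^ 2) (1 + a + 2 * I * t)‖ ≤ D := by
        rw [hre]
        by_cases h2 : χ ^ 2 = 1
        · rw [h2]
          have htl : b * l < |t| := by
            by_contra! hcon
            exact hcase ⟨h2, hcon⟩
          refine (h.norm_charSeries_one_le ha (2 * t) (r := 2 * b) (by positivity) ?_).trans ?_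
          · have := Complex.abs_im_le_norm (a + I * ((2 * t : ℝ) : ℂ))
            refine le_trans ?_ this
            simp only [Complex.add_im, Complex.ofReal_im, Complex.mul_im, Complex.I_re, Complex.I_im,
              Complex.ofReal_re, zero_mul, one_mul, zero_add, abs_mul, abs_two]
            linarith
          · rw [hD]
            have : 2 / (2 * b) = 1 / b := by field_simp
            rw [this]
            gcongr
        · refine (h.norm_charSeries_le (G.pow_mem hχ 2) h2 ha (2 * t)).trans ?_
          rw [hD]
          have : C ≤ 1 / b + C := by
            have : 0 < 1 / b := by positivity
            linarith
          gcongr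
      have d1 : ‖charSeries (1 : DirichletCharacter ℂ M) (1 + a)‖ ≤ E / r ^ 4 := by
        have h2 := h.norm_charSeries_one_le ha 0 (pow_pos hr0 4) (by simp [abs_of_pos ha, hal])
        simp only [Complex.ofReal_zero, mul_zero, add_zero, abs_zero] at h2
        refine h2.trans ?_
        have hr4 : r ^ 4 ≤ 1 := pow_le_one₀ hr0.le hr1
        have : (1 + a) * (2 / r ^ 4 + C) ≤ 4 * (2 / r ^ 4 + C) := by gcongr; linarith
        refine (add_le_add le_rfl this).trans ?_
        rw [le_div_iff₀ (pow_pos hr0 4)]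
        have : (1 + 4 * (2 / r ^ 4 + C)) * r ^ 4 = r ^ 4 + 8 + 4 * C * r ^ 4 := by field_simp; ring
        rw [this, hE]
        nlinarith
      rw [norm_mul, norm_mul, norm_pow, norm_pow] at h341
      set m := ‖charSeries χ (1 + a + I * t)‖
      have h5 : 1 ≤ (E / r ^ 4) ^ 3 * m ^ 4 * D := by
        refine le_trans h341 ?_
        gcongr
      have h6 : (r ^ 3 * g) ^ 4 ≤ m ^ 4 := by
        have e1 : (E / r ^ 4) ^ 3 * m ^ 4 * D = m ^ 4 * (E ^ 3 * D) / r ^ 12 := by field_simp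
        rw [e1, le_div_iff₀ (by positivity), one_mul] at h5
        have e2 : (r ^ 3 * g) ^ 4 = r ^ 12 / (E ^ 4 * D ^ 4) := by rw [hg]; field_simp
        rw [e2, div_le_iff₀ (by positivity)]
        refine h5.trans ?_
        have e3 : E ^ 3 ≤ E ^ 4 := pow_le_pow_right₀ (by linarith) (by norm_num)
        have e4 : D ≤ D ^ 4 := le_self_pow₀ hD1 (by norm_num)
        gcongr
      exact (pow_le_pow_iff_left₀ (by positivity) (norm_nonneg _) (by norm_num)).1 h6
    have hr4l : 0 < r ^ 4 * l := by positivity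
    have hr4l1 : r ^ 4 * l ≤ 1 := mul_le_one₀ (pow_le_one₀ hr0.le hr1) hl.le h.le_one
    have hpos : 0 < r ^ 3 * g := by positivity
    rcases le_total (r ^ 4 * l) a with hal | hal
    · linarith [main a ha ha3 hal]
    · have h1 := h.norm_charSeries_sub_le hχ hχ1 ha ha3 t hr4l t
      have h2 := main (r ^ 4 * l) hr4l (by linarith) le_rfl
      have h3 : ‖((1 + (r ^ 4 * l : ℝ) + I * t) - (1 + a + I * t) : ℂ)‖ ≤ r ^ 4 * l := by
        rw [show ((1 + (r ^ 4 * l : ℝ) + I * t) - (1 + a + I * t) : ℂ) =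
          ((r ^ 4 * l - a : ℝ) : ℂ) by push_cast; ring, norm_real, norm_of_nonneg (by linarith)]
        linarith
      have h4 : ‖((1 + (r ^ 4 * l : ℝ) + I * t) - (1 + a + I * t) : ℂ)‖ *
          ((17 + 4 * |t|) * C / l) ≤ r ^ 3 * g / 2 := by
        calc _ ≤ r ^ 4 * l * ((17 + 4 * T) * C / l) := by gcongr
          _ = r ^ 3 * (r * F) := by rw [hF]; field_simp
          _ = _ := by rw [hr]; field_simp
      have h5 := norm_le_norm_add_norm_sub' (charSeries χ (1 + (r ^ 4 * l : ℝ) + I * t))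
        (charSeries χ (1 + a + I * t))
      linarith
end

section
open ArithmeticFunction hiding log

lemma two_mul_log_four_add_five_le : 2 * (log 4 + 5) ≤ 13 := by
  have : log 4 = 2 * log 2 := by rw [show (4 : ℝ) = 2 ^ 2 by norm_num, log_pow]; norm_num
  linarith [log_two_lt_d9]

lemma sum_log_div_prime_le {S : Finset ℕ} (hS : ∀ p ∈ S, p.Prime) {y : ℝ} (hy1 : 1 ≤ y)
    (hy : ∀ p ∈ S, (p : ℝ) ≤ y) : ∑ p ∈ S, log p / p ≤ log y + 6 := by
  have hN : 1 ≤ ⌊y⌋₊ := Nat.le_floor (by simpa using hy1)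
  have h1 := (abs_le.1 (sum_vonMangoldt_div_sub_log_le _ hN)).2
  have h2 := log_le_log (by exact_mod_cast hN) (Nat.floor_le (by linarith))
  have h3 : ∑ p ∈ S, log p / p ≤ ∑ n ∈ Icc 0 ⌊y⌋₊, vonMangoldt n / n := by
    rw [sum_congr rfl (g := fun n : ℕ => vonMangoldt n / n) fun p hp => by
      rw [vonMangoldt_apply_prime (hS p hp)]]
    refine sum_le_sum_of_subset_of_nonneg (fun p hp => mem_Icc.2 ⟨Nat.zero_le _, ?_⟩) ?_
    · exact Nat.le_floor (hy p hp)
    · intro n _ _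
      exact div_nonneg vonMangoldt_nonneg (Nat.cast_nonneg _)
  linarith [two_mul_log_four_add_five_le]

lemma sum_one_div_prime_le_of_log {S : Finset ℕ} (hS : ∀ p ∈ S, p.Prime) {a b : ℝ} (ha : 1 ≤ a)
    (hab : a ≤ b) (h : ∀ p ∈ S, a < log p ∧ log p ≤ b) :
    ∑ p ∈ S, 1 / (p : ℝ) ≤ log (b / a) + 13 / a := by
  have hp : ∀ p ∈ S, (0 : ℝ) < p := fun p hp => mod_cast (hS p hp).pos
  have h1 := sum_one_div_prime_le hS (by linarith [add_one_le_exp a]) (exp_le_exp.2 hab)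
    (fun p hp' => (log_le_iff_le_exp (hp p hp')).1 (h p hp').2)
  rw [log_exp, log_exp, filter_true_of_mem fun p hp' =>
    (lt_log_iff_exp_lt (hp p hp')).1 (h p hp').1] at h1
  refine h1.trans (add_le_add le_rfl ?_)
  have := two_mul_log_four_add_five_le
  gcongr

lemma sum_exp_div_prime_le {L : ℝ} (hL : 13 ≤ L) (J : ℕ) :
    ∀ S : Finset ℕ, (∀ p ∈ S, p.Prime) → (∀ p ∈ S, L < log p) → (∀ p ∈ S, log p ≤ (J + 1) * L) →
    ∑ p ∈ S, exp (-(log p / L)) / p ≤ 4 * (1 - (1 / 2) ^ J) := by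
  have hL0 : 0 < L := by linarith
  induction J with
  | zero =>
    intro S _ h1 h2
    have := eq_empty_of_forall_notMem fun p hp => by
      have a1 := h1 p hp
      have a2 := h2 p hp
      simp at a2; linarith
    simp [this]
  | succ J ih =>
    intro S hS h1 h2
    rw [← sum_filter_add_sum_filter_not S (fun p : ℕ => log p ≤ (J + 1) * L)]
    have i1 := ih (S.filter fun p : ℕ => log p ≤ (J + 1) * L) (fun p hp => hS p (mem_filter.1 hp).1)
      (fun p hp => h1 p (mem_filter.1 hp).1) (fun p hp => (mem_filter.1 hp).2)
    have i2 := sum_one_div_prime_le_of_log (S := S.filter fun p : ℕ => ¬ log p ≤ (J + 1) * L)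
      (fun p hp => hS p (mem_filter.1 hp).1) (a := (J + 1) * L) (b := (J + 1 + 1) * L)
      (by nlinarith) (by nlinarith) (fun p hp => ⟨not_le.1 (mem_filter.1 hp).2, by
        have := h2 p (mem_filter.1 hp).1
        push_cast at this; exact this⟩)
    have i3 : log ((J + 1 + 1) * L / ((J + 1) * L)) + 13 / ((J + 1) * L) ≤ 2 := by
      rw [mul_div_mul_right _ _ hL0.ne']
      have a2 : log ((J + 1 + 1 : ℝ) / (J + 1)) ≤ log 2 := log_le_log (by positivity) (by rw [div_le_iff₀ (by linarith)]; linarith)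
      have a3 : 13 / ((J + 1) * L) ≤ 1 := by rw [div_le_one (by positivity)]; nlinarith
      linarith [log_two_lt_d9]
    have i4 : ∑ p ∈ S.filter (fun p : ℕ => ¬ log p ≤ (J + 1) * L), exp (-(log p / L)) / p ≤
        (1 / 2) ^ (J + 1) * 2 := by
      refine le_trans ?_ (mul_le_mul_of_nonneg_left (i2.trans i3) (by positivity))
      rw [mul_sum]
      refine sum_le_sum fun p hp => ?_
      rw [div_eq_mul_one_div]
      refine mul_le_mul_of_nonneg_right ?_ (by positivity)
      have b1 : (J + 1 : ℝ) ≤ log p / L := by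
        rw [le_div_iff₀ hL0]; exact (not_le.1 (mem_filter.1 hp).2).le
      have b2 : exp (-1) ≤ 1 / 2 := by
        rw [exp_neg, one_div]
        exact inv_anti₀ two_pos (by linarith [exp_one_gt_d9])
      calc exp (-(log p / L)) ≤ exp (((J + 1 : ℕ) : ℝ) * (-1)) := by
            refine exp_le_exp.2 ?_
            push_cast; linarith
        _ = exp (-1) ^ (J + 1) := by rw [exp_nat_mul]
        _ ≤ _ := (by gcongr)
    calc _ ≤ 4 * (1 - (1 / 2) ^ J) + (1 / 2) ^ (J + 1) * 2 := add_le_add i1 i4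
      _ ≤ _ := by rw [pow_succ]; linarith [pow_pos (by norm_num : (0 : ℝ) < 1 / 2) J]

/-- A weight on the primes that is small away from `log p ≍ L`. -/
noncomputable def cutoffWeight (L : ℝ) (n : ℕ) : ℝ :=
  if log n ≤ L then log n / L else exp (-(log n / L))

lemma sum_cutoffWeight_div_le {L : ℝ} (hL : 13 ≤ L) {S : Finset ℕ} (hS : ∀ p ∈ S, p.Prime) :
    ∑ p ∈ S, cutoffWeight L p / p ≤ 6 := by
  have hL0 : 0 < L := by linarith
  rw [← sum_filter_add_sum_filter_not S (fun p : ℕ => log p ≤ L)]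
  have h1 : ∑ p ∈ S.filter (fun p : ℕ => log p ≤ L), cutoffWeight L p / p ≤ 2 := by
    rw [sum_congr rfl (g := fun p : ℕ => log p / p / L) fun p hp => by
      rw [cutoffWeight, if_pos (mem_filter.1 hp).2]; ring]
    rw [← sum_div, div_le_iff₀ hL0]
    have := sum_log_div_prime_le (S := S.filter (fun p : ℕ => log p ≤ L)) (y := exp L)
      (fun p hp => hS p (mem_filter.1 hp).1) (by linarith [add_one_le_exp L]) (fun p hp => by
        have hp' := mem_filter.1 hp
        exact (log_le_iff_le_exp (mod_cast (hS p hp'.1).pos)).1 hp'.2)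
    rw [log_exp] at this
    linarith
  have h2 : ∑ p ∈ S.filter (fun p : ℕ => ¬ log p ≤ L), cutoffWeight L p / p ≤ 4 := by
    rw [sum_congr rfl (g := fun p : ℕ => exp (-(log p / L)) / p) fun p hp => by
      rw [cutoffWeight, if_neg (mem_filter.1 hp).2]]
    obtain ⟨J, hJ⟩ : ∃ J : ℕ, ∀ p ∈ S, log p ≤ (J + 1) * L := by
      obtain ⟨m, hm⟩ := S.exists_le
      obtain ⟨J, hJ⟩ := exists_nat_ge (log m / L)
      refine ⟨J, fun p hp => ?_⟩
      have : log p ≤ log m := log_le_log (by exact_mod_cast (hS p hp).pos) (by exact_mod_cast hm p hp)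
      rw [div_le_iff₀ hL0] at hJ
      linarith
    refine (sum_exp_div_prime_le hL J _ (fun p hp => hS p (mem_filter.1 hp).1)
      (fun p hp => not_le.1 (mem_filter.1 hp).2) (fun p hp => hJ p (mem_filter.1 hp).1)).trans ?_
    have : (0 : ℝ) < (1 / 2) ^ J := by positivity
    linarith
  linarith

lemma sum_window_le {L h : ℝ} (hL : 13 ≤ L) (hh : 0 < h) (hh' : h ≤ 1 / 4) {S : Finset ℕ}
    (hS : ∀ p ∈ S, p.Prime) (hw : ∀ p ∈ S, (1 - h) * L < log p ∧ log p ≤ (1 + h) * L) :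
    ∑ p ∈ S, 1 / (p : ℝ) ≤ 3 * h + 18 / L := by
  have hL0 : 0 < L := by linarith
  refine (sum_one_div_prime_le_of_log hS (by nlinarith) (by nlinarith) hw).trans (add_le_add ?_ ?_)
  · rw [mul_div_mul_right _ _ hL0.ne']
    refine (log_le_sub_one_of_pos (div_pos (by linarith) (by linarith))).trans ?_
    rw [sub_le_iff_le_add, div_le_iff₀ (by linarith)]
    nlinarith
  · rw [div_le_div_iff₀ (by nlinarith) hL0]
    nlinarith

/-- A polynomial approximation `(1 - u) * W u` to the indicator function of `u < e⁻¹`. -/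
lemma exists_cutoff_polynomial {h η : ℝ} (hh : 0 < h) (hh' : h ≤ 1 / 4) (hη : 0 < η) (hη' : η ≤ 1) :
    ∃ W : Polynomial ℝ, ∀ u : ℝ, 0 ≤ u → u ≤ 1 → |(1 - u) * W.eval u| ≤ 8 ∧
      (u ≤ exp (-(1 + h)) → |1 - (1 - u) * W.eval u| ≤ η * u) ∧
      (exp (-(1 - h)) ≤ u → |(1 - u) * W.eval u| ≤ η * (1 - u)) := by
  set u₁ := exp (-(1 + h)) with hu₁
  set u₂ := exp (-(1 - h)) with hu₂
  have h12 : u₁ < u₂ := exp_lt_exp.2 (by linarith)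
  have h2 : u₂ ≤ 1 / 2 := by
    have e1 : exp (1 - h) * u₂ = 1 := by rw [hu₂, ← exp_add]; simp
    have e2 : 2 ≤ exp (1 - h) := by
      refine le_trans ?_ (exp_le_exp.2 (by linarith : (3 / 4 : ℝ) ≤ 1 - h))
      have := quadratic_le_exp_of_nonneg (by norm_num : (0 : ℝ) ≤ 3 / 4)
      linarith
    nlinarith
  have h1 : 1 / 4 ≤ u₁ := by
    have e1 : exp (1 + h) * u₁ = 1 := by rw [hu₁, ← exp_add]; simp
    have e2 : exp (1 + h) ≤ 4 := by
      have e3 : exp (1 + h) ^ 4 ≤ 4 ^ 4 := by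
        rw [← exp_nat_mul]
        have : exp ((4 : ℝ) * (1 + h)) ≤ exp 1 ^ 5 := by
          rw [← exp_nat_mul]
          exact exp_le_exp.2 (by push_cast; linarith)
        refine this.trans ?_
        have e5 : exp 1 ^ 5 ≤ 2.72 ^ 5 := pow_le_pow_left₀ (exp_pos _).le (by linarith [exp_one_lt_d9]) 5
        refine e5.trans (by norm_num)
      exact (pow_le_pow_iff_left₀ (exp_pos _).le (by norm_num) (by norm_num)).1 e3
    nlinarith [exp_pos (-(1 + h))]
  set φ : ℝ → ℝ := fun u => max 0 (min 1 ((u₂ - u) / (u₂ - u₁))) with hφ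
  have hφ0 : ∀ u, 0 ≤ φ u := fun u => le_max_left _ _
  have hφ1 : ∀ u, φ u ≤ 1 := fun u => max_le zero_le_one (min_le_left _ _)
  have hφa : ∀ u ≤ u₁, φ u = 1 := fun u hu => by
    have : 1 ≤ (u₂ - u) / (u₂ - u₁) := by rw [le_div_iff₀ (by linarith)]; linarith
    simp [hφ, this]
  have hφb : ∀ u, u₂ ≤ u → φ u = 0 := fun u hu => by
    have : (u₂ - u) / (u₂ - u₁) ≤ 0 := div_nonpos_of_nonpos_of_nonneg (by linarith) (by linarith)
    simp only [hφ]
    exact max_eq_left ((min_le_right _ _).trans this)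
  set g : ℝ → ℝ := fun u => φ u / (1 - min u (1 / 2)) - (1 - φ u) / max u (1 / 4) with hg
  have hgc : Continuous g := by
    have hφc : Continuous φ := by fun_prop
    refine (hφc.div (by fun_prop) fun u => ?_).sub ((continuous_const.sub hφc).div (by fun_prop) fun u => ?_)
    · have := min_le_right u (1 / 2); linarith
    · have := le_max_right u (1 / 4); linarith
  have hgb : ∀ u, |g u| ≤ 6 := fun u => by
    have a1 : φ u / (1 - min u (1 / 2)) ≤ 2 := by
      have := min_le_right u (1 / 2)
      rw [div_le_iff₀ (by linarith)]; linarith [hφ1 u]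
    have a2 : 0 ≤ φ u / (1 - min u (1 / 2)) := div_nonneg (hφ0 u) (by linarith [min_le_right u (1 / 2)])
    have a3 : (1 - φ u) / max u (1 / 4) ≤ 4 := by
      have := le_max_right u (1 / 4)
      rw [div_le_iff₀ (by linarith)]; linarith [hφ0 u]
    have a4 : 0 ≤ (1 - φ u) / max u (1 / 4) := div_nonneg (by linarith [hφ1 u]) (by linarith [le_max_right u (1 / 4)])
    rw [abs_le]; constructor <;> simp only [hg] <;> linarith
  obtain ⟨R, hR⟩ := exists_polynomial_near_of_continuousOn 0 1 g hgc.continuousOn η hη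
  refine ⟨1 + Polynomial.X * R, fun u hu0 hu1 => ?_⟩
  have hRu := (hR u ⟨hu0, hu1⟩).le
  simp only [Polynomial.eval_add, Polynomial.eval_one, Polynomial.eval_mul, Polynomial.eval_X]
  refine ⟨?_, fun hu => ?_, fun hu => ?_⟩
  · have hRb : |R.eval u| ≤ 7 := by
      have := abs_sub_abs_le_abs_sub (R.eval u) (g u)
      linarith [hgb u]
    rw [abs_mul, abs_of_nonneg (by linarith : 0 ≤ 1 - u)]
    have b1 : |1 + u * R.eval u| ≤ 8 := by
      refine (abs_add_le _ _).trans ?_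
      rw [abs_one, abs_mul, abs_of_nonneg hu0]
      nlinarith
    nlinarith
  · have hg1 : g u = 1 / (1 - u) := by
      simp only [hg, hφa u hu]
      rw [min_eq_left (by linarith)]; simp
    have hne : 1 - u ≠ 0 := by linarith
    have e : 1 - (1 - u) * (1 + u * R.eval u) = -(u * ((1 - u) * (R.eval u - g u))) := by
      rw [hg1]; field_simp; ring
    rw [e, abs_neg, abs_mul, abs_mul, abs_of_nonneg hu0, abs_of_nonneg (by linarith : 0 ≤ 1 - u)]
    have : (1 - u) * |R.eval u - g u| ≤ η := by nlinarith
    nlinarith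
  · have hg1 : g u = -(1 / u) := by
      simp only [hg, hφb u hu]
      rw [max_eq_left (by linarith)]; simp
    have hne : u ≠ 0 := by linarith
    have e : (1 - u) * (1 + u * R.eval u) = (1 - u) * (u * (R.eval u - g u)) := by
      rw [hg1]; field_simp; ring
    rw [e, abs_mul, abs_mul, abs_of_nonneg hu0, abs_of_nonneg (by linarith : 0 ≤ 1 - u)]
    have : u * |R.eval u - g u| ≤ η := by nlinarith
    nlinarith

lemma sum_abs_indicator_sub_div_le {h η : ℝ} (hh : 0 < h) (hh' : h ≤ 1 / 4) (hη : 0 < η)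
    {W : Polynomial ℝ} (hW : ∀ u : ℝ, 0 ≤ u → u ≤ 1 → |(1 - u) * W.eval u| ≤ 8 ∧
      (u ≤ exp (-(1 + h)) → |1 - (1 - u) * W.eval u| ≤ η * u) ∧
      (exp (-(1 - h)) ≤ u → |(1 - u) * W.eval u| ≤ η * (1 - u)))
    {L : ℝ} (hL : 13 ≤ L) {S : Finset ℕ} (hS : ∀ p ∈ S, p.Prime) :
    ∑ p ∈ S, |(if L < log p then 1 else 0) -
      (1 - exp (-(log p / L))) * W.eval (exp (-(log p / L)))| / p ≤ 6 * η + 9 * (3 * h + 18 / L) := by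
  have hL0 : 0 < L := by linarith
  have hpt : ∀ p ∈ S, |(if L < log p then 1 else 0) -
      (1 - exp (-(log p / L))) * W.eval (exp (-(log p / L)))| / p ≤ η * (cutoffWeight L p / p) +
      9 * (if (1 - h) * L < log p ∧ log p ≤ (1 + h) * L then 1 / (p : ℝ) else 0) := by
    intro p hp
    have hp0 : (0 : ℝ) < p := mod_cast (hS p hp).pos
    set τ := log p / L with hτ
    have hlog : log p = τ * L := by rw [hτ]; field_simp
    have hτ0 : 0 ≤ τ := by positivity
    obtain ⟨q1, q2, q3⟩ := hW _ (exp_pos (-τ)).le (exp_le_one_iff.2 (by linarith))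
    have hw0 : 0 ≤ cutoffWeight L p := by
      rw [cutoffWeight]; split_ifs <;> positivity
    rcases le_or_gt (log p) ((1 - h) * L) with c1 | c1
    · have e1 : ¬ L < log p := by nlinarith
      rw [if_neg e1, if_neg (fun h => absurd h.1 (not_lt.2 c1)), zero_sub, abs_neg, mul_zero, add_zero,
        ← mul_div_assoc]
      refine div_le_div_of_nonneg_right ?_ hp0.le
      have c2 : τ ≤ 1 - h := by rw [hτ, div_le_iff₀ hL0]; exact c1
      refine (q3 (by gcongr)).trans ?_
      rw [cutoffWeight, if_pos (not_lt.1 e1), ← hτ]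
      have := add_one_le_exp (-τ)
      exact mul_le_mul_of_nonneg_left (by linarith) hη.le
    rcases le_or_gt (log p) ((1 + h) * L) with c2 | c2
    · rw [if_pos (⟨c1, c2⟩ : _ ∧ _), mul_one_div]
      have : |(if L < log p then 1 else 0) - (1 - exp (-τ)) * W.eval (exp (-τ))| ≤ 9 := by
        refine (abs_sub _ _).trans ?_
        have : |(if L < log p then (1 : ℝ) else 0)| ≤ 1 := by split_ifs <;> simp
        linarith
      have h2 := div_le_div_of_nonneg_right this hp0.le
      have : 0 ≤ η * (cutoffWeight L p / p) := by positivity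
      linarith
    · have e1 : L < log p := by nlinarith
      rw [if_pos e1, if_neg (fun h => absurd h.2 (not_le.2 c2)), mul_zero, add_zero,
        ← mul_div_assoc]
      refine div_le_div_of_nonneg_right ?_ hp0.le
      have c3 : 1 + h ≤ τ := by rw [hτ, le_div_iff₀ hL0]; exact c2.le
      rw [cutoffWeight, if_neg (not_le.2 e1)]
      exact q2 (by gcongr)
  refine (sum_le_sum hpt).trans ?_
  rw [sum_add_distrib, ← mul_sum, ← mul_sum, ← sum_filter]
  have s1 := sum_cutoffWeight_div_le hL hS
  have s2 := sum_window_le hL hh hh' (S := S.filter fun p : ℕ => (1 - h) * L < log p ∧ log p ≤ (1 + h) * L)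
    (fun p hp => hS p (mem_filter.1 hp).1) (fun p hp => (mem_filter.1 hp).2)
  nlinarith

lemma term_mul_exp_pow (a : ℕ → ℂ) (α L : ℝ) (j n : ℕ) :
    LSeries.term a (1 + α) n * ((exp (-(log n / L)) ^ j : ℝ) : ℂ) =
      LSeries.term a (1 + ((α + j / L : ℝ) : ℂ)) n := by
  rcases eq_or_ne n 0 with rfl | hn
  · simp
  · have hn0 : (n : ℂ) ≠ 0 := Nat.cast_ne_zero.2 hn
    have h1 : LSeries.term a (1 + ((α + j / L : ℝ) : ℂ)) n =
        a n / Complex.exp (Complex.log n * (1 + ((α + j / L : ℝ) : ℂ))) := by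
      rw [LSeries.term_of_ne_zero hn, Complex.cpow_def_of_ne_zero hn0]
    have h2 : LSeries.term a (1 + α) n = a n / Complex.exp (Complex.log n * (1 + α)) := by
      rw [LSeries.term_of_ne_zero hn, Complex.cpow_def_of_ne_zero hn0]
    rw [h1, h2, ← exp_nat_mul, Complex.ofReal_exp, div_mul_eq_mul_div,
      div_eq_div_iff (Complex.exp_ne_zero _) (Complex.exp_ne_zero _), mul_assoc, ← Complex.exp_add,
      ← Complex.natCast_log]
    congr 2
    push_cast
    ring

lemma hasSum_term_mul_polynomial {a : ℕ → ℂ} (ha : ∀ n, ‖a n‖ ≤ 1) (W : Polynomial ℝ) {α L : ℝ}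
    (hα : 0 < α) (hL : 0 < L) : HasSum (fun n : ℕ => LSeries.term a (1 + α) n *
        (((1 - exp (-(log n / L))) * W.eval (exp (-(log n / L))) : ℝ) : ℂ))
      (∑ j ∈ range (W.natDegree + 1), (W.coeff j : ℂ) * (LSeries a (1 + ((α + (j : ℕ) / L : ℝ) : ℂ))
        - LSeries a (1 + ((α + (j + 1 : ℕ) / L : ℝ) : ℂ)))) := by
  have hs : ∀ β : ℝ, 0 < β → HasSum (LSeries.term a (1 + β)) (LSeries a (1 + β)) := fun β hβ =>
    (LSeriesSummable_of_bounded_of_one_lt_re (m := 1) (fun n _ => ha n) (by simp [hβ])).LSeriesHasSum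
  have key : ∀ n : ℕ, LSeries.term a (1 + α) n *
        (((1 - exp (-(log n / L))) * W.eval (exp (-(log n / L))) : ℝ) : ℂ) =
      ∑ j ∈ range (W.natDegree + 1), (W.coeff j : ℂ) *
      (LSeries.term a (1 + ((α + j / L : ℝ) : ℂ)) n -
        LSeries.term a (1 + ((α + (j + 1 : ℕ) / L : ℝ) : ℂ)) n) := fun n => by
    simp_rw [← term_mul_exp_pow]
    rw [Polynomial.eval_eq_sum_range]
    push_cast
    rw [mul_sum, mul_sum]
    exact sum_congr rfl fun j _ => by ring
  rw [funext key]
  exact hasSum_sum (fun j _ => HasSum.mul_left _ (HasSum.sub (hs (α + j / L) (by positivity)) (hs (α + (j + 1 : ℕ) / L) (by positivity))))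

/-- If the Dirichlet series over primes is Lipschitz near `1`, its tails are small. -/
lemma exists_norm_tail_lSeries_le {ε : ℝ} (hε : 0 < ε) : ∃ K : ℝ, 13 ≤ K ∧ ∀ L C₁ : ℝ, 0 ≤ C₁ →
    K ≤ L → K * C₁ ≤ L → ∀ a : ℕ → ℂ, (∀ n, ‖a n‖ ≤ 1) → (∀ n, ¬ n.Prime → a n = 0) →
    (∀ α β : ℝ, 0 < α → α ≤ β → β ≤ 3 → ‖LSeries a (1 + α) - LSeries a (1 + β)‖ ≤ C₁ * (β - α)) →
    ∀ α : ℝ, 0 < α → α ≤ 1 → ‖LSeries (fun n => if L < log n then a n else 0) (1 + α)‖ ≤ ε := by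
  set h : ℝ := min (1 / 4) (ε / 108) with hhdef
  set η : ℝ := min 1 (ε / 24) with hηdef
  have hh : 0 < h := by positivity
  have hη : 0 < η := by positivity
  have hh' : h ≤ 1 / 4 := min_le_left _ _
  have hhe : h ≤ ε / 108 := min_le_right _ _
  have hηe : η ≤ ε / 24 := min_le_right _ _
  obtain ⟨W, hW⟩ := exists_cutoff_polynomial hh hh' hη (min_le_left _ _)
  set d := W.natDegree with hd
  set B : ℝ := ∑ j ∈ range (d + 1), |W.coeff j| with hB
  refine ⟨13 + (d + 1) + 648 / ε + 4 * B / ε, by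
    have : 0 ≤ (d + 1) + 648 / ε + 4 * B / ε := by positivity
    linarith, ?_⟩
  intro L C₁ hC₁ hKL hKC a ha hap hLip α hα hα1
  have p1 : 0 ≤ 648 / ε := by positivity
  have p2 : 0 ≤ 4 * B / ε := by positivity
  have hL : 13 ≤ L := by linarith
  have hL0 : 0 < L := by linarith
  have hdL : (d + 1 : ℝ) / L ≤ 1 := by rw [div_le_one hL0]; linarith
  set Q : ℕ → ℝ := fun n => (1 - exp (-(log n / L))) * W.eval (exp (-(log n / L))) with hQ
  have hQsum := hasSum_term_mul_polynomial ha W hα hL0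
  have hmain : ‖∑ j ∈ range (d + 1), (W.coeff j : ℂ) *
        (LSeries a (1 + ((α + j / L : ℝ) : ℂ)) - LSeries a (1 + ((α + (j + 1 : ℕ) / L : ℝ) : ℂ)))‖ ≤ ε / 4 := by
    refine (norm_sum_le _ _).trans ?_
    have : ∀ j ∈ range (d + 1), ‖(W.coeff j : ℂ) *
        (LSeries a (1 + ((α + j / L : ℝ) : ℂ)) - LSeries a (1 + ((α + (j + 1 : ℕ) / L : ℝ) : ℂ)))‖ ≤
        |W.coeff j| * (C₁ / L) := fun j hj => by
      rw [norm_mul, norm_real]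
      refine mul_le_mul_of_nonneg_left ?_ (abs_nonneg _)
      have hj2 : ((j + 1 : ℕ) : ℝ) / L ≤ 1 := (div_le_div_of_nonneg_right (by exact_mod_cast mem_range.1 hj) hL0.le).trans hdL
      refine (hLip _ _ ((fun j => by positivity) j) ?_ ?_).trans (le_of_eq ?_)
      · push_cast
        have : j / L ≤ (j + 1) / L := by gcongr; linarith
        linarith
      · linarith
      · push_cast; field_simp; ring
    refine (sum_le_sum this).trans ?_
    rw [← sum_mul, ← hB, ← mul_div_assoc, div_le_iff₀ hL0]
    have h5 : 4 * B / ε * C₁ ≤ L := by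
      refine le_trans ?_ hKC
      refine mul_le_mul_of_nonneg_right ?_ hC₁
      linarith
    rw [div_mul_eq_mul_div, div_le_iff₀ hε] at h5
    linarith
  have hcut : LSeriesHasSum (fun n => if L < log n then a n else 0) (1 + α)
      (LSeries (fun n => if L < log n then a n else 0) (1 + α)) :=
    (LSeriesSummable_of_bounded_of_one_lt_re (m := 1) (fun n _ => by
      split_ifs
      · exact ha n
      · simp) (by simp [hα])).LSeriesHasSum
  have hdiff := HasSum.sub hcut hQsum
  have hlim := hdiff.tendsto_sum_nat.norm
  have hbd : ‖LSeries (fun n => if L < log n then a n else 0) (1 + α) -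
      (∑ j ∈ range (d + 1), (W.coeff j : ℂ) *
        (LSeries a (1 + ((α + j / L : ℝ) : ℂ)) - LSeries a (1 + ((α + (j + 1 : ℕ) / L : ℝ) : ℂ))))‖ ≤ 3 * ε / 4 := by
    refine le_of_tendsto hlim (Filter.Eventually.of_forall fun N => ?_)
    refine (norm_sum_le _ _).trans ?_
    have hS : ∀ p ∈ (range N).filter Nat.Prime, p.Prime := fun p hp => (mem_filter.1 hp).2
    have h1 := sum_abs_indicator_sub_div_le hh hh' hη hW hL hS
    have h2 : 6 * η + 9 * (3 * h + 18 / L) ≤ 3 * ε / 4 := by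
      have : 18 / L ≤ ε / 36 := by
        have : 648 / ε ≤ L := by linarith
        rw [div_le_iff₀ hε] at this
        rw [div_le_div_iff₀ hL0 (by norm_num)]; linarith
      linarith
    refine le_trans ?_ (h1.trans h2)
    rw [sum_filter]
    refine sum_le_sum fun n _ => ?_
    by_cases hn : n.Prime
    · rw [if_pos hn]
      have hn0 := hn.ne_zero
      have e : LSeries.term (fun n => if L < log n then a n else 0) (1 + α) n -
          LSeries.term a (1 + α) n * (Q n : ℂ) =
          LSeries.term a (1 + α) n * (((if L < log n then 1 else 0) - Q n : ℝ) : ℂ) := by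
        rw [LSeries.term_of_ne_zero hn0, LSeries.term_of_ne_zero hn0]
        split_ifs <;> push_cast <;> ring
      rw [e, norm_mul, norm_real, norm_eq_abs, mul_comm, div_eq_mul_one_div]
      refine mul_le_mul_of_nonneg_left ?_ (abs_nonneg _)
      rw [LSeries.norm_term_eq, if_neg hn0]
      have hn1 : (1 : ℝ) ≤ n := mod_cast hn.one_lt.le
      have hre : (1 + α : ℂ).re = 1 + α := by simp
      rw [hre]
      have : (n : ℝ) ≤ n ^ (1 + α) := by
        conv_lhs => rw [← rpow_one n]
        exact rpow_le_rpow_of_exponent_le hn1 (by linarith)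
      exact div_le_div₀ zero_le_one (ha n) (by linarith) this
    · rw [if_neg hn]
      have e := hap n hn
      have e1 : LSeries.term (fun n => if L < log n then a n else 0) (1 + α) n = 0 := by
        simp [LSeries.term, e]
      have e2 : LSeries.term a (1 + α) n = 0 := by simp [LSeries.term, e]
      rw [e1, e2]; simp
  have := norm_le_norm_add_norm_sub' (LSeries (fun n => if L < log n then a n else 0) (1 + α))
    (∑ j ∈ range (d + 1), (W.coeff j : ℂ) *
        (LSeries a (1 + ((α + j / L : ℝ) : ℂ)) - LSeries a (1 + ((α + (j + 1 : ℕ) / L : ℝ) : ℂ))))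
  linarith
end

section
open ArithmeticFunction hiding log

lemma changeLevel_natCast {n m : ℕ} (hm : n ∣ m) (χ : DirichletCharacter ℂ n) {k : ℕ}
    (hk : k.Coprime m) : changeLevel hm χ (k : ZMod m) = χ (k : ZMod n) := by
  have := changeLevel_eq_cast_of_dvd' χ hm (a := (k : ℤ)) (Nat.isCoprime_iff_coprime.2 hk)
  simpa using this

lemma coprime_prod_primesUpTo_iff {w : ℝ} {n : ℕ} :
    n.Coprime (∏ p ∈ primesUpTo w, p) ↔ ∀ p ∈ primesUpTo w, ¬ p ∣ n := by
  rw [Nat.coprime_prod_right_iff]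
  refine forall₂_congr fun p hp => ?_
  rw [Nat.coprime_comm, (prime_of_mem_primesUpTo hp).coprime_iff_not_dvd]

lemma sum_changeLevel_eq {w t : ℝ} (ht : 1 ≤ t) {N M : ℕ} (hM : M = ∏ p ∈ primesUpTo w, p)
    (h : N ∣ M) (χ : DirichletCharacter ℂ N) :
    ∑ n ∈ Icc 1 ⌊t⌋₊, changeLevel h χ (n : ZMod M) =
      1 + ∑ n ∈ roughIn w t, χ n := by
  rw [← insert_Icc_add_one_left_eq_Icc (Nat.one_le_floor_iff _ |>.2 ht), sum_insert (by simp)]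
  congr 1
  · simp
  · rw [roughIn, sum_filter]
    refine sum_congr rfl fun n _ => ?_
    split_ifs with hn
    · refine changeLevel_natCast h χ ?_
      rw [hM]; exact coprime_prod_primesUpTo_iff.2 hn
    · refine MulChar.map_nonunit _ ?_
      rwa [ZMod.isUnit_iff_coprime, hM, coprime_prod_primesUpTo_iff]

lemma eventually_isRoughFamily {δ : ℝ} (hδ : 0 < δ) (hδ' : δ ≤ 1 / 14) :
    ∀ᶠ x : ℝ in atTop, ∀ N : ℕ, N = ∏ p ∈ primesUpTo x, p →
      ∀ M : ℕ, M = ∏ p ∈ primesUpTo (exp (δ * Chebyshev.theta x)), p → ∀ h : N ∣ M,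
        IsRoughFamily (changeLevel (R := ℂ) h).range (2 * exp 13)
          (1 / (2 * (δ * Chebyshev.theta x))) := by
  obtain ⟨w₁, hw₁, hA⟩ := exists_abs_card_roughIn_sub_le
  obtain ⟨w₂, hw₂⟩ := eventually_atTop.1 eventually_prod_primesUpTo_le
  filter_upwards [eventually_norm_sum_roughIn_le hδ hδ', eventually_half_le_theta,
    eventually_ge_atTop (2 * (max (log w₁) (log w₂) + 1) / δ)] with x hx hθ hxb
  intro N hN M hM h
  set Θ := δ * Chebyshev.theta x with hΘ
  set z := exp Θ with hz
  have hlog : log z = Θ := log_exp _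
  have hΘb : max (log w₁) (log w₂) + 1 ≤ Θ := by
    rw [div_le_iff₀ hδ] at hxb
    nlinarith
  have hl1 : 0 ≤ log w₁ := log_nonneg (by linarith)
  have hΘ1 : 1 ≤ Θ := by linarith [le_max_left (log w₁) (log w₂)]
  have hz1 : w₁ ≤ z := by
    refine (log_le_iff_le_exp (by linarith)).1 ?_
    linarith [le_max_left (log w₁) (log w₂)]
  have hz2 : w₂ ≤ z := by
    rcases le_or_gt w₂ 0 with h0 | h0
    · exact h0.trans (exp_pos _).le
    · refine (log_le_iff_le_exp h0).1 ?_
      linarith [le_max_right (log w₁) (log w₂)]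
  have hform : ∀ t : ℝ, 1 ≤ t → exp 13 * (t / log z) * exp (-(1 / 2 * (log t / log z))) ≤
      2 * exp 13 * (1 / (2 * Θ)) * t ^ (1 - 1 / (2 * Θ)) := fun t ht => by
    rw [hlog, rpow_sub (by linarith), rpow_one, rpow_def_of_pos (x := t) (by linarith),
      exp_neg, ← div_eq_mul_inv]
    have : log t * (1 / (2 * Θ)) = 1 / 2 * (log t / Θ) := by field_simp
    rw [this]
    refine le_of_eq ?_
    field_simp
  refine ⟨?_, by positivity, (by rw [div_le_one (by positivity)]; linarith), ⟨∏ p ∈ primesUpTo z, (1 - 1 / p), ?_, ?_, ?_⟩, ?_⟩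
  · have := add_one_le_exp 13; linarith
  · exact prod_nonneg fun p hp => (one_sub_one_div_mem (prime_of_mem_primesUpTo hp)).1
  · refine (hw₂ z hz2).trans (le_of_eq ?_)
    rw [hlog]; field_simp
  · intro t ht
    have e := sum_changeLevel_eq ht hM (one_dvd M) 1
    rw [map_one] at e
    rw [summatoryError, e]
    have e2 : ∑ n ∈ roughIn z t, (1 : DirichletCharacter ℂ 1) n = ((roughIn z t).card : ℂ) := by
      rw [sum_congr rfl fun n _ => MulChar.one_apply (isUnit_of_subsingleton _)]
      simp
    rw [e2]
    refine le_trans (le_of_eq ?_) ((hA z hz1 t ht).trans (hform t ht))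
    rw [← norm_eq_abs, ← norm_real]
    congr 1
    push_cast
    ring
  · rintro χ ⟨ψ, rfl⟩ hχ t ht
    rw [summatoryError, sum_changeLevel_eq ht hM h ψ]
    refine le_trans (le_of_eq ?_) ((hx N hN ψ (fun h0 => hχ (by rw [h0, map_one])) z rfl t ht).trans
      (hform t ht))
    congr 1
    push_cast
    ring

/-- The Dirichlet series of a character over the primes `p` with `L < log p`. -/
noncomputable def primeTail (L : ℝ) {M : ℕ} (χ : DirichletCharacter ℂ M) (s : ℂ) : ℂ :=
  LSeries (fun n : ℕ => if L < log n then if n.Prime then χ n else 0 else 0) s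

lemma exists_norm_lSeries_logMul_le : ∃ K₀ : ℝ, 0 ≤ K₀ ∧ ∀ {M : ℕ} (χ : DirichletCharacter ℂ M)
    {s : ℂ}, 1 < s.re → ‖LSeries (LSeries.logMul fun n : ℕ => if n.Prime then χ n else 0) s‖ ≤
      ‖deriv (charSeries χ) s‖ / ‖charSeries χ s‖ + K₀ := by
  have hg := vonMangoldt.summable_residueClass_non_primes_div (a := (0 : ZMod 1))
  set g : ℕ → ℝ := fun n => (if n.Prime then 0 else
    vonMangoldt.residueClass (0 : ZMod 1) n) / n with hgdef
  have hg0 : ∀ n, 0 ≤ g n := fun n => by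
    simp only [hgdef]
    split_ifs
    · simp
    · exact div_nonneg (vonMangoldt.residueClass_nonneg _ _) (Nat.cast_nonneg _)
  refine ⟨∑' n, g n, tsum_nonneg hg0, fun {M} χ {s} hs => ?_⟩
  set a : ℕ → ℂ := fun n : ℕ => if n.Prime then χ n else 0 with ha
  have ha1 : ∀ n, ‖a n‖ ≤ 1 := fun n => by
    simp only [ha]
    split_ifs
    · exact χ.norm_le_one _
    · simp
  have habs : LSeries.abscissaOfAbsConv a < s.re := by
    refine lt_of_le_of_lt (LSeries.abscissaOfAbsConv_le_one_of_isBigO_one ?_) (mod_cast hs)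
    exact Asymptotics.isBigO_of_le _ fun n => by simpa using ha1 n
  have h1 := (LSeriesSummable_logMul_of_lt_re habs).LSeriesHasSum
  have h2 := (DirichletCharacter.LSeriesSummable_twist_vonMangoldt χ hs).LSeriesHasSum
  have h3 := HasSum.sub h2 h1
  have hb : ‖LSeries ((fun n : ℕ => χ n) * fun n : ℕ => (vonMangoldt n : ℂ)) s -
      LSeries (LSeries.logMul a) s‖ ≤ ∑' n, g n := by
    rw [← h3.tsum_eq]
    refine tsum_of_norm_bounded hg.hasSum fun n => ?_
    rcases eq_or_ne n 0 with rfl | hn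
    · simpa using hg0 0
    rw [LSeries.term_of_ne_zero hn, LSeries.term_of_ne_zero hn, ← sub_div]
    by_cases hp : n.Prime
    · have : LSeries.logMul a n = χ n * (vonMangoldt n : ℂ) := by
        rw [LSeries.logMul, vonMangoldt_apply_prime hp, Complex.natCast_log]
        simp [ha, hp, mul_comm]
      rw [this]
      simpa using hg0 n
    · have : LSeries.logMul a n = 0 := by simp [LSeries.logMul, ha, hp]
      rw [this, sub_zero, norm_div, Complex.norm_natCast_cpow_of_pos (Nat.pos_of_ne_zero hn)]
      simp only [hgdef, if_neg hp]
      have hn1 : (1 : ℝ) ≤ n := mod_cast Nat.one_le_iff_ne_zero.2 hn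
      refine div_le_div₀ (vonMangoldt.residueClass_nonneg _ _) ?_ (by linarith) ?_
      · have : vonMangoldt.residueClass (0 : ZMod 1) n =
            vonMangoldt n := by
          simp [vonMangoldt.residueClass, Set.indicator, Subsingleton.elim (n : ZMod 1) 0]
        rw [this]
        simp only [Pi.mul_apply, norm_mul, norm_real,
          norm_of_nonneg vonMangoldt_nonneg]
        exact mul_le_of_le_one_left vonMangoldt_nonneg (χ.norm_le_one _)
      · conv_lhs => rw [← rpow_one n]
        exact rpow_le_rpow_of_exponent_le hn1 hs.le
  rw [DirichletCharacter.LSeries_twist_vonMangoldt_eq χ hs] at hb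
  have := norm_le_norm_add_norm_sub (LSeries (LSeries.logMul a) s) (-deriv (LSeries fun n : ℕ => χ n) s /
    LSeries (fun n : ℕ => χ n) s)
  rw [norm_div, norm_neg] at this
  change _ ≤ ‖deriv (LSeries fun n : ℕ => χ n) s‖ / ‖LSeries (fun n : ℕ => χ n) s‖ + _
  rw [norm_sub_rev] at hb
  have t2 := norm_le_norm_add_norm_sub' (LSeries (LSeries.logMul a) s)
    (-deriv (LSeries fun n : ℕ => χ n) s / LSeries (fun n : ℕ => χ n) s)
  rw [norm_div, norm_neg] at t2
  linarith

/-- A bound for the logarithmic derivative gives small tails of the sum over primes. -/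
lemma exists_norm_primeTail_le {ε : ℝ} (hε : 0 < ε) : ∃ K : ℝ, 13 ≤ K ∧ ∀ L C₁ : ℝ, 0 ≤ C₁ →
    K ≤ L → K * C₁ ≤ L → ∀ {M : ℕ} (χ : DirichletCharacter ℂ M) (t : ℝ),
    (∀ a : ℝ, 0 < a → a ≤ 3 → ‖deriv (charSeries χ) (1 + a + I * t)‖ ≤
      C₁ * ‖charSeries χ (1 + a + I * t)‖) →
    ∀ α : ℝ, 0 < α → α ≤ 1 → ‖primeTail L χ (1 + α + I * t)‖ ≤ ε := by
  obtain ⟨K₀, hK₀, hlog⟩ := exists_norm_lSeries_logMul_le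
  obtain ⟨K, hK, h⟩ := exists_norm_tail_lSeries_le hε
  refine ⟨K * (2 + K₀) * 2, by nlinarith, fun L C₁ hC₁ hL hLC M χ t hd α hα hα1 => ?_⟩
  set a : ℕ → ℂ := fun n : ℕ => if n.Prime then χ n else 0 with ha
  have ha1 : ∀ n, ‖a n‖ ≤ 1 := fun n => by
    simp only [ha]
    split_ifs
    · exact χ.norm_le_one _
    · simp
  set b : ℕ → ℂ := fun n => a n / n ^ (I * t) with hb
  have hterm : ∀ (c : ℕ → ℂ) β, LSeries (fun n => c n / n ^ (I * t)) (1 + β) =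
      LSeries c (1 + β + I * t) := fun c β => by
    refine tsum_congr fun n => ?_
    rcases eq_or_ne n 0 with rfl | hn
    · simp
    rw [LSeries.term_of_ne_zero hn, LSeries.term_of_ne_zero hn,
      Complex.cpow_add (1 + β) _ (Nat.cast_ne_zero.2 hn), div_div, mul_comm]
  have hb1 : ∀ n, ‖b n‖ ≤ 1 := fun n => by
    rcases eq_or_ne n 0 with rfl | hn
    · simp [hb, ha, Nat.not_prime_zero]
    rw [hb, norm_div, Complex.norm_natCast_cpow_of_pos (Nat.pos_of_ne_zero hn)]
    simpa using ha1 n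
  have hK0 : 0 ≤ K := by linarith
  have p1 := mul_nonneg hK0 hC₁
  have p2 := mul_nonneg hK0 hK₀
  have p3 := mul_nonneg p2 hC₁
  have key := h L (C₁ + K₀) (by linarith) (by nlinarith) (by nlinarith) b hb1
    (fun n hn => by simp [hb, ha, hn]) ?_ α hα hα1
  · have e : (fun n : ℕ => if L < log n then b n else 0) =
        fun n : ℕ => (if L < log n then a n else 0) / n ^ (I * t) := by
      funext n
      split_ifs <;> simp [hb]
    rw [e, hterm] at key
    exact key
  intro β β' hβ hββ hβ3
  rw [hterm, hterm, norm_sub_rev]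
  have hre : ∀ u : ℝ, 0 < u → 1 < (1 + u + I * t : ℂ).re := fun u hu => one_lt_re_one_add_add hu t
  have habs : ∀ u : ℝ, 0 < u → LSeries.abscissaOfAbsConv a < (1 + u + I * t : ℂ).re := fun u hu => by
    refine lt_of_le_of_lt (LSeries.abscissaOfAbsConv_le_one_of_isBigO_one ?_) (mod_cast hre u hu)
    exact Asymptotics.isBigO_of_le _ fun n => by simpa using ha1 n
  have hder : ∀ u : ℝ, 0 < u → HasDerivAt (fun u : ℝ => LSeries a (1 + u + I * t))
      (-LSeries (LSeries.logMul a) (1 + u + I * t)) u := fun u hu => by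
    have h1 : HasDerivAt (fun u : ℝ => (1 + u + I * t : ℂ)) 1 u := by
      simpa using ((Complex.ofRealCLM.hasDerivAt (x := u)).const_add 1).add_const (I * t)
    have := (LSeries_hasDerivAt (habs u hu)).comp u h1
    simpa [Function.comp_def] using this
  have := (convex_Icc β β').norm_image_sub_le_of_norm_hasDerivWithin_le (C := C₁ + K₀)
    (fun u hu => (hder u (by linarith [hu.1])).hasDerivWithinAt) (fun u hu => ?_)
    (Set.left_mem_Icc.2 hββ) (Set.right_mem_Icc.2 hββ)
  · rwa [norm_of_nonneg (by linarith)] at this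
  · have hu0 : 0 < u := by linarith [hu.1]
    rw [norm_neg]
    refine (hlog χ (hre u hu0)).trans ?_
    have hne : 0 < ‖charSeries χ (1 + u + I * t)‖ :=
      norm_pos_iff.2 (DirichletCharacter.LSeries_ne_zero_of_one_lt_re χ (hre u hu0))
    have := hd u hu0 (hu.2.trans hβ3)
    rw [← div_le_iff₀ hne] at this
    linarith
end

lemma primeTail_changeLevel {n m : ℕ} (h : n ∣ m) (χ : DirichletCharacter ℂ n) {L : ℝ}
    (hL : ∀ p : ℕ, p.Prime → L < log p → ¬ p ∣ m) (s : ℂ) :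
    primeTail L (changeLevel h χ) s = primeTail L χ s := by
  rw [primeTail, primeTail]
  congr 1
  funext k
  split_ifs with h1 h2
  · exact changeLevel_natCast h χ ((h2.coprime_iff_not_dvd).2 (hL k h2 h1))
  · rfl
  · rfl

lemma exists_norm_primeTail_le_of_level {ε : ℝ} (hε : 0 < ε) (M : ℕ) [NeZero M] (T : ℝ) :
    ∃ L₀ : ℝ, ∀ χ : DirichletCharacter ℂ M, χ ≠ 1 → ∀ L : ℝ, L₀ ≤ L → ∀ t : ℝ, |t| ≤ T →
      ∀ α : ℝ, 0 < α → α ≤ 1 → ‖primeTail L χ (1 + α + I * t)‖ ≤ ε := by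
  obtain ⟨K, hK, h⟩ := exists_norm_primeTail_le hε
  have key : ∀ χ : DirichletCharacter ℂ M, ∃ L₀ : ℝ, χ ≠ 1 → ∀ L : ℝ, L₀ ≤ L → ∀ t : ℝ, |t| ≤ T →
      ∀ α : ℝ, 0 < α → α ≤ 1 → ‖primeTail L χ (1 + α + I * t)‖ ≤ ε := fun χ => by
    by_cases hχ : χ = 1
    · exact ⟨0, fun h => absurd hχ h⟩
    have hcts : ContinuousOn (fun u : ℝ × ℝ =>
        deriv (DirichletCharacter.LFunction χ) (1 + u.1 + I * u.2) /
          DirichletCharacter.LFunction χ (1 + u.1 + I * u.2))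
        (Set.Icc 0 3 ×ˢ Set.Icc (-T) T) := by
      have hmap : Continuous fun u : ℝ × ℝ => (1 + u.1 + I * u.2 : ℂ) := by fun_prop
      have hdiff := differentiable_LFunction hχ
      refine ContinuousOn.div ?_ (hdiff.continuous.comp hmap).continuousOn fun u hu => ?_
      · exact ((hdiff.contDiff (n := 1)).continuous_deriv le_rfl |>.comp hmap).continuousOn
      · exact DirichletCharacter.LFunction_ne_zero_of_one_le_re χ (Or.inl hχ) (by
          have := hu.1.1
          simpa using this)
    obtain ⟨C₁, hC₁⟩ := (isCompact_Icc.prod isCompact_Icc).exists_bound_of_continuousOn hcts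
    refine ⟨max K (K * |C₁|), fun _ L hL t ht α hα hα1 => h L |C₁| (abs_nonneg _)
      ((le_max_left _ _).trans hL) ((le_max_right _ _).trans hL) χ t (fun a ha ha3 => ?_) α hα hα1⟩
    have hre := one_lt_re_one_add_add ha t
    have e1 : charSeries χ (1 + a + I * t) =
        DirichletCharacter.LFunction χ (1 + a + I * t) :=
      (DirichletCharacter.LFunction_eq_LSeries χ hre).symm
    have e2 : deriv (charSeries χ) (1 + a + I * t) =
        deriv (DirichletCharacter.LFunction χ) (1 + a + I * t) :=
      (deriv_LFunction_eq_deriv_LSeries χ hre).symm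
    have := (hC₁ (a, t) ⟨⟨ha.le, ha3⟩, abs_le.1 ht⟩).trans (le_abs_self C₁)
    rw [norm_div, div_le_iff₀ (norm_pos_iff.2 (DirichletCharacter.LFunction_ne_zero_of_one_le_re χ (Or.inl hχ) hre.le))] at this
    rwa [e1, e2]
  choose L hL using key
  obtain ⟨L₀, hL₀⟩ := (Set.finite_range L).bddAbove
  exact ⟨L₀, fun χ hχ L' hL' => hL χ hχ L' ((hL₀ ⟨χ, rfl⟩).trans hL')⟩

lemma IsRoughFamily.norm_deriv_charSeries_le {M : ℕ} {G : Subgroup (DirichletCharacter ℂ M)} {C l : ℝ}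
    (h : IsRoughFamily G C l) {χ : DirichletCharacter ℂ M} (hχ : χ ∈ G) (hχ1 : χ ≠ 1) {a : ℝ}
    (ha : 0 < a) (ha3 : a ≤ 3) (t : ℝ) :
    ‖deriv (charSeries χ) (1 + a + I * t)‖ ≤ (17 + 4 * |t|) * C / l := by
  have h1 := h.one_le
  have h2 := h.pos
  refine norm_deriv_le_of_lip' (by positivity) ?_
  filter_upwards [((isOpen_lt continuous_const Complex.continuous_re).mem_nhds (one_lt_re_one_add_add ha t))] with w hw
  have e : 1 + ((w.re - 1 : ℝ) : ℂ) + I * (w.im : ℝ) = w := by apply Complex.ext <;> simp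
  have key := h.norm_charSeries_sub_le hχ hχ1 ha ha3 t (a' := w.re - 1) (by linarith) w.im
  rw [e] at key
  exact key.trans_eq (mul_comm _ _)

lemma conductor_not_dvd_of_squarefree {N p q : ℕ} (hN : Squarefree N) (hp : p.Prime) (hq : q * p = N)
    (χ : DirichletCharacter ℂ q) : ¬ p ∣ (changeLevel (Dvd.intro p hq) χ).conductor := by
  have : NeZero N := ⟨hN.ne_zero⟩
  intro h
  have h1 := (mem_conductorSet_iff_conductor_dvd _ (Dvd.intro p hq)).1
    (changeLevel_factorsThrough χ (Dvd.intro p hq))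
  have h2 := h.trans h1
  exact hp.one_lt.ne' (Nat.isUnit_iff.1 (hN p (hq ▸ Nat.mul_dvd_mul_right h2 p)))

lemma squarefree_prod_primesUpTo (x : ℝ) : Squarefree (∏ p ∈ primesUpTo x, p) := by
  refine squarefree_prod_of_pairwise_isCoprime (fun p hp q hq hpq => ?_) fun p hp =>
    (prime_of_mem_primesUpTo hp).prime.squarefree
  exact Nat.coprime_iff_isRelPrime.1
    ((Nat.coprime_primes (prime_of_mem_primesUpTo hp) (prime_of_mem_primesUpTo hq)).2 hpq)

/-- After removing at most one prime from the modulus, all prime sums twisted by nontrivial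
characters are small. -/
lemma eventually_exists_norm_primeTail_le {ε T : ℝ} (hε : 0 < ε) (hT : 0 ≤ T) :
    ∀ᶠ x : ℝ in atTop, ∃ B₀ : ℕ, (B₀ = 1 ∨ B₀.Prime ∧ (B₀ : ℝ) ≤ x ∧ 50 ≤ B₀) ∧
      ∀ q : ℕ, q * B₀ = ∏ p ∈ primesUpTo x, p → ∀ χ : DirichletCharacter ℂ q, χ ≠ 1 →
        ∀ L : ℝ, Chebyshev.theta x ≤ L → ∀ t : ℝ, |t| ≤ T → ∀ α : ℝ, 0 < α → α ≤ 1 →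
          ‖primeTail L χ (1 + α + I * t)‖ ≤ ε := by
  have hC : 1 ≤ 2 * exp 13 := by have := add_one_le_exp 13; linarith
  set C : ℝ := 2 * exp 13 with hCdef
  obtain ⟨c, hc, hpage⟩ := exists_real_unique hC
  obtain ⟨c₀, hc₀, hlower⟩ := exists_charSeries_lower hC hc hT
  obtain ⟨K, hK, htail⟩ := exists_norm_primeTail_le hε
  set Q : ℕ := ∏ p ∈ primesUpTo 49, p with hQ
  have hQ0 : NeZero Q := ⟨(squarefree_prod_primesUpTo _).ne_zero⟩
  obtain ⟨L₀, hfix⟩ := exists_norm_primeTail_le_of_level hε Q T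
  set C₂ : ℝ := (17 + 4 * T) * C / c₀ with hC₂
  set δ : ℝ := min (1 / 14) (1 / (2 * K * C₂)) with hδdef
  have hδ : 0 < δ := by positivity
  have hδ14 : δ ≤ 1 / 14 := min_le_left _ _
  have hδK : K * (C₂ * (2 * δ)) ≤ 1 := by
    have : δ ≤ 1 / (2 * K * C₂) := min_le_right _ _
    rw [le_div_iff₀ (by positivity)] at this
    linarith
  filter_upwards [eventually_isRoughFamily hδ hδ14, eventually_half_le_theta,
    eventually_two_mul_log_le (c := 2 / δ) (by positivity), eventually_ge_atTop (2 * K),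
    eventually_ge_atTop (2 * L₀), eventually_ge_atTop (2 * log 49),
    eventually_ge_atTop 100] with x hfam hθ hxlog hxK hxL₀ hx49 hx100
  set θ := Chebyshev.theta x with hθdef
  have hθ0 : 0 < θ := by linarith
  set N : ℕ := ∏ p ∈ primesUpTo x, p with hN
  set z : ℝ := exp (δ * θ) with hz
  set M : ℕ := ∏ p ∈ primesUpTo z, p with hM
  have hxz : x ≤ z := by
    rw [hz, ← log_le_iff_le_exp (by linarith)]
    rw [div_mul_eq_mul_div, div_le_iff₀ hδ] at hxlog
    nlinarith
  have hNM : N ∣ M := prod_dvd_prod_of_subset _ _ _ (primesUpTo_subset hxz)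
  have hN0 : NeZero N := ⟨(squarefree_prod_primesUpTo _).ne_zero⟩
  have hM0 : NeZero M := ⟨(squarefree_prod_primesUpTo _).ne_zero⟩
  have hNsq := squarefree_prod_primesUpTo x
  have hF := hfam N hN M hM hNM
  have hndvd : ∀ (w : ℝ) L, 1 ≤ w → log w ≤ L → ∀ p : ℕ, p.Prime → L < log p →
      ¬ p ∣ ∏ p ∈ primesUpTo w, p := fun w L hw hwL p hp hpL hd => by
    obtain ⟨r, hr, hpr⟩ := (hp.prime.dvd_finsetProd_iff _).1 hd
    have := (Nat.prime_dvd_prime_iff_eq hp (prime_of_mem_primesUpTo hr)).1 hpr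
    have h1 := le_of_mem_primesUpTo hr
    rw [← this] at h1
    have := log_le_log (by exact_mod_cast hp.pos) h1
    linarith
  have hzθ : log z ≤ θ := by rw [hz, log_exp]; nlinarith
  -- characters without small values
  have good : ∀ ψ : DirichletCharacter ℂ N, ψ ≠ 1 →
      ¬ (changeLevel hNM ψ ^ 2 = 1 ∧ ∃ a : ℝ, 0 < a ∧ a ≤ 3 ∧
        ‖charSeries (changeLevel hNM ψ) (1 + a)‖ < c) →
      ∀ L : ℝ, θ ≤ L → ∀ t : ℝ, |t| ≤ T → ∀ α : ℝ, 0 < α → α ≤ 1 →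
          ‖primeTail L ψ (1 + α + I * t)‖ ≤ ε := by
    intro ψ hψ hex L hL t ht α hα hα1
    have hψ1 : changeLevel hNM ψ ≠ 1 := fun h0 =>
      hψ ((changeLevel_eq_one_iff hNM).1 h0)
    rw [← primeTail_changeLevel hNM ψ (hndvd z L (one_le_exp (by positivity)) (hzθ.trans hL))]
    refine htail L (C₂ * (2 * δ) * θ) (by positivity) (by linarith) ?_ _ t (fun a ha ha3 => ?_) α hα hα1
    · have : K * (C₂ * (2 * δ) * θ) = K * (C₂ * (2 * δ)) * θ := by ring
      rw [this]
      exact (mul_le_of_le_one_left hθ0.le hδK).trans hL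
    · have h1 := hF.norm_deriv_charSeries_le ⟨ψ, rfl⟩ hψ1 ha ha3 t
      have h2 := hlower hF _ ⟨ψ, rfl⟩ hψ1 (fun h2 a ha ha3 => by
        by_contra! h3
        exact hex ⟨h2, a, ha, ha3, h3⟩) t ht a ha ha3
      refine h1.trans ?_
      have h3 : C₂ * (2 * δ) * θ * c₀ ≤ C₂ * (2 * δ) * θ *
          ‖charSeries (changeLevel hNM ψ) (1 + a + I * t)‖ := by gcongr
      refine le_trans ?_ h3
      rw [hC₂, div_div_eq_mul_div, div_one]
      have : (17 + 4 * T) * C / c₀ * (2 * δ) * θ * c₀ = (17 + 4 * T) * C * (2 * (δ * θ)) := by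
        field_simp
      rw [this]
      gcongr
  -- reduction to the full modulus
  have lift : ∀ (q : ℕ) (hqN : q ∣ N) (χ : DirichletCharacter ℂ q), ∀ L : ℝ, θ ≤ L → ∀ s : ℂ,
      primeTail L χ s = primeTail L (changeLevel hqN χ) s := fun q hqN χ L hL s => by
    refine (primeTail_changeLevel hqN χ (fun p hp hpL => ?_) s).symm
    refine hndvd x L (by linarith) (le_trans ?_ hL) p hp hpL
    refine le_trans (by gcongr) hzθ
  by_cases hexc : ∃ ψ : DirichletCharacter ℂ N, ψ ≠ 1 ∧
      (changeLevel hNM ψ ^ 2 = 1 ∧ ∃ a : ℝ, 0 < a ∧ a ≤ 3 ∧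
        ‖charSeries (changeLevel hNM ψ) (1 + a)‖ < c)
  swap
  · refine ⟨1, Or.inl rfl, fun q hq χ hχ L hL t ht α hα hα1 => ?_⟩
    have hqN := Dvd.intro _ hq
    rw [lift q hqN χ L hL]
    have h1 : changeLevel hqN χ ≠ 1 := fun h0 =>
      hχ ((changeLevel_eq_one_iff hqN).1 h0)
    exact good _ h1 (fun h => hexc ⟨_, h1, h⟩) L hL t ht α hα hα1
  obtain ⟨ψ₁, hψ₁, hsq, hsmall⟩ := hexc
  have huniq : ∀ ψ : DirichletCharacter ℂ N, ψ ≠ 1 →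
      (changeLevel hNM ψ ^ 2 = 1 ∧ ∃ a : ℝ, 0 < a ∧ a ≤ 3 ∧
        ‖charSeries (changeLevel hNM ψ) (1 + a)‖ < c) → ψ = ψ₁ := fun ψ hψ h => by
    refine changeLevel_injective hNM (hpage hF _ ⟨ψ, rfl⟩ _ ⟨ψ₁, rfl⟩ ?_ ?_ h.1 hsq h.2 hsmall)
    · exact fun h0 => hψ ((changeLevel_eq_one_iff hNM).1 h0)
    · exact fun h0 => hψ₁ ((changeLevel_eq_one_iff hNM).1 h0)
  by_cases hbig : ∃ p : ℕ, p.Prime ∧ 50 ≤ p ∧ p ∣ ψ₁.conductor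
  · obtain ⟨p, hp, hp50, hpc⟩ := hbig
    have hpx : p ≤ x := by
      by_contra! hpx
      obtain ⟨r, hr, hpr⟩ := (hp.prime.dvd_finsetProd_iff _).1 (hpc.trans ψ₁.conductor_dvd_level)
      have := (Nat.prime_dvd_prime_iff_eq hp (prime_of_mem_primesUpTo hr)).1 hpr
      have h1 := le_of_mem_primesUpTo hr
      rw [← this] at h1
      linarith
    refine ⟨p, Or.inr ⟨hp, hpx, hp50⟩, fun q hq χ hχ L hL t ht α hα hα1 => ?_⟩
    have hqN := Dvd.intro _ hq
    rw [lift q hqN χ L hL]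
    have h1 : changeLevel hqN χ ≠ 1 := fun h0 =>
      hχ ((changeLevel_eq_one_iff hqN).1 h0)
    refine good _ h1 (fun h => ?_) L hL t ht α hα hα1
    have := conductor_not_dvd_of_squarefree hNsq hp hq χ
    rw [huniq _ h1 h] at this
    exact this hpc
  · push Not at hbig
    refine ⟨1, Or.inl rfl, fun q hq χ hχ L hL t ht α hα hα1 => ?_⟩
    have hqN := Dvd.intro _ hq
    rw [lift q hqN χ L hL]
    have h1 : changeLevel hqN χ ≠ 1 := fun h0 =>
      hχ ((changeLevel_eq_one_iff hqN).1 h0)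
    by_cases h : (changeLevel hNM (changeLevel hqN χ) ^ 2 = 1 ∧
        ∃ a : ℝ, 0 < a ∧ a ≤ 3 ∧ ‖charSeries
          (changeLevel hNM (changeLevel hqN χ)) (1 + a)‖ < c)
    swap
    · exact good _ h1 h L hL t ht α hα hα1
    rw [huniq _ h1 h]
    have hcQ : ψ₁.conductor ∣ Q := by
      rw [← Nat.prod_primeFactors_of_squarefree (hNsq.squarefree_of_dvd ψ₁.conductor_dvd_level)]
      refine prod_dvd_prod_of_subset _ _ _ fun p hp => ?_
      have hpp := Nat.prime_of_mem_primeFactors hp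
      refine (mem_primesUpTo (by norm_num)).2 ⟨hpp, ?_⟩
      by_contra! h49
      have : 50 ≤ p := by
        have : 49 < p := mod_cast h49
        omega
      exact hbig p hpp this (Nat.dvd_of_mem_primeFactors hp)
    have hprim : ψ₁.primitiveCharacter ≠ 1 := fun h0 => hψ₁ (by
      rw [← changeLevel_primitiveCharacter ψ₁, h0, map_one])
    rw [← changeLevel_primitiveCharacter ψ₁, primeTail_changeLevel,
      ← primeTail_changeLevel hcQ]
    · refine hfix _ (fun h0 => hprim ((changeLevel_eq_one_iff hcQ).1 h0)) L
        (by linarith) t ht α hα hα1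
    · exact hndvd 49 L (by norm_num) (by linarith)
    · exact fun p hp hpL => hndvd x L (by linarith)
        ((log_le_log (by linarith) hxz).trans (hzθ.trans hL)) p hp hpL

section

/-- The triangular weight supported on `[-T, T]`. -/
noncomputable def fejerWeight (T t : ℝ) : ℝ := max 0 (1 - |t| / T)

/-- The Fejér kernel, the Fourier transform of the triangular weight. -/
noncomputable def fejerKernel (T r : ℝ) : ℝ := ∫ t, fejerWeight T t * cos (t * r)

variable {T : ℝ}

lemma continuous_fejerWeight : Continuous (fejerWeight T) := by unfold fejerWeight; fun_prop

lemma fejerWeight_nonneg (t : ℝ) : 0 ≤ fejerWeight T t := le_max_left _ _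

lemma fejerWeight_eq_zero (hT : 0 < T) {t : ℝ} (ht : T ≤ |t|) : fejerWeight T t = 0 :=
  max_eq_left (by have := (one_le_div hT).2 ht
                  linarith)

lemma integrable_fejerWeight (hT : 0 < T) : Integrable (fejerWeight T) := by
  refine continuous_fejerWeight.integrable_of_hasCompactSupport
    (HasCompactSupport.intro (isCompact_Icc (a := -T) (b := T)) fun t ht => ?_)
  refine fejerWeight_eq_zero hT ?_
  by_contra! h
  exact ht ⟨(abs_lt.1 h).1.le, (abs_lt.1 h).2.le⟩

lemma integral_fejerWeight_mul {f : ℝ → ℝ} (hT : 0 < T) (hf : ∀ t, f |t| = f t) :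
    ∫ t, fejerWeight T t * f t = 2 * ∫ t in (0 : ℝ)..T, (1 - t / T) * f t := by
  have h := integral_comp_abs (f := fun t => max 0 (1 - t / T) * f t)
  simp only [hf] at h
  rw [show (∫ t, fejerWeight T t * f t) = ∫ t, max 0 (1 - |t| / T) * f t from rfl, h,
    intervalIntegral.integral_of_le hT.le]
  congr 1
  rw [setIntegral_eq_of_subset_of_forall_sdiff_eq_zero (s := Set.Ioc 0 T) measurableSet_Ioi
    Set.Ioc_subset_Ioi_self]
  · refine setIntegral_congr_fun measurableSet_Ioc fun t ht => ?_
    have := (div_le_one hT).2 ht.2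
    rw [max_eq_right (by linarith)]
  · intro t ht
    have h1 : T ≤ t := by
      by_contra! h2
      exact ht.2 ⟨ht.1, h2.le⟩
    have := (one_le_div hT).2 h1
    rw [max_eq_left (by linarith), zero_mul]

lemma integral_fejerWeight_eq (hT : 0 < T) : ∫ t, fejerWeight T t = T := by
  have h := integral_fejerWeight_mul (f := fun _ => 1) hT fun _ => rfl
  have h2 : (∫ t in 0..T, (1 - t / T) * 1) = T / 2 := by
    rw [intervalIntegral.integral_eq_sub_of_hasDerivAt (f := fun t => t - t ^ 2 / (2 * T))]
    · field_simp; ring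
    · intro t _
      have := (hasDerivAt_id' t).sub (((hasDerivAt_id' t).pow 2).div_const (2 * T))
      refine this.congr_deriv ?_
      field_simp
      norm_num
      ring
    · exact (by fun_prop : Continuous fun t : ℝ => (1 - t / T) * 1).intervalIntegrable _ _
  simp only [mul_one] at h h2
  linarith

lemma fejerKernel_eq (hT : 0 < T) {r : ℝ} (hr : r ≠ 0) :
    fejerKernel T r = 2 * (1 - cos (T * r)) / (T * r ^ 2) := by
  have h := integral_fejerWeight_mul (f := fun t => cos (t * r)) hT fun t => by
    rcases abs_choice t with h | h <;> simp [h]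
  rw [fejerKernel, h, intervalIntegral.integral_eq_sub_of_hasDerivAt
    (f := fun t => (1 - t / T) * sin (t * r) / r - cos (t * r) / (T * r ^ 2))]
  · simp only [zero_mul, sin_zero, cos_zero]
    field_simp
    ring
  · intro t _
    have h1 : HasDerivAt (fun t : ℝ => t * r) r t := by
      simpa using (hasDerivAt_id' t).mul_const r
    refine ((((((hasDerivAt_id' t).div_const T).const_sub 1).mul h1.sin).div_const r).sub (h1.cos.div_const (T * r ^ 2))).congr_deriv ?_
    field_simp
    ring
  · exact (by fun_prop : Continuous fun t : ℝ => (1 - t / T) * cos (t * r)).intervalIntegrable _ _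

lemma integrable_fejerWeight_mul (hT : 0 < T) {f : ℝ → ℝ} (hf : Continuous f)
    (h1 : ∀ t, |f t| ≤ 1) : Integrable fun t => fejerWeight T t * f t := by
  refine (integrable_fejerWeight hT).mono (continuous_fejerWeight.mul hf).aestronglyMeasurable
    (.of_forall fun t => ?_)
  rw [norm_mul]
  exact mul_le_of_le_one_right (norm_nonneg _) (h1 t)

lemma fejerKernel_le (hT : 0 < T) (r : ℝ) : fejerKernel T r ≤ T := by
  refine le_of_le_of_eq ?_ (integral_fejerWeight_eq hT)
  refine integral_mono (integrable_fejerWeight_mul hT (by fun_prop) fun t => abs_cos_le_one _)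
    (integrable_fejerWeight hT) fun t => ?_
  exact mul_le_of_le_one_right (fejerWeight_nonneg t) (cos_le_one _)

lemma fejerKernel_nonneg (hT : 0 < T) (r : ℝ) : 0 ≤ fejerKernel T r := by
  rcases eq_or_ne r 0 with rfl | hr
  · simp only [fejerKernel, mul_zero, cos_zero, mul_one]
    rw [integral_fejerWeight_eq hT]
    exact hT.le
  · rw [fejerKernel_eq hT hr]
    have := cos_le_one (T * r)
    positivity

lemma fejerKernel_le_div (hT : 0 < T) {r : ℝ} (hr : r ≠ 0) : fejerKernel T r ≤ 4 / (T * r ^ 2) := by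
  rw [fejerKernel_eq hT hr]
  have := neg_one_le_cos (T * r)
  gcongr
  linarith

lemma fejerKernel_le_inv (hT : 0 < T) (r : ℝ) :
    fejerKernel T r ≤ 8 * T * (1 + (T * r) ^ 2)⁻¹ := by
  rw [← div_eq_mul_inv, le_div_iff₀ (by positivity)]
  by_cases h : (T * r) ^ 2 ≤ 1
  · have := mul_le_mul (fejerKernel_le hT r) (show 1 + (T * r) ^ 2 ≤ 2 by linarith) (by positivity)
      hT.le
    linarith
  · push Not at h
    have hr : r ≠ 0 := by rintro rfl; norm_num at h
    have h1 := fejerKernel_le_div hT hr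
    have h2 : fejerKernel T r * (1 + (T * r) ^ 2) ≤ 4 / (T * r ^ 2) * (2 * (T * r) ^ 2) :=
      mul_le_mul h1 (by linarith) (by positivity) (by positivity)
    refine h2.trans (le_of_eq ?_)
    field_simp
    ring

lemma continuous_fejerKernel (hT : 0 < T) : Continuous (fejerKernel T) := by
  refine continuous_of_dominated (bound := fejerWeight T)
    (fun r => (continuous_fejerWeight.mul (by fun_prop)).aestronglyMeasurable)
    (fun r => .of_forall fun t => ?_) (integrable_fejerWeight hT) (.of_forall fun t => by fun_prop)
  rw [norm_mul, norm_of_nonneg (fejerWeight_nonneg t)]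
  exact mul_le_of_le_one_right (fejerWeight_nonneg t) (abs_cos_le_one _)

lemma integrable_fejerKernel (hT : 0 < T) : Integrable (fejerKernel T) := by
  refine Integrable.mono' (g := fun r => 8 * T * (1 + (T * r) ^ 2)⁻¹) ?_
    (continuous_fejerKernel hT).aestronglyMeasurable (.of_forall fun r => ?_)
  · exact (integrable_inv_one_add_sq.comp_mul_left' hT.ne').const_mul _
  · rw [norm_of_nonneg (fejerKernel_nonneg hT r)]
    exact fejerKernel_le_inv hT r

lemma integral_fejerKernel_le (hT : 0 < T) : ∫ r, fejerKernel T r ≤ 8 * π := by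
  have h := integral_mono (integrable_fejerKernel hT) ((integrable_inv_one_add_sq.comp_mul_left'
    hT.ne').const_mul (8 * T)) (fun r => fejerKernel_le_inv hT r)
  refine h.trans (le_of_eq ?_)
  rw [integral_const_mul, Measure.integral_comp_mul_left (fun x => (1 + x ^ 2)⁻¹) T,
    integral_univ_inv_one_add_sq, abs_of_pos (by positivity), smul_eq_mul]
  field_simp

lemma le_integral_fejerKernel (hT : 0 < T) : 0.8 ≤ ∫ r, fejerKernel T r := by
  have h1 : (∫ r in Set.Icc (-(1 / T)) (1 / T), (0.4 * T : ℝ))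
      ≤ ∫ r in Set.Icc (-(1 / T)) (1 / T), fejerKernel T r := by
    refine setIntegral_mono_on (integrableOn_const (by simp))
      (integrable_fejerKernel hT).integrableOn measurableSet_Icc fun r hr => ?_
    have hr1 : |T * r| ≤ 1 := by
      rw [abs_mul, abs_of_pos hT, ← le_div_iff₀' hT]
      exact abs_le.2 hr
    rcases eq_or_ne r 0 with rfl | hr0
    · simp only [fejerKernel, mul_zero, cos_zero, mul_one]
      rw [integral_fejerWeight_eq hT]
      linarith
    · rw [fejerKernel_eq hT hr0, le_div_iff₀ (by positivity)]
      have h2 := cos_le_one_sub_mul_cos_sq (hr1.trans (by linarith [pi_gt_three]))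
      have h3 : 0.2 ≤ 2 / π ^ 2 := by
        rw [le_div_iff₀ (by positivity)]
        nlinarith [pi_lt_d2, pi_gt_three]
      nlinarith
  have h2 := setIntegral_le_integral (s := Set.Icc (-(1 / T)) (1 / T)) (integrable_fejerKernel hT)
    (.of_forall fun r => fejerKernel_nonneg hT r)
  refine le_trans (le_of_eq ?_) (h1.trans h2)
  rw [setIntegral_const, smul_eq_mul, volume_real_Icc_of_le (by
    have : 0 ≤ 1 / T := by positivity
    linarith)]
  field_simp
  norm_num

/-- Outside a neighbourhood of the origin the Fejér kernel is dominated by an integrable function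
with small integral. -/
lemma fejerKernel_le_tail (hT : 0 < T) {τ r : ℝ} (hτ : 0 < τ) (hr : τ < |r|) :
    fejerKernel T r ≤ 4 * (1 + 1 / τ ^ 2) / T * (1 + r ^ 2)⁻¹ := by
  have hr0 : r ≠ 0 := by rintro rfl; simp at hr; linarith
  refine (fejerKernel_le_div hT hr0).trans ?_
  have h1 : τ ^ 2 ≤ r ^ 2 := by rw [← sq_abs r]; gcongr
  rw [← div_eq_mul_inv, div_div, div_le_div_iff₀ (by positivity) (by positivity)]
  have h2 := (one_le_div (by positivity)).2 h1
  have h3 : 4 * (1 + 1 / τ ^ 2) * (T * r ^ 2) = 4 * T * (r ^ 2 + r ^ 2 / τ ^ 2) := by ring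
  rw [h3]
  nlinarith
end

section

/-- The Fourier transform of `G`, normalised as `∫ e^{-itw} G(w) dw`. -/
noncomputable def expTransform (G : ℝ → ℂ) (t : ℝ) : ℂ :=
  ∫ w, Complex.exp (-(I * (t * w : ℝ))) * G w

variable {T : ℝ} {G : ℝ → ℂ}

lemma norm_exp_I_mul (x : ℝ) : ‖Complex.exp (I * x)‖ = 1 := by
  rw [mul_comm, Complex.norm_exp_ofReal_mul_I]

lemma norm_exp_neg_I_mul (x : ℝ) : ‖Complex.exp (-(I * x))‖ = 1 := by
  rw [← mul_neg, ← Complex.ofReal_neg, norm_exp_I_mul]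

lemma integral_fejerWeight_mul_exp (hT : 0 < T) (r : ℝ) :
    ∫ t, (fejerWeight T t : ℂ) * Complex.exp (I * (t * r : ℝ)) = fejerKernel T r := by
  have hi r : Integrable fun t : ℝ =>
      (fejerWeight T t : ℂ) * Complex.exp (I * (t * r : ℝ)) := by
    refine (integrable_fejerWeight hT).mono (Continuous.aestronglyMeasurable ?_)
      (.of_forall fun t => ?_)
    · exact (Complex.continuous_ofReal.comp continuous_fejerWeight).mul (by fun_prop)
    · rw [norm_mul, norm_exp_I_mul, mul_one, norm_real]
  have h1 := integral_neg_eq_self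
    (fun t : ℝ => (fejerWeight T t : ℂ) * Complex.exp (I * (t * r : ℝ))) volume
  have h2 t : (fejerWeight T (-t) : ℂ) * Complex.exp (I * ((-t) * r : ℝ)) =
      (fejerWeight T t : ℂ) * Complex.exp (I * (t * (-r) : ℝ)) := by
    rw [fejerWeight, abs_neg, ← fejerWeight, neg_mul_comm]
  simp only [h2] at h1
  have h3 := integral_add (hi r) (hi (-r))
  rw [h1, ← two_mul] at h3
  have h4 t : (fejerWeight T t : ℂ) * Complex.exp (I * (t * r : ℝ)) +
      (fejerWeight T t : ℂ) * Complex.exp (I * (t * (-r) : ℝ)) =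
      2 * ((fejerWeight T t * cos (t * r) : ℝ) : ℂ) := by
    push_cast
    rw [Complex.cos]
    ring_nf
  simp only [h4] at h3
  rw [integral_const_mul] at h3
  rw [← mul_left_cancel₀ two_ne_zero h3, fejerKernel]
  exact integral_ofReal

lemma continuous_expTransform (hG : Integrable G) : Continuous (expTransform G) := by
  refine continuous_of_dominated (bound := fun w => ‖G w‖)
    (fun t => (Continuous.aestronglyMeasurable (by fun_prop)).mul hG.aestronglyMeasurable)
    (fun t => .of_forall fun w => ?_) hG.norm (.of_forall fun w => by fun_prop)
  rw [norm_mul, norm_exp_neg_I_mul, one_mul]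

lemma norm_expTransform_le (t : ℝ) : ‖expTransform G t‖ ≤ ∫ w, ‖G w‖ := by
  refine (norm_integral_le_integral_norm _).trans (le_of_eq ?_)
  simp only [norm_mul, norm_exp_neg_I_mul, one_mul]

lemma integrable_fejerWeight_mul_of_bound (hT : 0 < T) {f : ℝ → ℂ} (hf : Continuous f) {C : ℝ}
    (hC : ∀ t, ‖f t‖ ≤ C) : Integrable fun t => (fejerWeight T t : ℂ) * f t := by
  refine ((integrable_fejerWeight hT).mul_const C).mono' ((Complex.continuous_ofReal.comp
    continuous_fejerWeight).mul hf).aestronglyMeasurable (.of_forall fun t => ?_)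
  rw [norm_mul, norm_real, norm_of_nonneg (fejerWeight_nonneg t)]
  exact mul_le_mul_of_nonneg_left (hC t) (fejerWeight_nonneg t)

lemma integral_fejerWeight_mul_expTransform (hT : 0 < T) (hG : Integrable G) (w' : ℝ) :
    ∫ t, (fejerWeight T t : ℂ) * (Complex.exp (I * (t * w' : ℝ)) * expTransform G t) =
      ∫ w, (fejerKernel T (w' - w) : ℂ) * G w := by
  have h1 t :
      (fejerWeight T t : ℂ) * (Complex.exp (I * (t * w' : ℝ)) * expTransform G t) =
      ∫ w, (fejerWeight T t : ℂ) * Complex.exp (I * (t * (w' - w) : ℝ)) * G w := by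
    rw [expTransform, ← integral_const_mul, ← integral_const_mul]
    congr 1 with w
    rw [← mul_assoc (Complex.exp _), ← Complex.exp_add, ← mul_assoc]
    congr 3
    push_cast
    ring
  simp only [h1]
  rw [integral_integral_swap]
  · congr 1 with w
    rw [integral_mul_const, integral_fejerWeight_mul_exp hT]
  · have hk : Integrable fun t => (fejerWeight T t : ℂ) := (integrable_fejerWeight hT).ofReal
    refine (hk.mul_prod hG).mono ?_ (.of_forall fun z => ?_)
    · refine AEStronglyMeasurable.mul ?_ hG.aestronglyMeasurable.comp_snd
      refine Continuous.aestronglyMeasurable ?_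
      exact ((Complex.continuous_ofReal.comp continuous_fejerWeight).comp continuous_fst).mul
        (by fun_prop)
    · simp only [Function.uncurry, norm_mul, norm_exp_I_mul, mul_one]
      exact le_rfl

/-- A bounded integrable function has a small transform in mean square, with Fejér weight. -/
lemma integral_fejerWeight_mul_norm_sq_le (hT : 0 < T) (hG : Integrable G) {B : ℝ}
    (hB : ∀ w, ‖G w‖ ≤ B) :
    ∫ t, fejerWeight T t * ‖expTransform G t‖ ^ 2 ≤ 8 * π * B * ∫ w, ‖G w‖ := by
  have hc : Integrable fun w => (starRingEnd ℂ) (G w) := by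
    refine hG.mono (Complex.continuous_conj.comp_aestronglyMeasurable hG.aestronglyMeasurable)
      (.of_forall fun w => by simp)
  have h1 t : ((fejerWeight T t * ‖expTransform G t‖ ^ 2 : ℝ) : ℂ) =
      ∫ w, (fejerWeight T t : ℂ) * expTransform G t *
        (Complex.exp (I * (t * w : ℝ)) * (starRingEnd ℂ) (G w)) := by
    rw [integral_const_mul]
    push_cast
    rw [mul_assoc, ← Complex.mul_conj']
    congr 2
    rw [expTransform, ← integral_conj]
    congr 1 with w
    rw [map_mul, ← Complex.exp_conj]
    simp
  have h2 : ((∫ t, fejerWeight T t * ‖expTransform G t‖ ^ 2 : ℝ) : ℂ) =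
      ∫ w, (∫ v, (fejerKernel T (w - v) : ℂ) * G v) * (starRingEnd ℂ) (G w) := by
    rw [← integral_complex_ofReal]
    simp only [h1]
    rw [integral_integral_swap]
    · congr 1 with w
      rw [← integral_fejerWeight_mul_expTransform hT hG, ← integral_mul_const]
      congr 1 with t
      ring
    · have hk := integrable_fejerWeight_mul_of_bound hT (continuous_expTransform hG)
        (fun t => norm_expTransform_le t)
      refine (hk.mul_prod hc).mono ?_ (.of_forall fun z => ?_)
      · refine hk.aestronglyMeasurable.comp_fst.mul
          (AEStronglyMeasurable.mul ?_ hc.aestronglyMeasurable.comp_snd)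
        exact Continuous.aestronglyMeasurable (by fun_prop)
      · simp only [Function.uncurry, norm_mul, norm_exp_I_mul, one_mul]
        exact le_rfl
  have h3 w : ‖∫ v, (fejerKernel T (w - v) : ℂ) * G v‖ ≤ 8 * π * B := by
    refine (norm_integral_le_of_norm_le
      (((integrable_fejerKernel hT).comp_sub_left w).mul_const B) (.of_forall fun v => ?_)).trans ?_
    · rw [norm_mul, norm_real, norm_of_nonneg (fejerKernel_nonneg hT _)]
      exact mul_le_mul_of_nonneg_left (hB v) (fejerKernel_nonneg hT _)
    · rw [integral_mul_const, integral_sub_left_eq_self (fejerKernel T)]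
      exact mul_le_mul_of_nonneg_right (integral_fejerKernel_le hT) ((norm_nonneg _).trans (hB 0))
  rw [← norm_of_nonneg (integral_nonneg fun t => mul_nonneg (fejerWeight_nonneg t) (by positivity)), ← norm_real, h2, ← integral_const_mul]
  refine norm_integral_le_of_norm_le (hG.norm.const_mul _) (.of_forall fun w => ?_)
  rw [norm_mul, RCLike.norm_conj]
  exact mul_le_mul_of_nonneg_right (h3 w) (norm_nonneg _)

/-- A Tauberian lower bound: if the transform of a real function `G` is small in mean, `G` cannot
be very negative throughout a neighbourhood of a point. -/
lemma le_of_integral_fejerWeight_mul_norm_le (hT : 0 < T) {G : ℝ → ℝ} (hG : Integrable G)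
    {ε τ M B w' : ℝ} (hτ : 0 < τ) (hTτ : 4 * π * (1 + 1 / τ ^ 2) / T ≤ 0.4) (hB0 : 0 ≤ B)
    (hM : ∀ w, |w - w'| ≤ τ → G w ≤ M) (hB : ∀ w, G w ≤ B)
    (hε : ∫ t, fejerWeight T t * ‖expTransform (fun w => (G w : ℂ)) t‖ ≤ ε) :
    -(0.4 * M) ≤ ε + B * (4 * π * (1 + 1 / τ ^ 2) / T) ∨ 0 ≤ M := by
  by_cases hM0 : 0 ≤ M
  · exact .inr hM0
  push Not at hM0
  refine .inl ?_
  have hGc : Integrable fun w => (G w : ℂ) := hG.ofReal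
  set A := 4 * (1 + 1 / τ ^ 2) / T with hA
  have h1 : -ε ≤ ∫ w, fejerKernel T (w' - w) * G w := by
    have h := integral_fejerWeight_mul_expTransform hT hGc w'
    have h2 : ‖∫ w, (fejerKernel T (w' - w) : ℂ) * (G w : ℂ)‖ ≤ ε := by
      rw [← h]
      refine (norm_integral_le_integral_norm _).trans (le_trans (le_of_eq ?_) hε)
      congr 1 with t
      rw [norm_mul, norm_mul, norm_exp_I_mul, one_mul, norm_real,
        norm_of_nonneg (fejerWeight_nonneg t)]
    have h3 : (∫ w, (fejerKernel T (w' - w) : ℂ) * (G w : ℂ)) =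
        ((∫ w, fejerKernel T (w' - w) * G w : ℝ) : ℂ) := by
      rw [← integral_complex_ofReal]
      congr 1 with w
      push_cast
      rfl
    rw [h3, norm_real] at h2
    exact neg_le_of_abs_le h2
  have hK := (integrable_fejerKernel hT).comp_sub_left w'
  have ht := integrable_inv_one_add_sq.comp_sub_left w'
  have h2 : (∫ w, fejerKernel T (w' - w) * G w) ≤
      ∫ w, (M * fejerKernel T (w' - w) + (B - M) * A * (1 + (w' - w) ^ 2)⁻¹) := by
    have hKG : Integrable fun w => fejerKernel T (w' - w) * G w := by
      refine (hG.norm.const_mul T).mono' (((continuous_fejerKernel hT).comp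
        (continuous_const.sub continuous_id)).aestronglyMeasurable.mul hG.aestronglyMeasurable)
        (.of_forall fun w => ?_)
      rw [norm_mul, norm_of_nonneg (fejerKernel_nonneg hT _)]
      exact mul_le_mul_of_nonneg_right (fejerKernel_le hT _) (norm_nonneg _)
    refine integral_mono hKG ((hK.const_mul M).add (ht.const_mul _)) fun w => ?_
    have hK0 := fejerKernel_nonneg hT (w' - w)
    have hp : 0 ≤ A * (1 + (w' - w) ^ 2)⁻¹ := by positivity
    simp only [mul_assoc (B - M)]
    by_cases hw : |w - w'| ≤ τ
    · have := mul_le_mul_of_nonneg_left (hM w hw) hK0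
      nlinarith
    · push Not at hw
      rw [abs_sub_comm] at hw
      have h5 := fejerKernel_le_tail hT hτ hw
      rw [← hA] at h5
      have := mul_le_mul_of_nonneg_left (hB w) hK0
      nlinarith
  rw [integral_add (hK.const_mul M) (ht.const_mul _), integral_const_mul, integral_const_mul,
    integral_sub_left_eq_self (fejerKernel T),
    integral_sub_left_eq_self (fun x : ℝ => (1 + x ^ 2)⁻¹), integral_univ_inv_one_add_sq] at h2
  have h6 : 4 * π * (1 + 1 / τ ^ 2) / T = A * π := by rw [hA]; ring
  rw [h6] at hTτ ⊢
  nlinarith [le_integral_fejerKernel hT]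
end

section

/-- The sum of the values `f n` over `1 ≤ n ≤ v`. -/
noncomputable def partialSum {M : Type*} [AddCommMonoid M] (f : ℕ → M) (v : ℝ) : M := ∑ n ∈ Icc 1 ⌊v⌋₊, f n

/-- The exponentially weighted summatory function of `f` in the variable `log v`. -/
noncomputable def laplaceDensity (f : ℕ → ℂ) (σ w : ℝ) : ℂ := exp (-(σ * w)) * partialSum f (exp w)

variable {f : ℕ → ℂ} {C σ : ℝ}

lemma laplaceDensity_of_neg {w : ℝ} (hw : w < 0) : laplaceDensity f σ w = 0 := by
  rw [laplaceDensity, partialSum, Nat.floor_eq_zero.2 (by simpa using hw)]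
  simp

lemma norm_laplaceDensity_le (hC : ∀ v, 1 ≤ v → ‖partialSum f v‖ ≤ C * v) {w : ℝ} (hw : 0 ≤ w) :
    ‖laplaceDensity f σ w‖ ≤ C * exp (-(σ - 1) * w) := by
  rw [laplaceDensity, norm_mul, norm_real, norm_of_nonneg (exp_nonneg _)]
  refine (mul_le_mul_of_nonneg_left (hC _ (one_le_exp hw)) (exp_nonneg _)).trans (le_of_eq ?_)
  rw [mul_left_comm, ← exp_add]
  ring_nf

lemma norm_laplaceDensity_le_const (hσ : 1 < σ)
    (hC : ∀ v, 1 ≤ v → ‖partialSum f v‖ ≤ C * v) (w : ℝ) : ‖laplaceDensity f σ w‖ ≤ C := by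
  have hC0 : 0 ≤ C := by simpa using (norm_nonneg _).trans (hC 1 le_rfl)
  rcases lt_or_ge w 0 with hw | hw
  · rwa [laplaceDensity_of_neg hw, norm_zero]
  · exact (norm_laplaceDensity_le hC hw).trans
      (mul_le_of_le_one_right hC0 (exp_le_one_iff.2 (by nlinarith)))

lemma measurable_laplaceDensity : Measurable (laplaceDensity f σ) := by
  exact (by fun_prop : Measurable fun w : ℝ => ((exp (-(σ * w)) : ℝ) : ℂ)).mul ((measurable_from_nat (f := fun n => ∑ k ∈ Icc 1 n, f k)).comp (Nat.measurable_floor.comp measurable_exp))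

lemma integrable_exp_indicator (hσ : 1 < σ) : Integrable
    ((Set.Ici (0 : ℝ)).indicator fun w => C * exp (-(σ - 1) * w)) := by
  rw [integrable_indicator_iff measurableSet_Ici, integrableOn_Ici_iff_integrableOn_Ioi]
  exact (integrableOn_exp_mul_Ioi (by linarith) 0).const_mul C

lemma norm_laplaceDensity_le_indicator (hC : ∀ v, 1 ≤ v → ‖partialSum f v‖ ≤ C * v) (w : ℝ) :
    ‖laplaceDensity f σ w‖ ≤ (Set.Ici (0 : ℝ)).indicator (fun w => C * exp (-(σ - 1) * w)) w := by
  by_cases hw : 0 ≤ w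
  · rw [Set.indicator_of_mem (by exact hw)]
    exact norm_laplaceDensity_le hC hw
  · rw [Set.indicator_of_notMem (by exact hw), laplaceDensity_of_neg (not_le.1 hw), norm_zero]

lemma integrable_laplaceDensity (hσ : 1 < σ) (hC : ∀ v, 1 ≤ v → ‖partialSum f v‖ ≤ C * v) :
    Integrable (laplaceDensity f σ) :=
  (integrable_exp_indicator hσ).mono' measurable_laplaceDensity.aestronglyMeasurable
    (.of_forall (norm_laplaceDensity_le_indicator hC))

lemma integral_norm_laplaceDensity_le (hσ : 1 < σ) (hC : ∀ v, 1 ≤ v → ‖partialSum f v‖ ≤ C * v) :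
    ∫ w, ‖laplaceDensity f σ w‖ ≤ C / (σ - 1) := by
  refine (integral_mono (integrable_laplaceDensity hσ hC).norm (integrable_exp_indicator hσ)
    (norm_laplaceDensity_le_indicator hC)).trans (le_of_eq ?_)
  rw [integral_indicator measurableSet_Ici, integral_Ici_eq_integral_Ioi, integral_const_mul,
    integral_exp_mul_Ioi (by linarith)]
  simp
  rw [← neg_div_neg_eq]
  ring

lemma lSeries_eq_mul_expTransform (hσ : 1 < σ) (hC : ∀ v, 1 ≤ v → ‖partialSum f v‖ ≤ C * v)
    {t : ℝ} (hS : LSeriesSummable f (σ + I * t)) :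
    LSeries f (σ + I * t) =
      (σ + I * t) * expTransform (laplaceDensity f σ) t := by
  have h := LSeries_eq_mul_integral f zero_le_one (s := σ + I * t) (by simpa using hσ) hS
    (Asymptotics.IsBigO.of_bound C (.of_forall fun n => by
      rcases Nat.eq_zero_or_pos n with rfl | hn
      · simp
      · have := hC n (mod_cast hn)
        simpa [partialSum] using this))
  rw [h]
  congr 1
  have himg : exp '' Set.Ioi 0 = Set.Ioi 1 := by
    ext v
    constructor
    · rintro ⟨w, hw, rfl⟩
      exact one_lt_exp_iff.2 hw
    · exact fun hv => ⟨log v, log_pos hv, exp_log (zero_lt_one.trans hv)⟩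
  rw [← himg, integral_image_eq_integral_deriv_smul_of_monotoneOn measurableSet_Ioi
    (fun w _ => (hasDerivAt_exp w).hasDerivWithinAt) (exp_monotone.monotoneOn _),
    expTransform, ← integral_Ici_eq_integral_Ioi,
    ← setIntegral_eq_integral_of_forall_compl_eq_zero (s := Set.Ici 0) (f := fun w =>
      Complex.exp (-(I * (t * w : ℝ))) * laplaceDensity f σ w)
      fun w hw => by rw [laplaceDensity_of_neg (not_le.1 hw), mul_zero],
    integral_Ici_eq_integral_Ioi, integral_Ici_eq_integral_Ioi]
  refine setIntegral_congr_fun measurableSet_Ioi fun w _ => ?_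
  simp only [laplaceDensity, partialSum]
  rw [Complex.cpow_def_of_ne_zero (by simp), ← Complex.ofReal_log (exp_nonneg w), log_exp,
    Complex.real_smul, Complex.ofReal_exp, Complex.ofReal_exp, mul_left_comm, ← Complex.exp_add,
    ← mul_assoc, ← Complex.exp_add, mul_comm]
  congr 2
  push_cast
  ring
end

/-- The indicator function of the integers `n ≥ 2` free of prime factors up to `y`. -/
noncomputable def roughCoeff (y : ℝ) (n : ℕ) : ℂ :=
  if 2 ≤ n ∧ ∀ p ∈ primesUpTo y, ¬ p ∣ n then 1 else 0

lemma norm_roughCoeff_le (y : ℝ) (n : ℕ) : ‖roughCoeff y n‖ ≤ 1 := by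
  rw [roughCoeff]; split_ifs <;> simp

/-- If a character vanishes at all primes up to `y`, its `L`-series is the exponential of nearly
its prime sum over the primes beyond `y`. -/
lemma exists_exp_eq_lSeries : ∃ C : ℝ, 0 ≤ C ∧ ∀ {y : ℝ}, 2 ≤ y → ∀ {M : ℕ}
    (χ : DirichletCharacter ℂ M), (∀ p : ℕ, p.Prime → (p : ℝ) ≤ y → χ p = 0) → ∀ {s : ℂ}, 1 < s.re →
    ∃ z : ℂ, Complex.exp z = LSeries (fun n : ℕ => χ n) s ∧
      ‖z - primeTail (log y) χ s‖ ≤ C * y ^ (-(9 / 10) : ℝ) := by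
  refine ⟨∑' p : Nat.Primes, p ^ (-(11 / 10) : ℝ), tsum_nonneg fun p => by positivity,
    fun {y} hy {M} χ h0 {s} hs => ⟨_, DirichletCharacter.LSeries_eulerProduct_exp_log χ hs, ?_⟩⟩
  have hy0 : 0 < y := by linarith
  set a : ℕ → ℂ := fun n => if log y < log n then if n.Prime then χ n else 0 else 0 with ha
  have ha1 : ∀ n ≠ 0, ‖a n‖ ≤ 1 := fun n _ => by
    simp only [ha]
    split_ifs
    · exact χ.norm_le_one _
    · simp
    · simp
  have hterm (p : Nat.Primes) : LSeries.term a s p = χ p * p ^ (-s) := by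
    rw [LSeries.term_of_ne_zero p.2.ne_zero, Complex.cpow_neg, ← div_eq_mul_inv]
    congr 1
    simp only [ha, if_pos p.2]
    split_ifs with h
    · rfl
    · rw [h0 p p.2 ((log_le_log_iff (mod_cast p.2.pos) hy0).1 (not_lt.1 h))]
  have hP : primeTail (log y) χ s = ∑' p : Nat.Primes, χ p * p ^ (-s) := by
    rw [primeTail, LSeries, ← tsum_subtype_eq_of_support_subset (s := {p : ℕ | p.Prime})]
    · exact tsum_congr hterm
    · intro n hn
      by_contra h
      refine hn ?_
      rcases eq_or_ne n 0 with rfl | hn0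
      · simp
      · rw [LSeries.term_of_ne_zero hn0]
        simp only [Set.mem_ofPred_eq] at h
        simp [h]
  have hsumP : Summable fun p : Nat.Primes => χ p * p ^ (-s) := by
    have := (LSeriesSummable_of_bounded_of_one_lt_re ha1 hs).subtype {p : ℕ | p.Prime}
    exact this.congr hterm
  rw [hP, ← (summable_neg_log_one_sub_mul_prime_cpow χ hs).tsum_sub hsumP,
    ← tsum_mul_right]
  refine tsum_of_norm_bounded ((Nat.Primes.summable_rpow.2 (by norm_num)).mul_right _).hasSum fun p => ?_
  have hp0 : (0 : ℝ) < p := mod_cast p.2.pos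
  by_cases hpy : p ≤ y
  · rw [h0 p p.2 hpy]
    simp
    positivity
  · push Not at hpy
    set z := χ p * p ^ (-s) with hz
    have hz1 : ‖z‖ ≤ (p : ℝ)⁻¹ := by
      rw [hz, norm_mul, Complex.norm_natCast_cpow_of_pos p.2.pos, ← rpow_neg_one]
      refine (mul_le_of_le_one_left (by positivity) (χ.norm_le_one _)).trans ?_
      exact rpow_le_rpow_of_exponent_le (by linarith) (by simpa using hs.le)
    have hp2 : (p : ℝ)⁻¹ ≤ 1 / 2 := by
      rw [inv_le_comm₀ hp0 (by norm_num)]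
      linarith
    have h1 := Complex.norm_log_one_add_sub_self_le (z := -z) (by rw [norm_neg]; linarith)
    rw [norm_neg] at h1
    have h2 : (1 - ‖z‖)⁻¹ ≤ 2 := by
      rw [inv_le_comm₀ (by linarith) (by norm_num)]
      linarith
    have h3 : -Complex.log (1 - z) - z = -(Complex.log (1 + -z) - -z) := by
      rw [← sub_eq_add_neg]; ring
    rw [h3, norm_neg]
    have h4 : ‖z‖ ^ 2 ≤ (p : ℝ)⁻¹ ^ 2 := by gcongr
    have h5 : (p : ℝ)⁻¹ ^ 2 ≤ p ^ (-(11 / 10) : ℝ) * y ^ (-(9 / 10) : ℝ) := by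
      rw [inv_pow, ← rpow_natCast, ← rpow_neg hp0.le,
        show (-((2 : ℕ) : ℝ)) = -(11 / 10) + -(9 / 10) by norm_num, rpow_add hp0]
      exact mul_le_mul_of_nonneg_left
        (rpow_le_rpow_of_nonpos hy0 hpy.le (by norm_num)) (by positivity)
    nlinarith

/-- Expanding the logarithm to second order. -/
lemma norm_sub_add_sq_div_two_le {P z : ℂ} {ε δ : ℝ} (hP : ‖P‖ ≤ ε) (hδ : ‖z - P‖ ≤ δ)
    (hε : ε + δ ≤ 1 / 4) {A : ℂ} (hA : Complex.exp z = 1 + A) :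
    ‖P - A + A ^ 2 / 2‖ ≤ 2 * (ε + δ) * ‖A‖ ^ 2 + δ := by
  have hz : ‖z‖ ≤ ε + δ := by
    have := norm_add_le (z - P) P
    rw [sub_add_cancel] at this
    linarith
  have hA1 : ‖A‖ ≤ 2 * ‖z‖ := by
    have h := Complex.norm_exp_sub_one_le (x := z) (by linarith)
    rwa [hA, add_sub_cancel_left] at h
  have hlog : Complex.log (1 + A) = z := by
    rw [← hA]
    have h := (Complex.abs_im_le_norm z).trans (hz.trans hε)
    exact Complex.log_exp (by linarith [neg_le_of_abs_le h, pi_gt_three])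
      (by linarith [le_of_abs_le h, pi_gt_three])
  have h := Complex.norm_log_sub_logTaylor_le 2 (z := A) (by linarith)
  rw [hlog, Complex.logTaylor_succ, Complex.logTaylor_succ, Complex.logTaylor_succ,
    Complex.logTaylor_zero] at h
  have h1 : z - ((((fun _ => 0) + fun z : ℂ => (-1) ^ (0 + 1) * z ^ 0 / (0 : ℕ)) +
      (fun z : ℂ => (-1) ^ (1 + 1) * z ^ 1 / (1 : ℕ))) +
      fun z : ℂ => (-1) ^ (2 + 1) * z ^ 2 / (2 : ℕ) : ℂ → ℂ) A = z - A + A ^ 2 / 2 := by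
    simp only [Pi.add_apply]
    norm_num
    ring
  rw [h1] at h
  have h2 : (1 - ‖A‖)⁻¹ ≤ 2 := by
    rw [inv_le_comm₀ (by linarith) (by norm_num)]
    linarith
  have h3 : ‖A‖ ^ (2 + 1) * (1 - ‖A‖)⁻¹ / (2 + 1 : ℝ) ≤ ‖A‖ ^ 2 * ‖A‖ := by
    rw [div_le_iff₀ (by norm_num)]
    have := mul_le_mul_of_nonneg_left h2 (show 0 ≤ ‖A‖ ^ 3 by positivity)
    push_cast
    nlinarith [show 0 ≤ ‖A‖ ^ 3 by positivity]
  have h4 : P - A + A ^ 2 / 2 = (z - A + A ^ 2 / 2) - (z - P) := by ring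
  rw [h4]
  refine (norm_sub_le _ _).trans (add_le_add (h.trans (h3.trans ?_)) hδ)
  nlinarith

/-- The twisted `L`-series of rough integers, plus one, is that of an imprimitive character. -/
lemma lSeries_changeLevel_eq {y : ℝ} {q M : ℕ} (h : q ∣ M) (hM : M = ∏ p ∈ primesUpTo y, p)
    (χ : DirichletCharacter ℂ q) {s : ℂ} (hs : 1 < s.re) :
    LSeries (fun n : ℕ => changeLevel h χ n) s =
      1 + LSeries (fun n => χ n * roughCoeff y n) s := by
  have hs1 : LSeriesSummable (fun n => χ n * roughCoeff y n) s :=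
    LSeriesSummable_of_bounded_of_one_lt_re (m := 1) (fun n _ => by
      rw [norm_mul]
      exact mul_le_one₀ (χ.norm_le_one _) (norm_nonneg _) (norm_roughCoeff_le y n)) hs
  have h1 : LSeries (fun n : ℕ => if n = 1 then 1 else 0) s = 1 := by
    rw [LSeries, tsum_eq_single 1 (fun n hn => by
      rcases eq_or_ne n 0 with rfl | hn0
      · simp
      · rw [LSeries.term_of_ne_zero hn0, if_neg hn, zero_div])]
    simp
  rw [← h1, ← LSeries_add (LSeriesSummable_of_bounded_of_one_lt_re (m := 1) (fun n _ => by split_ifs <;> simp) hs) hs1]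
  refine LSeries_congr (fun {n} hn => ?_) s
  simp only [Pi.add_apply, roughCoeff]
  have hc : n.Coprime M ↔ ∀ p ∈ primesUpTo y, ¬p ∣ n := hM ▸ coprime_prod_primesUpTo_iff
  by_cases hcop : n.Coprime M
  · rw [changeLevel_natCast h χ hcop]
    by_cases hn1 : n = 1
    · simp [hn1]
    · rw [if_neg hn1, if_pos ⟨by omega, hc.1 hcop⟩, mul_one, zero_add]
  · rw [MulChar.map_nonunit _ (by rwa [ZMod.isUnit_iff_coprime]), if_neg (by
      rintro rfl; exact hcop (Nat.coprime_one_left M)), if_neg (fun h => hcop (hc.2 h.2))]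
    simp

section

/-- Parseval's identity for Dirichlet characters. -/
lemma sum_norm_sum_dirichletCharacter_sq {q : ℕ} [NeZero q] (z : ZMod q → ℂ) :
    ∑ χ : DirichletCharacter ℂ q, ‖∑ b, χ b * z b‖ ^ 2 =
      q.totient * ∑ b with IsUnit b, ‖z b‖ ^ 2 := by
  have h1 (χ : DirichletCharacter ℂ q) : ((‖∑ b, χ b * z b‖ ^ 2 : ℝ) : ℂ) =
      ∑ b, ∑ c with IsUnit c, (χ c⁻¹ * χ b) * (z b * (starRingEnd ℂ) (z c)) := by
    push_cast
    rw [← Complex.mul_conj', map_sum, sum_mul_sum]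
    refine sum_congr rfl fun b _ => ?_
    rw [sum_filter]
    refine sum_congr rfl fun c _ => ?_
    split_ifs with hc
    · have : (starRingEnd ℂ) (χ c) = χ c⁻¹ := by
        rw [starRingEnd_apply, MulChar.star_apply', MulChar.inv_apply_eq_inv', inv_eq_iff_eq_inv,
          eq_comm, inv_eq_of_mul_eq_one_right]
        rw [← map_mul, ZMod.inv_mul_of_unit _ hc, map_one]
      rw [map_mul, this]
      ring
    · rw [χ.map_nonunit hc, zero_mul, map_zero, mul_zero]
  have h2 : ((∑ χ : DirichletCharacter ℂ q, ‖∑ b, χ b * z b‖ ^ 2 : ℝ) : ℂ) =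
      ((q.totient * ∑ b with IsUnit b, ‖z b‖ ^ 2 : ℝ) : ℂ) := by
    rw [Complex.ofReal_sum, sum_congr rfl fun χ _ => h1 χ, sum_comm]
    simp only [sum_comm (s := (univ : Finset (DirichletCharacter ℂ q)))]
    rw [sum_comm]
    push_cast
    rw [mul_sum]
    refine sum_congr rfl fun c hc => ?_
    have hc' := (mem_filter.1 hc).2
    simp only [← sum_mul, sum_char_inv_mul_char_eq ℂ hc']
    rw [sum_eq_single c (fun b _ hb => by rw [if_neg hb.symm, zero_mul]) (by simp), if_pos rfl,
      Complex.mul_conj']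
  exact_mod_cast h2

variable {q : ℕ} {y σ : ℝ}

/-- The indicator of rough integers in a residue class. -/
noncomputable def roughClass (y : ℝ) {q : ℕ} (b : ZMod q) (n : ℕ) : ℂ :=
  if (n : ZMod q) = b then roughCoeff y n else 0

lemma partialSum_roughClass (b : ZMod q) (v : ℝ) :
    partialSum (roughClass y b) v = (roughCount y b v : ℂ) := by
  have h : (Icc 1 ⌊v⌋₊).filter (fun n : ℕ => (2 ≤ n ∧ ∀ p ∈ primesUpTo y, ¬p ∣ n) ∧
      (n : ZMod q) = b) = (roughIn y v).filter fun n : ℕ => (n : ZMod q) = b := by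
    ext n
    simp only [mem_filter, mem_roughIn, mem_Icc]
    constructor
    · rintro ⟨⟨_, h1⟩, ⟨h2, h3⟩, h4⟩
      exact ⟨⟨h2, h1, h3⟩, h4⟩
    · rintro ⟨⟨h2, h1, h3⟩, h4⟩
      exact ⟨⟨by omega, h1⟩, ⟨h2, h3⟩, h4⟩
  rw [roughCount, ← h, partialSum]
  simp only [roughClass, roughCoeff]
  rw [card_filter]
  push_cast
  refine sum_congr rfl fun n _ => ?_
  split_ifs <;> simp_all

lemma laplaceDensity_twist [NeZero q] (χ : DirichletCharacter ℂ q) (w : ℝ) :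
    laplaceDensity (fun n => χ n * roughCoeff y n) σ w =
      ∑ b, χ b * laplaceDensity (roughClass y b) σ w := by
  simp only [laplaceDensity, partialSum, mul_left_comm (χ _), ← mul_sum]
  congr 1
  simp only [mul_sum]
  rw [sum_comm]
  refine sum_congr rfl fun n _ => ?_
  rw [sum_eq_single (n : ZMod q) (fun b _ hb => by rw [roughClass, if_neg hb.symm, mul_zero])
    (by simp), roughClass, if_pos rfl]

lemma sum_integral_fejerWeight_mul_norm_sq_le [NeZero q] {C T : ℝ} (hT : 0 < T) (hσ : 1 < σ)
    (hC : ∀ b : ZMod q, IsUnit b → ∀ v, 0 ≤ v → q.totient * roughCount y b v ≤ C * v) :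
    ∫ t, fejerWeight T t * ∑ χ : DirichletCharacter ℂ q,
      ‖expTransform (laplaceDensity (fun n => χ n * roughCoeff y n) σ) t‖ ^ 2 ≤
      8 * π * C ^ 2 / (σ - 1) := by
  have hφ : (0 : ℝ) < q.totient := mod_cast Nat.totient_pos.2 (NeZero.pos q)
  have hC' : ∀ b : ZMod q, IsUnit b → ∀ v, 1 ≤ v →
      ‖partialSum (roughClass y b) v‖ ≤ C / q.totient * v := fun b hb v hv => by
    rw [partialSum_roughClass, norm_real, norm_of_nonneg (roughCount_nonneg _ _ _),
      div_mul_eq_mul_div, le_div_iff₀' hφ]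
    exact hC b hb v (by linarith)
  have hin (b : ZMod q) : Integrable (laplaceDensity (roughClass y b) σ) := by
    refine integrable_laplaceDensity hσ (C := 1) fun v hv => ?_
    refine (norm_sum_le _ _).trans ((sum_le_card_nsmul _ _ 1 fun n _ => ?_).trans ?_)
    · rw [roughClass]
      split_ifs
      · exact norm_roughCoeff_le y n
      · simp
    · simpa using Nat.floor_le (by linarith)
  have htr (χ : DirichletCharacter ℂ q) t :
      expTransform (laplaceDensity (fun n => χ n * roughCoeff y n) σ) t =
        ∑ b, χ b * expTransform (laplaceDensity (roughClass y b) σ) t := by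
    simp only [expTransform, laplaceDensity_twist, mul_sum]
    rw [integral_finsetSum]
    · refine sum_congr rfl fun b _ => ?_
      simp only [mul_left_comm _ (χ b)]
      rw [integral_const_mul]
    · intro b _
      simp only [mul_left_comm _ (χ b)]
      refine Integrable.const_mul ((hin b).mono ((Continuous.aestronglyMeasurable (by fun_prop)).mul
        (hin b).aestronglyMeasurable) (.of_forall fun w => ?_)) _
      rw [Pi.mul_apply, norm_mul, norm_exp_neg_I_mul, one_mul]
  simp only [htr, sum_norm_sum_dirichletCharacter_sq, mul_left_comm _ (q.totient : ℝ)]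
  rw [integral_const_mul]
  simp only [mul_sum]
  rw [integral_finsetSum]
  · have h1 : ∀ b ∈ (univ : Finset (ZMod q)).filter (fun b => IsUnit b),
        ∫ t, fejerWeight T t * ‖expTransform (laplaceDensity (roughClass y b) σ) t‖ ^ 2 ≤
        8 * π * (C / q.totient) * (C / q.totient / (σ - 1)) := fun b hb => by
      have hb' := hC' b (mem_filter.1 hb).2
      have hC0 : 0 ≤ C / q.totient := by simpa using (norm_nonneg _).trans (hb' 1 le_rfl)
      refine (integral_fejerWeight_mul_norm_sq_le hT (hin b)
        (norm_laplaceDensity_le_const hσ hb')).trans ?_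
      exact mul_le_mul_of_nonneg_left (integral_norm_laplaceDensity_le hσ hb') (by positivity)
    have hcard : ((univ : Finset (ZMod q)).filter (fun b => IsUnit b)).card = q.totient := by
      rw [← ZMod.card_units_eq_totient, ← card_univ,
        ← card_map ⟨((↑) : (ZMod q)ˣ → ZMod q), Units.val_injective⟩]
      congr 1
      ext b
      simp only [mem_filter, mem_univ, true_and, Finset.mem_map,
        Function.Embedding.coeFn_mk]
      rfl
    refine (mul_le_mul_of_nonneg_left (sum_le_card_nsmul _ _ _ h1) hφ.le).trans (le_of_eq ?_)
    rw [hcard, nsmul_eq_mul]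
    field_simp
  · intro b _
    have hc := continuous_expTransform (hin b)
    refine ((integrable_fejerWeight hT).mul_const
      ((∫ w, ‖laplaceDensity (roughClass y b) σ w‖) ^ 2)).mono'
      (continuous_fejerWeight.mul (hc.norm.pow 2)).aestronglyMeasurable (.of_forall fun t => ?_)
    rw [norm_of_nonneg (mul_nonneg (fejerWeight_nonneg t) (by positivity))]
    exact mul_le_mul_of_nonneg_left (pow_le_pow_left₀ (norm_nonneg _) (norm_expTransform_le t) 2)
      (fejerWeight_nonneg t)
end

section

/-- The indicator of the primes beyond `y`. -/
noncomputable def primeCoeff (y : ℝ) (n : ℕ) : ℂ := if log y < log n then if n.Prime then 1 else 0 else 0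

/-- Primes beyond `y` minus the second order expansion in rough integers. -/
noncomputable def mixedCoeff (y : ℝ) : ℕ → ℂ :=
  primeCoeff y - roughCoeff y + (1 / 2 : ℂ) • (LSeries.convolution (roughCoeff y) (roughCoeff y))

/-- The sum of `χ a⁻¹ * χ n` over the nonprincipal characters. -/
noncomputable def classWeight {q : ℕ} (a : ZMod q) (n : ℕ) : ℂ :=
  (if a = (n : ZMod q) then (q.totient : ℂ) else 0) - (1 : DirichletCharacter ℂ q) n

variable {q : ℕ} {y σ : ℝ} {s : ℂ}

lemma lSeriesSummable_twist {f : ℕ → ℂ} (hf : ∀ n, ‖f n‖ ≤ 1) (χ : DirichletCharacter ℂ q)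
    (hs : 1 < s.re) : LSeriesSummable (((χ ·) : ℕ → ℂ) * f) s :=
  LSeriesSummable_of_bounded_of_one_lt_re (m := 1) (fun n _ => by
    rw [Pi.mul_apply, norm_mul]
    exact mul_le_one₀ (χ.norm_le_one _) (norm_nonneg _) (hf n)) hs

lemma norm_primeCoeff_le (y : ℝ) (n : ℕ) : ‖primeCoeff y n‖ ≤ 1 := by
  rw [primeCoeff]; split_ifs <;> simp

lemma lSeries_twist_mixedCoeff (χ : DirichletCharacter ℂ q) (hs : 1 < s.re) : LSeriesSummable (((χ
    ·) : ℕ → ℂ) * mixedCoeff y) s ∧ LSeries (((χ ·) : ℕ → ℂ) * mixedCoeff y) s = primeTail (log y) χ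
    s - LSeries (fun n => χ n * roughCoeff y n) s + LSeries (fun n => χ n * roughCoeff y n) s ^ 2 /
    2 := by
  have h1 := lSeriesSummable_twist (norm_primeCoeff_le y) χ hs
  have h2 := lSeriesSummable_twist (norm_roughCoeff_le y) χ hs
  have h3 := (h2.convolution h2).smul (1 / 2)
  have he : ((χ ·) : ℕ → ℂ) * mixedCoeff y = ((χ ·) : ℕ → ℂ) * primeCoeff y -
      ((χ ·) : ℕ → ℂ) * roughCoeff y + (1 / 2 : ℂ) • (LSeries.convolution (((χ ·) : ℕ → ℂ) * roughCoeff y)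
        (((χ ·) : ℕ → ℂ) * roughCoeff y)) := by
    rw [χ.mul_convolution_distrib, mixedCoeff, mul_add, mul_sub, mul_smul_comm]
  have hp : LSeries (((χ ·) : ℕ → ℂ) * primeCoeff y) s = primeTail (log y) χ s := by
    rw [primeTail]
    congr 1
    ext n
    rw [Pi.mul_apply, primeCoeff]
    split_ifs <;> simp
  rw [he]
  refine ⟨(h1.sub h2).add h3, ?_⟩
  rw [LSeries_add (h1.sub h2) h3, LSeries_sub h1 h2, LSeries_smul, LSeries_convolution' h2 h2, hp]
  change _ - LSeries (fun n => χ n * roughCoeff y n) s + 1 / 2 *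
    (LSeries (fun n => χ n * roughCoeff y n) s * LSeries (fun n => χ n * roughCoeff y n) s) = _
  ring

lemma classWeight_eq [NeZero q] {a : ZMod q} (ha : IsUnit a) (n : ℕ) :
    classWeight a n = ∑ χ : DirichletCharacter ℂ q with χ ≠ 1, χ a⁻¹ * χ n := by
  have h := sum_char_inv_mul_char_eq ℂ ha (n : ZMod q)
  rw [← sum_filter_add_sum_filter_not _ (fun χ : DirichletCharacter ℂ q => χ ≠ 1)] at h
  have h1 : ∑ χ : DirichletCharacter ℂ q with ¬χ ≠ 1, χ a⁻¹ * χ n =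
      (1 : DirichletCharacter ℂ q) n := by
    rw [show (univ.filter fun χ : DirichletCharacter ℂ q => ¬χ ≠ 1) = {1} by ext; simp,
      sum_singleton, MulChar.one_apply, one_mul]
    exact isUnit_iff_exists_inv.2 ⟨a, ZMod.inv_mul_of_unit a ha⟩
  rw [classWeight, ← h, h1, add_sub_cancel_right]

lemma lSeries_classWeight_mul [NeZero q] {a : ZMod q} (ha : IsUnit a) (hs : 1 < s.re) :
    LSeriesSummable (classWeight a * mixedCoeff y) s ∧ LSeries (classWeight a * mixedCoeff y) s = ∑
    χ : DirichletCharacter ℂ q with χ ≠ 1, χ a⁻¹ * LSeries (((χ ·) : ℕ → ℂ) * mixedCoeff y) s := by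
  have he : classWeight a * mixedCoeff y = ∑ χ : DirichletCharacter ℂ q with χ ≠ 1,
      χ a⁻¹ • (((χ ·) : ℕ → ℂ) * mixedCoeff y) := by
    ext n
    simp only [Pi.mul_apply, classWeight_eq ha, Finset.sum_apply, Pi.smul_apply, smul_eq_mul,
      sum_mul, mul_assoc]
  have h (χ : DirichletCharacter ℂ q) := (lSeries_twist_mixedCoeff (y := y) χ hs).1.smul (χ a⁻¹)
  rw [he]
  refine ⟨LSeriesSummable.sum fun χ _ => h χ, ?_⟩
  rw [LSeries_sum fun χ _ => h χ]
  exact sum_congr rfl fun χ _ => LSeries_smul _ _ _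

lemma exists_norm_lSeries_mixedCoeff_le : ∃ C : ℝ, 0 ≤ C ∧ ∀ {y : ℝ}, 2 ≤ y → ∀ {q : ℕ},
    q ∣ ∏ p ∈ primesUpTo y, p → ∀ (χ : DirichletCharacter ℂ q) {s : ℂ}, 1 < s.re → ∀ {ε : ℝ},
    ‖primeTail (log y) χ s‖ ≤ ε → ε + C * y ^ (-(9 / 10) : ℝ) ≤ 1 / 4 →
    ‖LSeries (((χ ·) : ℕ → ℂ) * mixedCoeff y) s‖ ≤ 2 * (ε + C * y ^ (-(9 / 10) : ℝ)) *
      ‖LSeries (fun n => χ n * roughCoeff y n) s‖ ^ 2 + C * y ^ (-(9 / 10) : ℝ) := by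
  obtain ⟨C, hC0, hC⟩ := exists_exp_eq_lSeries
  refine ⟨C, hC0, fun {y} hy {q} hq χ {s} hs {ε} hε hε4 => ?_⟩
  obtain ⟨M, hM⟩ : ∃ M, M = ∏ p ∈ primesUpTo y, p := ⟨_, rfl⟩
  rw [← hM] at hq
  obtain ⟨z, hz, hzd⟩ := hC hy (changeLevel hq χ) (fun p hp hpy =>
    MulChar.map_nonunit _ fun h => by
      rw [ZMod.isUnit_iff_coprime, hM, coprime_prod_primesUpTo_iff] at h
      exact h p ((mem_primesUpTo (by linarith)).2 ⟨hp, hpy⟩) dvd_rfl) hs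
  rw [primeTail_changeLevel hq χ (fun p hp hL hd => by
    rw [hM] at hd
    obtain ⟨r, hr, hpr⟩ := hp.prime.exists_mem_finset_dvd hd
    rw [(Nat.prime_dvd_prime_iff_eq hp (prime_of_mem_primesUpTo hr)).1 hpr] at hL
    exact absurd (log_le_log (by exact_mod_cast (prime_of_mem_primesUpTo hr).pos)
      (le_of_mem_primesUpTo hr)) (not_le.2 hL))] at hzd
  rw [lSeries_changeLevel_eq hq hM χ hs] at hz
  rw [(lSeries_twist_mixedCoeff χ hs).2]
  exact norm_sub_add_sq_div_two_le hε hzd hε4 hz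

/-- The mean size of the transform of the discrepancy. -/
lemma integral_fejerWeight_mul_norm_classWeight_le [NeZero q] {a : ZMod q} (ha : IsUnit a) {T D K
    ε η : ℝ} (hT : 0 < T) (hσ : 1 < σ) (hσ2 : σ ≤ 2) (hε : 0 ≤ ε) (hη : 0 ≤ η) (hD : ∀ b : ZMod q,
    IsUnit b → ∀ v, 0 ≤ v → q.totient * roughCount y b v ≤ D * v) (hK : ∀ v, 1 ≤ v → ‖partialSum
    (classWeight a * mixedCoeff y) v‖ ≤ K * v) (hE : ∀ χ : DirichletCharacter ℂ q, χ ≠ 1 → ∀ t : ℝ,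
    |t| ≤ T → ‖LSeries (((χ ·) : ℕ → ℂ) * mixedCoeff y) (σ + I * t)‖ ≤ ε * ‖LSeries (fun n
    => χ n * roughCoeff y n) (σ + I * t)‖ ^ 2 + η) :
    ∫ t, fejerWeight T t * ‖expTransform (laplaceDensity (classWeight a * mixedCoeff y) σ) t‖ ≤
      ε * (2 + T) * (8 * π * D ^ 2 / (σ - 1)) + q.totient * η * T := by
  have hR (χ : DirichletCharacter ℂ q) v (hv : 1 ≤ v) :
      ‖partialSum (fun n => χ n * roughCoeff y n) v‖ ≤ 1 * v := by
    refine (norm_sum_le _ _).trans ((sum_le_card_nsmul _ _ 1 fun n _ => ?_).trans ?_)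
    · rw [norm_mul]
      exact mul_le_one₀ (χ.norm_le_one _) (norm_nonneg _) (norm_roughCoeff_le y n)
    · simpa using Nat.floor_le (by linarith)
  set Q : ℝ → ℝ := fun t => ∑ χ : DirichletCharacter ℂ q,
      ‖expTransform (laplaceDensity (fun n => χ n * roughCoeff y n) σ) t‖ ^ 2 with hQ
  have hQc : Continuous Q := continuous_finsetSum _ fun χ _ =>
    (continuous_expTransform (integrable_laplaceDensity hσ (hR χ))).norm.pow 2
  have hpt t (ht : |t| ≤ T) : ‖expTransform (laplaceDensity (classWeight a * mixedCoeff y) σ) t‖ ≤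
        ε * (2 + T) * Q t + q.totient * η := by
    have hs : 1 < (σ + I * t : ℂ).re := by simpa using hσ
    obtain ⟨hS, hsum⟩ := lSeries_classWeight_mul (y := y) ha hs
    have h := lSeries_eq_mul_expTransform hσ hK hS
    have hs1 := hs.le.trans (Complex.re_le_norm _)
    have hs2 : ‖(σ + I * t : ℂ)‖ ≤ 2 + T := by
      refine (norm_add_le _ _).trans ?_
      rw [norm_mul, Complex.norm_I, one_mul, norm_real, norm_real,
        norm_of_nonneg (by linarith), norm_eq_abs]
      linarith
    have h1 : ‖LSeries (classWeight a * mixedCoeff y) (σ + I * t)‖ ≤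
        ε * ‖(σ + I * t : ℂ)‖ ^ 2 * Q t + q.totient * η := by
      rw [hsum]
      have hb : ∀ χ ∈ (univ : Finset (DirichletCharacter ℂ q)).filter (· ≠ 1), ‖χ a⁻¹ * LSeries (((χ
          ·) : ℕ → ℂ) * mixedCoeff y) (σ + I * t)‖ ≤ ε * ‖(σ + I * t : ℂ)‖ ^ 2 *
          ‖expTransform (laplaceDensity (fun n => χ n * roughCoeff y n) σ) t‖ ^ 2 + η := by
        intro χ hχ
        rw [norm_mul]
        refine (mul_le_of_le_one_left (norm_nonneg _) (χ.norm_le_one _)).trans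
          ((hE χ (mem_filter.1 hχ).2 t ht).trans (le_of_eq ?_))
        rw [lSeries_eq_mul_expTransform hσ (hR χ)
          (lSeriesSummable_twist (norm_roughCoeff_le y) χ hs), norm_mul]
        ring
      refine (norm_sum_le_of_le _ hb).trans ((sum_le_sum_of_subset_of_nonneg
        (filter_subset _ _) fun χ _ _ => by positivity).trans (le_of_eq ?_))
      rw [sum_add_distrib, ← mul_sum, sum_const, nsmul_eq_mul,
        card_univ, ← Nat.card_eq_fintype_card, card_eq_totient_of_hasEnoughRootsOfUnity]
    rw [h, norm_mul] at h1
    refine le_of_mul_le_mul_left (h1.trans ?_) (by linarith : 0 < ‖(σ + I * t : ℂ)‖)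
    have h2 := mul_le_mul_of_nonneg_left hs2
      (show 0 ≤ ‖(σ + I * t : ℂ)‖ * (ε * Q t) by positivity)
    have h3 := mul_le_mul_of_nonneg_left hs1 (show 0 ≤ q.totient * η by positivity)
    nlinarith
  have hg := continuous_expTransform (integrable_laplaceDensity hσ hK)
  have hsupp (f : ℝ → ℝ) : Function.support (fun t => fejerWeight T t * f t) ⊆ Set.Icc (-T) T := by
    intro t ht
    rw [Function.mem_support] at ht
    by_contra hc
    refine ht ?_
    rw [fejerWeight_eq_zero hT, zero_mul]
    by_contra! h
    exact hc ⟨by linarith [neg_lt_of_abs_lt h], by linarith [lt_of_abs_lt h]⟩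
  have hi (f : ℝ → ℝ) (hf : Continuous f) : Integrable fun t => fejerWeight T t * f t :=
    (continuous_fejerWeight.mul hf).integrable_of_hasCompactSupport
      (HasCompactSupport.of_support_subset_isCompact isCompact_Icc (hsupp f))
  calc _ ≤ ∫ t, (ε * (2 + T)) * (fejerWeight T t * Q t) + q.totient * η * fejerWeight T t := by
        refine integral_mono (hi _ hg.norm) (((hi _ hQc).const_mul _).add
          ((integrable_fejerWeight hT).const_mul _)) fun t => ?_
        dsimp only
        rcases le_total |t| T with ht | ht
        · nlinarith [mul_le_mul_of_nonneg_left (hpt t ht) (fejerWeight_nonneg (T := T) t)]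
        · rw [fejerWeight_eq_zero hT ht]; simp
    _ ≤ _ := by
        rw [integral_add ((hi _ hQc).const_mul _) ((integrable_fejerWeight hT).const_mul _),
          integral_const_mul, integral_const_mul, integral_fejerWeight_eq hT]
        have := mul_le_mul_of_nonneg_left (sum_integral_fejerWeight_mul_norm_sq_le hT hσ hD)
          (show 0 ≤ ε * (2 + T) by positivity)
        linarith
end

section

/-- The discrepancy of rough integers in residue classes. -/
lemma exists_abs_totient_mul_roughCount_sub_card_le : ∃ y₁ : ℝ, 3 ≤ y₁ ∧ ∀ y : ℝ, y₁ ≤ y →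
    ∀ S ⊆ primesUpTo y, ∀ q : ℕ, q = ∏ p ∈ S, p → (q : ℝ) ≤ y ^ (4 / 5 : ℝ) →
    ∀ b : ZMod q, IsUnit b →
      (∀ v, 0 ≤ v → q.totient * roughCount y b v ≤ 201 / log y * v) ∧
      ∀ v, 1 ≤ v → |q.totient * roughCount y b v - (roughIn y v).card| ≤
        exp 18 / log y * v ^ (1 - 3 / 4 / log y) := by
  obtain ⟨w₁, h1, hup⟩ := exists_totient_mul_roughCount_le
  obtain ⟨w₂, h2, hdisc⟩ := exists_abs_totient_mul_roughCount_sub_le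
  obtain ⟨w₃, h3, hcard⟩ := exists_card_roughIn_le
  refine ⟨max 3 (max w₁ (max w₂ w₃)), le_max_left _ _, fun y hy S hS q hq hqy b hb => ?_⟩
  simp only [max_le_iff] at hy
  obtain ⟨hy3, hy1, hy2, hyc⟩ := hy
  have hy0 : 0 < y := by linarith
  have hL := log_pos (by linarith)
  have hU : ∀ v, 0 ≤ v → q.totient * roughCount y b v ≤ 201 / log y * v := fun v hv => by
    rcases le_or_gt v y with h | h
    · rw [roughCount_eq_zero b h, mul_zero]; positivity
    · rw [div_mul_eq_mul_div, mul_div_assoc]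
      refine hup y hy1 S hS q hq b hb v (le_trans ?_ h.le)
      refine (mul_le_mul_of_nonneg_right hqy (by positivity)).trans ?_
      rw [← rpow_add hy0]
      exact (rpow_le_rpow_of_exponent_le (by linarith) (by norm_num)).trans (rpow_one y).le
  refine ⟨hU, fun v hv => ?_⟩
  have hv0 : 0 < v := by linarith
  have hpow : v ^ (1 - 3 / 4 / log y) = v * exp (-(3 / 4 * (log v / log y))) := by
    rw [sub_eq_add_neg, rpow_add hv0, rpow_one, rpow_def_of_pos hv0]
    ring_nf
  rw [hpow]
  rcases le_or_gt v y with hvy | hvy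
  · rw [roughCount_eq_zero b hvy, roughIn_eq_empty hvy]; simp; positivity
  have hq0 : (0 : ℝ) < q := by
    rw [hq]
    exact_mod_cast prod_pos fun p hp => (prime_of_mem_primesUpTo (hS hp)).pos
  rcases le_or_gt (q * y ^ 14) v with hv14 | hv14
  · have hq1 : (1 : ℝ) ≤ q := mod_cast hq0
    have e1 := hdisc y hy2 S hS q hq b hb v hv14
    have e2 := hdisc y hy2 ∅ (by simp) 1 (by simp) 0 (isUnit_of_subsingleton _) v (by
      simpa using (le_mul_of_one_le_left (by positivity) hq1).trans hv14)
    rw [roughCount_one_eq, Nat.totient_one, Nat.cast_one, one_mul, div_one] at e2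
    have hlq : log q ≤ 4 / 5 * log y := by
      rw [← log_rpow hy0]
      gcongr
    have e3 : exp (-(3 / 4 * (log (v / q) / log y))) ≤
        exp 1 * exp (-(3 / 4 * (log v / log y))) := by
      rw [← exp_add, log_div hv0.ne' hq0.ne', sub_div]
      have : log q / log y ≤ 4 / 5 := by rwa [div_le_iff₀ hL]
      exact exp_le_exp.2 (by linarith)
    have e4 : exp 12 * exp 1 * 2 ≤ exp 18 := by
      rw [show (18 : ℝ) = 12 + 1 + 5 by norm_num, exp_add, exp_add]
      have := add_one_le_exp 5
      gcongr
      linarith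
    have e5 : 0 ≤ v / log y * exp (-(3 / 4 * (log v / log y))) := by positivity
    have e6 : 1 ≤ exp 1 := one_le_exp (by norm_num)
    have e7 := mul_le_mul_of_nonneg_left e3 (show 0 ≤ exp 12 * (v / log y) by positivity)
    have e8 := mul_le_mul_of_nonneg_left e6
      (show 0 ≤ exp 12 * (v / log y * exp (-(3 / 4 * (log v / log y)))) by positivity)
    have e9 := mul_le_mul_of_nonneg_right e4 e5
    calc _ ≤ _ := abs_sub_le _ _ _
      _ ≤ exp 12 * (v / log y) * exp (-(3 / 4 * (log (v / q) / log y))) +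
          exp 12 * (v / log y) * exp (-(3 / 4 * (log v / log y))) :=
        add_le_add e1 (by rwa [abs_sub_comm])
      _ ≤ exp 18 * (v / log y * exp (-(3 / 4 * (log v / log y)))) := by linarith
      _ = _ := by ring
  · have e1 := hU v hv0.le
    have e2 := hcard y hyc v hv0.le
    have e3 : 0 ≤ q.totient * roughCount y b v := mul_nonneg (by positivity) (roughCount_nonneg _ _ _)
    have hlv : log v / log y ≤ 74 / 5 := by
      rw [div_le_iff₀ hL, ← log_rpow hy0]
      refine log_le_log hv0 (hv14.le.trans ?_)
      rw [← rpow_natCast]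
      refine (mul_le_mul_of_nonneg_right hqy (by positivity)).trans ?_
      rw [← rpow_add hy0]
      norm_num
    have e4 : 201 ≤ exp 18 * exp (-(3 / 4 * (log v / log y))) := by
      rw [← exp_add]
      refine le_trans ?_ (exp_le_exp.2 (show (6 : ℝ) ≤ _ by linarith))
      rw [show (6 : ℝ) = (6 : ℕ) * 1 by norm_num, exp_nat_mul]
      exact le_trans (by norm_num) (pow_le_pow_left₀ (by norm_num) exp_one_gt_d9.le 6)
    have e5 := mul_le_mul_of_nonneg_right e4 (show 0 ≤ v / log y by positivity)
    have e6 : exp 18 / log y * (v * exp (-(3 / 4 * (log v / log y)))) =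
      exp 18 * exp (-(3 / 4 * (log v / log y))) * (v / log y) := by ring
    rw [div_mul_eq_mul_div, mul_div_assoc] at e1
    rw [e6, abs_le]
    constructor <;> linarith

lemma sum_inv_roughIn_le {y : ℝ} (hy : 3 ≤ y)
    (h : ∀ v, 0 ≤ v → ((roughIn y v).card : ℝ) ≤ 201 * (v / log y)) {V : ℝ} (hV : 1 ≤ V) :
    ∑ m ∈ roughIn y V, 1 / (m : ℝ) ≤ 600 * (log V / log y) := by
  have hy0 : 0 < y := by linarith
  have hL1 : 1 ≤ log y := by
    rw [le_log_iff_exp_le hy0]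
    linarith [exp_one_lt_d9]
  have key (j : ℕ) : ∀ V, 0 ≤ V → V ≤ 2 ^ j * y →
      ∑ m ∈ roughIn y V, 1 / (m : ℝ) ≤ 402 * j / log y := by
    induction j with
    | zero =>
      intro V hV hVy
      rw [roughIn_eq_empty (by simpa using hVy)]; simp
    | succ j ih =>
      intro V hV hVy
      rcases hV.eq_or_lt with rfl | hV0
      · rw [roughIn_eq_empty hy0.le]; simp; positivity
      have hsub : (roughIn y V).filter (fun m : ℕ => m ≤ V / 2) ⊆ roughIn y (V / 2) := by
        intro m hm
        obtain ⟨hm, hm2⟩ := mem_filter.1 hm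
        obtain ⟨h1, -, h3⟩ := mem_roughIn.1 hm
        exact mem_roughIn.2 ⟨h1, Nat.le_floor hm2, h3⟩
      rw [← sum_filter_add_sum_filter_not _ (fun m : ℕ => m ≤ V / 2)]
      have e1 := (sum_le_sum_of_subset_of_nonneg (f := fun m : ℕ => 1 / (m : ℝ)) hsub
        fun m _ _ => by positivity).trans (ih (V / 2) (by positivity) (by
          rw [pow_succ] at hVy; linarith))
      have e2 : ∑ m ∈ (roughIn y V).filter (fun m : ℕ => ¬m ≤ V / 2), 1 / (m : ℝ) ≤
          201 * (V / log y) * (2 / V) := by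
        refine (sum_le_card_nsmul _ _ (2 / V) fun m hm => ?_).trans ?_
        · have := (mem_filter.1 hm).2
          rw [div_le_div_iff₀ (by linarith) hV0]
          linarith
        · rw [nsmul_eq_mul]
          refine mul_le_mul_of_nonneg_right (le_trans ?_ (h V hV)) (by positivity)
          exact_mod_cast card_filter_le _ _
      have e3 : 201 * (V / log y) * (2 / V) = 402 / log y := by field_simp; norm_num
      rw [e3] at e2
      push_cast
      have : 402 * (j + 1) / log y = 402 * j / log y + 402 / log y := by ring
      linarith
  rcases le_or_gt V y with hVy | hVy
  · rw [roughIn_eq_empty hVy]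
    simp
    exact div_nonneg (log_nonneg hV) (by linarith)
  have hV0 : 0 < V := by linarith
  have hl2 := log_two_gt_d9
  have hj := Nat.ceil_lt_add_one (div_nonneg (log_nonneg ((one_le_div hy0).2 hVy.le)) (by linarith))
  refine (key ⌈log (V / y) / log 2⌉₊ V hV0.le ?_).trans ?_
  · rw [← div_le_iff₀ hy0, ← rpow_natCast, ← log_le_log_iff (by positivity) (by positivity),
      log_rpow (by norm_num), ← div_le_iff₀ (by linarith)]
    exact Nat.le_ceil _
  · rw [mul_div_assoc', div_le_div_iff_of_pos_right (by linarith)]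
    rw [log_div hV0.ne' hy0.ne', sub_div] at hj
    have e1 : 1 ≤ log y / log 2 := by
      rw [le_div_iff₀ (by linarith)]; linarith [log_two_lt_d9]
    have e2 : log V / log 2 ≤ 600 / 402 * log V := by
      rw [div_le_iff₀ (by linarith)]
      nlinarith [log_nonneg hV]
    rw [log_div hV0.ne' hy0.ne', sub_div]
    nlinarith
end

section

/-- Dirichlet's hyperbola method for a symmetric weight. -/
lemma sum_divisorsAntidiagonal_eq {F : ℕ → ℕ → ℂ} (hF : ∀ m k, F m k = F k m) {v : ℝ}
    (hv : 1 ≤ v) :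
    ∑ n ∈ Icc 1 ⌊v⌋₊, ∑ p ∈ n.divisorsAntidiagonal, F p.1 p.2 =
      2 * ∑ m ∈ Icc 1 ⌊√v⌋₊, partialSum (F m) (v / m) -
        ∑ m ∈ Icc 1 ⌊√v⌋₊, partialSum (F m) (√v) := by
  have hv0 : 0 ≤ v := by linarith
  set N := ⌊v⌋₊ with hN
  have hs1 := one_le_sqrt.2 hv
  have hsv : √v ≤ v := by nlinarith [sq_sqrt hv0]
  have hA : ∑ n ∈ Icc 1 N, ∑ p ∈ n.divisorsAntidiagonal, F p.1 p.2 =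
      ∑ m ∈ Icc 1 N, ∑ k ∈ Icc 1 N, if m * k ≤ N then F m k else 0 := by
    rw [← sum_product (f := fun p : ℕ × ℕ => if p.1 * p.2 ≤ N then F p.1 p.2 else 0),
      ← sum_filter]
    rw [← sum_fiberwise_of_maps_to (t := Icc 1 N) (g := fun p : ℕ × ℕ => p.1 * p.2)]
    · refine sum_congr rfl fun n hn => ?_
      refine sum_congr ?_ fun _ _ => rfl
      obtain ⟨hn1, hn2⟩ := mem_Icc.1 hn
      rw [Nat.divisorsAntidiagonal_eq_prod_filter_of_le (by omega) hn2]
      ext p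
      simp only [mem_filter, mem_product, mem_Icc, mem_Ioc]
      constructor
      · rintro ⟨⟨⟨_, _⟩, _, _⟩, h⟩
        exact ⟨⟨⟨⟨by omega, by omega⟩, by omega, by omega⟩, h ▸ hn2⟩, h⟩
      · rintro ⟨⟨⟨⟨_, _⟩, _, _⟩, _⟩, h⟩
        exact ⟨⟨⟨by omega, by omega⟩, by omega, by omega⟩, h⟩
    · intro p hp
      simp only [mem_filter, mem_product, mem_Icc] at hp ⊢
      exact ⟨Nat.mul_pos hp.1.1.1 hp.1.2.1, hp.2⟩
  have hmk (m k : ℕ) (hm : 1 ≤ m) : m * k ≤ N ↔ k ≤ v / m := by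
    rw [hN, Nat.le_floor_iff hv0, le_div_iff₀' (mod_cast hm)]
    push_cast
    rfl
  have hpt : ∀ m ∈ Icc 1 N, ∀ k ∈ Icc 1 N, (if m * k ≤ N then F m k else 0) =
      (if m ≤ √v then if k ≤ v / m then F m k else 0 else 0) +
      (if k ≤ √v then if m ≤ v / k then F k m else 0 else 0) -
      (if m ≤ √v then if k ≤ √v then F m k else 0 else 0) := by
    intro m hm k hk
    have hm1 := (mem_Icc.1 hm).1
    have hk1 := (mem_Icc.1 hk).1
    simp only [← hmk m k hm1, ← hmk k m hk1, mul_comm k m, hF k m]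
    by_cases h1 : m ≤ √v <;> by_cases h2 : k ≤ √v
    · have : m * k ≤ N := by
        rw [hN, Nat.le_floor_iff hv0]
        push_cast
        calc m * k ≤ √v * √v := by gcongr
          _ = v := mul_self_sqrt hv0
      simp [h1, h2, this]
    · simp [h1, h2]
    · simp [h1, h2]
    · have : ¬m * k ≤ N := by
        rw [hN, Nat.le_floor_iff hv0]
        push Not at h1 h2 ⊢
        push_cast
        calc v = √v * √v := (mul_self_sqrt hv0).symm
          _ < m * k := by gcongr
      simp [h1, h2, this]
  have hfl r (hr : r ≤ v) : (Icc 1 N).filter (fun k : ℕ => k ≤ r) =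
      Icc 1 ⌊r⌋₊ := by
    ext k
    simp only [mem_filter, mem_Icc]
    constructor
    · rintro ⟨⟨h1, _⟩, h3⟩
      exact ⟨h1, Nat.le_floor h3⟩
    · rintro ⟨h1, h2⟩
      have := (Nat.le_floor_iff' (by omega)).1 h2
      exact ⟨⟨h1, Nat.le_floor (this.trans hr)⟩, this⟩
  have hps r (hr : r ≤ v) m :
      ∑ k ∈ Icc 1 N, (if k ≤ r then F m k else 0) = partialSum (F m) r := by
    rw [← sum_filter, hfl r hr, partialSum]
  have hB : ∑ m ∈ Icc 1 N, ∑ k ∈ Icc 1 N,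
      (if m ≤ √v then if k ≤ v / m then F m k else 0 else 0) =
      ∑ m ∈ Icc 1 ⌊√v⌋₊, partialSum (F m) (v / m) := by
    rw [← hfl _ hsv, sum_filter]
    refine sum_congr rfl fun m hm => ?_
    split_ifs with h
    · exact hps _ (div_le_self hv0 (mod_cast (mem_Icc.1 hm).1)) m
    · simp
  have hC : ∑ m ∈ Icc 1 N, ∑ k ∈ Icc 1 N,
      (if m ≤ √v then if k ≤ √v then F m k else 0 else 0) =
      ∑ m ∈ Icc 1 ⌊√v⌋₊, partialSum (F m) (√v) := by
    rw [← hfl _ hsv, sum_filter]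
    refine sum_congr rfl fun m _ => ?_
    split_ifs with h
    · exact hps _ hsv m
    · simp
  rw [hA, sum_congr rfl fun m hm => sum_congr rfl (hpt m hm)]
  simp only [sum_sub_distrib, sum_add_distrib]
  rw [hB, hC, sum_comm, hB]
  ring

variable {q : ℕ} {y : ℝ}

lemma classWeight_natCast_mul (a : ZMod q) {m : ℕ} (hm : m.Coprime q) (k : ℕ) :
    classWeight a (m * k) = classWeight (a * (m : ZMod q)⁻¹) k := by
  have hu := (ZMod.isUnit_iff_coprime m q).2 hm
  have h1 := ZMod.mul_inv_of_unit _ hu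
  rw [classWeight, classWeight, Nat.cast_mul, map_mul, MulChar.one_apply hu, one_mul]
  congr 1
  refine if_congr ⟨fun h => ?_, fun h => ?_⟩ rfl rfl
  · rw [h, mul_right_comm, h1, one_mul]
  · rw [← h, mul_left_comm, h1, mul_one]

lemma isUnit_mul_inv_natCast {a : ZMod q} (ha : IsUnit a) {m : ℕ} (hm : m.Coprime q) :
    IsUnit (a * (m : ZMod q)⁻¹) :=
  ha.mul (isUnit_iff_exists_inv.2 ⟨m, ZMod.inv_mul_of_unit _ ((ZMod.isUnit_iff_coprime m q).2 hm)⟩)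

lemma roughCoeff_eq_one_or_zero (y : ℝ) (n : ℕ) : roughCoeff y n = 1 ∨ roughCoeff y n = 0 := by
  rw [roughCoeff]; split_ifs <;> simp

lemma sum_Icc_roughCoeff_mul (V : ℝ) (f : ℕ → ℝ) :
    ∑ m ∈ Icc 1 ⌊V⌋₊, ‖roughCoeff y m‖ * f m = ∑ m ∈ roughIn y V, f m := by
  have : roughIn y V = (Icc 1 ⌊V⌋₊).filter fun n => 2 ≤ n ∧ ∀ p ∈ primesUpTo y, ¬p ∣ n := by
    ext n
    simp only [mem_roughIn, mem_filter, mem_Icc]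
    constructor
    · rintro ⟨h1, h2, h3⟩; exact ⟨⟨by omega, h2⟩, h1, h3⟩
    · rintro ⟨⟨_, h2⟩, h1, h3⟩; exact ⟨h1, h2, h3⟩
  rw [this, sum_filter]
  refine sum_congr rfl fun m _ => ?_
  rw [roughCoeff]
  split_ifs <;> simp

lemma partialSum_classWeight_mul_roughCoeff (hq : ∀ n, roughCoeff y n ≠ 0 → n.Coprime q)
    (b : ZMod q) (v : ℝ) : partialSum (classWeight b * roughCoeff y) v =
      ((q.totient * roughCount y b v - (roughIn y v).card : ℝ) : ℂ) := by
  have h1 := partialSum_roughClass (y := y) b v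
  have h2 := partialSum_roughClass (y := y) (0 : ZMod 1) v
  rw [roughCount_one_eq] at h2
  push_cast at h1 h2 ⊢
  rw [← h1, ← h2]
  simp only [partialSum, mul_sum, ← sum_sub_distrib]
  refine sum_congr rfl fun n _ => ?_
  have h3 : roughClass y (0 : ZMod 1) n = roughCoeff y n := if_pos (Subsingleton.elim _ _)
  rw [Pi.mul_apply, classWeight, h3, roughClass]
  by_cases h0 : roughCoeff y n = 0
  · simp [h0]
  · rw [MulChar.one_apply ((ZMod.isUnit_iff_coprime n q).2 (hq n h0)), sub_mul, one_mul]
    congr 1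
    simp only [eq_comm (a := b)]
    split_ifs <;> simp

/-- The discrepancy of products of two rough integers. -/
lemma norm_partialSum_classWeight_mul_convolution_le (hq : ∀ n, roughCoeff y n ≠ 0 → n.Coprime q)
    {a : ZMod q} (ha : IsUnit a) {F : ℝ → ℝ} (hF : ∀ b : ZMod q, IsUnit b → ∀ v, 1 ≤ v →
      ‖partialSum (classWeight b * roughCoeff y) v‖ ≤ F v) {v : ℝ} (hv : 1 ≤ v) :
    ‖partialSum (classWeight a * (LSeries.convolution (roughCoeff y) (roughCoeff y))) v‖ ≤
      2 * ∑ m ∈ roughIn y (√v), F (v / m) + ∑ _m ∈ roughIn y (√v), F (√v) := by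
  set G : ℕ → ℕ → ℂ := fun m k => classWeight a (m * k) * (roughCoeff y m * roughCoeff y k) with hG
  have h1 : partialSum (classWeight a * (LSeries.convolution (roughCoeff y) (roughCoeff y))) v =
      ∑ n ∈ Icc 1 ⌊v⌋₊, ∑ p ∈ n.divisorsAntidiagonal, G p.1 p.2 := by
    refine sum_congr rfl fun n _ => ?_
    rw [Pi.mul_apply, LSeries.convolution_def, mul_sum]
    refine sum_congr rfl fun p hp => ?_
    rw [hG]
    dsimp only
    rw [(Nat.mem_divisorsAntidiagonal.1 hp).1]
  have h2 m V (hV : 1 ≤ V) :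
      ‖partialSum (G m) V‖ ≤ ‖roughCoeff y m‖ * F V := by
    by_cases h0 : roughCoeff y m = 0
    · simp [hG, h0, partialSum]
    have hm := hq m h0
    have : partialSum (G m) V = roughCoeff y m *
        partialSum (classWeight (a * (m : ZMod q)⁻¹) * roughCoeff y) V := by
      simp only [partialSum, mul_sum, hG, classWeight_natCast_mul a hm, Pi.mul_apply]
      exact sum_congr rfl fun k _ => by ring
    rw [this, norm_mul]
    exact mul_le_mul_of_nonneg_left (hF _ (isUnit_mul_inv_natCast ha hm) V hV) (norm_nonneg _)
  rw [h1, sum_divisorsAntidiagonal_eq (fun m k => by simp only [hG, mul_comm]) hv,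
    ← sum_Icc_roughCoeff_mul, ← sum_Icc_roughCoeff_mul]
  refine (norm_sub_le _ _).trans (add_le_add ?_ (norm_sum_le_of_le _ fun m _ => h2 m _ (one_le_sqrt.2 hv)))
  rw [norm_mul, Complex.norm_ofNat]
  refine mul_le_mul_of_nonneg_left (norm_sum_le_of_le _ fun m hm => h2 m _ ?_) (by norm_num)
  obtain ⟨hm1, hm2⟩ := mem_Icc.1 hm
  have hm3 := (Nat.le_floor_iff' (by omega)).1 hm2
  rw [one_le_div (mod_cast hm1)]
  nlinarith [sq_sqrt (show 0 ≤ v by linarith)]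
end

section

lemma partialSum_classWeight_mul_mixedCoeff {q : ℕ} (a : ZMod q) (y v : ℝ) :
    partialSum (classWeight a * mixedCoeff y) v = partialSum (classWeight a * primeCoeff y) v -
      partialSum (classWeight a * roughCoeff y) v +
        1 / 2 * partialSum (classWeight a * (LSeries.convolution (roughCoeff y) (roughCoeff y))) v := by
  simp only [partialSum, mul_sum, ← sum_sub_distrib, ← sum_add_distrib]
  refine sum_congr rfl fun n _ => ?_
  simp only [Pi.mul_apply, mixedCoeff, Pi.add_apply, Pi.sub_apply, Pi.smul_apply, smul_eq_mul]
  ring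

/-- Up to a small error, only the primes contribute to the discrepancy. -/
lemma exists_norm_partialSum_classWeight_sub_le : ∃ y₁ : ℝ, 3 ≤ y₁ ∧ ∀ y : ℝ, y₁ ≤ y →
    ∀ S ⊆ primesUpTo y, ∀ q : ℕ, q = ∏ p ∈ S, p → (q : ℝ) ≤ y ^ (4 / 5 : ℝ) →
    ∀ a : ZMod q, IsUnit a → ∀ v, 1 ≤ v →
      ‖partialSum (classWeight a * mixedCoeff y) v -
        partialSum (classWeight a * primeCoeff y) v‖ ≤
        exp 27 * (v / log y) * exp (-(3 / 10 * (log v / log y))) := by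
  obtain ⟨y₁, hy₁, hdisc⟩ := exists_abs_totient_mul_roughCount_sub_card_le
  obtain ⟨y₂, hy₂, hcard⟩ := exists_card_roughIn_le
  refine ⟨max y₁ y₂, le_max_of_le_left hy₁, fun y hy S hS q hq hqy a ha v hv => ?_⟩
  obtain ⟨hy1, hy2⟩ := max_le_iff.1 hy
  have hv0 : 0 < v := by linarith
  have hL1 : 1 ≤ log y := by
    rw [le_log_iff_exp_le (by linarith)]
    linarith [exp_one_lt_d9]
  have hL : 0 < log y := by linarith
  have hcop : ∀ n, roughCoeff y n ≠ 0 → n.Coprime q := fun n hn => by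
    rw [hq]
    refine coprime_of_mem_roughIn (v := n) hS (mem_roughIn.2 ?_)
    rw [roughCoeff, ite_ne_right_iff] at hn
    exact ⟨hn.1.1, by simp, hn.1.2⟩
  set θ := 3 / 4 / log y with hθ
  have hθ0 : 0 < θ := by positivity
  set K := exp 18 / log y with hK
  have hK0 : 0 < K := by positivity
  have hF : ∀ b : ZMod q, IsUnit b → ∀ v, 1 ≤ v →
      ‖partialSum (classWeight b * roughCoeff y) v‖ ≤ K * v ^ (1 - θ) := fun b hb v hv => by
    rw [partialSum_classWeight_mul_roughCoeff hcop, norm_real]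
    exact (hdisc y hy1 S hS q hq hqy b hb).2 v hv
  have h1 := hF a ha v hv
  have h2 := norm_partialSum_classWeight_mul_convolution_le hcop ha hF hv
  have hs1 := one_le_sqrt.2 hv
  have hs0 : 0 < √v := by linarith
  have hsq := sqrt_eq_rpow v
  set u := log v / log y with hu
  have hu0 := div_nonneg (log_nonneg hv) hL.le
  have hW : v ^ (1 - θ / 2) = v * exp (-(3 / 8 * u)) := by
    rw [sub_eq_add_neg, rpow_add hv0, rpow_one, rpow_def_of_pos hv0, hθ, hu]
    ring_nf
  set W := v ^ (1 - θ / 2) with hWdef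
  have h3 : ∑ m ∈ roughIn y (√v), K * (v / m) ^ (1 - θ) ≤ K * W * (300 * u) := by
    have hm : ∀ m ∈ roughIn y (√v), K * (v / m) ^ (1 - θ) ≤ K * W * (1 / m) := fun m hm => by
      obtain ⟨hm1, hm2, -⟩ := mem_roughIn.1 hm
      have hm0 : (0 : ℝ) < m := mod_cast (by omega : 0 < m)
      rw [mul_assoc]
      refine mul_le_mul_of_nonneg_left ?_ hK0.le
      have e1 : m ^ θ ≤ v ^ (θ / 2) := by
        refine (rpow_le_rpow hm0.le ((Nat.le_floor_iff' (by omega)).1 hm2) hθ0.le).trans (le_of_eq ?_)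
        rw [hsq, ← rpow_mul hv0.le]
        ring_nf
      rw [div_rpow hv0.le hm0.le, rpow_sub hm0, rpow_one, mul_one_div, div_div_eq_mul_div]
      refine div_le_div_of_nonneg_right ?_ hm0.le
      refine (mul_le_mul_of_nonneg_left e1 (by positivity)).trans (le_of_eq ?_)
      rw [← rpow_add hv0, hWdef]
      ring_nf
    refine (sum_le_sum hm).trans ?_
    rw [← mul_sum]
    refine mul_le_mul_of_nonneg_left ?_ (by positivity)
    refine (sum_inv_roughIn_le (hy₁.trans hy1) (hcard y hy2) hs1).trans (le_of_eq ?_)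
    rw [log_sqrt hv0.le, hu]
    ring
  have h4 : ∑ _m ∈ roughIn y (√v), K * (√v) ^ (1 - θ) ≤ 201 * (K * W) := by
    rw [sum_const, nsmul_eq_mul]
    have e1 : W = √v * (√v) ^ (1 - θ) := by
      rw [hsq, ← rpow_mul hv0.le, ← rpow_add hv0, hWdef]
      ring_nf
    have e2 : ((roughIn y (√v)).card : ℝ) ≤ 201 * √v := by
      refine (hcard y hy2 _ hs0.le).trans (mul_le_mul_of_nonneg_left ?_ (by norm_num))
      exact div_le_self hs0.le hL1
    refine (mul_le_mul_of_nonneg_right e2 (by positivity)).trans (le_of_eq ?_)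
    rw [e1]
    ring
  have h5 : v ^ (1 - θ) ≤ W := rpow_le_rpow_of_exponent_le hv (by linarith)
  rw [partialSum_classWeight_mul_mixedCoeff, show ∀ a b c : ℂ, a - b + c - a = c - b by
    intros; ring]
  have h6 : K * W * (300 * u + 102) ≤ exp 27 * (v / log y) * exp (-(3 / 10 * u)) := by
    have e1 : u ≤ 40 / 3 * exp (3 / 40 * u) := by linarith [add_one_le_exp (3 / 40 * u)]
    have e2 : 1 ≤ exp (3 / 40 * u) := one_le_exp (by positivity)
    have e3 : 4102 ≤ exp 9 := by
      rw [show (9 : ℝ) = (9 : ℕ) * 1 by norm_num, exp_nat_mul]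
      exact le_trans (by norm_num) (pow_le_pow_left₀ (by norm_num) exp_one_gt_d9.le 9)
    have e4 : 300 * u + 102 ≤ exp 9 * exp (3 / 40 * u) := by nlinarith
    refine (mul_le_mul_of_nonneg_left e4 (by positivity)).trans (le_of_eq ?_)
    rw [hW, hK, show (27 : ℝ) = 18 + 9 by norm_num, exp_add,
      show -(3 / 10 * u) = -(3 / 8 * u) + 3 / 40 * u by ring, exp_add]
    ring
  refine ((norm_sub_le _ _).trans ?_).trans h6
  rw [norm_mul, show ‖(1 / 2 : ℂ)‖ = 1 / 2 by norm_num]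
  have := mul_le_mul_of_nonneg_left h5 hK0.le
  have hKW : 0 < K * W := by positivity
  nlinarith
end

section
open Chebyshev

/-- The primes in `(y, v]`. -/
noncomputable def primesBetween (y v : ℝ) : Finset ℕ :=
  (Icc 1 ⌊v⌋₊).filter fun p => log y < log p ∧ p.Prime

variable {q : ℕ} {y : ℝ}

lemma primesBetween_subset_roughIn (v : ℝ) : primesBetween y v ⊆ roughIn y v := by
  intro p hp
  obtain ⟨h1, h2, h3⟩ := mem_filter.1 hp
  refine mem_roughIn.2 ⟨h3.two_le, (mem_Icc.1 h1).2, fun r hr hd => ?_⟩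
  rw [(Nat.prime_dvd_prime_iff_eq (prime_of_mem_primesUpTo hr) h3).1 hd] at hr
  exact absurd (log_le_log (by exact_mod_cast h3.pos) (le_of_mem_primesUpTo hr)) (not_le.2 h2)

lemma le_card_primesBetween (hy : 0 ≤ y) {v : ℝ} (hv : 1 < v)
    (h : 92 / 100 * v ≤ psi v) :
    92 / 100 * v / log v - y ≤ (primesBetween y v).card := by
  have h1 := h.trans (psi_le_primeCounting_mul_log' v)
  have h2 : (Nat.primeCounting ⌊v⌋₊ : ℝ) ≤ (primesBetween y v).card + y := by
    rw [← Nat.primesLE_card_eq_primeCounting]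
    have hs : Nat.primesLE ⌊v⌋₊ ⊆ primesBetween y v ∪ Icc 1 ⌊y⌋₊ := by
      intro p hp
      obtain ⟨hp1, hp2⟩ := Nat.mem_primesLE.1 hp
      rw [mem_union, primesBetween, mem_filter, mem_Icc, mem_Icc]
      rcases lt_or_ge (log y) (log p) with hl | hl
      · exact .inl ⟨⟨hp2.one_le, hp1⟩, hl, hp2⟩
      · refine .inr ⟨hp2.one_le, Nat.le_floor ?_⟩
        have hp0 : (1 : ℝ) < p := mod_cast hp2.one_lt
        rcases hy.eq_or_lt with rfl | hy0
        · rw [log_zero] at hl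
          exact absurd (log_pos hp0) (not_lt.2 hl)
        · exact (log_le_log_iff (by linarith) hy0).1 hl
    have := (card_le_card hs).trans (card_union_le _ _)
    rw [Nat.card_Icc, Nat.add_sub_cancel] at this
    have h3 : ((Nat.primesLE ⌊v⌋₊).card : ℝ) ≤ (primesBetween y v).card + ⌊y⌋₊ := by
      exact_mod_cast this
    linarith [Nat.floor_le hy]
  have hl := log_pos hv
  have h3 := (div_le_iff₀ hl).2 h1
  linarith

lemma partialSum_classWeight_mul_primeCoeff {S : Finset ℕ} (hS : S ⊆ primesUpTo y)
    (hq : q = ∏ p ∈ S, p) (a : ZMod q) (v : ℝ) :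
    partialSum (classWeight a * primeCoeff y) v =
      ((q.totient * ((primesBetween y v).filter fun p : ℕ => a = (p : ZMod q)).card -
        (primesBetween y v).card : ℝ) : ℂ) := by
  have h : partialSum (classWeight a * primeCoeff y) v =
      ∑ p ∈ primesBetween y v, ((if a = (p : ZMod q) then (q.totient : ℂ) else 0) - 1) := by
    rw [partialSum, primesBetween, sum_filter]
    refine sum_congr rfl fun p hp => ?_
    rw [Pi.mul_apply, classWeight, primeCoeff]
    by_cases h1 : log y < log p
    · by_cases h2 : p.Prime
      · have hc := coprime_of_mem_roughIn hS (primesBetween_subset_roughIn v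
          (mem_filter.2 ⟨hp, h1, h2⟩))
        rw [← hq] at hc
        simp [h1, h2, MulChar.one_apply ((ZMod.isUnit_iff_coprime p q).2 hc)]
      · simp [h1, h2]
    · simp [h1]
  rw [h, sum_sub_distrib, ← sum_filter]
  simp [mul_comm]

lemma exists_eq_ofReal (a : ZMod q) (y : ℝ) :
    ∃ g : ℕ → ℝ, ∀ n, (classWeight a * mixedCoeff y) n = (g n : ℂ) := by
  have hr : ∀ n, roughCoeff y n ∈ Complex.ofRealHom.range := fun n => by
    rcases roughCoeff_eq_one_or_zero y n with h | h <;> rw [h]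
    · exact one_mem _
    · exact zero_mem _
  have hn : ∀ n, (classWeight a * mixedCoeff y) n ∈ Complex.ofRealHom.range := fun n => by
    refine mul_mem (sub_mem ?_ ?_) (add_mem (sub_mem ?_ (hr n)) (mul_mem ⟨1 / 2, by simp⟩ ?_))
    · split_ifs
      · exact natCast_mem _ _
      · exact zero_mem _
    · by_cases hu : IsUnit (n : ZMod q)
      · rw [MulChar.one_apply hu]; exact one_mem _
      · rw [MulChar.map_nonunit _ hu]; exact zero_mem _
    · rw [primeCoeff]
      split_ifs
      exacts [one_mem _, zero_mem _, zero_mem _]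
    · rw [LSeries.convolution_def]
      exact sum_mem fun p _ => mul_mem (hr _) (hr _)
  choose g hg using hn
  exact ⟨g, fun n => (hg n).symm⟩
end

lemma exp_mul_div_mul_exp_le {v L : ℝ} (hL : 0 < L) (h : 1 ≤ v) :
    exp 27 * (v / L) * exp (-(3 / 10 * (log v / L))) ≤ exp 27 / L * v := by
  rw [show exp 27 / L * v = exp 27 * (v / L) by ring]
  refine mul_le_of_le_one_right (by positivity) (exp_le_one_iff.2 ?_)
  have := div_nonneg (log_nonneg h) hL.le
  linarith

lemma abs_le_of_abs_sub_sub_le {v L g u p : ℝ} (hL : 0 < L) (h : 1 ≤ v)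
    (hg : |g - (u - p)| ≤ exp 27 * (v / L) * exp (-(3 / 10 * (log v / L))))
    (hu : u ≤ 201 / L * v) (hu1 : 0 ≤ u) (hp : 0 ≤ p) (hp1 : p ≤ v) :
    |g| ≤ (201 / L + 1 + exp 27 / L) * v := by
  obtain ⟨h1, h2⟩ := abs_le.1 (hg.trans (exp_mul_div_mul_exp_le hL h))
  exact abs_le.2 ⟨by linarith, by linarith⟩

/-- A Tauberian step in which `u` counts primes in a residue class and `p` counts all primes. -/
lemma le_of_integral_laplaceDensity_le {g : ℕ → ℝ} {u p : ℝ → ℝ} (hu : Monotone u)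
    (hp : Monotone p) {L T : ℝ} (hL : 1 ≤ L) (hT : 0 < T)
    (hu0 : ∀ v, 1 ≤ v → u v ≤ 201 / L * v) (hu1 : ∀ v, 0 ≤ u v) (hp0 : ∀ v, 0 ≤ p v)
    (hp1 : ∀ v, 1 ≤ v → p v ≤ v)
    (hTτ : 4 * π * (1 + 1 / (1 / 1000) ^ 2) / T = 1 / 200000 / (201 + exp 27))
    (hg : ∀ v, 1 ≤ v → |partialSum g v - (u v - p v)| ≤
      exp 27 * (v / L) * exp (-(3 / 10 * (log v / L))))
    (hI : ∫ t, fejerWeight T t * ‖expTransform (laplaceDensity (fun n => (g n : ℂ))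
      (1 + 1 / (128 * L))) t‖ ≤ 1 / 200000 / L) :
    p (exp (128 * L - 1 / 500)) ≤ exp (1 / 500 + 1 / (64000 * L)) * u (exp (128 * L)) +
      exp (128 * L + 1) * (exp (-11) + 1 / 40000) / L := by
  have hL0 : 0 < L := by linarith
  obtain ⟨σ, hσ⟩ : ∃ σ, σ = 1 + 1 / (128 * L) := ⟨_, rfl⟩
  have hσ1 : 1 < σ := by rw [hσ]; linarith [show 0 < 1 / (128 * L) by positivity]
  have hσw : σ * (128 * L) = 128 * L + 1 := by rw [hσ]; field_simp
  have hσe : exp (σ * (1 / 500)) = exp (1 / 500 + 1 / (64000 * L)) := by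
    rw [hσ]; congr 1; field_simp; ring
  rw [← hσ] at hI
  have hv v : partialSum (fun n => (g n : ℂ)) v = ((partialSum g v : ℝ) : ℂ) := by
    simp [partialSum]
  obtain ⟨G, hG⟩ : ∃ G : ℝ → ℝ, G = fun w => exp (-(σ * w)) * partialSum g (exp w) := ⟨_, rfl⟩
  have hGe : laplaceDensity (fun n => (g n : ℂ)) σ = fun w => (G w : ℂ) := by
    ext w
    rw [laplaceDensity, hv, hG]
    push_cast
    rfl
  have hK v (h : 1 ≤ v) : ‖partialSum (fun n => (g n : ℂ)) v‖ ≤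
      (201 / L + 1 + exp 27 / L) * v := by
    rw [hv, norm_real]
    exact abs_le_of_abs_sub_sub_le hL0 h (hg v h) (hu0 v h) (hu1 v) (hp0 v) (hp1 v h)
  have hin : Integrable G := by
    have h := integrable_laplaceDensity hσ1 hK
    rw [hGe] at h
    simpa using h.re
  have hexp {w : ℝ} (hw : 0 ≤ w) : exp (-(σ * w)) * exp w ≤ 1 := by
    rw [← exp_add, exp_le_one_iff]
    nlinarith
  have hB w : G w ≤ (201 + exp 27) / L := by
    rcases lt_or_ge w 0 with hw | hw
    · have h := laplaceDensity_of_neg (f := fun n => (g n : ℂ)) (σ := σ) hw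
      rw [hGe] at h
      rw [Complex.ofReal_eq_zero.1 h]
      positivity
    · have he := one_le_exp hw
      have h2 := (abs_le.1 ((hg _ he).trans (exp_mul_div_mul_exp_le hL0 he))).2
      have h3 : partialSum g (exp w) ≤ (201 + exp 27) / L * exp w := by
        have := hu0 _ he
        have := hp0 (exp w)
        rw [add_div]
        linarith
      rw [hG]
      calc _ ≤ exp (-(σ * w)) * ((201 + exp 27) / L * exp w) :=
          mul_le_mul_of_nonneg_left h3 (exp_nonneg _)
        _ = (201 + exp 27) / L * (exp (-(σ * w)) * exp w) := by ring
        _ ≤ _ := mul_le_of_le_one_right (by positivity) (hexp hw)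
  obtain ⟨M, hM⟩ : ∃ M, M = exp (-(σ * (128 * L - 1 / 500))) * u (exp (128 * L)) -
    exp (-(σ * (128 * L))) * p (exp (128 * L - 1 / 500)) + exp (-11) / L := ⟨_, rfl⟩
  have hnear w (hw : |w - (128 * L - 1 / 1000)| ≤ 1 / 1000) : G w ≤ M := by
    obtain ⟨ha, hb⟩ := abs_le.1 hw
    have hw0 : 0 ≤ w := by linarith
    have h2 := (abs_le.1 (hg _ (one_le_exp hw0))).2
    rw [log_exp] at h2
    have h3 : exp 27 * (exp w / L) * exp (-(3 / 10 * (w / L))) ≤ exp w * (exp (-11) / L) := by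
      have : exp 27 * exp (-(3 / 10 * (w / L))) ≤ exp (-11) := by
        rw [← exp_add, exp_le_exp]
        have : 127.9 ≤ w / L := by rw [le_div_iff₀ hL0]; linarith
        linarith
      calc _ = exp w / L * (exp 27 * exp (-(3 / 10 * (w / L)))) := by ring
        _ ≤ exp w / L * exp (-11) := by gcongr
        _ = _ := by ring
    have h4 : u (exp w) ≤ u (exp (128 * L)) := hu (exp_le_exp.2 (by linarith))
    have h5 : p (exp (128 * L - 1 / 500)) ≤ p (exp w) := hp (exp_le_exp.2 (by linarith))
    rw [hG, hM]
    calc exp (-(σ * w)) * partialSum g (exp w) ≤ exp (-(σ * w)) * (u (exp (128 * L)) -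
          p (exp (128 * L - 1 / 500)) + exp w * (exp (-11) / L)) := by gcongr; linarith
      _ = exp (-(σ * w)) * u (exp (128 * L)) - exp (-(σ * w)) * p (exp (128 * L - 1 / 500)) +
          exp (-(σ * w)) * exp w * (exp (-11) / L) := by ring
      _ ≤ _ := by
        refine add_le_add (sub_le_sub (mul_le_mul_of_nonneg_right (exp_le_exp.2 ?_) (hu1 _))
          (mul_le_mul_of_nonneg_right (exp_le_exp.2 ?_) (hp0 _)))
          (mul_le_of_le_one_left (by positivity) (hexp hw0)) <;> nlinarith
  have hc : 4 * π * (1 + 1 / (1 / 1000) ^ 2) / T ≤ 0.4 := by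
    rw [hTτ, div_le_iff₀ (by positivity)]
    linarith [exp_pos 27]
  rw [hGe] at hI
  have key := le_of_integral_fejerWeight_mul_norm_le hT hin (by norm_num) hc
    (by positivity : 0 ≤ (201 + exp 27) / L) hnear hB hI
  rw [hTτ, div_mul_div_comm, mul_comm (201 + exp 27), mul_div_mul_right _ _ (by positivity)] at key
  have hM2 : -(1 / 40000 / L) ≤ M := by
    have : 0 < 1 / 200000 / L := by positivity
    have h5 : 1 / 40000 / L = 5 * (1 / 200000 / L) := by ring
    rcases key with h | h <;> linarith
  have h6 : exp (128 * L + 1) * M = exp (1 / 500 + 1 / (64000 * L)) * u (exp (128 * L)) -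
      p (exp (128 * L - 1 / 500)) + exp (128 * L + 1) * (exp (-11) / L) := by
    rw [hM, mul_add, mul_sub, ← mul_assoc, ← mul_assoc, ← hσw, ← exp_add, ← exp_add,
      add_neg_cancel, exp_zero, one_mul, ← hσe]
    ring_nf
  have h7 := mul_le_mul_of_nonneg_left hM2 (exp_nonneg (128 * L + 1))
  rw [h6] at h7
  rw [mul_div_assoc, add_div, mul_add]
  linarith

section

lemma nine_tenths_mul_le_of_le {l y u p : ℝ} (hl : 1000 ≤ l) (hly : l ≤ 1 / 10 ^ 7 * y)
    (hy : y = exp l) (hp : 92 / 100 * exp (128 * l - 1 / 500) / (128 * l - 1 / 500) - y ≤ p)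
    (h : p ≤ exp (1 / 500 + 1 / (64000 * l)) * u +
      exp (128 * l + 1) * (exp (-11) + 1 / 40000) / l) :
    9 / 10 * (exp (128 * l) / (128 * l)) ≤ u := by
  obtain ⟨w, hw⟩ : ∃ w, w = exp (128 * l) / (128 * l) := ⟨_, rfl⟩
  have hw0 : 0 < w := by rw [hw]; positivity
  have he1 : exp (128 * l - 1 / 500) = exp (128 * l) * exp (-(1 / 500)) := by
    rw [← exp_add]; rfl
  have h1 : (91816 / 100000 : ℝ) * w ≤ 92 / 100 * exp (128 * l - 1 / 500) / (128 * l - 1 / 500) := by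
    rw [hw, he1, mul_div_assoc']
    gcongr ?_ / ?_
    · linarith
    · have := mul_le_mul_of_nonneg_left (add_one_le_exp (-(1 / 500) : ℝ)) (exp_nonneg (128 * l))
      linarith
    · linarith
  have h2 : y ≤ 1 / 10000 * w := by
    have hyp : y ^ 2 ≤ exp (128 * l) := by
      rw [hy, ← exp_nat_mul]
      gcongr
      norm_num
    have hy0 := hy ▸ exp_pos l
    rw [hw, mul_div_assoc', le_div_iff₀ (by positivity)]
    nlinarith
  have h3 : exp (128 * l + 1) * (exp (-11) + 1 / 40000) / l ≤ 146 / 10000 * w := by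
    have h4 : exp (128 * l + 1) * (exp (-11) + 1 / 40000) / l =
        128 * (exp 1 * exp (-11) + exp 1 * (1 / 40000)) * w := by
      rw [hw, exp_add]; field_simp
    rw [h4, ← exp_add]
    have h5 : exp (1 + -11) ≤ 46 / 10 ^ 6 := by
      rw [show (1 + -11 : ℝ) = -(10 : ℕ) * 1 by norm_num, neg_mul, exp_neg, exp_nat_mul]
      refine inv_le_of_inv_le₀ (by norm_num) ?_
      refine le_trans (by norm_num) (pow_le_pow_left₀ (by norm_num) exp_one_gt_d9.le 10)
    have h6 := exp_one_lt_d9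
    gcongr
    linarith
  have h7 : exp (1 / 500 + 1 / (64000 * l)) * (9979 / 10000) ≤ 1 := by
    have h8 : 1 / (64000 * l) ≤ 1 / 10 ^ 6 :=
      one_div_le_one_div_of_le (by norm_num) (by linarith)
    have h9 : 9979 / 10000 ≤ exp (-(1 / 500 + 1 / (64000 * l))) := by
      linarith [add_one_le_exp (-(1 / 500 + 1 / (64000 * l)))]
    calc _ ≤ exp (1 / 500 + 1 / (64000 * l)) * exp (-(1 / 500 + 1 / (64000 * l))) := by gcongr
      _ = 1 := by rw [← exp_add, add_neg_cancel, exp_zero]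
  have hu : 0 ≤ u := by
    by_contra! hu
    have := mul_neg_of_pos_of_neg (exp_pos (1 / 500 + 1 / (64000 * l))) hu
    linarith
  rw [← hw]
  nlinarith

lemma exists_totient_mul_card_primesBetween_ge : ∃ ε > 0, ∃ T > 0, ∃ y₁ : ℝ, 3 ≤ y₁ ∧
    ∀ y : ℝ, y₁ ≤ y → ∀ S ⊆ primesUpTo y, ∀ q : ℕ, q = ∏ p ∈ S, p → (q : ℝ) ≤ y ^ (4 / 5 : ℝ) →
    (∀ χ : DirichletCharacter ℂ q, χ ≠ 1 → ∀ t : ℝ, |t| ≤ T → ∀ α : ℝ, 0 < α → α ≤ 1 →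
      ‖primeTail (log y) χ (1 + α + I * t)‖ ≤ ε) →
    ∀ a : ZMod q, IsUnit a → 9 / 10 * (exp (128 * log y) / (128 * log y)) ≤
      q.totient * ((primesBetween y (exp (128 * log y))).filter
        fun p : ℕ => a = (p : ZMod q)).card := by
  obtain ⟨C, hC0, hC⟩ := exists_norm_lSeries_mixedCoeff_le
  obtain ⟨y₁, hy₁, hup⟩ := exists_abs_totient_mul_roughCount_sub_card_le
  obtain ⟨y₂, hy₂, hdisc⟩ := exists_norm_partialSum_classWeight_sub_le
  obtain ⟨T, hT⟩ : ∃ T, T = 4 * π * (1 + 1 / (1 / 1000) ^ 2) * (200000 * (201 + exp 27)) :=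
    ⟨_, rfl⟩
  have hT0 : 0 < T := by rw [hT]; positivity
  have hTτ : 4 * π * (1 + 1 / (1 / 1000) ^ 2) / T = 1 / 200000 / (201 + exp 27) := by
    rw [hT]; field_simp
  obtain ⟨A, hA⟩ : ∃ A, A = (2 + T) * (8 * π * 201 ^ 2 * 128) := ⟨_, rfl⟩
  have hA0 : 0 < A := by rw [hA]; positivity
  obtain ⟨ε, hε⟩ : ∃ ε, ε = min (1 / 8) (1 / (1600000 * A)) := ⟨_, rfl⟩
  have hε0 : 0 < ε := by rw [hε]; positivity
  have hε8 := hε ▸ min_le_left _ _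
  have hεA : 4 * ε * A ≤ 1 / 400000 := by
    have := hε ▸ min_le_right _ _
    rw [le_div_iff₀ (by positivity)] at this
    linarith
  obtain ⟨y₃, hy₃⟩ := eventually_atTop.1 (((eventually_log_le_mul_rpow
    (show 0 < ε / (C + 1) by positivity) (show 0 < 9 / 10 by norm_num)).and
    (eventually_log_le_mul_rpow (show 0 < 1 / (400000 * (C * T + 1)) by positivity)
      (show 0 < 1 / 10 by norm_num))).and
    ((eventually_log_le_mul_rpow (show 0 < 1 / 10 ^ 7 by norm_num) one_pos).and
      ((tendsto_log_atTop.eventually_ge_atTop 1000).and eventually_mul_le_psi)))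
  refine ⟨ε, hε0, T, hT0, max y₁ (max y₂ y₃), le_max_of_le_left hy₁,
    fun y hy S hS q hq hqy hE a ha => ?_⟩
  simp only [max_le_iff] at hy
  obtain ⟨hya, hyb, hyc⟩ := hy
  obtain ⟨⟨e1, e2⟩, e3, e4, -⟩ := hy₃ y hyc
  rw [rpow_one] at e3
  have hy3 := hy₁.trans hya
  have hy0 : 0 < y := by linarith
  obtain ⟨l, hl⟩ : ∃ l, l = log y := ⟨_, rfl⟩
  have hye := exp_log hy0
  rw [← hl] at e1 e2 e3 e4 hye hE ⊢
  have hl0 : 0 < l := by linarith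
  have hq0 : q ≠ 0 := by
    rw [hq]; exact prod_ne_zero_iff.2 fun p hp => (prime_of_mem_primesUpTo (hS hp)).ne_zero
  have : NeZero q := ⟨hq0⟩
  obtain ⟨η, hη⟩ : ∃ η, η = C * y ^ (-(9 / 10) : ℝ) := ⟨_, rfl⟩
  have hη0 : 0 ≤ η := by rw [hη]; positivity
  have hηε : η ≤ ε := by
    rw [hη, rpow_neg hy0.le, ← div_eq_mul_inv, div_le_iff₀ (by positivity)]
    rw [div_mul_eq_mul_div, le_div_iff₀ (by positivity)] at e1
    nlinarith
  have hηT : q.totient * η * T ≤ 1 / 400000 / l := by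
    have h1 : (q.totient : ℝ) ≤ y ^ (4 / 5 : ℝ) := le_trans (mod_cast q.totient_le) hqy
    have h2 : y ^ (4 / 5 : ℝ) * y ^ (-(9 / 10) : ℝ) * y ^ (1 / 10 : ℝ) = 1 := by
      rw [← rpow_add hy0, ← rpow_add hy0]; norm_num
    obtain ⟨r, hr⟩ : ∃ r, r = y ^ (4 / 5 : ℝ) * y ^ (-(9 / 10) : ℝ) := ⟨_, rfl⟩
    have hr0 : 0 < r := by rw [hr]; positivity
    rw [← hr] at h2
    have h3 : q.totient * η * T ≤ r * (C * T) := by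
      rw [hη, hr]
      calc _ ≤ y ^ (4 / 5 : ℝ) * (C * y ^ (-(9 / 10) : ℝ)) * T := by gcongr
        _ = _ := by ring
    refine h3.trans ?_
    rw [le_div_iff₀ hl0]
    rw [div_mul_eq_mul_div, one_mul, le_div_iff₀ (by positivity)] at e2
    have h4 := mul_le_mul_of_nonneg_left e2 hr0.le
    rw [h2] at h4
    nlinarith
  have hD := fun b hb => (hup y hya S hS q hq hqy b hb).1
  rw [← hl] at hD
  obtain ⟨g, hg⟩ := exists_eq_ofReal a y
  have hgv v : partialSum (classWeight a * mixedCoeff y) v = ((partialSum g v : ℝ) : ℂ) := by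
    simp [partialSum, ← hg]
  obtain ⟨p, hp⟩ : ∃ p : ℝ → ℝ, p = fun v => ((primesBetween y v).card : ℝ) := ⟨_, rfl⟩
  obtain ⟨u, hu⟩ : ∃ u : ℝ → ℝ, u = fun v => (q.totient *
    ((primesBetween y v).filter fun p : ℕ => a = (p : ZMod q)).card : ℝ) := ⟨_, rfl⟩
  have hsub {v w : ℝ} (h : v ≤ w) : primesBetween y v ⊆ primesBetween y w :=
    filter_subset_filter _ (Icc_subset_Icc_right (Nat.floor_le_floor h))
  have hpm : Monotone p := fun v w h => by
    rw [hp]; exact Nat.cast_le.2 (card_le_card (hsub h))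
  have hum : Monotone u := fun v w h => by
    rw [hu]
    exact mul_le_mul_of_nonneg_left (Nat.cast_le.2 (card_le_card
      (filter_subset_filter _ (hsub h)))) (Nat.cast_nonneg _)
  have hu0 v (hv : 1 ≤ v) : u v ≤ 201 / l * v := by
    refine le_trans ?_ (hD a ha v (by linarith))
    rw [hu]
    refine mul_le_mul_of_nonneg_left (Nat.cast_le.2 (card_le_card fun p hp => ?_))
      (Nat.cast_nonneg _)
    rw [mem_filter] at hp ⊢
    exact ⟨primesBetween_subset_roughIn v hp.1, hp.2.symm⟩
  have hp1 v (hv : 1 ≤ v) : p v ≤ v := by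
    rw [hp]
    refine le_trans (Nat.cast_le.2 (card_filter_le _ _)) ?_
    simpa using Nat.floor_le (by linarith)
  have hp0 v : 0 ≤ p v := by rw [hp]; positivity
  have hu1 v : 0 ≤ u v := by rw [hu]; positivity
  have hgb v (hv : 1 ≤ v) : |partialSum g v - (u v - p v)| ≤
      exp 27 * (v / l) * exp (-(3 / 10 * (log v / l))) := by
    have h := hdisc y hyb S hS q hq hqy a ha v hv
    rw [partialSum_classWeight_mul_primeCoeff hS hq, hgv, ← Complex.ofReal_sub,
      norm_real, norm_eq_abs, ← hl] at h
    rwa [hu, hp]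
  have hK v (hv : 1 ≤ v) : ‖partialSum (classWeight a * mixedCoeff y) v‖ ≤
      (201 / l + 1 + exp 27 / l) * v := by
    rw [hgv, norm_real]
    exact abs_le_of_abs_sub_sub_le hl0 hv (hgb v hv) (hu0 v hv) (hu1 v) (hp0 v) (hp1 v hv)
  have hl1 : 1 / (128 * l) ≤ 1 := (div_le_one (by positivity)).2 (by linarith)
  have hI := integral_fejerWeight_mul_norm_classWeight_le (σ := 1 + 1 / (128 * l)) (K := _)
    (ε := 2 * (ε + η)) ha hT0 (by linarith [show 0 < 1 / (128 * l) by positivity])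
    (by linarith) (by positivity) hη0 hD hK
    (fun χ hχ t ht => by
      have h := hE χ hχ t ht (1 / (128 * l)) (by positivity) hl1
      rw [hl] at h
      have h2 := hC (by linarith) (hq ▸ prod_dvd_prod_of_subset _ _ _ hS) χ (by simpa [← hl] using hl0) h (by rw [← hη]; linarith)
      rw [← hη] at h2
      rw [hl]
      push_cast at h2 ⊢
      exact h2)
  have hI2 : 2 * (ε + η) * (2 + T) * (8 * π * (201 / l) ^ 2 / (1 + 1 / (128 * l) - 1)) +
      q.totient * η * T ≤ 1 / 200000 / l := by
    have : 2 * (ε + η) * (2 + T) * (8 * π * (201 / l) ^ 2 / (1 + 1 / (128 * l) - 1)) =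
        2 * (ε + η) * A / l := by
      rw [hA, add_sub_cancel_left]; field_simp
    rw [this]
    have h2 : 2 * (ε + η) * A / l ≤ 1 / 400000 / l := by
      gcongr
      nlinarith
    have : 1 / 200000 / l = 1 / 400000 / l + 1 / 400000 / l := by ring
    linarith
  rw [(funext hg)] at hI
  have key := le_of_integral_laplaceDensity_le hum hpm (by linarith) hT0 hu0 hu1 hp0 hp1 hTτ hgb
    (hI.trans hI2)
  have hu' : u (exp (128 * l)) = (q.totient * ((primesBetween y (exp (128 * l))).filter
    fun p : ℕ => a = (p : ZMod q)).card : ℝ) := by rw [hu]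
  rw [← hu']
  refine nine_tenths_mul_le_of_le e4 e3 hye.symm ?_ key
  have hye' : y ≤ exp (128 * l - 1 / 500) := by
    rw [← hye]; exact exp_le_exp.2 (by linarith)
  have := le_card_primesBetween hy0.le (by linarith) (hy₃ _ (hyc.trans hye')).2.2.2
  rw [log_exp] at this
  rwa [hp]
end

lemma card_primesBetween_le_ncard {q : ℕ} {y Z : ℝ} (hq0 : 0 < q) (hqy : (q : ℝ) ≤ y) {a : ℕ}
    (haq : a ≤ q) :
    ((primesBetween y (q * Z)).filter fun p : ℕ => (a : ZMod q) = (p : ZMod q)).card ≤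
      {z : ℤ | 1 ≤ z ∧ (z : ℝ) ≤ Z ∧ Prime ((q : ℤ) * z + a)}.ncard := by
  have hq0' : (0 : ℝ) < q := mod_cast hq0
  have hz {p : ℕ} (hp : p ∈ (primesBetween y (q * Z)).filter
      fun p : ℕ => (a : ZMod q) = (p : ZMod q)) : (q : ℤ) * (((p : ℤ) - a) / q) + a = p := by
    have h := (ZMod.intCast_eq_intCast_iff_dvd_sub (a : ℤ) (p : ℤ) q).1
      (mod_cast (mem_filter.1 hp).2)
    rw [Int.mul_ediv_cancel' h]
    ring
  rw [← Set.ncard_coe_finset]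
  refine Set.ncard_le_ncard_of_injOn (fun p : ℕ => ((p : ℤ) - a) / q) (fun p hp => ?_)
    (fun p hp r hr h => ?_) ((Set.finite_Icc (1 : ℤ) ⌊Z⌋).subset fun z hz => ⟨hz.1, Int.le_floor.2 hz.2.1⟩)
  · have h1 := hz hp
    obtain ⟨h2, h3, h4⟩ := mem_filter.1 (mem_filter.1 hp).1
    obtain ⟨z, hzd⟩ : ∃ z, z = ((p : ℤ) - a) / q := ⟨_, rfl⟩
    rw [← hzd] at h1
    have h6 := (Nat.le_floor_iff' h4.ne_zero).1 (mem_Icc.1 h2).2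
    have h7 : (q : ℝ) * z + a = p := mod_cast h1
    have h8 : (q : ℤ) < p := by exact_mod_cast hqy.trans_lt ((log_lt_log_iff (hq0'.trans_le hqy) (by exact_mod_cast h4.pos)).1 h3)
    refine hzd ▸ ⟨?_, ?_, h1 ▸ Nat.prime_iff_prime_int.1 h4⟩
    · by_contra! h
      nlinarith
    · have : 0 ≤ a := a.cast_nonneg
      exact le_of_mul_le_mul_left (by linarith) hq0'
  · have h1 := hz hp
    have h2 := hz hr
    simp only at h
    rw [h, h2] at h1
    exact_mod_cast h1.symm

lemma mul_le_of_density_le {κ c l k m Z E ε : ℝ} (hl : 0 < l) (hm : 0 < m) (hE : 0 < E)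
    (hZ : 0 ≤ Z) (hc : 0 ≤ c) (hκ : 0 ≤ κ) (hkm : 160 * k ≤ m) (h : 9 / 10 * Z ≤ κ * c * (k + m))
    (h' : κ * (98 / 100) * (l * E) ≤ 1 + 1 / 100) (hε : 0 ≤ ε) :
    (1 - ε) * (1 - exp (-2)) * (E / (1 + 1 / 160)) * (l / m) * Z ≤ c := by
  have he2 : 1 - exp (-2) ≤ 87 / 100 := by
    have h1 : exp (-2) = (exp 1 ^ 2)⁻¹ := by rw [exp_neg, ← exp_nat_mul]; norm_num
    have h2 : exp 1 ^ 2 ≤ 7.4 := by nlinarith [exp_one_lt_d9, exp_one_gt_d9]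
    have h3 := inv_anti₀ (by positivity) h2
    rw [← h1] at h3
    norm_num at h3
    linarith
  have h4 : 9 / 10 * (98 / 100) * (l * E) * Z ≤ (1 + 1 / 100) * (1 + 1 / 160) * m * c := by
    calc _ = 9 / 10 * Z * (98 / 100 * (l * E)) := by ring
      _ ≤ κ * c * (k + m) * (98 / 100 * (l * E)) := by gcongr
      _ ≤ κ * c * ((1 + 1 / 160) * m) * (98 / 100 * (l * E)) := by gcongr; linarith
      _ = κ * (98 / 100) * (l * E) * ((1 + 1 / 160) * m * c) := by ring
      _ ≤ (1 + 1 / 100) * ((1 + 1 / 160) * m * c) := by gcongr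
      _ = _ := by ring
  have h5 : (1 - ε) * (1 - exp (-2)) ≤ 87 / 100 := by
    have : 0 ≤ 1 - exp (-2) := by simp
    nlinarith
  calc _ = (1 - ε) * (1 - exp (-2)) * (E / (1 + 1 / 160) * (l / m) * Z) := by ring
    _ ≤ 87 / 100 * (E / (1 + 1 / 160) * (l / m) * Z) := by gcongr
    _ = 87 / 100 * (l * E) * Z / ((1 + 1 / 160) * m) := by field_simp
    _ ≤ c := by
      rw [div_le_iff₀ (by positivity)]
      have : 0 ≤ l * E * Z := by positivity
      linarith

end

/-- Lower bound for the number of primes of the form `Pz + a` with `z ∈ [Z]`, where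
`P = P(x)/B₀` for a suitable `B₀` (either `1` or a prime `≤ x`), `Z ≥ P^160` and
`1 ≤ a ≤ P` with `gcd(a, P) = 1`. -/
theorem primes_in_AP_lower_bound :
    ∀ ε : ℝ, 0 < ε → ∃ x₀ : ℝ, ∀ x : ℝ, x₀ ≤ x →
      ∃ B₀ : ℕ, (B₀ = 1 ∨ (Nat.Prime B₀ ∧ (B₀ : ℝ) ≤ x)) ∧
        (let P : ℕ := primorialBelow x / B₀
        ∀ Z : ℝ, (P : ℝ) ^ (160 : ℕ) ≤ Z →
          ∀ a : ℤ, 1 ≤ a → a ≤ (P : ℤ) → Int.gcd a (P : ℤ) = 1 →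
            (1 - ε) * (1 - Real.exp (-2)) *
                (Real.exp Real.eulerMascheroniConstant / (1 + 1 / 160)) *
                (Real.log x / Real.log Z) * Z
              ≤ (({z : ℤ | 1 ≤ z ∧ (z : ℝ) ≤ Z ∧ Prime ((P : ℤ) * z + a)}.ncard : ℝ))) := by
  intro ε hε
  obtain ⟨ε₀, hε₀, T, hT, y₁, hy₁, hmain⟩ := exists_totient_mul_card_primesBetween_ge
  obtain ⟨x₀, hx₀⟩ := Filter.eventually_atTop.1
    ((eventually_exists_norm_primeTail_le hε₀ hT.le).and
    ((eventually_prod_one_sub_one_div_le (show 0 < 1 / 100 by norm_num)).and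
    (eventually_half_le_theta.and
    (eventually_log_le_mul_rpow (show 0 < 1 / 20 by norm_num) one_pos))))
  refine ⟨max x₀ y₁, fun x hx => ?_⟩
  obtain ⟨hxa, hxb⟩ := max_le_iff.1 hx
  obtain ⟨⟨B, hB, hE⟩, hM, hθ, hlx⟩ := hx₀ x hxa
  rw [rpow_one] at hlx
  have hx3 := hy₁.trans hxb
  have hlx0 : 0 < log x := log_pos (by linarith)
  refine ⟨B, hB.imp_right fun h => ⟨h.1, h.2.1⟩, ?_⟩
  intro P Z hZ a ha1 haP hgcd
  obtain ⟨q, hqP⟩ : ∃ q, q = P := ⟨_, rfl⟩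
  rw [← hqP] at hZ haP hgcd ⊢
  obtain ⟨S, hS⟩ : ∃ S, S = (primesUpTo x).erase B := ⟨_, rfl⟩
  have hSx := hS ▸ Finset.erase_subset _ _
  have hS1 (h : B = 1) : S = primesUpTo x := hS ▸ Finset.erase_eq_of_notMem
    fun hm => Nat.not_prime_one (h ▸ prime_of_mem_primesUpTo hm)
  -- multiplicative functions over the primes up to `x`
  have hprod {M : Type} [CommMonoid M] (f : ℕ → M) (hf : B = 1 → f B = 1) :
      (∏ p ∈ S, f p) * f B = ∏ p ∈ primesUpTo x, f p := by
    rcases hB with h | h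
    · rw [hf h, mul_one, hS1 h]
    · rw [hS, Finset.prod_erase_mul _ _ ((mem_primesUpTo (by linarith)).2 ⟨h.1, h.2.1⟩)]
  have hB0 := hB.elim (by omega) fun h => h.1.pos
  have hqB : q * B = ∏ p ∈ primesUpTo x, p := by
    rw [hqP]
    exact Nat.div_mul_cancel (Dvd.intro_left _ (hprod (fun p => p) id))
  have hqS : q = ∏ p ∈ S, p := by
    rw [← hprod (fun p => p) id] at hqB
    exact Nat.eq_of_mul_eq_mul_right hB0 hqB
  have hSp : ∀ p ∈ S, p.Prime := fun p hp => prime_of_mem_primesUpTo (hSx hp)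
  have hq0 := hqS ▸ Finset.prod_pos fun p hp => (hSp p hp).pos
  have hq0' : (0 : ℝ) < q := mod_cast hq0
  have hBx : log B ≤ log x := by
    rcases hB with h | h
    · rw [h, Nat.cast_one, log_one]; exact hlx0.le
    · exact log_le_log (by exact_mod_cast hB0) h.2.1
  have hlq : Chebyshev.theta x - log x ≤ log q := by
    rw [theta_eq_log_prod_primesUpTo, ← hqB, Nat.cast_mul, log_mul hq0'.ne' (by positivity)]
    linarith
  have hq1 := (log_pos_iff hq0'.le).1 (by linarith)
  have hZ0 := lt_of_lt_of_le (by positivity) hZ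
  have hlZ : 160 * log q ≤ log Z := by
    have := log_le_log (by positivity) hZ
    rwa [log_pow] at this
  have hlX := log_mul hq0'.ne' hZ0.ne'
  obtain ⟨y, hy⟩ : ∃ y, y = exp (log (q * Z) / 128) := ⟨_, rfl⟩
  have hly : log y = log (q * Z) / 128 := by rw [hy, log_exp]
  have hX : exp (128 * log y) = q * Z := by
    rw [hly, mul_div_cancel₀ _ (by norm_num), exp_log (by positivity)]
  have hy0 := hy ▸ exp_pos _
  have hθy : Chebyshev.theta x ≤ log y := by linarith
  have hxy : x ≤ y := (log_le_log_iff (by linarith) hy0).1 (by linarith)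
  have hqy : q ≤ y ^ (4 / 5 : ℝ) := by
    rw [← log_le_log_iff hq0' (by positivity), log_rpow hy0]
    linarith
  lift a to ℕ using by omega
  have key := hmain y (hxb.trans hxy) S (hSx.trans (primesUpTo_subset hxy)) q hqS hqy
    (fun χ hχ t ht α hα hα1 => hE q hqB χ hχ _ hθy t ht α hα hα1) a
    ((ZMod.isUnit_iff_coprime a q).2 (by simpa using hgcd))
  rw [hX] at key
  obtain ⟨κ, hκ⟩ : ∃ κ, κ = ∏ p ∈ S, (1 - 1 / (p : ℝ)) := ⟨_, rfl⟩
  obtain ⟨c, hc⟩ : ∃ c : ℝ, c = {z : ℤ | 1 ≤ z ∧ z ≤ Z ∧ Prime ((q : ℤ) * z + a)}.ncard :=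
    ⟨_, rfl⟩
  have hκ0 := hκ ▸ Finset.prod_nonneg fun p hp => (one_sub_one_div_mem (hSp p hp)).1
  have hφ : (q.totient : ℝ) = q * κ := by rw [hqS, totient_prod_primes hSp, hκ]
  have hcard := card_primesBetween_le_ncard hq0 ((log_le_log_iff hq0' hy0).1 (by linarith)) (Z := Z) (mod_cast haP : a ≤ q)
  have h1 : 9 / 10 * (q * Z / (log q + log Z)) ≤ q * κ * c := by
    have h2 := key.trans (mul_le_mul_of_nonneg_left (Nat.cast_le.2 hcard) (Nat.cast_nonneg _))
    rw [← hc, hφ, hly, mul_div_cancel₀ _ (by norm_num), hlX] at h2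
    exact h2
  have hκx : κ * (98 / 100) ≤ (1 + 1 / 100) * exp (-eulerMascheroniConstant) / log x := by
    refine le_trans ?_ hM
    rcases hB with h | h
    · rw [← hS1 h, ← hκ]
      linarith
    · rw [← hprod (fun p : ℕ => 1 - 1 / (p : ℝ)) fun h1 => absurd h1 h.1.ne_one, ← hκ]
      gcongr
      have : (50 : ℝ) ≤ B := mod_cast h.2.2
      have := one_div_le_one_div_of_le (by norm_num) this
      linarith
  have h2 : 9 / 10 * Z ≤ κ * c * (log q + log Z) := by
    rw [mul_div_assoc', div_le_iff₀ (by linarith)] at h1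
    refine le_of_mul_le_mul_left ?_ hq0'
    linarith
  rw [exp_neg, ← div_eq_mul_inv, div_div, le_div_iff₀ (by positivity)] at hκx
  rw [← hc]
  refine mul_le_of_density_le hlx0 (by linarith) (exp_pos _) hZ0.le (hc ▸ Nat.cast_nonneg _) hκ0
    (by linarith) h2 ?_ hε.le
  linarith
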